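/- Let ω ∈ Ω and let μ_ω be a Borel probability measure on ℝ such that lim_{X→∞} (1/X)·∫_X^{2X} F(Ê(x;ω)/σ(X;ω)) dx = ∫_ℝ F dμ_ω for every bounded continuous F. Then μ_ω is moment-determinate (it is the unique Borel probability measure on ℝ with its sequence of moments), and its moments are given by ∫_ℝ α^j dμ_ω(α) = (j!/(2^{j/2}·(j/2)!))·L_j(ω) for every even j ≥ 0, and ∫_ℝ α^j dμ_ω(α) = 0 for every odd j ≥ 1. -/

import Mathlib

open MeasureTheory Filter Real

noncomputable section

/-- The Cygan–Korányi norm on `ℝ³`. -/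
def cyganNorm (u : ℝ × ℝ × ℝ) : ℝ :=
  ((u.1 ^ 2 + u.2.1 ^ 2) ^ 2 + u.2.2 ^ 2) ^ ((1 : ℝ) / 4)

/-- The unit ball for the Cygan–Korányi norm. -/
def cyganBall : Set (ℝ × ℝ × ℝ) := {u | cyganNorm u ≤ 1}

/-- The Heisenberg dilation `δ_x`. -/
def heisDil (x : ℝ) (u : ℝ × ℝ × ℝ) : ℝ × ℝ × ℝ := (x * u.1, x * u.2.1, x ^ 2 * u.2.2)

/-- Euclidean volume of the Cygan–Korányi unit ball. -/
def volB : ℝ := (volume cyganBall).toReal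

/-- `N(x)`: the number of integer lattice points inside `δ_x B`. -/
def latticeCount (x : ℝ) : ℕ :=
  Set.ncard {p : ℤ × ℤ × ℤ | ((p.1 : ℝ), (p.2.1 : ℝ), (p.2.2 : ℝ)) ∈ heisDil x '' cyganBall}

/-- The error term `E(x;ω)` for the shell count. -/
def Eshell (ω : ℝ → ℝ) (x : ℝ) : ℝ :=
  ((latticeCount (x + ω x) : ℝ) - (latticeCount x : ℝ))
    - volB * ∑ j ∈ Finset.Icc 1 4, (Nat.choose 4 j : ℝ) * x ^ (4 - j) * ω x ^ j

/-- The normalized error term `Ê(x;ω) = E(x;ω)/x²`. -/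
def Ehat (ω : ℝ → ℝ) (x : ℝ) : ℝ := Eshell ω x / x ^ 2

/-- `σ(X;ω)`, the square root of the variance of `Ê(x;ω)` over `[X,2X]`. -/
def sigmaShell (ω : ℝ → ℝ) (X : ℝ) : ℝ :=
  Real.sqrt ((1 / X) * ∫ x in X..(2 * X), Ehat ω x ^ 2)

/-- `M_j(X;ω) = (1/X)·∫_X^{2X} (ω(x)·log ω(x))^j dx`. -/
def Mom (j : ℕ) (X : ℝ) (ω : ℝ → ℝ) : ℝ :=
  (1 / X) * ∫ x in X..(2 * X), (ω x * Real.log (ω x)) ^ j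

/-- `L_j(ω) = lim_{X→∞} M_j(X;ω)/M_2(X;ω)^{j/2}`. -/
def Llim (ω : ℝ → ℝ) (j : ℕ) : ℝ :=
  limUnder atTop fun X => Mom j X ω / Mom 2 X ω ^ (j / 2)

/-- The Gaussian moment factor `j!/(2^{j/2}·(j/2)!)`. -/
def gaussMoment (j : ℕ) : ℝ :=
  (Nat.factorial j : ℝ) / (2 ^ (j / 2) * (Nat.factorial (j / 2) : ℝ))

/-- The regularity class `Ω` of gap width functions. -/
structure OmegaClass (ω : ℝ → ℝ) : Prop where
  contDiff : ContDiffOn ℝ 2 ω (Set.Ioi 0)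
  pos : ∀ x, 0 < x → 0 < ω x
  tendsto_zero : Tendsto ω atTop (nhds 0)
  deriv_small : ∀ᶠ x in atTop, |deriv ω x| < 1 / 2
  zeros_bound : ∃ C > (0 : ℝ), ∃ ξ > (0 : ℝ), ∀ᶠ X in atTop,
    {x ∈ Set.Icc X (2 * X) | deriv ω x = 0}.Finite ∧
    {x ∈ Set.Icc X (2 * X) | deriv (deriv ω) x = 0}.Finite ∧
    ({x ∈ Set.Icc X (2 * X) | deriv ω x = 0}.ncard : ℝ) *
        sSup (ω '' Set.Icc X (2 * X)) ≤ C * X ^ ((1 : ℝ) / 2) ∧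
    ({x ∈ Set.Icc X (2 * X) | deriv (deriv ω) x = 0}.ncard : ℝ) ≤ C * X ^ (1 - ξ)
  mom2_lower : ∀ α > (0 : ℝ), ∃ c > (0 : ℝ), ∀ᶠ X in atTop, c * X ^ (-α) ≤ Mom 2 X ω
  Llim_exists : ∀ j : ℕ, Even j →
    Tendsto (fun X => Mom j X ω / Mom 2 X ω ^ (j / 2)) atTop (nhds (Llim ω j))
  carleman : Tendsto (fun n => ∑ k ∈ Finset.range n,
      (gaussMoment (2 * (k + 1)) * Llim ω (2 * (k + 1))) ^
        ((-1 : ℝ) / (2 * ((k : ℝ) + 1)))) atTop atTop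

/-- `r₂(m)`: the number of representations of `m` as a sum of two integer squares. -/
def r2 (m : ℕ) : ℕ := Set.ncard {p : ℤ × ℤ | p.1 ^ 2 + p.2 ^ 2 = (m : ℤ)}

/-- The sawtooth function `ψ(t) = t − ⌊t⌋ − 1/2`. -/
def sawtooth (t : ℝ) : ℝ := t - ⌊t⌋ - 1 / 2

/-- The sawtooth sum `Ξ_ψ(x;ω)`. -/
def XiPsi (ω : ℝ → ℝ) (x : ℝ) : ℝ :=
  (∑ m ∈ Finset.Icc 1 ⌊(x + ω x) ^ 2⌋₊,
      (r2 m : ℝ) * sawtooth (Real.sqrt ((x + ω x) ^ 4 - (m : ℝ) ^ 2)))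
    - ∑ m ∈ Finset.Icc 1 ⌊x ^ 2⌋₊, (r2 m : ℝ) * sawtooth (Real.sqrt (x ^ 4 - (m : ℝ) ^ 2))

open scoped Topology

namespace CK
open Finset (sum_congr sum_nonneg prod_nonneg mul_sum sum_mul sum_range_succ sum_add_distrib sum_le_sum sum_le_sum_of_subset_of_nonneg mem_range Icc mem_Icc finite_toSet sum_const mem_filter sum_filter sum_product sum_bij mem_product sum_div sum_comm mem_coe sum_Icc_succ_top sum_sub_distrib single_le_sum abs_sum_le_sum_abs sum_union mem_Ioc sum_insert Ico prod_const card_univ sum_mul_sum sum_le_card_nsmul)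
open Set (mem_ofPred_eq Ioc Ioo uIcc uIcc_of_le uIoc_of_le Ioi)
open Nat (floor_le)
open Complex (norm_real normSq_eq_norm_sq normSq)
open Fintype (card_fin piFinset)
open intervalIntegral (integral_add_adjacent_intervals integral_eq_sub_of_hasDerivAt integral_of_le integral_congr integral_mono_on)

/-! ### Part A: Carleman's theorem (Bang's proof) -/

lemma bang_step (F:ℕ → ℝ → ℂ) (M:ℕ → ℝ) (hF : ∀ n x, HasDerivAt (F n) (F (n+1) x) x)
    (hM : ∀ n, 0 < M n) (hb : ∀ n x, ‖F n x‖ ≤ M n)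
    (hmono : Antitone fun n => M n/M (n+1)) (N:ℕ) (x β:ℝ)
    (hβ : exp (-(N+1:ℝ))≤β) (hx : ∀ n, ‖F n x‖ ≤ exp n*M n*β) (h:ℝ) (hh : 0 ≤ h) (n:ℕ) :
    ‖F n (x+h)‖ ≤ exp n*M n*β*exp (exp 1*(M (N+1)/M N)*h) := by
  have hβ0 : 0 < β := lt_of_lt_of_le (exp_pos _) hβ
  set c := exp 1*(M (N+1)/M N) with hc
  have hc0 : 0 < c := by have := hM N; have := hM (N+1); positivity
  have big : ∀ n, N+1 ≤ n → ∀ h, 0 ≤ h → ‖F n (x+h)‖ ≤ exp n*M n*β*exp (c*h) := by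
    intro n hn h hh
    have h1 : 1 ≤ exp n*β := by
      calc (1:ℝ) ≤ exp (n-(N+1:ℝ)) := by
            apply one_le_exp
            have : ((N+1:ℕ):ℝ) ≤ n := by exact_mod_cast hn
            push_cast at this; linarith
        _ = exp n*exp (-(N+1:ℝ)) := by rw [← exp_add]; ring_nf
        _≤_ := by gcongr
    have h2 : 1 ≤ exp (c*h) := one_le_exp (by positivity)
    calc ‖F n (x+h)‖ ≤ M n := hb _ _
      _ = M n*1*1 := by ring
      _ ≤ M n*(exp n*β)*exp (c*h) := by
          have := hM n
          gcongr
      _ = _ := by ring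
  have small : ∀ d, ∀ n, n+d = N+1 → ∀ h, 0 ≤ h → ‖F n (x+h)‖ ≤ exp n*M n*β*exp (c*h) := by
    intro d
    induction d with
    | zero => intro n hn; exact big n (by omega)
    | succ d ih =>
      intro n hn h hh
      have ih' := ih (n+1) (by omega)
      have hd : ∀ s, HasDerivAt (fun s => F n (x+s)) (F (n+1) (x+s)) s := by
        intro s
        exact HasDerivAt.comp_const_add x s (hF n (x+s))
      have hB : ∀ s, HasDerivAt (fun s => exp n*M n*β*exp (c*s))
          (exp n*M n*β*(exp (c*s)*c)) s := by
        intro s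
        apply HasDerivAt.const_mul
        have := ((hasDerivAt_id s).const_mul c).exp
        simpa using this
      have key := image_norm_le_of_norm_deriv_right_le_deriv_boundary (a := 0) (b := h)
        (f := fun s => F n (x+s)) (f' := fun s => F (n+1) (x+s))
        (fun s _ => (hd s).continuousAt.continuousWithinAt)
        (fun s _ => (hd s).hasDerivWithinAt) (by simpa using hx n) hB (by
          intro s hs
          refine (ih' s hs.1).trans ?_
          have h3 : M N/M (N+1) ≤ M n/M (n+1) := hmono (by omega)
          have h4 : M (n+1) ≤ M n*(M (N+1)/M N) := by
            have := hM n; have := hM (n+1); have := hM N; have := hM (N+1)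
            rw [div_le_div_iff₀ (by positivity) (by positivity)] at h3
            rw [mul_div_assoc', le_div_iff₀ (by positivity)]
            linarith
          have h5 : exp ((n+1:ℕ):ℝ) = exp n*exp 1 := by
            rw [← exp_add]; push_cast; ring_nf
          rw [h5]
          calc exp n*exp 1*M (n+1)*β*exp (c*s)
              ≤ exp n*exp 1*(M n*(M (N+1)/M N))*β*exp (c*s) := by gcongr
            _ = _ := by rw [hc]; ring)
      exact key ⟨hh, le_rfl⟩
  rcases le_total (N+1) n with hn | hn
  · exact big n hn h hh
  · exact small (N+1-n) n (by omega) h hh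

lemma bang (F:ℕ → ℝ → ℂ) (M:ℕ → ℝ) (hF : ∀ n x, HasDerivAt (F n) (F (n+1) x) x)
    (hM : ∀ n, 0 < M n) (hb : ∀ n x, ‖F n x‖ ≤ M n)
    (hmono : Antitone fun n => M n/M (n+1)) (h0 : ∀ n, F n 0=0)
    (hdiv : ¬ Summable fun n => M n/M (n+1)) (x:ℝ) (hx : 0 ≤ x) : F 0 x=0 := by
  set a:ℕ → ℝ := fun n => (exp 1)⁻¹*(M n/M (n+1)) with ha
  have ha0 : ∀ n, 0 ≤ a n := fun n => by have := hM n; have := hM (n+1); positivity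
  have Q : ∀ d:ℕ, ∀ K:ℕ, ∀ x, 0 ≤ x → x≤∑ i ∈ Finset.range d, a (K+i) →
      ∀ n, ‖F n x‖ ≤ exp n*M n*exp (-(K:ℝ)) := by
    intro d
    induction d with
    | zero =>
      intro K x hx0 hx1 n
      have : x=0 := le_antisymm (by simpa using hx1) hx0
      subst this
      rw [h0]; have := hM n; simp; positivity
    | succ d ih =>
      intro K x hx0 hx1 n
      rw [Finset.sum_range_succ'] at hx1
      have hy := ih (K+1) (max (x-a K) 0) (le_max_right _ _) (by
        apply max_le
        · have : ∑ i ∈ Finset.range d, a (K+(i+1)) = ∑ i ∈ Finset.range d, a (K+1+i) :=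
            sum_congr rfl fun i _ => by congr 1; ring
          simp only [add_zero] at hx1
          linarith
        · exact sum_nonneg fun i _ => ha0 _)
      have h1 : x-max (x-a K) 0 ≤ a K := by
        have := le_max_left (x-a K) 0; linarith
      have h2 : 0 ≤ x-max (x-a K) 0 := by
        rw [sub_nonneg]; exact max_le (by linarith [ha0 K]) hx0
      have := bang_step F M hF hM hb hmono K (max (x-a K) 0) (exp (-(K+1:ℝ))) le_rfl
        (by intro n; simpa using hy n) (x-max (x-a K) 0) h2 n
      rw [add_sub_cancel] at this
      refine this.trans ?_
      have h3 : exp 1*(M (K+1)/M K)*(x-max (x-a K) 0)≤1 := by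
        have := hM K; have := hM (K+1)
        calc exp 1*(M (K+1)/M K)*(x-max (x-a K) 0) ≤ exp 1*(M (K+1)/M K)*a K := by
              gcongr
          _ = 1 := by rw [ha]; field_simp
      calc exp n*M n*exp (-(K+1:ℝ))*exp (exp 1*(M (K+1)/M K)*(x-max (x-a K) 0))
          ≤ exp n*M n*exp (-(K+1:ℝ))*exp 1 := by
            have := hM n
            gcongr
        _ = _ := by rw [mul_assoc, ← exp_add]; ring_nf
  have hdiv' : ∀ K, ∃ d, x≤∑ i ∈ Finset.range d, a (K+i) := by
    intro K
    have hns : ¬ Summable fun i => a (K+i) := by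
      intro hs
      apply hdiv
      have hs2 : Summable a := by
        rw [← summable_nat_add_iff K]
        simpa [add_comm] using hs
      have := hs2.mul_left (exp 1)
      refine this.congr fun n => ?_
      simp [ha]
    have ht := (not_summable_iff_tendsto_nat_atTop_of_nonneg (fun i => ha0 (K+i))).1 hns
    exact (ht.eventually_ge_atTop x).exists
  have hall : ∀ K:ℕ, ‖F 0 x‖ ≤ M 0*exp (-(K:ℝ)) := by
    intro K
    obtain ⟨d, hd⟩ := hdiv' K
    simpa using Q d K x hx hd 0
  have hlim : Tendsto (fun K:ℕ => M 0*exp (-(K:ℝ))) atTop (nhds (M 0*0)) :=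
    ((tendsto_exp_neg_atTop_nhds_zero).comp tendsto_natCast_atTop_atTop).const_mul _
  rw [mul_zero] at hlim
  have := ge_of_tendsto' hlim hall
  simpa using this

lemma carleman_ineq (a:ℕ → ℝ) (ha : ∀ n, 0 < a n) (P:ℕ) :
    ∑ n ∈ Finset.range P, (∏ i ∈ Finset.range (n+1), a i)^((1:ℝ)/(n+1))
      ≤ exp 1*∑ i ∈ Finset.range P, a i := by
  set c:ℕ → ℝ := fun i => ((i:ℝ)+2)^(i+1)/((i:ℝ)+1)^i with hc
  have hc0 : ∀ i, 0 < c i := fun i => by rw [hc]; positivity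
  have hprod : ∀ n, ∏ i ∈ Finset.range n, c i=((n:ℝ)+1)^n := by
    intro n
    induction n with
    | zero => simp
    | succ n ih =>
      rw [Finset.prod_range_succ, ih, hc]; push_cast
      field_simp
      ring
  have h1 : ∀ n:ℕ, (∏ i ∈ Finset.range (n+1), a i)^((1:ℝ)/(n+1)) ≤
      ∑ i ∈ Finset.range (n+1), c i*a i*(1/((n:ℝ)+1)-1/((n:ℝ)+2)) := by
    intro n
    have am := geom_mean_le_arith_mean_weighted (Finset.range (n+1)) (fun _ => 1/((n:ℝ)+1))
      (fun i => c i*a i) (fun _ _ => by positivity) (by simp; field_simp)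
      (fun i _ => (mul_pos (hc0 i) (ha i)).le)
    rw [finsetProd_rpow _ _ (fun i _ => (mul_pos (hc0 i) (ha i)).le),
      Finset.prod_mul_distrib, hprod, mul_rpow (by positivity)
      (prod_nonneg fun i _ => (ha i).le)] at am
    have h2 : (((n+1:ℕ):ℝ)+1)^(n+1)=(((n:ℝ)+2))^((n:ℝ)+1) := by
      have h3 : ((n:ℝ)+1)=((n+1:ℕ):ℝ) := by push_cast; ring
      have h4 : ((n:ℝ)+2)^((n:ℝ)+1)=((n:ℝ)+2)^(n+1) := by
        rw [h3, rpow_natCast]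
      rw [h4]; push_cast; ring
    rw [h2, ← rpow_mul (by positivity), mul_one_div_cancel (by positivity), rpow_one] at am
    rw [← mul_sum] at am
    rw [← sum_mul]
    have : (1/((n:ℝ)+1)-1/((n:ℝ)+2))=(1/((n:ℝ)+1))/((n:ℝ)+2) := by
      field_simp; ring
    rw [this, mul_div_assoc', le_div_iff₀ (by positivity)]
    linarith
  have hce : ∀ i:ℕ, c i*(1/((i:ℝ)+1)) ≤ exp 1 := by
    intro i
    have : c i*(1/((i:ℝ)+1))=(1+1/((i:ℝ)+1))^(i+1) := by
      rw [hc]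
      have : (1+1/((i:ℝ)+1))=((i:ℝ)+2)/((i:ℝ)+1) := by field_simp; ring
      rw [this, div_pow]
      field_simp
      ring
    rw [this]
    calc (1+1/((i:ℝ)+1))^(i+1)≤(exp (1/((i:ℝ)+1)))^(i+1) := by
          gcongr
          linarith [add_one_le_exp (1/((i:ℝ)+1))]
      _ = exp 1 := by
          rw [← exp_nat_mul]; congr 1; push_cast; field_simp
  have h3 : ∀ P:ℕ, ∑ n ∈ Finset.range P, ∑ i ∈ Finset.range (n+1), c i*a i*(1/((n:ℝ)+1)-1/((n:ℝ)+2))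
      = ∑ i ∈ Finset.range P, c i*a i*(1/((i:ℝ)+1)-1/((P:ℝ)+1)) := by
    intro P
    induction P with
    | zero => simp
    | succ P ih =>
      rw [sum_range_succ, ih, sum_range_succ (fun i => c i*a i*(1/((P:ℝ)+1)-1/((P:ℝ)+2))),
        ← add_assoc, ← sum_add_distrib, sum_range_succ]
      push_cast
      congr 1
      · apply sum_congr rfl; intro i _; ring
      · ring
  calc _≤_ := sum_le_sum fun n _ => h1 n
    _ = _ := h3 P
    _≤∑ i ∈ Finset.range P, exp 1*a i := by
      apply sum_le_sum
      intro i _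
      have := hce i
      have hp : 0 ≤ c i*a i := (mul_pos (hc0 i) (ha i)).le
      have hP : 0≤1/((P:ℝ)+1) := by positivity
      calc c i*a i*(1/((i:ℝ)+1)-1/((P:ℝ)+1)) ≤ c i*a i*(1/((i:ℝ)+1)) := by
            apply mul_le_mul_of_nonneg_left _ hp; linarith
        _ = (c i*(1/((i:ℝ)+1)))*a i := by ring
        _ ≤ exp 1*a i := by gcongr; exact (ha i).le
    _ = _ := by rw [mul_sum]

lemma memLp_of_pow {μ : Measure ℝ} [IsFiniteMeasure μ]
    (h : ∀ j:ℕ, Integrable (fun α:ℝ => α^j) μ) (k:ℕ) : MemLp id k μ := by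
  rcases Nat.eq_zero_or_pos k with rfl | hk
  · simpa using aestronglyMeasurable_id
  · rw [← integrable_norm_rpow_iff aestronglyMeasurable_id (by exact_mod_cast hk.ne') (by simp)]
    have := (h k).norm
    refine this.congr (Eventually.of_forall fun x => ?_)
    simp

theorem carleman_unique (μ ν : Measure ℝ) [IsProbabilityMeasure μ] [IsProbabilityMeasure ν]
    (hμ : ∀ j:ℕ, Integrable (fun α:ℝ => α^j) μ)
    (hν : ∀ j:ℕ, Integrable (fun α:ℝ => α^j) ν)
    (heq : ∀ j:ℕ, ∫ α, α^j ∂ν = ∫ α, α^j ∂μ)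
    (hpos : ∀ k:ℕ, 0 < ∫ α, α^(2*k) ∂μ)
    (hdiv : Tendsto (fun n => ∑ k ∈ Finset.range n,
      (∫ α, α^(2*(k+1)) ∂μ)^((-1:ℝ)/(2*((k:ℝ)+1)))) atTop atTop) : ν = μ := by
  set ρ : Measure ℝ := μ+ν with hρ
  set M:ℕ → ℝ := fun n => ∫ x, |x|^n ∂ρ with hMdef
  have hiμ : ∀ n:ℕ, Integrable (fun x:ℝ => |x|^n) μ := fun n => by
    simpa [abs_pow] using (hμ n).abs
  have hiν : ∀ n:ℕ, Integrable (fun x:ℝ => |x|^n) ν := fun n => by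
    simpa [abs_pow] using (hν n).abs
  have hiρ : ∀ n:ℕ, Integrable (fun x:ℝ => |x|^n) ρ := fun n => (hiμ n).add_measure (hiν n)
  have hMsplit : ∀ n, M n = ∫ x, |x|^n ∂μ+∫ x, |x|^n ∂ν := fun n =>
    integral_add_measure (hiμ n) (hiν n)
  have hM2 : ∀ k, M (2*k)=2*∫ α, α^(2*k) ∂μ := by
    intro k
    rw [hMsplit]
    have : ∀ x:ℝ, |x|^(2*k) = x^(2*k) := fun x => by rw [pow_mul, sq_abs, ← pow_mul]
    simp only [this, heq]
    ring
  have hcs : ∀ n, M (n+1)^2 ≤ M n*M (n+2) := by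
    intro n
    have hq : ∀ t:ℝ, 0 ≤ M n*(t*t)+(2*M (n+1))*t+M (n+2) := by
      intro t
      have : M n*(t*t)+(2*M (n+1))*t+M (n+2) = ∫ x, |x|^n*(t + |x|)^2 ∂ρ := by
        have e : ∀ x:ℝ, |x|^n*(t + |x|)^2=(t*t) * |x|^n+(2*t) * |x|^(n+1) + |x|^(n+2) := by
          intro x; ring
        simp only [e]
        have i1 : Integrable (fun x => (t*t) * |x|^n+(2*t) * |x|^(n+1)) ρ :=
          ((hiρ n).const_mul _).add ((hiρ (n+1)).const_mul _)
        rw [integral_add i1 (hiρ (n+2)),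
          integral_add ((hiρ n).const_mul _) ((hiρ (n+1)).const_mul _),
          integral_const_mul, integral_const_mul]
        simp only [hMdef]; ring
      rw [this]
      exact integral_nonneg fun x => by positivity
    have := discrim_le_zero hq
    unfold discrim at this
    nlinarith
  have hMnn : ∀ n, 0 ≤ M n := fun n => integral_nonneg fun x => by positivity
  have hM : ∀ n, 0 < M n := by
    intro n
    rcases Nat.even_or_odd' n with ⟨k, rfl | rfl⟩
    · rw [hM2]; have := hpos k; positivity
    · have h1 := hcs (2*k+1)
      have h2 : 0 < M (2*k+1+1) := by
        have := hM2 (k+1)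
        rw [show 2*k+1+1=2*(k+1) by ring, this]
        have := hpos (k+1); positivity
      rcases (hMnn (2*k+1)).lt_or_eq with h | h
      · exact h
      · rw [← h, zero_mul] at h1
        nlinarith
  have hmono : Antitone fun n => M n/M (n+1) := by
    apply antitone_nat_of_succ_le
    intro n
    rw [div_le_div_iff₀ (hM _) (hM _)]
    have := hcs n
    nlinarith
  have hdivM : ¬ Summable fun n => M n/M (n+1) := by
    intro hs
    set a:ℕ → ℝ := fun n => M n/M (n+1) with ha
    have ha0 : ∀ n, 0 < a n := fun n => div_pos (hM _) (hM _)
    have hprod : ∀ n, ∏ i ∈ Finset.range n, a i = M 0/M n := by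
      intro n
      induction n with
      | zero => simp [(hM 0).ne']
      | succ n ih =>
        rw [Finset.prod_range_succ, ih, ha]
        have := (hM n).ne'; have := (hM (n+1)).ne'; field_simp
    have hM0 : M 0=2 := by simpa using hM2 0
    -- bound the divergent sum
    have hbd : ∀ n:ℕ, ∑ k ∈ Finset.range n,
      (∫ α, α^(2*(k+1)) ∂μ)^((-1:ℝ)/(2*((k:ℝ)+1))) ≤ exp 1*∑' i, a i := by
      intro n
      have h1 : ∀ k:ℕ, (∫ α, α^(2*(k+1)) ∂μ)^((-1:ℝ)/(2*((k:ℝ)+1))) =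
        (∏ i ∈ Finset.range ((2*k+1)+1), a i)^((1:ℝ)/((2*k+1:ℕ)+1)) := by
        intro k
        rw [hprod, show 2*k+1+1=2*(k+1) by ring, hM2, hM0]
        have hp := hpos (k+1)
        rw [show (2:ℝ)/(2*∫ α, α^(2*(k+1)) ∂μ)=(∫ α, α^(2*(k+1)) ∂μ)⁻¹ by field_simp]
        rw [inv_rpow hp.le, ← rpow_neg hp.le]
        congr 1
        push_cast
        rw [neg_div]; congr 2; ring
      have h2 := carleman_ineq a ha0 (2*n)
      have h3 : ∑ k ∈ Finset.range n,
          (∏ i ∈ Finset.range ((2*k+1)+1), a i)^((1:ℝ)/((2*k+1:ℕ)+1)) ≤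
          ∑ n ∈ Finset.range (2*n), (∏ i ∈ Finset.range (n+1), a i)^((1:ℝ)/(n+1)) := by
        have hnn : ∀ m:ℕ, 0≤(∏ i ∈ Finset.range (m+1), a i)^((1:ℝ)/(m+1)) := fun m =>
          rpow_nonneg (prod_nonneg fun i _ => (ha0 i).le) _
        rw [← Finset.sum_image (f := fun m:ℕ => (∏ i ∈ Finset.range (m+1), a i)^((1:ℝ)/(m+1)))
          (g := fun k:ℕ => 2*k+1) (s := Finset.range n) (fun x _ y _ h => by simpa using h)]
        apply sum_le_sum_of_subset_of_nonneg
        · intro m hm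
          simp only [Finset.mem_image, mem_range] at hm ⊢
          obtain ⟨k, hk, rfl⟩ := hm
          omega
        · intro m _ _; exact hnn m
      rw [sum_congr rfl fun k _ => h1 k]
      refine h3.trans (h2.trans ?_)
      gcongr
      exact hs.sum_le_tsum _ (fun i _ => (ha0 i).le)
    obtain ⟨n, hn⟩ := (hdiv.eventually_gt_atTop (exp 1*∑' i, a i)).exists
    exact absurd (hbd n) (not_le.2 hn)
  have hLμ := memLp_of_pow hμ
  have hLν := memLp_of_pow hν
  set F:ℕ → ℝ → ℂ := fun n => iteratedDeriv n (fun t => charFun μ t-charFun ν t) with hF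
  have hcμ : ContDiff ℝ (⊤:ℕ∞) (charFun μ) := contDiff_charFun' hLμ
  have hcν : ContDiff ℝ (⊤:ℕ∞) (charFun ν) := contDiff_charFun' hLν
  have hcd : ContDiff ℝ (⊤:ℕ∞) (fun t => charFun μ t-charFun ν t) := hcμ.sub hcν
  have hFd : ∀ n x, HasDerivAt (F n) (F (n+1) x) x := by
    intro n x
    have : DifferentiableAt ℝ (F n) x :=
      (hcd.differentiable_iteratedDeriv n (by exact_mod_cast WithTop.coe_lt_top n)) x
    have h2 := this.hasDerivAt
    rw [hF] at h2 ⊢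
    simp only [iteratedDeriv_succ]
    exact h2
  have hFeq : ∀ n x, F n x = iteratedDeriv n (charFun μ) x-iteratedDeriv n (charFun ν) x := by
    intro n x
    rw [hF]
    exact iteratedDeriv_sub ((hcμ.of_le (by exact_mod_cast le_top)).contDiffAt)
      ((hcν.of_le (by exact_mod_cast le_top)).contDiffAt)
  have hF0 : ∀ n, F n 0=0 := by
    intro n
    rw [hFeq, iteratedDeriv_charFun_zero (hLμ n), iteratedDeriv_charFun_zero (hLν n), heq, sub_self]
  have bd1 : ∀ (κ : Measure ℝ) (n:ℕ) (x:ℝ),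
      ‖(Complex.I^n*∫ y:ℝ, (y:ℂ)^n*Complex.exp (x*y*Complex.I) ∂κ)‖ ≤ ∫ y, |y|^n ∂κ := by
    intro κ n x
    rw [norm_mul, norm_pow, Complex.norm_I, one_pow, one_mul]
    refine (norm_integral_le_integral_norm _).trans (le_of_eq ?_)
    congr 1
    ext y
    rw [norm_mul, ← Complex.ofReal_mul, Complex.norm_exp_ofReal_mul_I]
    simp
  have hFb : ∀ n x, ‖F n x‖ ≤ M n := by
    intro n x
    rw [hFeq, hMsplit, iteratedDeriv_charFun (hLμ n), iteratedDeriv_charFun (hLν n)]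
    exact (norm_sub_le _ _).trans (add_le_add (bd1 μ n x) (bd1 ν n x))
  have hpos' := bang F M hFd hM hFb hmono hF0 hdivM
  have hneg' := bang (fun n x => (-1)^n*F n (-x)) M (by
      intro n x
      have h1 := ((hFd n (-x)).scomp x (hasDerivAt_neg x)).const_mul ((-1:ℂ)^n)
      have h2 : ((-1:ℂ)^(n+1)*F (n+1) (-x))=(-1:ℂ)^n*((-1:ℝ) • F (n+1) (-x)) := by
        rw [pow_succ]; simp
      rw [h2]
      exact h1) hM (by
      intro n x; simpa using hFb n (-x)) hmono (by intro n; simp [hF0]) hdivM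
  have hz : ∀ x, charFun μ x = charFun ν x := by
    intro x
    rcases le_total 0 x with h | h
    · have := hpos' x h
      simpa [hF, sub_eq_zero] using this
    · have := hneg' (-x) (by linarith)
      simpa [hF, sub_eq_zero] using this
  exact (Measure.ext_of_charFun (funext hz)).symm

open GaussianInt in
/-- Gaussian integers of norm `n`. -/
def SG (n:ℕ) : Set GaussianInt := {z | z.norm = n}

lemma gnorm_def (z : GaussianInt) : z.norm = z.re^2+z.im^2 := by
  rw [Zsqrtd.norm_def]; ring

lemma gnorm_nonneg (z : GaussianInt) : 0 ≤ z.norm := by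
  rw [gnorm_def]; positivity

lemma r2_eq (n:ℕ) : r2 n=(SG n).ncard := by
  unfold r2
  refine Set.ncard_congr (fun p _ => (⟨p.1, p.2⟩ : GaussianInt)) ?_ ?_ ?_
  · rintro ⟨a, b⟩ h
    simp only [SG, mem_ofPred_eq, gnorm_def] at *
    exact h
  · rintro ⟨a, b⟩ ⟨c, d⟩ _ _ h
    simpa using Zsqrtd.ext_iff.1 h
  · rintro ⟨a, b⟩ h
    refine ⟨(a, b), ?_, rfl⟩
    simp only [SG, mem_ofPred_eq, gnorm_def] at *
    exact h

lemma SG_subset (n:ℕ) : SG n ⊆ (fun p:ℤ × ℤ => (⟨p.1, p.2⟩ : GaussianInt)) ''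
    ((Icc (-(n:ℤ)) n ×ˢ Icc (-(n:ℤ)) n : Finset (ℤ×ℤ)) : Set (ℤ × ℤ)) := by
  rintro ⟨a, b⟩ h
  simp only [SG, mem_ofPred_eq, gnorm_def] at h
  refine ⟨(a, b), ?_, rfl⟩
  simp only [Finset.coe_product, Finset.coe_Icc, Set.mem_prod, Set.mem_Icc]
  refine ⟨⟨?_, ?_⟩, ⟨?_, ?_⟩⟩ <;> nlinarith [sq_nonneg a, sq_nonneg b]

lemma SG_finite (n:ℕ) : (SG n).Finite :=
  ((finite_toSet _).image _).subset (SG_subset n)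

lemma norm_star (z : GaussianInt) : (star z).norm = z.norm := by
  simp [gnorm_def]

lemma mul_star_eq (z : GaussianInt) : z*star z=((z.norm:ℤ) : GaussianInt) := by
  rw [Zsqrtd.norm_eq_mul_conj]

lemma norm_pos_of_ne {z : GaussianInt} (h : z ≠ 0) : 0 < z.norm := GaussianInt.norm_pos.2 h

lemma norm_dvd {a b : GaussianInt} (h : a ∣ b) : a.norm ∣ b.norm := by
  obtain ⟨c, rfl⟩ := h; rw [Zsqrtd.norm_mul]; exact dvd_mul_right _ _

lemma norm_intCast (n:ℤ) : ((n : GaussianInt)).norm = n^2 := by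
  simp [gnorm_def]

lemma r2_one : r2 1≤4 := by
  rw [r2_eq]
  have : SG 1 ⊆ (({⟨1,0⟩, ⟨-1,0⟩, ⟨0,1⟩, ⟨0,-1⟩} : Finset GaussianInt) : Set GaussianInt) := by
    rintro ⟨a, b⟩ h
    simp only [SG, mem_ofPred_eq, gnorm_def, Nat.cast_one] at h
    have ha : a≤1 := by nlinarith [sq_nonneg b]
    have ha' : -1 ≤ a := by nlinarith [sq_nonneg b]
    have hb : b≤1 := by nlinarith [sq_nonneg a]
    have hb' : -1 ≤ b := by nlinarith [sq_nonneg a]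
    simp only [Finset.coe_insert, Finset.coe_singleton, Set.mem_insert_iff, Set.mem_singleton_iff,
      Zsqrtd.ext_iff]
    interval_cases a <;> interval_cases b <;> simp_all
  refine (Set.ncard_le_ncard this (finite_toSet _)).trans ?_
  rw [Set.ncard_coe_finset]
  exact Finset.card_le_four

/-- submultiplicativity on coprime arguments -/
lemma r2_mul_le {m n:ℕ} (hm : 0 < m) (hn : 0 < n) (h : Nat.Coprime m n) :
    r2 (m*n) ≤ r2 m*r2 n := by
  rw [r2_eq, r2_eq, r2_eq, ← Set.ncard_prod]
  refine Set.ncard_le_ncard_of_injOn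
    (fun z => (EuclideanDomain.gcd z (m : GaussianInt), z/EuclideanDomain.gcd z (m : GaussianInt)))
    ?_ ?_ ((SG_finite m).prod (SG_finite n))
  · intro z hz
    have hz' : z.norm = m*n := by simpa [SG] using hz
    set d := EuclideanDomain.gcd z (m : GaussianInt) with hd
    have hz0 : z ≠ 0 := by
      rintro rfl
      have : (0:ℤ) = m*n := by simpa using hz'
      have : (0:ℤ) < m*n := by positivity
      omega
    have hdz : d ∣ z := EuclideanDomain.gcd_dvd_left _ _
    have hdm : d ∣ (m : GaussianInt) := EuclideanDomain.gcd_dvd_right _ _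
    have hd0 : d ≠ 0 := fun h0 => hz0 (by rw [h0] at hdz; exact zero_dvd_iff.1 hdz)
    obtain ⟨w, hw⟩ := hdz
    have hq : z/d = w := by rw [hw]; exact mul_div_cancel_left₀ _ hd0
    have hcop : IsCoprime (m:ℤ) (n:ℤ) := Nat.isCoprime_iff_coprime.2 h
    -- norm of d divides m
    have h1 : d.norm ∣ m := by
      have a1 : d.norm ∣ (m:ℤ)*n := by rw [← hz']; exact norm_dvd ⟨w, hw⟩
      have a2 : d.norm ∣ (m:ℤ)*m := by
        have := norm_dvd hdm
        have e := norm_intCast (m:ℤ)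
        simp only [Int.cast_natCast] at e
        rw [e, sq] at this; exact this
      obtain ⟨u, v, huv⟩ := hcop
      have : (m:ℤ) = u*(m*m)+v*(m*n) := by linear_combination (-(m:ℤ))*huv
      rw [this]
      exact dvd_add (a2.mul_left _) (a1.mul_left _)
    -- w divides n
    have h2 : w ∣ (n : GaussianInt) := by
      -- d is a combination of z and m
      have hb := EuclideanDomain.gcd_eq_gcd_ab z (m : GaussianInt)
      rw [← hd] at hb
      have hzmn : z ∣ (m : GaussianInt)*n := by
        refine ⟨star z, ?_⟩
        rw [mul_star_eq, hz']; push_cast; rfl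
      have : d*w ∣ d*n := by
        rw [← hw]
        rw [hb, add_mul]
        exact dvd_add (((dvd_mul_right _ _).mul_right _)) (by
          rw [mul_right_comm]; exact hzmn.mul_right _)
      exact (mul_dvd_mul_iff_left hd0).1 this
    have h3 : w.norm ∣ n := by
      have a1 : w.norm ∣ (m:ℤ)*n := by rw [← hz']; exact norm_dvd ⟨d, by rw [hw, mul_comm]⟩
      have a2 : w.norm ∣ (n:ℤ)*n := by
        have := norm_dvd h2
        have e := norm_intCast (n:ℤ)
        simp only [Int.cast_natCast] at e
        rw [e, sq] at this; exact this
      obtain ⟨u, v, huv⟩ := hcop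
      have : (n:ℤ) = u*(m*n)+v*(n*n) := by linear_combination (-(n:ℤ))*huv
      rw [this]
      exact dvd_add (a1.mul_left _) (a2.mul_left _)
    have h4 : d.norm*w.norm = m*n := by rw [← Zsqrtd.norm_mul, ← hw, hz']
    have hm' : (0:ℤ) < m := by exact_mod_cast hm
    have hn' : (0:ℤ) < n := by exact_mod_cast hn
    have l1 := Int.le_of_dvd hm' h1
    have l2 := Int.le_of_dvd hn' h3
    have p1 := norm_pos_of_ne hd0
    have p2 := gnorm_nonneg w
    have e1 : d.norm = m := by nlinarith
    have e2 : w.norm = n := by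
      rw [e1] at h4; exact mul_left_cancel₀ hm'.ne' h4
    refine ⟨e1, ?_⟩
    change (z/d).norm = n
    rw [hq, e2]
  · intro z _ w _ hzw
    simp only [Prod.mk.injEq] at hzw
    have a1 := EuclideanDomain.mul_div_cancel' (a := z) (b := EuclideanDomain.gcd z (m:GaussianInt))
      (by
        intro h0
        have := EuclideanDomain.gcd_eq_zero_iff.1 h0
        have := this.2
        have : (m:ℤ)=0 := by
          have := congrArg Zsqrtd.re this
          simpa using this
        omega) (EuclideanDomain.gcd_dvd_left _ _)
    have a2 := EuclideanDomain.mul_div_cancel' (a := w) (b := EuclideanDomain.gcd w (m:GaussianInt))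
      (by
        intro h0
        have := EuclideanDomain.gcd_eq_zero_iff.1 h0
        have := this.2
        have : (m:ℤ)=0 := by
          have := congrArg Zsqrtd.re this
          simpa using this
        omega) (EuclideanDomain.gcd_dvd_left _ _)
    rw [← a1, ← a2, hzw.2, hzw.1]

lemma r2_prime_pow_le {p:ℕ} (hp : p.Prime) (a:ℕ) : r2 (p^a)≤4*(a+1) := by
  have hpZ : (0:ℤ) < p := by exact_mod_cast hp.pos
  by_cases hex : ∃ ϖ : GaussianInt, ϖ.norm = p
  · obtain ⟨ϖ, hϖ⟩ := hex
    have hϖ0 : ϖ ≠ 0 := by rintro rfl; simp at hϖ; omega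
    have hirr : Prime ϖ := by
      rw [← irreducible_iff_prime]
      refine ⟨?_, ?_⟩
      · intro hu
        have := (Zsqrtd.norm_eq_one_iff' (by norm_num) ϖ).2 hu
        rw [hϖ] at this
        have := hp.one_lt; omega
      · intro x y hxy
        have h1 : x.norm*y.norm = p := by rw [← Zsqrtd.norm_mul, ← hxy, hϖ]
        have h2 : x.norm.natAbs*y.norm.natAbs = p := by
          rw [← Int.natAbs_mul, h1]; simp
        have hpp := hp
        rw [← h2, Nat.prime_mul_iff] at hpp
        rcases hpp with ⟨_, h⟩ | ⟨_, h⟩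
        · right; exact Zsqrtd.norm_eq_one_iff.1 h
        · left; exact Zsqrtd.norm_eq_one_iff.1 h
    have key : ∀ (b:ℕ) (z : GaussianInt), z ∈ SG (p^(b+1)) → ¬ ϖ ∣ z → ∃ w, z = star ϖ*w := by
      intro b z hz hnd
      have : ϖ ∣ z*star z := by
        rw [mul_star_eq]
        have e : z.norm = p^(b+1) := by simpa [SG] using hz
        rw [e, pow_succ, ← hϖ]
        push_cast
        rw [← mul_star_eq]
        exact ⟨(ϖ*star ϖ)^b*star ϖ, by ring⟩
      rcases hirr.dvd_or_dvd this with h | h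
      · exact absurd h hnd
      · obtain ⟨w, hw⟩ := h
        refine ⟨star w, ?_⟩
        have := congrArg star hw
        rw [star_star, star_mul] at this
        rw [this, mul_comm]
    have down : ∀ (b:ℕ) (x w : GaussianInt), x.norm = p → x*w ∈ SG (p^(b+1)) → w ∈ SG (p^b) := by
      intro b x w hx hz
      have e : (x*w).norm = p^(b+1) := by simpa [SG] using hz
      rw [Zsqrtd.norm_mul, hx, pow_succ, mul_comm] at e
      have := mul_right_cancel₀ hpZ.ne' e
      simpa [SG] using this
    have T : ∀ b:ℕ, ({z ∈ SG (p^b) | ¬ ϖ ∣ z}).ncard≤4 := by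
      intro b
      induction b with
      | zero =>
        refine (Set.ncard_le_ncard (Set.sep_subset _ _) (SG_finite _)).trans ?_
        rw [pow_zero, ← r2_eq]; exact r2_one
      | succ b ih =>
        refine le_trans (Set.ncard_le_ncard (t := (fun z => star ϖ*z) '' {z ∈ SG (p^b) | ¬ ϖ ∣ z})
          ?_ (((SG_finite _).subset (Set.sep_subset _ _)).image _))
          ((Set.ncard_image_le ((SG_finite _).subset (Set.sep_subset _ _))).trans ih)
        rintro z ⟨hz, hnd⟩
        obtain ⟨w, rfl⟩ := key b z hz hnd
        exact ⟨w, ⟨down b _ w (by rw [norm_star, hϖ]) hz, fun h => hnd (h.mul_left _)⟩, rfl⟩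
    induction a with
    | zero => rw [pow_zero]; exact r2_one
    | succ a ih =>
      rw [r2_eq] at *
      have hsub : SG (p^(a+1)) ⊆ ((fun z => ϖ*z) '' SG (p^a)) ∪ {z ∈ SG (p^(a+1)) | ¬ ϖ ∣ z} := by
        intro z hz
        by_cases hd : ϖ ∣ z
        · left
          obtain ⟨w, rfl⟩ := hd
          exact ⟨w, down a _ w hϖ hz, rfl⟩
        · right; exact ⟨hz, hd⟩
      refine (Set.ncard_le_ncard hsub (((SG_finite _).image _).union
        ((SG_finite _).subset (Set.sep_subset _ _)))).trans ?_
      refine (Set.ncard_union_le _ _).trans ?_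
      have h1 := Set.ncard_image_le (f := (fun z => ϖ*z)) (SG_finite (p^a))
      have h2 := T (a+1)
      omega
  · push Not at hex
    have hnorm : ((p:GaussianInt)).norm = p^2 := by
      have := norm_intCast (p:ℤ); simpa using this
    have hirr : Prime (p : GaussianInt) := by
      rw [← irreducible_iff_prime]
      refine ⟨?_, ?_⟩
      · intro hu
        have := (Zsqrtd.norm_eq_one_iff' (by norm_num) _).2 hu
        rw [hnorm] at this
        have := hp.one_lt
        nlinarith
      · intro x y hxy
        have h1 : x.norm*y.norm = p^2 := by rw [← Zsqrtd.norm_mul, ← hxy, hnorm]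
        have h2 : x.norm.natAbs*y.norm.natAbs = p^2 := by
          rw [← Int.natAbs_mul, h1]; simp
        have h3 : x.norm.natAbs ∣ p^2 := ⟨_, h2.symm⟩
        rw [Nat.dvd_prime_pow hp] at h3
        obtain ⟨k, hk, hk'⟩ := h3
        interval_cases k
        · left; exact Zsqrtd.norm_eq_one_iff.1 (by simpa using hk')
        · exfalso
          apply hex x
          have := Int.natAbs_of_nonneg (gnorm_nonneg x)
          rw [← this, hk']; simp
        · right
          rw [hk'] at h2
          exact Zsqrtd.norm_eq_one_iff.1 (Nat.eq_of_mul_eq_mul_left (pow_pos hp.pos 2) (by omega))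
    induction a using Nat.strong_induction_on with
    | _ a ih =>
      match a, ih with
      | 0, _ => rw [pow_zero]; exact r2_one
      | 1, _ =>
        have : SG (p^1) = ∅ := by
          ext z; simp only [SG, mem_ofPred_eq, pow_one, Set.mem_empty_iff_false, iff_false]
          exact hex z
        rw [r2_eq, this]; simp
      | (a+2), ih =>
        have hsub : SG (p^(a+2)) ⊆ ((fun z => (p:GaussianInt)*z) '' SG (p^a)) := by
          intro z hz
          have e : z.norm = p^(a+2) := by simpa [SG] using hz
          have hd : (p:GaussianInt) ∣ z*star z := by
            rw [mul_star_eq, e]; push_cast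
            exact ⟨(p:GaussianInt)^(a+1), by ring⟩
          have : (p:GaussianInt) ∣ z := by
            rcases hirr.dvd_or_dvd hd with h | ⟨w, hw⟩
            · exact h
            · refine ⟨star w, ?_⟩
              have := congrArg star hw
              rw [star_star, star_mul] at this
              rw [this, mul_comm]; congr 1
          obtain ⟨w, rfl⟩ := this
          refine ⟨w, ?_, rfl⟩
          rw [Zsqrtd.norm_mul, hnorm, pow_add, mul_comm] at e
          have := mul_right_cancel₀ (pow_pos hpZ 2).ne' e
          simpa [SG] using this
        have h1 := ih a (by omega)
        rw [r2_eq] at *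
        refine (Set.ncard_le_ncard hsub ((SG_finite _).image _)).trans
          ((Set.ncard_image_le (SG_finite _)).trans (h1.trans (by omega)))

/-- `r2 n ≤ C n^ε`. -/
theorem r2_bound (ε:ℝ) (hε : 0 < ε) : ∃ C:ℝ, 1 ≤ C ∧ ∀ n:ℕ, 0 < n → (r2 n:ℝ) ≤ C*(n:ℝ)^ε := by
  -- constant for individual primes
  obtain ⟨K, hK1, hK⟩ : ∃ K:ℝ, 1 ≤ K ∧ ∀ a:ℕ, (4*((a:ℝ)+1)) ≤ K*((2:ℝ)^a)^ε := by
    have ht : Tendsto (fun a:ℕ => (4*((a:ℝ)+1))*(((2:ℝ)^ε)⁻¹)^a) atTop (nhds 0) := by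
      have h1 : ((2:ℝ)^ε)⁻¹ < 1 := inv_lt_one_of_one_lt₀ (one_lt_rpow (by norm_num) hε)
      have h0 : 0≤((2:ℝ)^ε)⁻¹ := by positivity
      have a1 := tendsto_self_mul_const_pow_of_lt_one h0 h1
      have a2 := tendsto_pow_atTop_nhds_zero_of_lt_one h0 h1
      have := (a1.const_mul 4).add (a2.const_mul 4)
      simp only [mul_zero, add_zero] at this
      refine this.congr fun a => by ring
    obtain ⟨K, hK⟩ := ht.bddAbove_range
    refine ⟨max K 1, le_max_right _ _, fun a => ?_⟩
    have := hK ⟨a, rfl⟩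
    simp only at this
    rw [inv_pow, ← div_eq_mul_inv, div_le_iff₀ (by positivity)] at this
    refine this.trans ?_
    rw [← rpow_natCast ((2:ℝ)^ε) a, ← rpow_natCast 2 a, ← rpow_mul (by norm_num),
      ← rpow_mul (by norm_num), mul_comm ε]
    gcongr
    exact le_max_left _ _
  obtain ⟨P, hP⟩ := exists_nat_ge ((16:ℝ)^(1/ε))
  -- claim with explicit constant
  have main : ∀ n:ℕ, 1 < n → (r2 n:ℝ) ≤ K^((n.primeFactors.filter (· < P)).card)*(n:ℝ)^ε := by
    intro n
    induction n using Nat.recOnPosPrimePosCoprime with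
    | zero => intro h; omega
    | one => intro h; omega
    | prime_pow p k hp hk =>
      intro _
      have hle : (r2 (p^k):ℝ)≤4*((k:ℝ)+1) := by exact_mod_cast r2_prime_pow_le hp k
      rw [Nat.primeFactors_prime_pow hk.ne' hp, Finset.filter_singleton]
      split_ifs with h
      · refine hle.trans ((hK k).trans ?_)
        simp only [Finset.card_singleton, pow_one]
        have : ((2:ℝ)^k)^ε≤(((p^k:ℕ):ℝ))^ε := by
          push_cast
          gcongr
          exact_mod_cast hp.two_le
        gcongr
      · simp only [Finset.card_empty, pow_zero, one_mul]
        refine hle.trans ?_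
        have h16 : (4*((k:ℝ)+1))≤(16:ℝ)^k := by
          have := one_add_mul_le_pow (a := (15:ℝ)) (by norm_num) k
          have hk' : (1:ℝ) ≤ k := by exact_mod_cast hk
          norm_num at this
          linarith
        have hp' : (16:ℝ)^(1/ε) ≤ p := hP.trans (by exact_mod_cast (not_lt.1 h))
        have : (16:ℝ)^k≤(((p^k:ℕ):ℝ))^ε := by
          push_cast
          calc (16:ℝ)^k=(((16:ℝ)^(1/ε))^k)^ε := by
                rw [← rpow_natCast ((16:ℝ)^(1/ε)), ← rpow_mul (by positivity),
                  ← rpow_mul (by positivity), ← rpow_natCast]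
                congr 1; field_simp
            _≤_ := by gcongr
        exact h16.trans this
    | coprime a b ha hb hab iha ihb =>
      intro _
      have h1 : (r2 (a*b):ℝ) ≤ r2 a*r2 b := by
        exact_mod_cast r2_mul_le (by omega) (by omega) hab
      have hc : (((a*b).primeFactors.filter (· < P)).card) =
          ((a.primeFactors.filter (· < P)).card)+((b.primeFactors.filter (· < P)).card) := by
        rw [hab.primeFactors_mul, Finset.filter_union, Finset.card_union_of_disjoint]
        exact (Finset.disjoint_filter_filter hab.disjoint_primeFactors)
      rw [hc, pow_add]
      push_cast
      rw [mul_rpow (by positivity) (by positivity)]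
      calc (r2 (a*b):ℝ) ≤ r2 a*r2 b := h1
        _≤(K^((a.primeFactors.filter (· < P)).card)*(a:ℝ)^ε) *
            (K^((b.primeFactors.filter (· < P)).card)*(b:ℝ)^ε) := by
              gcongr
              · exact iha ha
              · exact ihb hb
        _ = _ := by ring
  refine ⟨4*K^P, by nlinarith [one_le_pow₀ hK1 (n := P)], fun n hn => ?_⟩
  have hKP := one_le_pow₀ hK1 (n := P)
  rcases Nat.lt_or_ge 1 n with h | h
  · refine (main n h).trans ?_
    have : K^((n.primeFactors.filter (· < P)).card) ≤ K^P := by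
      refine pow_le_pow_right₀ hK1 ?_
      refine (Finset.card_le_card (t := Finset.range P) ?_).trans (by simp)
      intro x hx
      simpa using (Finset.mem_filter.1 hx).2
    gcongr
    linarith
  · have : n=1 := by omega
    subst this
    have : (r2 1:ℝ)≤4 := by exact_mod_cast r2_one
    simp only [Nat.cast_one, one_rpow, mul_one]
    linarith

lemma GB_finite (N:ℕ) : {z : GaussianInt | 0 < z.norm ∧ z.norm ≤ N}.Finite := by
  refine (Set.Finite.biUnion (finite_toSet (Finset.range (N+1))) (fun n _ => SG_finite n)).subset ?_
  rintro z ⟨h1, h2⟩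
  simp only [Set.mem_iUnion]
  refine ⟨z.norm.toNat, ?_, ?_⟩
  · simp; omega
  · simp only [SG, mem_ofPred_eq]; omega

/-- nonzero Gaussian integers of norm at most `N` -/
def GB (N:ℕ) : Finset GaussianInt := (GB_finite N).toFinset

lemma mem_GB {N:ℕ} {z : GaussianInt} : z ∈ GB N ↔ 0 < z.norm ∧ z.norm ≤ N := by
  simp [GB]

/-- Units -/
def UG : Finset GaussianInt := (SG_finite 1).toFinset

lemma mem_UG {z : GaussianInt} : z ∈ UG ↔ z.norm=1 := by simp [UG, SG]

def Prm (a : GaussianInt) : Prop := IsCoprime a (star a)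

open Classical in
/-- sum over primitive -/
def Srs (N:ℕ):ℝ := ∑ a ∈ GB N with Prm a, 1/(a.norm:ℝ)

def HH (N:ℕ):ℝ := ∑ a ∈ GB N, 1/(a.norm:ℝ)

def A2 (N:ℕ):ℝ := ∑ n ∈ Icc 1 N, (r2 n:ℝ)^2/n

lemma sum_GB (N:ℕ) (f:ℤ → ℝ) : ∑ a ∈ GB N, f a.norm = ∑ n ∈ Icc 1 N, (r2 n:ℝ)*f n := by
  classical
  rw [← Finset.sum_fiberwise_of_maps_to (s := GB N) (t := Icc 1 N) (g := fun z => z.norm.toNat)]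
  · refine sum_congr rfl fun n hn => ?_
    have hn' := Finset.mem_Icc.1 hn
    rw [sum_congr rfl (g := fun _ => f n), sum_const, nsmul_eq_mul, r2_eq,
      ← Set.ncard_coe_finset]
    · congr 3
      ext z
      simp only [Finset.coe_filter, mem_GB, mem_ofPred_eq, SG]
      omega
    · intro z hz
      rw [mem_filter, mem_GB] at hz
      congr 1; omega
  · intro z hz
    rw [mem_GB] at hz
    rw [mem_Icc]; omega

lemma HH_eq (N:ℕ) : HH N = ∑ n ∈ Icc 1 N, (r2 n:ℝ)/n := by
  unfold HH
  rw [sum_GB N (fun x => 1/(x:ℝ))]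
  refine sum_congr rfl fun n _ => by push_cast; ring

lemma norm_ne_zero_of_mem {N:ℕ} {z : GaussianInt} (h : z ∈ GB N) : z ≠ 0 := by
  rintro rfl; simp [mem_GB] at h

lemma ne_of_norm {z : GaussianInt} (h : z.norm ≠ 0) : z ≠ 0 := by
  rintro rfl; simp at h

lemma UG_mul_star {ε : GaussianInt} (h : ε ∈ UG) : ε*star ε=1 := by
  rw [mul_star_eq, mem_UG.1 h]; simp

lemma star_dvd_star {a b : GaussianInt} (h : a ∣ b) : star a ∣ star b := by
  obtain ⟨c, rfl⟩ := h; exact ⟨star c, by rw [star_mul, mul_comm]⟩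

lemma norm_mul_z (a b : GaussianInt) : (a*b).norm = a.norm*b.norm := Zsqrtd.norm_mul a b

lemma decomp {z w ε : GaussianInt} (hz : z ≠ 0) (hN : z.norm = w.norm) (hε : ε ∈ UG) :
    ∃ a u, Prm a ∧ u ∈ UG ∧ z=(EuclideanDomain.gcd z w*ε)*a ∧
      w=(EuclideanDomain.gcd z w*ε)*star a*u := by
  have hγz := EuclideanDomain.gcd_dvd_left z w
  have hγw := EuclideanDomain.gcd_dvd_right z w
  have hbez := EuclideanDomain.gcd_eq_gcd_ab z w
  set γ := EuclideanDomain.gcd z w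
  obtain ⟨a0, ha0⟩ := hγz
  obtain ⟨b0, hb0⟩ := hγw
  have hγ0 : γ ≠ 0 := by rintro h; rw [h, zero_mul] at ha0; exact hz ha0
  have hγN := norm_pos_of_ne hγ0
  have hue := UG_mul_star hε
  have hcop : IsCoprime a0 b0 := by
    refine ⟨EuclideanDomain.gcdA z w, EuclideanDomain.gcdB z w, ?_⟩
    apply mul_left_cancel₀ hγ0
    linear_combination (-EuclideanDomain.gcdA z w)*ha0-EuclideanDomain.gcdB z w*hb0-hbez
  have hNN : a0.norm = b0.norm := by
    rw [ha0, hb0, norm_mul_z, norm_mul_z] at hN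
    exact mul_left_cancel₀ hγN.ne' hN
  have hb0ne : b0 ≠ 0 := by
    rintro rfl
    rw [mul_zero] at hb0
    rw [hb0] at hN
    exact (norm_pos_of_ne hz).ne' (by rw [hN]; simp)
  have hd : b0 ∣ star a0 := by
    have : b0 ∣ a0*star a0 := by
      rw [mul_star_eq, hNN, ← mul_star_eq]; exact dvd_mul_right _ _
    exact hcop.symm.dvd_of_dvd_mul_left this
  obtain ⟨c, hc⟩ := hd
  have hcu : c ∈ UG := by
    rw [mem_UG]
    have := congrArg Zsqrtd.norm hc
    rw [norm_star, norm_mul_z, hNN] at this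
    exact (mul_left_cancel₀ (norm_pos_of_ne hb0ne).ne' (by rw [mul_one]; exact this)).symm
  have hcc := UG_mul_star hcu
  refine ⟨star ε*a0, star c*star ε*star ε, ?_, ?_, ?_, ?_⟩
  · unfold Prm
    rw [star_mul, star_star, hc]
    have e1 : IsUnit (star ε) := IsUnit.of_mul_eq_one ε (by rw [mul_comm]; exact hue)
    have e2 : IsUnit ε := IsUnit.of_mul_eq_one _ hue
    have e3 : IsUnit c := IsUnit.of_mul_eq_one _ hcc
    rw [isCoprime_mul_unit_left_left e1, mul_assoc, mul_comm c ε, ← mul_assoc,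
      isCoprime_mul_unit_right_right e3, isCoprime_mul_unit_right_right e2]
    exact hcop
  · rw [mem_UG, norm_mul_z, norm_mul_z, norm_star, norm_star, mem_UG.1 hcu, mem_UG.1 hε]; rfl
  · linear_combination ha0-γ*a0*hue
  · rw [star_mul, star_star, hc]
    linear_combination hb0-γ*b0*(1+ε*star ε)*hue*(c*star c)-γ*b0*hcc

lemma gdiv {x y : GaussianInt} (hx : x ≠ 0) : (x*y)/x = y := mul_div_cancel_left₀ _ hx

lemma decomp_div {z w ε : GaussianInt} (hz : z ≠ 0) (hN : z.norm = w.norm) (hε : ε ∈ UG) :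
    ∃ g a u, g = EuclideanDomain.gcd z w*ε ∧ Prm a ∧ u ∈ UG ∧ z = g*a ∧ w = g*star a*u ∧
      a = z/g ∧ u = w/(g*star (z/g)) ∧ g ≠ 0 := by
  obtain ⟨a, u, h1, h2, h3, h4⟩ := decomp hz hN hε
  refine ⟨_, a, u, rfl, h1, h2, h3, h4, ?_, ?_, ?_⟩
  · set g := EuclideanDomain.gcd z w*ε
    have hg : g ≠ 0 := by rintro h; rw [h, zero_mul] at h3; exact hz h3
    rw [h3, gdiv hg]
  · set g := EuclideanDomain.gcd z w*ε
    have hg : g ≠ 0 := by rintro h; rw [h, zero_mul] at h3; exact hz h3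
    have ha : a ≠ 0 := by rintro h; rw [h, mul_zero] at h3; exact hz h3
    have ea : z/g = a := by rw [h3, gdiv hg]
    rw [ea, h4, gdiv (mul_ne_zero hg (star_ne_zero.2 ha))]
  · intro h; rw [h, zero_mul] at h3; exact hz h3

/-- key counting identity -/
lemma A2_eq (N:ℕ) : A2 N = ∑ g ∈ GB N, 1/(g.norm:ℝ)*Srs (N/g.norm.toNat) := by
  classical
  let pairs : Finset (GaussianInt × GaussianInt) := (GB N ×ˢ GB N).filter fun p => p.1.norm = p.2.norm
  let tr : Finset (GaussianInt × GaussianInt × GaussianInt) :=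
    (GB N ×ˢ GB N ×ˢ UG).filter fun p => Prm p.2.1 ∧ p.1.norm*p.2.1.norm ≤ N
  have hU : (0:ℝ) < UG.card := by
    have : (1 : GaussianInt) ∈ UG := by rw [mem_UG]; simp
    exact_mod_cast Finset.card_pos.2 ⟨_, this⟩
  have h1 : A2 N = ∑ p ∈ pairs, 1/(p.1.norm:ℝ) := by
    rw [sum_filter, sum_product]
    have : ∀ z ∈ GB N, ∑ w ∈ GB N, (if z.norm = w.norm then 1/(z.norm:ℝ) else 0) =
        (r2 z.norm.toNat:ℝ)/z.norm := by
      intro z hz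
      rw [mem_GB] at hz
      rw [sum_GB N (fun x => if z.norm = x then 1/(z.norm:ℝ) else 0),
        Finset.sum_eq_single z.norm.toNat]
      · rw [if_pos (by omega)]; ring
      · intro b _ hb
        rw [if_neg (by omega), mul_zero]
      · intro hh; exfalso; apply hh; rw [mem_Icc]; omega
    rw [sum_congr rfl this]
    rw [sum_GB N (fun x => (r2 x.toNat:ℝ)/(x:ℝ))]
    unfold A2
    refine sum_congr rfl fun n _ => by simp; ring
  have h2 : ∑ q ∈ tr, 1/((q.1.norm:ℝ)*q.2.1.norm) =
      UG.card*∑ g ∈ GB N, 1/(g.norm:ℝ)*Srs (N/g.norm.toNat) := by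
    rw [sum_filter, sum_product, mul_sum]
    refine sum_congr rfl fun g hg => ?_
    rw [sum_product]
    simp only [sum_const, nsmul_eq_mul]
    rw [← mul_sum]
    congr 1
    rw [← sum_filter, Srs, mul_sum]
    rw [mem_GB] at hg
    refine sum_congr ?_ fun a _ => by rw [one_div_mul_one_div]
    ext a
    simp only [mem_filter, mem_GB]
    have key : (a.norm≤((N/g.norm.toNat:ℕ):ℤ)) ↔ g.norm*a.norm ≤ N := by
      have hg' : ((g.norm.toNat:ℕ):ℤ) = g.norm := by omega
      push_cast
      rw [hg', Int.le_ediv_iff_mul_le hg.1, mul_comm]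
    rw [key]
    constructor
    · rintro ⟨⟨h1, h2⟩, h3, h4⟩; exact ⟨⟨h1, h4⟩, h3⟩
    · rintro ⟨⟨h1, h4⟩, h3⟩
      exact ⟨⟨h1, by nlinarith⟩, h3, h4⟩
  have h3 : ∑ pe ∈ pairs ×ˢ UG, 1/(pe.1.1.norm:ℝ) = ∑ q ∈ tr, 1/((q.1.norm:ℝ)*q.2.1.norm) := by
    refine sum_bij (fun pe _ =>
      (EuclideanDomain.gcd pe.1.1 pe.1.2*pe.2,
       pe.1.1/(EuclideanDomain.gcd pe.1.1 pe.1.2*pe.2),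
       pe.1.2/(EuclideanDomain.gcd pe.1.1 pe.1.2*pe.2 *
          star (pe.1.1/(EuclideanDomain.gcd pe.1.1 pe.1.2*pe.2))))) ?_ ?_ ?_ ?_
    · rintro ⟨⟨z, w⟩, ε⟩ h
      simp only [mem_product, pairs, mem_filter, mem_GB] at h
      obtain ⟨⟨⟨⟨hz1, hz2⟩, hw1, hw2⟩, hN⟩, hε⟩ := h
      obtain ⟨g, a, u, hg, ha, hu, e1, e2, e3, e4, hg0⟩ := decomp_div (ne_of_norm hz1.ne') hN hε
      simp only
      rw [← hg, ← e4, ← e3]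
      have hn : z.norm = g.norm*a.norm := by rw [e1, norm_mul_z]
      have p1 := norm_pos_of_ne hg0
      have p2 : 0 < a.norm := by
        have := gnorm_nonneg a
        rcases this.lt_or_eq with h | h
        · exact h
        · rw [← h] at hn; omega
      simp only [tr, mem_filter, mem_product, mem_GB]
      refine ⟨⟨⟨p1, by nlinarith⟩, ⟨p2, by nlinarith⟩, hu⟩, ha, by omega⟩
    · rintro ⟨⟨z, w⟩, ε⟩ h ⟨⟨z', w'⟩, ε'⟩ h' heq
      simp only [mem_product, pairs, mem_filter, mem_GB] at h h'
      obtain ⟨⟨⟨⟨hz1, hz2⟩, hw1, hw2⟩, hN⟩, hε⟩ := h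
      obtain ⟨⟨⟨⟨hz1', hz2'⟩, hw1', hw2'⟩, hN'⟩, hε'⟩ := h'
      obtain ⟨g, a, u, hg, ha, hu, e1, e2, e3, e4, hg0⟩ := decomp_div (ne_of_norm hz1.ne') hN hε
      obtain ⟨g', a', u', hg', ha', hu', e1', e2', e3', e4', hg0'⟩ :=
        decomp_div (ne_of_norm hz1'.ne') hN' hε'
      simp only at heq
      rw [← hg, ← e4, ← e3, ← hg', ← e4', ← e3'] at heq
      simp only [Prod.mk.injEq] at heq
      obtain ⟨q1, q2, q3⟩ := heq
      subst q1 q2 q3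
      have hzz : z = z' := by rw [e1, e1']
      have hww : w = w' := by rw [e2, e2']
      subst hzz hww
      have : EuclideanDomain.gcd z w ≠ 0 := by rintro h; rw [h, zero_mul] at hg; exact hg0 hg
      have : ε = ε' := mul_left_cancel₀ this (by rw [← hg, ← hg'])
      rw [this]
    · rintro ⟨g, a, u⟩ h
      simp only [tr, mem_filter, mem_product, mem_GB] at h
      obtain ⟨⟨⟨hg1, hg2⟩, ⟨ha1, ha2⟩, hu⟩, ha, hle⟩ := h
      have hg0 := ne_of_norm hg1.ne'
      have ha0 := ne_of_norm ha1.ne'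
      have huu := mem_UG.1 hu
      set z := g*a with hz
      set w := g*star a*u with hw
      have hzn : z.norm = g.norm*a.norm := norm_mul_z _ _
      have hN : z.norm = w.norm := by
        rw [hz, hw, norm_mul_z, norm_mul_z, norm_mul_z, norm_star, huu, mul_one]
      have hzpos : 0 < z.norm := by rw [hzn]; positivity
      -- the gcd is an associate of g
      have hd1 : EuclideanDomain.gcd z w ∣ g := by
        obtain ⟨x, y, hxy⟩ := ha
        have e : g = x*z+(y*star u)*w := by
          rw [hz, hw]
          have := UG_mul_star hu
          linear_combination (-g)*hxy-g*y*star a*this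
        rw [e]
        exact dvd_add ((EuclideanDomain.gcd_dvd_left _ _).mul_left _)
          ((EuclideanDomain.gcd_dvd_right _ _).mul_left _)
      have hd2 : g ∣ EuclideanDomain.gcd z w := EuclideanDomain.dvd_gcd (dvd_mul_right _ _)
        (by rw [hw, mul_assoc]; exact dvd_mul_right _ _)
      obtain ⟨ε, hε⟩ := hd1
      have hεu : ε ∈ UG := by
        rw [mem_UG]
        have h1 := norm_dvd hd2
        have h2 : g.norm=(EuclideanDomain.gcd z w).norm*ε.norm := by
          rw [← norm_mul_z, ← hε]
        have h3 : 0 < (EuclideanDomain.gcd z w).norm := by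
          rcases (gnorm_nonneg (EuclideanDomain.gcd z w)).lt_or_eq with h | h
          · exact h
          · rw [← h] at h2; omega
        have h4 := Int.le_of_dvd h3 h1
        have h5 : 0 < ε.norm := by
          rcases (gnorm_nonneg ε).lt_or_eq with h | h
          · exact h
          · rw [← h] at h2; omega
        nlinarith
      refine ⟨((z, w), ε), ?_, ?_⟩
      · simp only [mem_product, pairs, mem_filter, mem_GB]
        exact ⟨⟨⟨⟨hzpos, by omega⟩, by omega, by omega⟩, hN⟩, hεu⟩
      · simp only
        rw [← hε]
        have ea : z/g = a := gdiv hg0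
        rw [ea, gdiv (mul_ne_zero hg0 (star_ne_zero.2 ha0))]
    · rintro ⟨⟨z, w⟩, ε⟩ h
      simp only [mem_product, pairs, mem_filter, mem_GB] at h
      obtain ⟨⟨⟨⟨hz1, hz2⟩, hw1, hw2⟩, hN⟩, hε⟩ := h
      obtain ⟨g, a, u, hg, ha, hu, e1, e2, e3, e4, hg0⟩ := decomp_div (ne_of_norm hz1.ne') hN hε
      simp only
      rw [← hg, ← e3, e1, norm_mul_z]
      push_cast; rfl
  rw [sum_product] at h3
  simp only [sum_const, nsmul_eq_mul] at h3
  rw [← mul_sum, h2, ← h1] at h3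
  exact mul_left_cancel₀ hU.ne' h3

lemma natCast_dvd_iff (e:ℕ) (a : GaussianInt) : (e : GaussianInt) ∣ a ↔ e ∣ Int.gcd a.re a.im := by
  have := Zsqrtd.intCast_dvd (d := -1) (e:ℤ) a
  rw [Int.cast_natCast] at this
  rw [this, ← Int.natCast_dvd_natCast, Int.dvd_coe_gcd_iff]

lemma norm_natCast (e:ℕ) : ((e : GaussianInt)).norm = e^2 := by
  have := norm_intCast (e:ℤ); simpa using this

lemma even_norm_iff (a : GaussianInt) : Even a.norm ↔ (⟨1,1⟩ : GaussianInt) ∣ a := by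
  constructor
  · intro h
    have h1 : Even (a.re+a.im) := by
      rw [gnorm_def] at h
      rw [Int.even_add] at *
      simpa [Int.even_pow] using h
    obtain ⟨k, hk⟩ := h1
    refine ⟨⟨k, k-a.re⟩, ?_⟩
    rw [Zsqrtd.ext_iff]
    simp
    omega
  · intro h
    have := norm_dvd h
    rw [gnorm_def ⟨1,1⟩] at this
    exact even_iff_two_dvd.2 (by simpa using this)

lemma isUnit_norm {z : GaussianInt} (h : IsUnit z) : z.norm=1 :=
  (Zsqrtd.norm_eq_one_iff' (by norm_num) z).2 h

lemma prm_iff (a : GaussianInt) (_ : a ≠ 0) : Prm a ↔ (¬ Even a.norm ∧ Int.gcd a.re a.im=1) := by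
  constructor
  · intro h
    constructor
    · intro he
      have h1 := (even_norm_iff a).1 he
      have h2 := (even_norm_iff (star a)).1 (by rw [norm_star]; exact he)
      have := isUnit_norm (h.isUnit_of_dvd' h1 h2)
      rw [gnorm_def] at this
      norm_num at this
    · have h1 : ((Int.gcd a.re a.im:ℕ) : GaussianInt) ∣ a := (natCast_dvd_iff _ _).2 dvd_rfl
      have h2 := star_dvd_star h1
      rw [star_natCast] at h2
      have := isUnit_norm (h.isUnit_of_dvd' h1 h2)
      rw [norm_natCast] at this
      have h3 : (Int.gcd a.re a.im)^2=1 := by exact_mod_cast this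
      exact (Nat.pow_eq_one.1 h3).resolve_right (by norm_num)
  · rintro ⟨h1, h2⟩
    unfold Prm
    rw [← EuclideanDomain.gcd_isUnit_iff]
    set γ := EuclideanDomain.gcd a (star a)
    have d1 : γ ∣ a := EuclideanDomain.gcd_dvd_left _ _
    have d2 : γ ∣ star a := EuclideanDomain.gcd_dvd_right _ _
    have d3 : γ ∣ ((2*a.re:ℤ) : GaussianInt) := by
      have e : ((2*a.re:ℤ) : GaussianInt) = a+star a := by
        rw [Zsqrtd.ext_iff]; simp; ring
      rw [e]; exact dvd_add d1 d2
    have d4 : γ ∣ ((2*a.im:ℤ) : GaussianInt) := by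
      have e : ((2*a.im:ℤ) : GaussianInt) = ⟨0,-1⟩*(a-star a) := by
        rw [Zsqrtd.ext_iff]; simp; ring
      rw [e]; exact (dvd_sub d1 d2).mul_left _
    have hb := Int.gcd_eq_gcd_ab a.re a.im
    rw [h2] at hb
    have d5 : γ ∣ ((2:ℤ) : GaussianInt) := by
      have e : ((2:ℤ) : GaussianInt)=((2*a.re:ℤ) : GaussianInt)*((Int.gcdA a.re a.im:ℤ):GaussianInt)
          + ((2*a.im:ℤ) : GaussianInt)*((Int.gcdB a.re a.im:ℤ):GaussianInt) := by
        rw [← Int.cast_mul, ← Int.cast_mul, ← Int.cast_add]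
        congr 1
        push_cast at hb
        linear_combination 2*hb
      rw [e]; exact dvd_add (d3.mul_right _) (d4.mul_right _)
    have n1 := norm_dvd d1
    have n2 := norm_dvd d5
    rw [norm_intCast] at n2
    have n0 := gnorm_nonneg γ
    have hle := Int.le_of_dvd (by norm_num) n2
    rw [← Zsqrtd.norm_eq_one_iff' (by norm_num)]
    norm_num at n2 hle
    have n3 : ¬ Even γ.norm := fun h => h1 (even_iff_two_dvd.2 ((even_iff_two_dvd.1 h).trans n1))
    generalize γ.norm = t at *
    interval_cases t <;> revert n2 n3 <;> decide

open Classical in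
def OO (N:ℕ):ℝ := ∑ a ∈ GB N with ¬ Even a.norm, 1/(a.norm:ℝ)

lemma HH_eq_OO (N:ℕ) : HH N = OO N+HH (N/2)/2 := by
  classical
  unfold HH OO
  rw [← Finset.sum_filter_add_sum_filter_not (GB N) (fun a => ¬ Even a.norm)]
  congr 1
  rw [sum_div]
  symm
  have hn : (⟨1,1⟩ : GaussianInt).norm=2 := by rw [gnorm_def]; norm_num
  have h0 : (⟨1,1⟩ : GaussianInt) ≠ 0 := ne_of_norm (by rw [hn]; norm_num)
  refine sum_bij (fun b _ => (⟨1,1⟩ : GaussianInt)*b) ?_ ?_ ?_ ?_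
  · intro b hb
    rw [mem_GB] at hb
    rw [mem_filter, mem_GB, norm_mul_z, hn, not_not]
    push_cast at hb
    exact ⟨⟨by omega, by omega⟩, even_two_mul _⟩
  · intro b _ c _ h
    exact mul_left_cancel₀ h0 h
  · intro a ha
    rw [mem_filter, mem_GB, not_not] at ha
    obtain ⟨b, hb⟩ := (even_norm_iff a).1 ha.2
    refine ⟨b, ?_, hb.symm⟩
    rw [mem_GB]
    have := ha.1
    rw [hb, norm_mul_z, hn] at this
    push_cast
    omega
  · intro b _
    rw [norm_mul_z, hn]; push_cast; ring

lemma OO_eq (N:ℕ) : OO N = HH N-HH (N/2)/2 := by rw [HH_eq_OO N]; ring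

open ArithmeticFunction in
lemma Srs_eq (N:ℕ) : Srs N = ∑ e ∈ (Icc 1 N).filter Odd,
    (moebius e:ℝ)/(e:ℝ)^2*OO (N/e^2) := by
  classical
  have h1 : Srs N = ∑ a ∈ GB N with ¬ Even a.norm, ∑ e ∈ Icc 1 N,
      if (e ∣ Int.gcd a.re a.im) then (moebius e:ℝ)*(1/(a.norm:ℝ)) else 0 := by
    unfold Srs
    have : (GB N).filter Prm=((GB N).filter (fun a => ¬ Even a.norm)).filter
        (fun a => Int.gcd a.re a.im=1) := by
      rw [Finset.filter_filter]
      refine Finset.filter_congr fun a ha => prm_iff a (norm_ne_zero_of_mem ha)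
    rw [this, sum_filter]
    refine sum_congr rfl fun a ha => ?_
    have haN := mem_GB.1 (Finset.mem_filter.1 ha).1
    have hg0 : Int.gcd a.re a.im ≠ 0 := by
      intro h
      rw [Int.gcd_eq_zero_iff] at h
      have := haN.1
      rw [gnorm_def, h.1, h.2] at this
      norm_num at this
    have hd : (Icc 1 N).filter (fun e => e ∣ Int.gcd a.re a.im)=(Int.gcd a.re a.im).divisors := by
      ext e
      simp only [mem_filter, mem_Icc, Nat.mem_divisors]
      constructor
      · rintro ⟨_, h⟩; exact ⟨h, hg0⟩
      · rintro ⟨h, _⟩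
        have hpos := Nat.pos_of_dvd_of_pos h (Nat.pos_of_ne_zero hg0)
        refine ⟨⟨hpos, ?_⟩, h⟩
        have h2 := norm_dvd ((natCast_dvd_iff e a).2 h)
        rw [norm_natCast] at h2
        have h3 := Int.le_of_dvd haN.1 h2
        have h4 : (e:ℤ)^2 ≤ N := h3.trans haN.2
        have h5 : e^2 ≤ N := by exact_mod_cast h4
        nlinarith
    rw [← sum_filter, hd, ← sum_mul, ← Int.cast_sum, ← coe_mul_zeta_apply,
      moebius_mul_coe_zeta, one_apply]
    split_ifs <;> simp
  rw [h1, sum_comm, sum_filter]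
  refine sum_congr rfl fun e he => ?_
  have he1 := (Finset.mem_Icc.1 he).1
  rw [← sum_filter, ← mul_sum, div_mul_eq_mul_div, mul_div_assoc]
  have heN : ((e:ℕ) : GaussianInt).norm=(e:ℤ)^2 := norm_natCast e
  have hez : (0:ℤ) < (e:ℤ)^2 := by positivity
  have he0 : ((e:ℕ) : GaussianInt) ≠ 0 := ne_of_norm (by rw [heN]; exact hez.ne')
  split_ifs with hodd
  · congr 1
    unfold OO
    rw [sum_div]
    symm
    have hoddZ : ¬ Even ((e:ℤ)^2) := by
      rw [Int.not_even_iff_odd]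
      exact ((Int.odd_coe_nat e).2 hodd).pow
    refine sum_bij (fun b _ => (e : GaussianInt)*b) ?_ ?_ ?_ ?_
    · intro b hb
      rw [mem_filter, mem_GB] at hb
      obtain ⟨⟨b1, b2⟩, b3⟩ := hb
      rw [mem_filter, mem_filter, mem_GB, norm_mul_z, heN]
      push_cast at b2
      rw [Int.le_ediv_iff_mul_le hez] at b2
      refine ⟨⟨⟨by positivity, by rw [mul_comm]; exact b2⟩, ?_⟩, (natCast_dvd_iff _ _).1 (dvd_mul_right _ _)⟩
      rw [Int.even_mul]; tauto
    · intro b _ c _ h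
      exact mul_left_cancel₀ he0 h
    · intro a ha
      rw [mem_filter, mem_filter, mem_GB] at ha
      obtain ⟨b, rfl⟩ := (natCast_dvd_iff _ _).2 ha.2
      refine ⟨b, ?_, rfl⟩
      have := ha.1
      rw [norm_mul_z, heN, Int.even_mul] at this
      rw [mem_filter, mem_GB]
      push_cast
      rw [Int.le_ediv_iff_mul_le hez, mul_comm]
      refine ⟨⟨pos_of_mul_pos_right this.1.1 hez.le, this.1.2⟩, by tauto⟩
    · intro b _
      rw [norm_mul_z, heN]; push_cast; rw [div_div, mul_comm]
  · rw [Finset.sum_eq_zero, mul_zero]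
    intro a ha
    exfalso
    rw [mem_filter, mem_filter, mem_GB] at ha
    obtain ⟨b, rfl⟩ := (natCast_dvd_iff _ _).2 ha.2
    apply ha.1.2
    rw [norm_mul_z, heN, Int.even_mul]
    left
    rw [Nat.not_odd_iff_even] at hodd
    exact ((Int.even_coe_nat e).2 hodd).pow_of_ne_zero (by norm_num)

def RR (n:ℕ):ℝ := ∑ m ∈ Icc 1 n, (r2 m:ℝ)

lemma RR_eq (n:ℕ) : RR n=(GB n).card := by
  have := sum_GB n (fun _ => 1)
  simp at this
  rw [RR, this]

lemma RR_tendsto : ∃ h > 0, Tendsto (fun n:ℕ => RR n/n) atTop (𝓝 h) := by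
  let L : Submodule ℤ (Fin 2 → ℝ) := Submodule.span ℤ (Set.range (Pi.basisFun ℝ (Fin 2)))
  let F : (Fin 2 → ℝ) → ℝ := fun v => v 0 ^2+v 1 ^2
  have hFc : Continuous F := by fun_prop
  set S : Set (Fin 2 → ℝ) := {x ∈ Set.univ | F x≤1} with hS
  have hS' : S = {x | F x≤1} := by simp [hS]
  have hconv : Convex ℝ S := by
    rw [hS']
    intro x hx y hy a b ha hb hab
    simp only [F, mem_ofPred_eq, Pi.add_apply, Pi.smul_apply, smul_eq_mul] at *
    have hb' : b=1-a := by linarith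
    subst hb'
    nlinarith [mul_nonneg ha hb, mul_nonneg (mul_nonneg ha hb) (sq_nonneg (x 0-y 0)),
      mul_nonneg (mul_nonneg ha hb) (sq_nonneg (x 1-y 1)), mul_le_mul_of_nonneg_left hx ha,
      mul_le_mul_of_nonneg_left hy hb]
  have hmeas : MeasurableSet S := by rw [hS']; exact measurableSet_le hFc.measurable measurable_const
  have hbdd : Bornology.IsBounded S := by
    refine (Metric.isBounded_closedBall (x := (0 : Fin 2 → ℝ)) (r := 1)).subset ?_
    rw [hS']
    intro x hx
    rw [mem_closedBall_zero_iff, pi_norm_le_iff_of_nonneg (by norm_num)]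
    simp only [F, mem_ofPred_eq] at hx
    intro i
    rw [norm_eq_abs, abs_le_one_iff_mul_self_le_one]
    fin_cases i
    · simp; nlinarith [sq_nonneg (x 1)]
    · simp; nlinarith [sq_nonneg (x 0)]
  have hT := ZLattice.covolume.tendsto_card_le_div (L := L) (X := Set.univ) (F := F)
    (fun _ _ _ _ => trivial) (fun x r _ => by simp [F]; ring) hbdd hmeas (hconv.addHaar_frontier volume)
  have hcv := ZLattice.covolume_pos L (volume)
  have hvol : 0 < volume.real S := by
    rw [measureReal_def, ENNReal.toReal_pos_iff]
    refine ⟨?_, hbdd.measure_lt_top⟩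
    have : (Metric.ball (0 : Fin 2 → ℝ) (1/2)) ⊆ S := by
      rw [hS']
      intro x hx
      rw [mem_ball_zero_iff, pi_norm_lt_iff (by norm_num)] at hx
      have h0 := abs_lt.1 (by simpa using hx 0 : |x 0| < 2⁻¹)
      have h1 := abs_lt.1 (by simpa using hx 1 : |x 1| < 2⁻¹)
      simp only [F, mem_ofPred_eq]
      nlinarith
    exact (Metric.measure_ball_pos _ _ (by norm_num)).trans_le (measure_mono this)
  refine ⟨volume.real S/ZLattice.covolume L volume, by positivity, ?_⟩
  have hcard : ∀ n:ℕ, (Nat.card ({x ∈ (Set.univ : Set (Fin 2 → ℝ)) | F x≤(n:ℝ)} ∩ L : Set (Fin 2 → ℝ)):ℝ)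
      = RR n+1 := by
    intro n
    rw [RR_eq, ← Nat.cast_add_one, Nat.cast_inj]
    have h0 : (0 : GaussianInt) ∉ GB n := by simp [mem_GB]
    rw [← Finset.card_insert_of_notMem h0, ← Set.ncard_coe_finset, Nat.card_coe_set_eq]
    symm
    refine Set.ncard_congr (fun z _ => ![(z.re:ℝ), (z.im:ℝ)]) ?_ ?_ ?_
    · intro z hz
      have hz' : z.norm ≤ n := by
        simp only [Finset.coe_insert, Set.mem_insert_iff, mem_coe, mem_GB] at hz
        rcases hz with rfl | h
        · simp
        · exact h.2
      rw [gnorm_def] at hz'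
      refine ⟨⟨trivial, ?_⟩, ?_⟩
      · simp only [F, Matrix.cons_val_zero, Matrix.cons_val_one]
        exact_mod_cast hz'
      · rw [SetLike.mem_coe, Module.Basis.mem_span_iff_repr_mem]
        intro i
        fin_cases i
        · exact ⟨z.re, by simp⟩
        · exact ⟨z.im, by simp⟩
    · intro z w _ _ h
      have a0 := congrFun h 0
      have a1 := congrFun h 1
      simp only [Matrix.cons_val_zero, Matrix.cons_val_one, Int.cast_inj] at a0 a1
      exact Zsqrtd.ext a0 a1
    · rintro v ⟨⟨_, hv⟩, hvL⟩
      rw [SetLike.mem_coe, Module.Basis.mem_span_iff_repr_mem] at hvL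
      obtain ⟨a, ha⟩ := hvL 0
      obtain ⟨b, hb⟩ := hvL 1
      simp at ha hb
      refine ⟨⟨a, b⟩, ?_, ?_⟩
      · simp only [F, ← ha, ← hb] at hv
        have hv' : a^2+b^2≤(n:ℤ) := by exact_mod_cast hv
        simp only [Finset.coe_insert, Set.mem_insert_iff, mem_coe, mem_GB]
        by_cases hz : (⟨a, b⟩ : GaussianInt)=0
        · left; exact hz
        · right; exact ⟨norm_pos_of_ne hz, by rw [gnorm_def]; exact hv'⟩
      · ext i; fin_cases i <;> simp [ha, hb]
  have hT2 := hT.comp tendsto_natCast_atTop_atTop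
  have h1 : Tendsto (fun n:ℕ => (1:ℝ)/n) atTop (𝓝 0) := tendsto_one_div_atTop_nhds_zero_nat
  have := hT2.sub h1
  rw [sub_zero] at this
  refine this.congr fun n => ?_
  simp only [Function.comp_apply, hcard]
  ring

lemma HH_abel (n:ℕ) : HH n = RR n/(n+1)+∑ m ∈ Finset.range (n+1), RR m/(m*(m+1)) := by
  rw [HH_eq]
  induction n with
  | zero => simp [RR]
  | succ n ih =>
    rw [sum_Icc_succ_top (by omega), ih, sum_range_succ _ (n+1)]
    have : RR (n+1) = RR n+r2 (n+1) := by unfold RR; rw [sum_Icc_succ_top (by omega)]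
    rw [this]
    push_cast
    field_simp
    ring

lemma harm_log : Tendsto (fun n:ℕ => (∑ i ∈ Finset.range n, (1:ℝ)/(i+1))/log n) atTop (𝓝 1) := by
  have h := tendsto_harmonic_sub_log
  have hlog : Tendsto (fun n:ℕ => log (n:ℝ)) atTop atTop := tendsto_log_atTop.comp tendsto_natCast_atTop_atTop
  have h2 := (h.div_atTop hlog).add_const 1
  rw [zero_add] at h2
  refine h2.congr' ?_
  filter_upwards [hlog.eventually_gt_atTop 0] with n hn
  have : ((harmonic n : ℚ):ℝ) = ∑ i ∈ Finset.range n, (1:ℝ)/(i+1) := by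
    simp [harmonic]
  rw [this]; field_simp; ring

lemma natlog_tendsto : Tendsto (fun n:ℕ => log (n:ℝ)) atTop atTop :=
  tendsto_log_atTop.comp tendsto_natCast_atTop_atTop

lemma log_succ_div : Tendsto (fun n:ℕ => log ((n:ℝ)+1)/log n) atTop (𝓝 1) := by
  have h1 : Tendsto (fun n:ℕ => log ((n:ℝ)+1)-log n) atTop (𝓝 0) := by
    exact tendsto_log_nat_add_one_sub_log
  have h2 := (h1.div_atTop natlog_tendsto).add_const 1
  rw [zero_add] at h2
  refine h2.congr' ?_
  filter_upwards [natlog_tendsto.eventually_gt_atTop 0] with n hn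
  field_simp; ring

lemma HH_tendsto : ∃ h > 0, Tendsto (fun n:ℕ => HH n/log n) atTop (𝓝 h) := by
  obtain ⟨h, hpos, hR⟩ := RR_tendsto
  refine ⟨h, hpos, ?_⟩
  have hg : Tendsto (fun n => ∑ i ∈ Finset.range n, (1:ℝ)/(i+1)) atTop atTop :=
    tendsto_sum_range_one_div_nat_succ_atTop
  have ho : (fun m:ℕ => RR m/(m*(m+1))-h*(1/((m:ℝ)+1))) =o[atTop] (fun m:ℕ => (1:ℝ)/(m+1)) := by
    rw [Asymptotics.isLittleO_iff_tendsto' (by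
      filter_upwards with m hm; exfalso
      have : (0:ℝ) < 1/((m:ℝ)+1) := by positivity
      linarith)]
    have := hR.sub_const h
    rw [sub_self] at this
    refine this.congr' ?_
    filter_upwards [eventually_gt_atTop 0] with m hm
    have : (0:ℝ) < m := by exact_mod_cast hm
    field_simp
  have hs := ho.sum_range (fun m => by positivity) hg
  have hs2 := hs.tendsto_div_nhds_zero
  have t1 : Tendsto (fun n:ℕ => (∑ i ∈ Finset.range (n+1), (1:ℝ)/(i+1))/log n) atTop (𝓝 1) := by
    have := (harm_log.comp (tendsto_add_atTop_nat 1)).mul log_succ_div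
    rw [mul_one] at this
    refine this.congr' ?_
    filter_upwards [natlog_tendsto.eventually_gt_atTop 0, (natlog_tendsto.comp (tendsto_add_atTop_nat 1)).eventually_gt_atTop 0] with n hn hn'
    simp only [Function.comp_apply] at *
    push_cast at *
    field_simp
  have t2 := (hs2.comp (tendsto_add_atTop_nat 1)).mul t1
  have t3 : Tendsto (fun n:ℕ => RR n/(n+1)/log n) atTop (𝓝 0) := by
    refine Tendsto.div_atTop (a := h) ?_ natlog_tendsto
    have := hR.mul (tendsto_natCast_div_add_atTop (1:ℝ))
    rw [mul_one] at this
    refine this.congr' ?_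
    filter_upwards [eventually_gt_atTop 0] with m hm
    have : (0:ℝ) < m := by exact_mod_cast hm
    field_simp
  have t4 := (t3.add t2).add (t1.const_mul h)
  rw [zero_mul, zero_add, zero_add, mul_one] at t4
  refine t4.congr fun n => ?_
  rw [HH_abel]
  simp only [Function.comp_apply]
  have hp : (0:ℝ) < ∑ i ∈ Finset.range (n+1), (1:ℝ)/(i+1) :=
    Finset.sum_pos (fun i _ => by positivity) ⟨0, by simp⟩
  rw [div_mul_div_cancel₀ hp.ne', sum_sub_distrib, ← mul_sum]
  ring

def ell (N:ℕ):ℝ := 1+log N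

lemma one_le_ell (N:ℕ) : 1 ≤ ell N := by
  unfold ell; linarith [log_natCast_nonneg N]

lemma ell_pos (N:ℕ) : 0 < ell N := by linarith [one_le_ell N]

lemma ell_mono {a b:ℕ} (h : a ≤ b) : ell a ≤ ell b := by
  unfold ell
  rcases Nat.eq_zero_or_pos a with rfl | ha
  · simpa using log_natCast_nonneg b
  · have : (a:ℝ) ≤ b := by exact_mod_cast h
    have h0 : (0:ℝ) < a := by exact_mod_cast ha
    linarith [log_le_log h0 this]

lemma ell_atTop : Tendsto ell atTop atTop := tendsto_atTop_add_const_left _ _ natlog_tendsto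

lemma ell_div_log : Tendsto (fun n => ell n/log n) atTop (𝓝 1) := by
  have h2 := ((tendsto_const_nhds (x := (1:ℝ))).div_atTop natlog_tendsto).add_const 1
  rw [zero_add] at h2
  refine h2.congr' ?_
  filter_upwards [natlog_tendsto.eventually_gt_atTop 0] with n hn
  unfold ell; field_simp

lemma log_div_ell : Tendsto (fun n:ℕ => log n/ell n) atTop (𝓝 1) := by
  have := ell_div_log.inv₀ one_ne_zero
  rw [inv_one] at this
  refine this.congr fun n => by rw [inv_div]

lemma floor_div_log {N d:ℕ} (hd : 1 ≤ d) (h : d ≤ N) :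
    log N-log d-log 2 ≤ log ((N/d:ℕ):ℝ) ∧ log ((N/d:ℕ):ℝ) ≤ log N-log d := by
  have hd0 : (0:ℝ) < d := by exact_mod_cast hd
  have hN0 : (0:ℝ) < N := by exact_mod_cast (by omega : 0 < N)
  have hq : 1 ≤ N/d := Nat.div_pos h hd
  have hq0 : (0:ℝ) < (N/d:ℕ) := by exact_mod_cast hq
  rw [← log_div hN0.ne' hd0.ne', ← log_div (by positivity) (by norm_num)]
  constructor
  · apply log_le_log (by positivity)
    rw [div_div, div_le_iff₀ (by positivity)]
    have h1 : N < d*(N/d)+d := by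
      have := Nat.div_add_mod N d
      have := Nat.mod_lt N hd
      omega
    have h2 : d ≤ d*(N/d) := Nat.le_mul_of_pos_right _ hq
    have h3 : N≤(N/d)*(d*2) := by nlinarith
    exact_mod_cast h3
  · apply log_le_log hq0
    exact Nat.cast_div_le

lemma ell_ratio (k:ℕ) (hk : 1 ≤ k) : Tendsto (fun N => ell (N/k)/ell N) atTop (𝓝 1) := by
  have h1 : Tendsto (fun N => (ell (N/k)-ell N)/ell N) atTop (𝓝 0) := by
    refine squeeze_zero_norm' (a := fun N => (log k+log 2)/ell N) ?_ (tendsto_const_nhds.div_atTop ell_atTop)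
    filter_upwards [eventually_ge_atTop k] with N hN
    rw [norm_div, norm_eq_abs, norm_eq_abs, abs_of_pos (ell_pos N)]
    have := floor_div_log hk hN
    have h2 := log_natCast_nonneg k
    have h3 := log_pos (by norm_num : (1:ℝ) < 2)
    gcongr
    · exact (ell_pos N).le
    rw [abs_le]; unfold ell
    constructor <;> linarith
  have h2 := h1.add_const 1
  rw [zero_add] at h2
  refine h2.congr fun N => ?_
  have := ell_pos N
  field_simp; ring

lemma bdd_of_tendsto {f:ℕ → ℝ} {h:ℝ} (H : Tendsto f atTop (𝓝 h)) : ∃ C, 0 < C ∧ ∀ n, |f n| ≤ C := by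
  obtain ⟨C, hC⟩ := H.norm.bddAbove_range
  refine ⟨max C 1, by positivity, fun n => ?_⟩
  exact (hC ⟨n, rfl⟩).trans (le_max_left _ _)

lemma tendsto_ell_of_log {f:ℕ → ℝ} {h:ℝ} (H : Tendsto (fun n:ℕ => f n/log n) atTop (𝓝 h)) :
    Tendsto (fun n => f n/ell n) atTop (𝓝 h) := by
  have := H.mul log_div_ell
  rw [mul_one] at this
  refine this.congr' ?_
  filter_upwards [natlog_tendsto.eventually_gt_atTop 0] with n hn
  field_simp

lemma div_atTop_nat (k:ℕ) (hk : 1 ≤ k) : Tendsto (fun N:ℕ => N/k) atTop atTop :=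
  Nat.tendsto_div_const_atTop (by omega)

lemma comp_ratio {f:ℕ → ℝ} {h:ℝ} (H : Tendsto (fun n:ℕ => f n/ell n) atTop (𝓝 h)) (k:ℕ) (hk : 1 ≤ k) :
    Tendsto (fun n => f (n/k)/ell n) atTop (𝓝 h) := by
  have := (H.comp (div_atTop_nat k hk)).mul (ell_ratio k hk)
  rw [mul_one] at this
  refine this.congr fun n => ?_
  have := ell_pos (n/k)
  have := ell_pos n
  simp only [Function.comp_apply]
  field_simp

lemma OO_tendsto {h:ℝ} (H : Tendsto (fun n:ℕ => HH n/ell n) atTop (𝓝 h)) :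
    Tendsto (fun n => OO n/ell n) atTop (𝓝 (h/2)) := by
  have := H.sub ((comp_ratio H 2 (by norm_num)).div_const 2)
  rw [show h-h/2 = h/2 by ring] at this
  refine this.congr fun n => ?_
  rw [OO_eq]; ring

lemma moeb_sum_pos : 0 < ∑' e:ℕ, (if Odd e then (ArithmeticFunction.moebius e:ℝ)/(e:ℝ)^2 else 0) := by
  set f:ℕ → ℝ := fun e => if Odd e then (ArithmeticFunction.moebius e:ℝ)/(e:ℝ)^2 else 0
  have hz := hasSum_zeta_two
  have hb : ∀ e, |f e| ≤ 1/(e:ℝ)^2 := by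
    intro e
    simp only [f]
    split_ifs
    · rw [abs_div, abs_of_nonneg (by positivity : (0:ℝ)≤(e:ℝ)^2)]
      gcongr
      exact_mod_cast ArithmeticFunction.abs_moebius_le_one
    · simp;
  have hs : Summable f := Summable.of_norm_bounded hz.summable hb
  have h1 : HasSum (fun e => f e+1/(e:ℝ)^2) (∑' e, f e+π^2/6) := hs.hasSum.add hz
  have h2 : f 1+1/((1:ℕ):ℝ)^2≤∑' e, f e+π^2/6 := by
    refine le_hasSum h1 1 fun e _ => ?_
    linarith [neg_le_of_abs_le (hb e)]
  have h3 : f 1=1 := by simp [f]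
  rw [h3] at h2
  have : π^2 < 12 := by nlinarith [pi_lt_d2, pi_pos]
  norm_num at h2
  linarith

lemma Srs_tendsto : ∃ b > 0, Tendsto (fun n => Srs n/ell n) atTop (𝓝 b) := by
  obtain ⟨h, hpos, H⟩ := HH_tendsto
  have H := OO_tendsto (tendsto_ell_of_log H)
  set f:ℕ → ℝ := fun e => if Odd e then (ArithmeticFunction.moebius e:ℝ)/(e:ℝ)^2 else 0 with hf
  refine ⟨(∑' e, f e)*(h/2), mul_pos moeb_sum_pos (by positivity), ?_⟩
  obtain ⟨C, hC0, hC⟩ := bdd_of_tendsto H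
  have key := tendsto_tsum_of_dominated_convergence (𝓕 := atTop) (f := fun (N e:ℕ) => if e ∈ Icc 1 N then f e*(OO (N/e^2)/ell N) else 0)
    (g := fun e => f e*(h/2)) (bound := fun e:ℕ => C*(1/(e:ℝ)^2)) (hasSum_zeta_two.summable.mul_left C) ?_ ?_
  · rw [tsum_mul_right] at key
    refine key.congr fun N => ?_
    rw [Srs_eq, tsum_eq_sum (s := Icc 1 N) (fun b hb => if_neg hb), sum_filter, sum_div]
    refine sum_congr rfl fun e he => ?_
    rw [if_pos he, hf]
    by_cases ho : Odd e
    · simp only [if_pos ho]; ring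
    · simp only [if_neg ho]; ring
  · intro e
    by_cases he : 1 ≤ e
    · have := (comp_ratio H (e^2) (Nat.one_le_pow _ _ he)).const_mul (f e)
      refine this.congr' ?_
      filter_upwards [eventually_ge_atTop e] with N hN
      rw [if_pos (Finset.mem_Icc.2 ⟨he, hN⟩)]
    · have : e=0 := by omega
      subst this
      simp [hf]
  · refine Eventually.of_forall fun N e => ?_
    split_ifs with he
    · rw [mem_Icc] at he
      have hb : |f e| ≤ 1/(e:ℝ)^2 := by
        simp only [f]
        split_ifs
        · rw [abs_div, abs_of_nonneg (by positivity : (0:ℝ)≤(e:ℝ)^2)]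
          gcongr
          exact_mod_cast ArithmeticFunction.abs_moebius_le_one
        · simp
      rw [norm_mul, norm_eq_abs, mul_comm]
      gcongr
      have h1 := hC (N/e^2)
      rw [norm_eq_abs, abs_div, abs_of_pos (ell_pos _)]
      rw [abs_div, abs_of_pos (ell_pos _), div_le_iff₀ (ell_pos _)] at h1
      rw [div_le_iff₀ (ell_pos _)]
      exact h1.trans (by gcongr; exact ell_mono (Nat.div_le_self _ _))
    · simp; positivity

lemma A2_eq' (N:ℕ) : A2 N = ∑ d ∈ Icc 1 N, (r2 d:ℝ)/d*Srs (N/d) := by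
  rw [A2_eq]
  have := sum_GB N (fun n => 1/(n:ℝ)*Srs (N/n.toNat))
  rw [this]
  refine sum_congr rfl fun d _ => ?_
  push_cast
  simp only [Int.toNat_natCast]
  ring

def WW (N:ℕ):ℝ := ∑ d ∈ Icc 1 N, (r2 d:ℝ)/d*(log N-log d)

lemma WW_eq (N:ℕ) : WW N = ∑ d ∈ Finset.range N, HH d*(log (d+1)-log d) := by
  induction N with
  | zero => simp [WW]
  | succ n ih =>
    rw [sum_range_succ, ← ih, HH_eq, WW, WW, sum_Icc_succ_top (by omega), sum_mul,
      ← sum_add_distrib]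
    simp only [sub_self, mul_zero, add_zero]
    refine sum_congr rfl fun d _ => ?_
    push_cast; ring

lemma WW_tendsto {h:ℝ} (H : Tendsto (fun n:ℕ => HH n/log n) atTop (𝓝 h)) :
    Tendsto (fun n => WW n/log n ^2) atTop (𝓝 (h/2)) := by
  set g:ℕ → ℝ := fun d => log ((d:ℝ)+1)^2-log d ^2 with hg
  have hgsum : ∀ n, ∑ i ∈ Finset.range n, g i = log n ^2 := by
    intro n
    have := Finset.sum_range_sub (fun d:ℕ => log (d:ℝ)^2) n
    simp at this
    simpa [hg] using this
  have hlt : ∀ d:ℕ, 1 ≤ d → log (d:ℝ) < log ((d:ℝ)+1) := fun d hd =>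
    log_lt_log (by exact_mod_cast hd) (by linarith)
  have hg0 : ∀ d, 0 ≤ g d := by
    intro d
    rcases Nat.eq_zero_or_pos d with rfl | hd
    · simp [hg]
    · have := hlt d hd
      have := log_natCast_nonneg d
      simp only [hg]; nlinarith
  have hg1 : ∀ d, 1 ≤ d → 0 < g d := by
    intro d hd
    have := hlt d hd
    have := log_natCast_nonneg d
    simp only [hg]; nlinarith
  have hl2 : Tendsto (fun n:ℕ => log (n:ℝ)^2) atTop atTop := (tendsto_pow_atTop two_ne_zero).comp natlog_tendsto
  have ho : (fun d:ℕ => HH d*(log (d+1)-log d)-(h/2)*g d) =o[atTop] g := by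
    rw [Asymptotics.isLittleO_iff_tendsto' (by
      filter_upwards [eventually_ge_atTop 1] with m hm h0
      exact absurd h0 (hg1 m hm).ne')]
    have t := H.mul ((log_succ_div.add_const 1).inv₀ (by norm_num))
    have t2 := t.sub_const (h/2)
    rw [show h*(1+1)⁻¹-h/2=0 by ring] at t2
    refine t2.congr' ?_
    filter_upwards [eventually_ge_atTop 1, natlog_tendsto.eventually_gt_atTop 0] with m hm hm2
    have h1 := hlt m hm
    have h2 := hg1 m hm
    have h3 : g m=(log ((m:ℝ)+1)-log m)*(log ((m:ℝ)+1)+log m) := by simp only [hg]; ring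
    have h4 : 0 < log ((m:ℝ)+1)-log m := by linarith
    have h5 : 0 < log ((m:ℝ)+1)+log m := by linarith
    rw [sub_div, mul_div_assoc (h/2), div_self h2.ne', h3]
    field_simp
  have hs := (ho.sum_range hg0 (by simpa only [hgsum] using hl2)).tendsto_div_nhds_zero
  have := hs.add_const (h/2)
  rw [zero_add] at this
  refine this.congr' ?_
  filter_upwards [hl2.eventually_gt_atTop 0] with n hn
  rw [sum_sub_distrib, ← mul_sum, hgsum, WW_eq, sub_div, mul_div_assoc (h/2), div_self hn.ne']
  ring

lemma A2_asymp : ∃ κ > 0, Tendsto (fun n => A2 n/log n ^2) atTop (𝓝 κ) := by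
  obtain ⟨h, hpos, H⟩ := HH_tendsto
  obtain ⟨b, bpos, hb⟩ := Srs_tendsto
  refine ⟨b*(h/2), by positivity, ?_⟩
  have hW := (WW_tendsto H).const_mul b
  have hl2 : Tendsto (fun n:ℕ => log (n:ℝ)^2) atTop atTop := (tendsto_pow_atTop two_ne_zero).comp natlog_tendsto
  -- difference
  have hdiff : Tendsto (fun n => (A2 n-b*WW n)/log n ^2) atTop (𝓝 0) := by
    rw [Metric.tendsto_atTop]
    intro ε hε
    have hev : ∀ᶠ n in atTop, |Srs n/ell n-b| < ε/(2*(h+1)) := by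
      have := Metric.tendsto_atTop.1 hb (ε/(2*(h+1))) (by positivity)
      obtain ⟨n0, hn0⟩ := this
      filter_upwards [eventually_ge_atTop n0] with n hn
      exact hn0 n hn
    obtain ⟨n0, hn0⟩ := eventually_atTop.1 hev
    set C:ℝ := ∑ i ∈ Finset.range n0, |Srs i-b*ell i| with hC
    have hC0 : 0 ≤ C := sum_nonneg fun _ _ => abs_nonneg _
    have hSb : ∀ y, |Srs y-b*ell y| ≤ ε/(2*(h+1))*ell y+C := by
      intro y
      have hl := ell_pos y
      by_cases hy : y < n0
      · have : |Srs y-b*ell y| ≤ C :=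
          single_le_sum (f := fun i => |Srs i-b*ell i|) (fun _ _ => abs_nonneg _) (Finset.mem_range.2 hy)
        have : 0≤ε/(2*(h+1))*ell y := by positivity
        linarith
      · have h1 := hn0 y (by omega)
        have : Srs y-b*ell y=(Srs y/ell y-b)*ell y := by field_simp
        rw [this, abs_mul, abs_of_pos hl]
        have := mul_le_mul_of_nonneg_right h1.le hl.le
        linarith
    have hbound : ∀ N, |A2 N-b*WW N| ≤ (ε/(2*(h+1))*ell N+C+b)*HH N := by
      intro N
      rw [A2_eq', WW, mul_sum, ← sum_sub_distrib, HH_eq, mul_sum]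
      refine (abs_sum_le_sum_abs _ _).trans (sum_le_sum fun d hd => ?_)
      rw [mem_Icc] at hd
      rw [show (r2 d:ℝ)/d*Srs (N/d)-b*((r2 d:ℝ)/d*(log N-log d)) =
        ((Srs (N/d)-b*ell (N/d))+b*(ell (N/d)-(log N-log d)))*((r2 d:ℝ)/d) by ring, abs_mul,
        abs_of_nonneg (by positivity : 0≤(r2 d:ℝ)/d)]
      gcongr
      refine (abs_add_le _ _).trans ?_
      have e1 := hSb (N/d)
      have e2 : ε/(2*(h+1))*ell (N/d)≤ε/(2*(h+1))*ell N := by gcongr; exact ell_mono (Nat.div_le_self _ _)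
      have e3 : |b*(ell (N/d)-(log N-log d))| ≤ b := by
        rw [abs_mul, abs_of_pos bpos]
        have : |ell (N/d)-(log N-log d)| ≤ 1 := by
          have := floor_div_log hd.1 hd.2
          have h2 : log 2 < 1 := by linarith [log_two_lt_d9]
          rw [abs_le]; unfold ell
          constructor <;> linarith
        nlinarith
      linarith
    have hlim : Tendsto (fun n:ℕ => (ε/(2*(h+1))*(ell n/log n)+(C+b)/log n)*(HH n/log n)) atTop
        (𝓝 ((ε/(2*(h+1))*1+0)*h)) :=
      ((ell_div_log.const_mul _).add (tendsto_const_nhds.div_atTop natlog_tendsto)).mul H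
    have hlt : (ε/(2*(h+1))*1+0)*h < ε := by
      rw [mul_one, add_zero, div_mul_eq_mul_div, div_lt_iff₀ (by positivity)]
      nlinarith
    obtain ⟨n1, hn1⟩ := eventually_atTop.1 ((hlim.eventually_lt_const hlt).and (natlog_tendsto.eventually_gt_atTop 0))
    refine ⟨n1, fun n hn => ?_⟩
    obtain ⟨h1, h2⟩ := hn1 n hn
    rw [dist_eq, sub_zero, abs_div, abs_of_pos (by positivity : 0 < log (n:ℝ)^2)]
    refine lt_of_le_of_lt ?_ h1
    rw [div_le_iff₀ (by positivity)]
    refine (hbound n).trans (le_of_eq ?_)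
    field_simp
    ring
  have := hdiff.add hW
  rw [zero_add] at this
  refine this.congr fun n => ?_
  ring

def VV (N:ℕ) (w:ℝ):ℝ := ∑ n ∈ Icc 1 N, (r2 n:ℝ)^2/(n:ℝ)^2*sin (π*√n*w)^2

def TT (M N:ℕ):ℝ := ∑ n ∈ Finset.Ioc M N, (r2 n:ℝ)^2/(n:ℝ)^2

lemma A2_block (η:ℝ) (hη : 0 < η) : ∀ᶠ M:ℕ in atTop, A2 (2*M)-A2 M≤η*log M ^2 := by
  obtain ⟨κ, hκ, H⟩ := A2_asymp
  have h2 : Tendsto (fun n:ℕ => log ((2*n:ℕ):ℝ)/log n) atTop (𝓝 1) := by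
    have h2 := ((tendsto_const_nhds (x := log 2)).div_atTop natlog_tendsto).add_const 1
    rw [zero_add] at h2
    refine h2.congr' ?_
    filter_upwards [natlog_tendsto.eventually_gt_atTop 0, eventually_gt_atTop 0] with n hn hn'
    rw [Nat.cast_mul, Nat.cast_two, log_mul (by norm_num) (by positivity)]
    field_simp
  have hd : Tendsto (fun n:ℕ => 2*n) atTop atTop := tendsto_id.const_mul_atTop' (by norm_num)
  have := ((H.comp hd).mul (h2.pow 2)).sub H
  rw [one_pow, mul_one, sub_self] at this
  filter_upwards [this.eventually_lt_const hη, natlog_tendsto.eventually_gt_atTop 0, (natlog_tendsto.comp hd).eventually_gt_atTop 0] with n h1 h2 h3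
  simp only [Function.comp_apply] at h1 h3
  have : A2 (2*n)/log ((2*n:ℕ):ℝ)^2*(log ((2*n:ℕ):ℝ)/log n)^2-A2 n/log n^2=(A2 (2*n)-A2 n)/log n^2 := by
    field_simp
  rw [this, div_lt_iff₀ (by positivity)] at h1
  exact h1.le

lemma TT_split {M K N:ℕ} (h : M ≤ K) : TT M N ≤ TT M K+TT K N := by
  unfold TT
  rw [← sum_union (Finset.disjoint_left.2 fun a => by simp; omega)]
  refine sum_le_sum_of_subset_of_nonneg (fun a => by simp; omega) fun i _ _ => by positivity

lemma TT_block {M:ℕ} (hM : 1 ≤ M) : TT M (2*M)≤(A2 (2*M)-A2 M)/M := by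
  have h : A2 (2*M)-A2 M = ∑ n ∈ Finset.Ioc M (2*M), (r2 n:ℝ)^2/n := by
    unfold A2
    rw [sub_eq_iff_eq_add, ← sum_union (Finset.disjoint_left.2 fun a => by simp; omega)]
    congr 1
    ext a; simp; omega
  rw [h, TT, sum_div]
  refine sum_le_sum fun n hn => ?_
  rw [mem_Ioc] at hn
  have h0 : (0:ℝ) < M := by exact_mod_cast hM
  have h1 : (M:ℝ) ≤ n := by exact_mod_cast hn.1.le
  have h2 : (0:ℝ) < n := by linarith
  rw [div_div, sq (n:ℝ)]
  gcongr

lemma TT_bound (η:ℝ) (hη : 0 < η) : ∀ᶠ M:ℕ in atTop, ∀ N, TT M N≤4*η*log M ^2/M := by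
  have h3 : ∀ᶠ M:ℕ in atTop, log ((2*M:ℕ):ℝ)^2≤3/2*log M^2 := by
    filter_upwards [natlog_tendsto.eventually_ge_atTop 4, eventually_gt_atTop 0] with n hn hn'
    rw [Nat.cast_mul, Nat.cast_two, log_mul (by norm_num) (by positivity)]
    have : log 2 < 0.7 := by linarith [log_two_lt_d9]
    have : 0 < log 2 := log_pos (by norm_num)
    nlinarith
  obtain ⟨M0, hM0⟩ := eventually_atTop.1 ((A2_block η hη).and (h3.and (eventually_ge_atTop 1)))
  filter_upwards [eventually_ge_atTop M0] with M hM N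
  induction hk : N-M using Nat.strong_induction_on generalizing M with
  | _ k ih =>
    obtain ⟨a1, a2, a3⟩ := hM0 M hM
    have hM' : (0:ℝ) < M := by exact_mod_cast a3
    by_cases hN : N ≤ M
    · have : TT M N=0 := by unfold TT; rw [Finset.Ioc_eq_empty (by omega)]; simp
      rw [this]; positivity
    · have := ih (N-2*M) (by omega) (2*M) (by omega) rfl
      refine (TT_split (K := 2*M) (by omega)).trans ?_
      have b1 := (TT_block a3).trans (div_le_div_of_nonneg_right a1 hM'.le)
      have b2 : 4*η*log ((2*M:ℕ):ℝ)^2/((2*M:ℕ):ℝ)≤3*η*log M^2/M := by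
        rw [Nat.cast_mul, Nat.cast_two] at *
        rw [div_le_div_iff₀ (by positivity) hM']
        have := mul_le_mul_of_nonneg_left a2 (by positivity : 0≤4*η*M)
        nlinarith
      calc _≤η*log M^2/M+3*η*log M^2/M := by linarith
        _ = _ := by ring

lemma VV_upper (M N:ℕ) (w:ℝ) : VV N w≤π^2*w^2*A2 M+TT M N := by
  have h1 : VV N w≤∑ n ∈ Icc 1 M, (r2 n:ℝ)^2/(n:ℝ)^2*sin (π*√n*w)^2 +
      ∑ n ∈ Finset.Ioc M N, (r2 n:ℝ)^2/(n:ℝ)^2*sin (π*√n*w)^2 := by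
    rw [← sum_union (Finset.disjoint_left.2 fun a => by simp; omega)]
    refine sum_le_sum_of_subset_of_nonneg (fun a => by simp; omega) fun i _ _ => by positivity
  refine h1.trans (add_le_add ?_ ?_)
  · unfold A2
    rw [mul_sum]
    refine sum_le_sum fun n hn => ?_
    rw [mem_Icc] at hn
    have h2 : (0:ℝ) < n := by exact_mod_cast hn.1
    have : sin (π*√n*w)^2≤(π*√n*w)^2 := sq_le_sq.2 abs_sin_le_abs
    rw [mul_pow, mul_pow, sq_sqrt h2.le] at this
    calc _≤(r2 n:ℝ)^2/(n:ℝ)^2*(π^2*n*w^2) := by gcongr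
      _ = _ := by field_simp
  · unfold TT
    refine sum_le_sum fun n hn => ?_
    have := sin_sq_le_one (π*√n*w)
    exact mul_le_of_le_one_right (by positivity) this

lemma VV_lower {M N:ℕ} (h : M ≤ N) {w η:ℝ} (hw : 0 < w) (hη : π^2*η≤1) (hM : M*w^2≤η) :
    (1-π^2*η)*(π^2*w^2*A2 M) ≤ VV N w := by
  have h1 : ∑ n ∈ Icc 1 M, (r2 n:ℝ)^2/(n:ℝ)^2*sin (π*√n*w)^2 ≤ VV N w :=
    sum_le_sum_of_subset_of_nonneg (fun a => by simp; omega) fun i _ _ => by positivity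
  refine le_trans ?_ h1
  unfold A2
  rw [mul_sum, mul_sum]
  refine sum_le_sum fun n hn => ?_
  rw [mem_Icc] at hn
  have h2 : (0:ℝ) < n := by exact_mod_cast hn.1
  set x := π*√n*w with hx
  have hx2 : x^2 = π^2*n*w^2 := by rw [hx, mul_pow, mul_pow, sq_sqrt h2.le]
  have hx0 : 0 < x := by positivity
  have hnM : (n:ℝ) ≤ M := by exact_mod_cast hn.2
  have hx3 : x^2≤π^2*η := by
    rw [hx2, mul_assoc]
    gcongr
    exact le_trans (by gcongr) hM
  have hx1 : x≤1 := by nlinarith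
  have hs := sin_gt_sub_cube hx0
  have hs2 : x^2*(1-π^2*η) ≤ sin x^2 := by
    have h4 : 0 ≤ x-x^3/4 := by nlinarith [mul_pos hx0 hx0]
    have h5 : (x-x^3/4)^2 ≤ sin x^2 := by gcongr; linarith [pow_pos hx0 3]
    have h6 : x^2*(1-x^2)≤(x-x^3/4)^2 := by
      have : (x-x^3/4)^2-x^2*(1-x^2) = x^4/2+x^6/16 := by ring
      have : 0 ≤ x^4/2+x^6/16 := by positivity
      linarith
    have h7 : x^2*(1-π^2*η) ≤ x^2*(1-x^2) := by gcongr
    linarith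
  calc _ = (r2 n:ℝ)^2/(n:ℝ)^2*(x^2*(1-π^2*η)) := by rw [hx2]; field_simp
    _≤_ := by gcongr

def Mw (η w:ℝ):ℕ := ⌊η*(w^2)⁻¹⌋₊

lemma Mw_tendsto {η:ℝ} (hη : 0 < η) : Tendsto (Mw η) (𝓝[>] 0) atTop := by
  unfold Mw
  refine tendsto_nat_floor_atTop.comp ?_
  refine Tendsto.const_mul_atTop hη ?_
  have : Tendsto (fun w:ℝ => (w^2)) (𝓝[>] 0) (𝓝[>] 0) := by
    rw [tendsto_nhdsWithin_iff]
    constructor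
    · have : Tendsto (fun w:ℝ => w^2) (𝓝 0) (𝓝 (0^2)) := (continuous_pow 2).tendsto 0
      simp at this
      exact this.mono_left nhdsWithin_le_nhds
    · filter_upwards [self_mem_nhdsWithin] with w hw
      exact pow_pos (Set.mem_Ioi.1 hw) 2
  exact tendsto_inv_nhdsGT_zero.comp this

lemma neglog_tendsto : Tendsto (fun w:ℝ => -log w) (𝓝[>] 0) atTop :=
  tendsto_neg_atBot_atTop.comp tendsto_log_nhdsGT_zero

lemma logMw {η:ℝ} (hη : 0 < η) : Tendsto (fun w => log (Mw η w)/(-log w)) (𝓝[>] 0) (𝓝 2) := by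
  have hd : Tendsto (fun w => (log (Mw η w)-2*(-log w))/(-log w)) (𝓝[>] 0) (𝓝 0) := by
    refine squeeze_zero_norm' (a := fun w => (|log η| + log 2)/(-log w)) ?_ (tendsto_const_nhds.div_atTop neglog_tendsto)
    filter_upwards [neglog_tendsto.eventually_gt_atTop 0, (Mw_tendsto hη).eventually_ge_atTop 1, self_mem_nhdsWithin] with w h1 h2 h3
    have h3 : 0 < w := h3
    rw [norm_div, norm_eq_abs, norm_eq_abs, abs_of_pos h1]
    gcongr
    have h4 : 0 < η*(w^2)⁻¹ := by positivity
    have h5 : (Mw η w:ℝ)≤η*(w^2)⁻¹ := floor_le h4.le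
    have h6 : η*(w^2)⁻¹ < Mw η w+1 := Nat.lt_floor_add_one _
    have h7 : (1:ℝ) ≤ Mw η w := by exact_mod_cast h2
    have e : log (η*(w^2)⁻¹) = log η+2*(- log w) := by
      rw [log_mul hη.ne' (by positivity), log_inv, log_pow]; push_cast; ring
    have h8 := log_le_log (by linarith) h5
    have h9 := log_le_log h4 (by linarith : η*(w^2)⁻¹≤2*Mw η w)
    rw [log_mul two_ne_zero (by positivity : (Mw η w:ℝ) ≠ 0)] at h9
    have hl2 : 0 < log 2 := log_pos (by norm_num)
    rw [abs_le]
    constructor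
    · linarith [neg_abs_le (log η)]
    · linarith [le_abs_self (log η)]
  have := hd.add_const 2
  rw [zero_add] at this
  refine this.congr' ?_
  filter_upwards [neglog_tendsto.eventually_gt_atTop 0] with w h1
  have : log w ≠ 0 := by linarith
  field_simp; ring

lemma A2Mw : ∃ κ > 0, ∀ η > 0, Tendsto (fun w => A2 (Mw η w)/log w^2) (𝓝[>] 0) (𝓝 (4*κ)) := by
  obtain ⟨κ, hκ, H⟩ := A2_asymp
  refine ⟨κ, hκ, fun η hη => ?_⟩
  have := (H.comp (Mw_tendsto hη)).mul ((logMw hη).pow 2)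
  rw [show κ*2^2=4*κ by ring] at this
  refine this.congr' ?_
  filter_upwards [neglog_tendsto.eventually_gt_atTop 0, (natlog_tendsto.comp (Mw_tendsto hη)).eventually_gt_atTop 0] with w h1 h2
  simp only [Function.comp_apply] at *
  have : log w ≠ 0 := by linarith
  field_simp

/-- Variance asymptotics. -/
lemma VV_asymp : ∃ κ > 0, ∀ ε > 0, ∀ᶠ w in 𝓝[>] (0:ℝ),
    (∀ N:ℕ, VV N w≤(κ+ε)*(w^2*log w^2)) ∧
    (∀ N:ℕ, (w^4)⁻¹ ≤ N+1 → (κ-ε)*(w^2*log w^2) ≤ VV N w) := by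
  obtain ⟨κ, hκ, H⟩ := A2Mw
  refine ⟨π^2*(4*κ), by positivity, fun ε hε => ?_⟩
  -- choose η
  obtain ⟨η, hη, h1, h2, h3⟩ : ∃ η:ℝ, 0 < η ∧ π^2*η≤1 ∧ 80*η≤ε/2 ∧ π^2*(π^2*(4*κ))*η≤ε/2 := by
    have a1 : 0 < π^2 := by positivity
    refine ⟨min (1/π^2) (min (ε/160) (ε/2/(π^2*(π^2*(4*κ))))), by positivity, ?_, ?_, ?_⟩
    · calc π^2*_≤π^2*(1/π^2) := by gcongr; exact min_le_left _ _
        _ = 1 := by field_simp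
    · have : min (1/π^2) (min (ε/160) (ε/2/(π^2*(π^2*(4*κ)))))≤ε/160 := (min_le_right _ _).trans (min_le_left _ _)
      linarith
    · calc _≤π^2*(π^2*(4*κ))*(ε/2/(π^2*(π^2*(4*κ)))) := by
            gcongr; exact (min_le_right _ _).trans (min_le_right _ _)
        _ = ε/2 := by field_simp
  have H1 := (H η hη).const_mul (π^2)
  have e1 := H1.eventually_lt_const (by linarith : π^2*(4*κ) < π^2*(4*κ)+ε/2)
  have e2 := (H1.const_mul (1-π^2*η)).eventually_const_lt
    (by nlinarith : π^2*(4*κ)-ε < (1-π^2*η)*(π^2*(4*κ)))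
  have e3 := ((logMw hη).pow 2).eventually_lt_const (by norm_num : (2:ℝ)^2 < 5)
  have e4 := (Mw_tendsto hη).eventually (TT_bound (η^2) (by positivity))
  have e5 : ∀ᶠ w in 𝓝[>] (0:ℝ), η*w^2 < 1 := by
    have : Tendsto (fun w:ℝ => η*w^2) (𝓝 0) (𝓝 (η*0^2)) := (Continuous.tendsto (by fun_prop) 0)
    simp at this
    exact (this.mono_left nhdsWithin_le_nhds).eventually_lt_const one_pos
  filter_upwards [e1, e2, e3, e4, e5, neglog_tendsto.eventually_gt_atTop 0, (Mw_tendsto hη).eventually_ge_atTop 1,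
    self_mem_nhdsWithin] with w f1 f2 f3 f4 f5 f6 f7 hw
  have hw : 0 < w := hw
  have hl : 0 < log w^2 := by nlinarith
  have hMpos : (1:ℝ) ≤ Mw η w := by exact_mod_cast f7
  have hfl : (Mw η w:ℝ)≤η*(w^2)⁻¹ := floor_le (by positivity)
  have hfl2 : η*(w^2)⁻¹ < Mw η w+1 := Nat.lt_floor_add_one _
  constructor
  · intro N
    have t1 := VV_upper (Mw η w) N w
    have t2 := f4 N
    have t3 : 4*η^2*log (Mw η w)^2/Mw η w≤ε/2*(w^2*log w^2) := by
      rw [div_pow, neg_sq, div_lt_iff₀ hl] at f3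
      rw [div_le_iff₀ (by linarith)]
      have q : η≤2*(Mw η w*w^2) := by
        have := mul_le_mul_of_nonneg_right (by linarith : η*(w^2)⁻¹≤2*Mw η w) (by positivity : 0 ≤ w^2)
        rw [mul_assoc, inv_mul_cancel₀ (by positivity)] at this
        linarith
      calc 4*η^2*log (Mw η w)^2≤4*η^2*(5*log w^2) := by gcongr
        _ = 20*η*log w^2*η := by ring
        _≤20*η*log w^2*(2*(Mw η w*w^2)) := by gcongr
        _ = 40*η*(w^2*log w^2)*Mw η w := by ring
        _≤_ := by gcongr; linarith
    rw [← mul_div_assoc, div_lt_iff₀ hl] at f1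
    have t4 : π^2*w^2*A2 (Mw η w) ≤ w^2*((π^2*(4*κ)+ε/2)*log w^2) := by
      have := mul_le_mul_of_nonneg_left f1.le (by positivity : 0 ≤ w^2)
      linarith
    calc _≤_ := t1
      _ ≤ w^2*((π^2*(4*κ)+ε/2)*log w^2)+ε/2*(w^2*log w^2) := by linarith
      _ = _ := by ring
  · intro N hN
    have hMN : Mw η w ≤ N := by
      have : (Mw η w:ℝ) < N+1 := by
        refine lt_of_le_of_lt hfl (lt_of_lt_of_le ?_ hN)
        rw [show w^4 = w^2*w^2 by ring, mul_inv]
        have : η < (w^2)⁻¹ := by rw [lt_inv_comm₀ hη (by positivity), ← one_div, lt_div_iff₀ hη]; linarith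
        gcongr
      have : Mw η w < N+1 := by exact_mod_cast this
      omega
    have hM : (Mw η w:ℝ)*w^2≤η := by
      calc _≤η*(w^2)⁻¹*w^2 := by gcongr
        _ = η := by field_simp
    refine le_trans ?_ (VV_lower hMN hw h1 hM)
    rw [← mul_div_assoc, ← mul_div_assoc, lt_div_iff₀ hl] at f2
    have := mul_le_mul_of_nonneg_left f2.le (by positivity : 0 ≤ w^2)
    linarith

/-- Gaussian moment function. -/
def gam (j:ℕ) (V:ℝ):ℝ := if Even j then gaussMoment j*V^(j/2) else 0

lemma gaussMoment_nonneg (j:ℕ) : 0 ≤ gaussMoment j := by unfold gaussMoment; positivity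
lemma gaussMoment_succ (k:ℕ) : (Nat.choose (2*(k+1)) 2:ℝ)*gaussMoment (2*k)=(k+1)*gaussMoment (2*(k+1)) := by
  unfold gaussMoment
  rw [show 2*k/2 = k by omega, show 2*(k+1)/2 = k+1 by omega, Nat.cast_choose_two,
    show 2*(k+1)=(2*k+1)+1 by ring, Nat.factorial_succ, Nat.factorial_succ, Nat.factorial_succ]
  push_cast
  field_simp
  ring

lemma pow_taylor2 (A:ℝ) (hA : 0 ≤ A) (k:ℕ) : ∃ C ≥ 0, ∀ V v:ℝ, 0 ≤ V → 0 ≤ v → V+v ≤ A →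
    |(V+v)^(k+1)-V^(k+1)-(k+1)*V^k*v| ≤ C*v^2 := by
  induction k with
  | zero => exact ⟨0, le_rfl, fun V v _ _ _ => by simp⟩
  | succ k ih =>
    obtain ⟨C, hC, h⟩ := ih
    refine ⟨A*C+(k+1)*A^k, by positivity, fun V v hV hv hs => ?_⟩
    have h1 := h V v hV hv hs
    have e : (V+v)^(k+1+1)-V^(k+1+1)-((k+1:ℕ)+1)*V^(k+1)*v =
      (V+v)*((V+v)^(k+1)-V^(k+1)-(k+1)*V^k*v)+(k+1)*V^k*v^2 := by
      push_cast; ring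
    rw [e]
    refine (abs_add_le _ _).trans ?_
    rw [abs_mul, abs_of_nonneg (by positivity : 0 ≤ V+v), abs_of_nonneg (by positivity : 0≤(k+1)*V^k*v^2), add_mul (A*C)]
    have : V ≤ A := by linarith
    have h2 : V^k ≤ A^k := pow_le_pow_left₀ hV this k
    refine add_le_add ?_ ?_
    · rw [mul_assoc A]
      exact mul_le_mul hs h1 (abs_nonneg _) hA
    · gcongr

lemma gam_step (A:ℝ) (hA : 0 ≤ A) (j:ℕ) (hj : 2 ≤ j) : ∃ C ≥ 0, ∀ V v:ℝ, 0 ≤ V → 0 ≤ v → V+v ≤ A →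
    |gam j (V+v)-gam j V-Nat.choose j 2*gam (j-2) V*v| ≤ C*v^2 := by
  rcases Nat.even_or_odd j with he | ho
  · obtain ⟨k, hk⟩ := he
    obtain ⟨k', rfl⟩ : ∃ k', k = k'+1 := ⟨k-1, by omega⟩
    have hj2 : j=2*(k'+1) := by omega
    subst hj2
    obtain ⟨C, hC, h⟩ := pow_taylor2 A hA k'
    refine ⟨gaussMoment (2*(k'+1))*C, mul_nonneg (gaussMoment_nonneg _) hC, fun V v hV hv hs => ?_⟩
    have e1 : Even (2*(k'+1)) := even_two_mul _
    have e2 : 2*(k'+1)-2=2*k' := by omega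
    rw [e2]
    unfold gam
    rw [if_pos e1, if_pos e1, if_pos (even_two_mul _), show 2*k'/2 = k' by omega, show 2*(k'+1)/2 = k'+1 by omega]
    have e : gaussMoment (2*(k'+1))*(V+v)^(k'+1)-gaussMoment (2*(k'+1))*V^(k'+1)-Nat.choose (2*(k'+1)) 2*(gaussMoment (2*k')*V^k')*v
      = gaussMoment (2*(k'+1))*((V+v)^(k'+1)-V^(k'+1)-(k'+1)*V^k'*v) := by
      have := gaussMoment_succ k'
      linear_combination (-V^k'*v)*this
    rw [e, abs_mul, abs_of_nonneg (gaussMoment_nonneg _), mul_assoc (gaussMoment _) C]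
    exact mul_le_mul_of_nonneg_left (h V v hV hv hs) (gaussMoment_nonneg _)
  · refine ⟨0, le_rfl, fun V v _ _ _ => ?_⟩
    have e1 : ¬ Even j := Nat.not_even_iff_odd.2 ho
    have e2 : ¬ Even (j-2) := by
      rw [Nat.not_even_iff_odd]
      exact Nat.Odd.sub_even hj ho even_two
    simp [gam, e1, e2]

lemma gam_bound (A:ℝ) (hA : 0 ≤ A) (j:ℕ) {V:ℝ} (h0 : 0 ≤ V) (hV : V ≤ A) : |gam j V| ≤ gaussMoment j*A^(j/2) := by
  unfold gam
  have := gaussMoment_nonneg j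
  split_ifs
  · rw [abs_of_nonneg (by positivity)]; gcongr
  · simp; positivity

structure CltData (A B δ:ℝ) (j:ℕ) (Q : Finset ℕ) (v p:ℕ → ℝ) (z:ℕ → ℕ → ℂ) (m : Finset ℕ → ℕ → ℂ) : Prop where
  m0 : m ∅ 0=1
  m1 : ∀ i, 0 < i → m ∅ i=0
  step : ∀ R ⊆ Q, ∀ q ∈ Q, q ∉ R → ∀ i, m (insert q R) i = ∑ l ∈ Finset.range (i+1), (Nat.choose i l:ℂ)*(m R (i-l)*z q l)
  z0 : ∀ q ∈ Q, z q 0=1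
  z1 : ∀ q ∈ Q, z q 1=0
  z2 : ∀ q ∈ Q, z q 2 = v q
  vnn : ∀ q ∈ Q, 0 ≤ v q
  v2 : ∀ q ∈ Q, v q^2≤δ*p q
  zb : ∀ q ∈ Q, ∀ i, 3 ≤ i → i ≤ j → ‖z q i‖ ≤ δ*p q
  vA : ∑ q ∈ Q, v q ≤ A
  pB : ∑ q ∈ Q, p q ≤ B
  δ0 : 0≤δ
  δ1 : δ≤1

lemma CltData.mono {A B δ:ℝ} {j j':ℕ} {Q : Finset ℕ} {v p:ℕ → ℝ} {z:ℕ → ℕ → ℂ} {m : Finset ℕ → ℕ → ℂ}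
    (h : CltData A B δ j Q v p z m) (hj : j' ≤ j) : CltData A B δ j' Q v p z m :=
  { h with zb := fun q hq i h3 hi => h.zb q hq i h3 (hi.trans hj) }

lemma clt_rec (A B:ℝ) (hA : 0 ≤ A) (hB : 0 ≤ B) (j:ℕ) : ∃ C ≥ 0, ∀ (δ:ℝ) (Q : Finset ℕ) (v p:ℕ → ℝ)
    (z:ℕ → ℕ → ℂ) (m : Finset ℕ → ℕ → ℂ), CltData A B δ j Q v p z m →
    ∀ R ⊆ Q, ‖m R j-(gam j (∑ q ∈ R, v q):ℝ)‖ ≤ C*δ := by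
  induction j using Nat.strong_induction_on with
  | _ j ih =>
  rcases Nat.lt_or_ge j 2 with hj | hj
  · refine ⟨0, le_rfl, fun δ Q v p z m h R hR => ?_⟩
    have key : m R 0=1 ∧ m R 1=0 := by
      induction R using Finset.induction_on with
      | empty => exact ⟨h.m0, h.m1 1 one_pos⟩
      | insert q R hq ihR =>
        obtain ⟨a0, a1⟩ := ihR (fun x hx => hR (Finset.mem_insert_of_mem hx))
        have hqQ := hR (Finset.mem_insert_self q R)
        have s := h.step R (fun x hx => hR (Finset.mem_insert_of_mem hx)) q hqQ hq
        constructor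
        · rw [s 0]; simp [a0, h.z0 q hqQ]
        · rw [s 1]; simp [sum_range_succ, a1, h.z1 q hqQ]
    interval_cases j
    · simp [gam, key.1, gaussMoment]
    · simp [gam, key.2]
  · choose! Cj hCj0 hCj using ih
    obtain ⟨Cg, hCg0, hCg⟩ := gam_step A hA j hj
    set D:ℝ := ∑ i ∈ Finset.range j, (Cj i+gaussMoment i*A^(i/2)) with hD
    have hterm : ∀ i ∈ Finset.range j, 0 ≤ Cj i+gaussMoment i*A^(i/2) := fun i hi =>
      add_nonneg (hCj0 i (Finset.mem_range.1 hi)) (mul_nonneg (gaussMoment_nonneg _) (by positivity))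
    have hD0 : 0 ≤ D := sum_nonneg hterm
    have h2j : 0 ≤ Cj (j-2) := hCj0 _ (by omega)
    refine ⟨(Nat.choose j 2*Cj (j-2))*A+(2^j*D+Cg)*B, by positivity, fun δ Q v p z m h R hR => ?_⟩
    have hmb : ∀ i < j, ∀ R ⊆ Q, ‖m R i‖ ≤ D := by
      intro i hi R hR
      have a1 := hCj i hi δ Q v p z m (h.mono hi.le) R hR
      have hV0 : 0≤∑ q ∈ R, v q := sum_nonneg fun q hq => h.vnn q (hR hq)
      have hVA : ∑ q ∈ R, v q ≤ A := (sum_le_sum_of_subset_of_nonneg hR fun q hq _ => h.vnn q hq).trans h.vA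
      have a2 := gam_bound A hA i hV0 hVA
      have a3 : ‖m R i‖ ≤ Cj i*δ + |gam i (∑ q ∈ R, v q)| := by
        have := norm_add_le (m R i-(gam i (∑ q ∈ R, v q):ℝ)) ((gam i (∑ q ∈ R, v q):ℝ):ℂ)
        rw [sub_add_cancel, norm_real, norm_eq_abs] at this
        linarith
      have a4 : Cj i*δ ≤ Cj i := mul_le_of_le_one_right (hCj0 i hi) h.δ1
      calc ‖m R i‖ ≤ Cj i+gaussMoment i*A^(i/2) := by linarith
        _ ≤ D := single_le_sum (f := fun i => Cj i+gaussMoment i*A^(i/2)) hterm (Finset.mem_range.2 hi)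
    have main : ∀ R ⊆ Q, ‖m R j-(gam j (∑ q ∈ R, v q):ℝ)‖ ≤
        ∑ q ∈ R, (Nat.choose j 2*Cj (j-2)*δ*v q+(2^j*D+Cg)*(δ*p q)) := by
      intro R
      induction R using Finset.induction_on with
      | empty =>
        intro _
        rw [h.m1 j (by omega)]
        have : gam j 0=0 := by
          unfold gam
          split_ifs
          · rw [zero_pow (by omega), mul_zero]
          · rfl
        simp [this]
      | insert q R hq ihR =>
        intro hR
        have hR' : R ⊆ Q := fun x hx => hR (Finset.mem_insert_of_mem hx)
        have hqQ := hR (Finset.mem_insert_self q R)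
        have s := h.step R hR' q hqQ hq j
        rw [sum_insert hq, sum_insert hq, s, add_comm (v q)]
        set V := ∑ q ∈ R, v q
        have hV0 : 0 ≤ V := sum_nonneg fun q hq => h.vnn q (hR' hq)
        have hVA : V+v q ≤ A := by
          have := (sum_le_sum_of_subset_of_nonneg hR fun q hq _ => h.vnn q hq).trans h.vA
          rw [sum_insert hq] at this
          linarith
        have hg := hCg V (v q) hV0 (h.vnn q hqQ) hVA
        have hsplit : ∑ l ∈ Finset.range (j+1), (Nat.choose j l:ℂ)*(m R (j-l)*z q l) =
            m R j+(Nat.choose j 2:ℂ)*(m R (j-2)*v q) +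
            ∑ l ∈ Ico 3 (j+1), (Nat.choose j l:ℂ)*(m R (j-l)*z q l) := by
          rw [← Finset.sum_range_add_sum_Ico _ (by omega : 3 ≤ j+1)]
          simp [sum_range_succ, h.z0 q hqQ, h.z1 q hqQ, h.z2 q hqQ]
        rw [hsplit]
        have e : m R j+(Nat.choose j 2:ℂ)*(m R (j-2)*v q) +
            ∑ l ∈ Ico 3 (j+1), (Nat.choose j l:ℂ)*(m R (j-l)*z q l)-(gam j (V+v q):ℝ) =
            (m R j-(gam j V:ℝ))+(Nat.choose j 2:ℂ)*(m R (j-2)-(gam (j-2) V:ℝ))*v q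
            + ∑ l ∈ Ico 3 (j+1), (Nat.choose j l:ℂ)*(m R (j-l)*z q l)
            - ((gam j (V+v q)-gam j V-Nat.choose j 2*gam (j-2) V*v q:ℝ):ℂ) := by
          push_cast; ring
        rw [e]
        refine (norm_sub_le _ _).trans ?_
        have n1 := norm_add_le ((m R j-(gam j V:ℝ))+(Nat.choose j 2:ℂ)*(m R (j-2)-(gam (j-2) V:ℝ))*v q)
          (∑ l ∈ Ico 3 (j+1), (Nat.choose j l:ℂ)*(m R (j-l)*z q l))
        have n2 := norm_add_le (m R j-(gam j V:ℝ)) ((Nat.choose j 2:ℂ)*(m R (j-2)-(gam (j-2) V:ℝ))*v q)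
        have n3 : ‖(Nat.choose j 2:ℂ)*(m R (j-2)-(gam (j-2) V:ℝ))*v q‖ ≤ Nat.choose j 2*Cj (j-2)*δ*v q := by
          rw [norm_mul, norm_mul, Complex.norm_natCast, norm_real, norm_eq_abs, abs_of_nonneg (h.vnn q hqQ)]
          have := hCj (j-2) (by omega) δ Q v p z m (h.mono (by omega)) R hR'
          have := h.vnn q hqQ
          rw [mul_assoc (Nat.choose j 2:ℝ) (Cj (j-2))]
          gcongr
        have hδp : 0≤δ*p q := (sq_nonneg _).trans (h.v2 q hqQ)
        have n4 : ‖∑ l ∈ Ico 3 (j+1), (Nat.choose j l:ℂ)*(m R (j-l)*z q l)‖ ≤ 2^j*D*(δ*p q) := by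
          refine (norm_sum_le _ _).trans ?_
          have : ∀ l ∈ Ico 3 (j+1), ‖(Nat.choose j l:ℂ)*(m R (j-l)*z q l)‖ ≤ Nat.choose j l*(D*(δ*p q)) := by
            intro l hl
            rw [Finset.mem_Ico] at hl
            rw [norm_mul, norm_mul, Complex.norm_natCast]
            have := hmb (j-l) (by omega) R hR'
            have := h.zb q hqQ l hl.1 (by omega)
            gcongr
          refine (sum_le_sum this).trans ?_
          rw [← sum_mul, mul_assoc]
          gcongr
          have hc := Nat.sum_range_choose j
          rw [show (2:ℝ)^j=((2^j:ℕ):ℝ) by push_cast; rfl, ← hc]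
          push_cast
          refine sum_le_sum_of_subset_of_nonneg (fun a => by simp) fun i _ _ => by positivity
        have n5 : ‖((gam j (V+v q)-gam j V-Nat.choose j 2*gam (j-2) V*v q:ℝ):ℂ)‖ ≤ Cg*(δ*p q) := by
          rw [norm_real, norm_eq_abs]
          exact hg.trans (mul_le_mul_of_nonneg_left (h.v2 q hqQ) hCg0)
        have n6 := ihR hR'
        rw [add_mul]
        linarith
    refine (main R hR).trans ?_
    have hp0 : 0≤δ := h.δ0
    calc _≤∑ q ∈ Q, (Nat.choose j 2*Cj (j-2)*δ*v q+(2^j*D+Cg)*(δ*p q)) := by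
          refine sum_le_sum_of_subset_of_nonneg hR fun q hq _ => ?_
          have := h.vnn q hq
          have : 0≤δ*p q := (sq_nonneg _).trans (h.v2 q hq)
          positivity
      _ = Nat.choose j 2*Cj (j-2)*δ*∑ q ∈ Q, v q+(2^j*D+Cg)*(δ*∑ q ∈ Q, p q) := by
          rw [sum_add_distrib, ← mul_sum, ← mul_sum, ← mul_sum]
      _ ≤ Nat.choose j 2*Cj (j-2)*δ*A+(2^j*D+Cg)*(δ*B) := by
          have := h.vA; have := h.pB
          gcongr
      _ = _ := by ring

lemma prod_le_sum_removed (n:ℕ) (y : Fin (n+2) → ℝ) (hy : ∀ l, 0 ≤ y l) :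
    ∏ l, y l≤∑ l : Fin (n+2), ∏ l' : Fin (n+1), (y (l.succAbove l'))^(((n:ℝ)+2)/((n:ℝ)+1)) := by
  obtain ⟨l0, hl0⟩ := Finite.exists_min y
  have h1 : ∏ l, y l≤∏ l' : Fin (n+1), (y (l0.succAbove l'))^(((n:ℝ)+2)/((n:ℝ)+1)) := by
    rw [Fin.prod_univ_succAbove _ l0]
    have e : y l0 = ∏ _l' : Fin (n+1), (y l0)^((1:ℝ)/((n:ℝ)+1)) := by
      rw [prod_const, card_univ, card_fin, ← rpow_natCast, ← rpow_mul (hy _)]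
      push_cast
      rw [one_div_mul_cancel (by positivity), rpow_one]
    calc y l0*∏ l' : Fin (n+1), y (l0.succAbove l')
        = ∏ l' : Fin (n+1), ((y l0)^((1:ℝ)/((n:ℝ)+1))*y (l0.succAbove l')) := by
          rw [Finset.prod_mul_distrib, ← e]
      _≤_ := by
          refine Finset.prod_le_prod (fun l' _ => mul_nonneg (rpow_nonneg (hy _) _) (hy _)) fun l' _ => ?_
          calc _≤(y (l0.succAbove l'))^((1:ℝ)/((n:ℝ)+1))*(y (l0.succAbove l'))^(1:ℝ) := by
                rw [rpow_one]
                exact mul_le_mul_of_nonneg_right (rpow_le_rpow (hy _) (hl0 _) (by positivity)) (hy _)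
            _ = _ := by
                rw [← rpow_add_of_nonneg (hy _) (by positivity) (by norm_num)]
                congr 1; field_simp; ring
  refine h1.trans ?_
  exact single_le_sum (f := fun l : Fin (n+2) => ∏ l' : Fin (n+1), (y (l.succAbove l'))^(((n:ℝ)+2)/((n:ℝ)+1)))
    (fun l _ => prod_nonneg fun l' _ => rpow_nonneg (hy _) _) (Finset.mem_univ l0)

lemma hyp_bound (n:ℕ) (s : Finset ℤ) (x:ℤ → ℝ) (hx : ∀ k, 0 ≤ x k) :
    ∑ f ∈ (piFinset (fun _ : Fin (n+2) => s)).filter (fun f => ∑ l, f l=0), ∏ l, x (f l) ≤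
      (n+2)*(∑ k ∈ s, (x k)^(((n:ℝ)+2)/((n:ℝ)+1)))^(n+1) := by
  have h1 : ∀ f : Fin (n+2) → ℤ, ∏ l, x (f l)≤∑ l : Fin (n+2), ∏ l' : Fin (n+1), (x (f (l.succAbove l')))^(((n:ℝ)+2)/((n:ℝ)+1)) :=
    fun f => prod_le_sum_removed n (fun l => x (f l)) (fun l => hx _)
  refine (sum_le_sum fun f _ => h1 f).trans ?_
  rw [sum_comm]
  have h2 : ∀ l : Fin (n+2), ∑ f ∈ (piFinset (fun _ : Fin (n+2) => s)).filter (fun f => ∑ l, f l=0),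
      ∏ l' : Fin (n+1), (x (f (l.succAbove l')))^(((n:ℝ)+2)/((n:ℝ)+1))≤(∑ k ∈ s, (x k)^(((n:ℝ)+2)/((n:ℝ)+1)))^(n+1) := by
    intro l
    have e : (∑ k ∈ s, (x k)^(((n:ℝ)+2)/((n:ℝ)+1)))^(n+1) =
        ∑ g ∈ piFinset (fun _ : Fin (n+1) => s), ∏ l', (x (g l'))^(((n:ℝ)+2)/((n:ℝ)+1)) := by
      have := Finset.prod_univ_sum (fun _ : Fin (n+1) => s) (fun _ k => (x k)^(((n:ℝ)+2)/((n:ℝ)+1)))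
      rw [prod_const, card_univ, card_fin] at this
      exact this
    rw [e]
    have hinj : Set.InjOn (fun (f : Fin (n+2) → ℤ) (l' : Fin (n+1)) => f (l.succAbove l'))
        ((piFinset (fun _ : Fin (n+2) => s)).filter (fun f => ∑ l, f l=0) : Finset (Fin (n+2) → ℤ)) := by
      intro f hf g hg hfg
      simp only [Finset.coe_filter, mem_ofPred_eq] at hf hg
      have hf2 := hf.2
      have hg2 := hg.2
      rw [Fin.sum_univ_succAbove _ l] at hf2 hg2
      have h3 : ∀ l', f (l.succAbove l') = g (l.succAbove l') := fun l' => congrFun hfg l'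
      have h4 : ∑ i, f (l.succAbove i) = ∑ i, g (l.succAbove i) := sum_congr rfl fun i _ => h3 i
      funext i
      rcases Fin.eq_self_or_eq_succAbove l i with rfl | ⟨l', rfl⟩
      · linarith
      · exact h3 l'
    rw [← Finset.sum_image (g := fun (f : Fin (n+2) → ℤ) (l' : Fin (n+1)) => f (l.succAbove l'))
      (f := fun g : Fin (n+1) → ℤ => ∏ l', (x (g l'))^(((n:ℝ)+2)/((n:ℝ)+1))) hinj]
    refine sum_le_sum_of_subset_of_nonneg ?_ fun g _ _ => prod_nonneg fun l' _ => rpow_nonneg (hx _) _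
    intro g hg
    rw [Finset.mem_image] at hg
    obtain ⟨f, hf, rfl⟩ := hg
    rw [mem_filter, Fintype.mem_piFinset] at hf
    rw [Fintype.mem_piFinset]
    exact fun l' => hf.1 _
  refine (sum_le_sum fun l _ => h2 l).trans ?_
  rw [sum_const, card_univ, card_fin, nsmul_eq_mul]
  push_cast
  exact le_rfl

/-- Convergent hyperplane sums. -/
lemma hyp_conv (n:ℕ) (θ:ℝ) (hθ : 1 < θ*(((n:ℝ)+2)/((n:ℝ)+1))) : ∃ K ≥ 0, ∀ (T:ℝ), 0 ≤ T → ∀ s : Finset ℤ, ∀ x:ℤ → ℝ,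
    (∀ k, 0 ≤ x k) → (∀ k ∈ s, x k ≤ T*(|k|:ℝ)^(-θ)) →
    ∑ f ∈ (piFinset (fun _ : Fin (n+2) => s)).filter (fun f => ∑ l, f l=0), ∏ l, x (f l) ≤ K*T^(n+2) := by
  set p := ((n:ℝ)+2)/((n:ℝ)+1) with hp
  have hp0 : 0 < p := by positivity
  have hsum : Summable (fun k:ℤ => (|k|:ℝ)^(-(θ*p))) := summable_abs_int_rpow hθ
  set Z := ∑' k:ℤ, (|k|:ℝ)^(-(θ*p)) with hZ
  have hZ0 : 0 ≤ Z := tsum_nonneg fun k => by positivity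
  refine ⟨(n+2)*Z^(n+1), by positivity, fun T hT s x hx hxs => ?_⟩
  refine (hyp_bound n s x hx).trans ?_
  have h1 : ∑ k ∈ s, (x k)^p ≤ T^p*Z := by
    calc _≤∑ k ∈ s, T^p*(|k|:ℝ)^(-(θ*p)) := by
          refine sum_le_sum fun k hk => ?_
          refine (rpow_le_rpow (hx k) (hxs k hk) hp0.le).trans (le_of_eq ?_)
          rw [mul_rpow hT (by positivity), ← rpow_mul (by positivity)]
          congr 2; ring
      _ ≤ T^p*Z := by
          rw [← mul_sum]
          gcongr
          exact hsum.sum_le_tsum s fun k _ => by positivity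
  have hT' : (T^p)^(n+1) = T^(n+2) := by
    rw [← rpow_natCast, ← rpow_mul hT, ← rpow_natCast]
    congr 1
    push_cast
    rw [hp]; field_simp
  have h0 : 0≤∑ k ∈ s, (x k)^p := sum_nonneg fun k _ => rpow_nonneg (hx k) _
  calc _≤((n:ℝ)+2)*(T^p*Z)^(n+1) := by
        gcongr
    _ = _ := by rw [mul_pow, hT']; ring

lemma sqrt_trace {K : Type*} [Field K] [Algebra ℚ K] [FiniteDimensional ℚ K] (m:ℕ) (hm : ¬ IsSquare m) (s : K) (hs : s^2 = m) :
    Algebra.trace ℚ K s=0 := by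
  have hmq : ∀ r : ℚ, r^2 ≠ (m:ℚ) := by
    intro r hr
    apply hm
    have : IsSquare ((m:ℚ)) := ⟨r, by rw [← hr, sq]⟩
    exact (Rat.isSquare_natCast_iff).1 this
  have hmin : minpoly ℚ s = Polynomial.X^2-Polynomial.C (m:ℚ) := by
    symm
    apply minpoly.eq_of_irreducible_of_monic
    · exact (X_pow_sub_C_irreducible_iff_of_prime Nat.prime_two).2 hmq
    · simp [hs]
    · exact Polynomial.monic_X_pow_sub_C _ two_ne_zero
  have hd : (Polynomial.X^2-Polynomial.C (m:ℚ)).natDegree=2 := Polynomial.natDegree_X_pow_sub_C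
  rw [trace_eq_finrank_mul_minpoly_nextCoeff, hmin, Polynomial.nextCoeff_of_natDegree_pos (by rw [hd]; norm_num), hd]
  have : (Polynomial.X^2-Polynomial.C (m:ℚ)).coeff (2-1)=0 := by
    rw [Polynomial.coeff_sub, Polynomial.coeff_X_pow, Polynomial.coeff_C]; norm_num
  rw [this]; simp

lemma sqf_mul_not_square {a b:ℕ} (ha : Squarefree a) (hb : Squarefree b) (hab : a ≠ b) : ¬ IsSquare (a*b) := by
  rintro ⟨k, hk⟩
  apply hab
  have ha0 := ha.ne_zero
  have hb0 := hb.ne_zero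
  apply Nat.eq_of_factorization_eq ha0 hb0
  intro p
  have h1 := ha.natFactorization_le_one p
  have h2 := hb.natFactorization_le_one p
  have hk0 : k ≠ 0 := by rintro rfl; simp at hk; tauto
  have h3 : (a*b).factorization p=(k*k).factorization p := by rw [hk]
  rw [Nat.factorization_mul ha0 hb0, Nat.factorization_mul hk0 hk0] at h3
  simp only [Finsupp.add_apply] at h3
  omega

lemma sqrt_indep (Q : Finset ℕ) (hQ : ∀ q ∈ Q, Squarefree q) (a:ℕ → ℤ) (h : ∑ q ∈ Q, (a q:ℝ)*√q=0) :
    ∀ q ∈ Q, a q=0 := by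
  intro q0 hq0
  set T : Set ℝ := (fun q:ℕ => √((q*q0:ℕ):ℝ)) '' (Q : Set ℕ) with hT
  have hTf : T.Finite := (finite_toSet Q).image _
  have : Finite T := hTf
  have : FiniteDimensional ℚ (IntermediateField.adjoin ℚ T) := by
    refine IntermediateField.finiteDimensional_adjoin fun x hx => ?_
    obtain ⟨q, _, rfl⟩ := hx
    refine ⟨Polynomial.X^2-Polynomial.C ((q*q0:ℕ):ℚ), Polynomial.monic_X_pow_sub_C _ two_ne_zero, ?_⟩
    simp [mul_pow]
  set K := IntermediateField.adjoin ℚ T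
  have hmem : ∀ q ∈ Q, √((q*q0:ℕ):ℝ) ∈ K := fun q hq =>
    IntermediateField.subset_adjoin ℚ T ⟨q, hq, rfl⟩
  let s:ℕ → K := fun q => if hq : q ∈ Q then ⟨_, hmem q hq⟩ else 0
  have hs : ∀ q ∈ Q, (s q:ℝ) = √((q*q0:ℕ):ℝ) := fun q hq => by simp only [s, dif_pos hq]
  have hrel : ∑ q ∈ Q, (a q : ℚ) • s q=0 := by
    apply Subtype.ext
    have : ((∑ q ∈ Q, (a q : ℚ) • s q : K):ℝ) = ∑ q ∈ Q, (a q:ℝ)*√((q*q0:ℕ):ℝ) := by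
      push_cast
      refine sum_congr rfl fun q hq => ?_
      rw [hs q hq, Rat.smul_def]
      push_cast
      rfl
    rw [this]
    have e : ∀ q ∈ Q, (a q:ℝ)*√((q*q0:ℕ):ℝ)=(a q:ℝ)*√q*√q0 := fun q _ => by
      push_cast
      rw [sqrt_mul (by positivity)]; ring
    rw [sum_congr rfl e, ← sum_mul, h, zero_mul]
    rfl
  have htr := congrArg (Algebra.trace ℚ K) hrel
  rw [map_sum, map_zero, Finset.sum_eq_single q0] at htr
  · rw [map_smul] at htr
    have hsq : s q0 = algebraMap ℚ K q0 := by
      apply Subtype.ext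
      rw [hs q0 hq0]
      push_cast
      rw [sqrt_mul_self (by positivity)]
    rw [hsq, Algebra.trace_algebraMap] at htr
    have hfr : 0 < Module.finrank ℚ K := Module.finrank_pos
    have hq00 := (hQ q0 hq0).ne_zero
    simp at htr
    rcases htr with h | h
    · exact_mod_cast h
    · exfalso; rcases h with h | h
      · omega
      · exact hq00 h
  · intro q hq hne
    rw [map_smul, sqrt_trace (q*q0) (sqf_mul_not_square (hQ q hq) (hQ q0 hq0) hne) (s q) ?_, smul_zero]
    apply Subtype.ext
    push_cast
    rw [hs q hq, sq_sqrt (by positivity)]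
    push_cast; rfl
  · intro h; exact absurd hq0 h

/-- trigonometric polynomials with frequencies in `ℝ` -/
abbrev TP := AddMonoidAlgebra ℂ ℝ

def MH (H : AddSubgroup ℝ) : Subalgebra ℂ TP :=
  (AddMonoidAlgebra.mapDomainAlgHom ℂ ℂ H.subtype).range

lemma single_mem_MH {H : AddSubgroup ℝ} {a:ℝ} (ha : a ∈ H) (c:ℂ) :
    (AddMonoidAlgebra.single a c : TP) ∈ MH H := by
  refine ⟨AddMonoidAlgebra.single ⟨a, ha⟩ c, ?_⟩
  simp [AddMonoidAlgebra.mapDomainAlgHom]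

lemma indep_c0 {H1 H2 : AddSubgroup ℝ} (h : ∀ a, a ∈ H1 → a ∈ H2 → a=0) {P R : TP}
    (hP : P ∈ MH H1) (hR : R ∈ MH H2) : (P*R).coeff 0 = P.coeff 0*R.coeff 0 := by
  obtain ⟨P', rfl⟩ := hP
  obtain ⟨R', rfl⟩ := hR
  induction P' using AddMonoidAlgebra.induction_linear with
  | zero => simp
  | add f g hf hg =>
    simp only [map_add, add_mul, AddMonoidAlgebra.coeff_add, Finsupp.add_apply, hf, hg]
  | single a c =>
    induction R' using AddMonoidAlgebra.induction_linear with
    | zero => simp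
    | add f g hf hg =>
      simp only [map_add, mul_add, AddMonoidAlgebra.coeff_add, Finsupp.add_apply, hf, hg]
    | single b d =>
      simp only [AddMonoidAlgebra.mapDomainAlgHom]
      simp [AddMonoidAlgebra.single_mul_single, Finsupp.single_apply]
      have key : ((a:ℝ)+b=0) ↔ (a=0 ∧ b=0) := by
        constructor
        · intro hab
          have ha : (a:ℝ)=0 := by
            apply h _ a.2
            have : (a:ℝ) = -b := by linarith
            rw [this]; exact H2.neg_mem b.2
          have hb : (b:ℝ)=0 := by linarith
          exact ⟨Subtype.ext ha, Subtype.ext hb⟩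
        · rintro ⟨rfl, rfl⟩; simp
      by_cases h1 : a=0 <;> by_cases h2 : b=0 <;> simp [key, h1, h2]

/-- the group spanned by the square roots of the elements of `R` -/
def sqG (R : Finset ℕ) : AddSubgroup ℝ where
  carrier := {y | ∃ a:ℕ → ℤ, y = ∑ q ∈ R, (a q:ℝ)*√q}
  zero_mem' := ⟨0, by simp⟩
  add_mem' := by
    rintro x y ⟨a, rfl⟩ ⟨b, rfl⟩
    exact ⟨a+b, by simp [add_mul, sum_add_distrib]⟩
  neg_mem' := by
    rintro x ⟨a, rfl⟩
    exact ⟨-a, by simp⟩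

lemma sqG_disj {R : Finset ℕ} {q:ℕ} (hq : q ∉ R) (hsq : ∀ n ∈ insert q R, Squarefree n) (y:ℝ)
    (h1 : y ∈ sqG {q}) (h2 : y ∈ sqG R) : y=0 := by
  obtain ⟨a, rfl⟩ := h1
  obtain ⟨b, hb⟩ := h2
  rw [Finset.sum_singleton] at hb ⊢
  have := sqrt_indep (insert q R) hsq (fun n => if n = q then a q else-b n) (by
    rw [sum_insert hq]
    have : ∑ n ∈ R, (((if n = q then a q else-b n:ℤ)):ℝ)*√n =-∑ n ∈ R, (b n:ℝ)*√n := by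
      rw [← Finset.sum_neg_distrib]
      apply sum_congr rfl
      intro n hn
      have : n ≠ q := by rintro rfl; exact hq hn
      simp [this]
    rw [this]; simp [hb]) q (by simp)
  simp at this
  simp [this]

def ee (t:ℝ):ℂ := Complex.exp (2*π*Complex.I*t)

/-- coefficients -/
def bet (w:ℝ) (n:ℕ) (y:ℝ):ℂ := ((r2 n:ℝ)/(2*n):ℝ)*(ee (y*w)-1)

def Kset (N q:ℕ) : Finset ℤ := (Icc (-(N:ℤ)) N).filter (fun k => k ≠ 0 ∧ q*k.natAbs^2 ≤ N)

def Qset (N:ℕ) : Finset ℕ := (Icc 1 N).filter Squarefree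

def Zq (N:ℕ) (w:ℝ) (q:ℕ) : TP :=
  ∑ k ∈ Kset N q, AddMonoidAlgebra.single ((k:ℝ)*√q) (bet w (q*k.natAbs^2) (k*√q))

def SR (N:ℕ) (w:ℝ) (R : Finset ℕ) : TP := ∑ q ∈ R, Zq N w q

lemma Zq_mem (N w q) : Zq N w q ∈ MH (sqG {q}) := by
  apply Subalgebra.sum_mem
  intro k _
  apply single_mem_MH
  exact ⟨fun _ => k, by simp⟩

lemma SR_mem (N w R) : SR N w R ∈ MH (sqG R) := by
  apply Subalgebra.sum_mem
  intro q hq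
  apply Subalgebra.sum_mem
  intro k _
  apply single_mem_MH
  refine ⟨fun n => if n = q then k else 0, ?_⟩
  simp [hq]

lemma SR_step (N w) {R : Finset ℕ} {q:ℕ} (hq : q ∉ R) (hsq : ∀ n ∈ insert q R, Squarefree n) (i:ℕ) :
    (SR N w (insert q R)^i).coeff 0 = ∑ l ∈ Finset.range (i+1), (Nat.choose i l:ℂ) *
      ((SR N w R^(i-l)).coeff 0*(Zq N w q^l).coeff 0) := by
  have : SR N w (insert q R) = Zq N w q+SR N w R := by
    simp [SR, sum_insert hq]
  rw [this, add_pow, AddMonoidAlgebra.coeff_sum, Finsupp.finsetSum_apply]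
  apply sum_congr rfl
  intro l _
  rw [mul_comm (_*_) (Nat.choose i l : TP), ← nsmul_eq_mul, AddMonoidAlgebra.coeff_smul,
    Finsupp.smul_apply, nsmul_eq_mul, indep_c0 (sqG_disj hq hsq) (pow_mem (Zq_mem N w q) l) (pow_mem (SR_mem N w R) (i-l)),
    mul_comm ((Zq N w q^l).coeff 0)]

lemma c0_pow {ι : Type*} (s : Finset ι) (lam : ι → ℝ) (b : ι → ℂ) (j:ℕ) :
    ((∑ k ∈ s, AddMonoidAlgebra.single (lam k) (b k) : TP)^j).coeff 0 =
     ∑ f ∈ (piFinset (fun _ : Fin j => s)).filter (fun f => ∑ l, lam (f l)=0), ∏ l, b (f l) := by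
  classical
  have h := Finset.prod_univ_sum (fun _ : Fin j => s) (fun _ k => (AddMonoidAlgebra.single (lam k) (b k) : TP))
  simp only [prod_const, card_univ, card_fin] at h
  rw [h, AddMonoidAlgebra.coeff_sum, Finsupp.finsetSum_apply, sum_filter]
  apply sum_congr rfl
  intro f _
  rw [AddMonoidAlgebra.prod_single]
  simp [Finsupp.single_apply]

lemma Kset_sum {M : Type*} [AddCommMonoid M] (N q:ℕ) (g:ℤ → M) :
    ∑ k ∈ Kset N q, g k = ∑ j ∈ (Icc 1 N).filter (fun j => q*j^2 ≤ N), (g j+g (-(j:ℤ))) := by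
  rw [← Finset.sum_filter_add_sum_filter_not (Kset N q) (fun k => 0 < k), sum_add_distrib]
  congr 1
  · refine Finset.sum_nbij' (fun k => k.natAbs) (fun j => (j:ℤ)) ?_ ?_ ?_ ?_ ?_
    · intro k hk
      simp only [Kset, mem_filter, mem_Icc] at hk ⊢
      exact ⟨by omega, hk.1.2.2⟩
    · intro k hk
      simp only [Kset, mem_filter, mem_Icc] at hk ⊢
      refine ⟨⟨by omega, by omega, ?_⟩, by omega⟩
      simpa using hk.2
    · intro k hk
      simp only [Kset, mem_filter, mem_Icc] at hk ⊢
      omega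
    · intro k hk
      simp
    · intro k hk
      simp only [Kset, mem_filter, mem_Icc] at hk ⊢
      congr 1; omega
  · refine Finset.sum_nbij' (fun k => k.natAbs) (fun j => -(j:ℤ)) ?_ ?_ ?_ ?_ ?_
    · intro k hk
      simp only [Kset, mem_filter, mem_Icc] at hk ⊢
      exact ⟨by omega, hk.1.2.2⟩
    · intro k hk
      simp only [Kset, mem_filter, mem_Icc] at hk ⊢
      refine ⟨⟨by omega, by omega, ?_⟩, by omega⟩
      simpa using hk.2
    · intro k hk
      simp only [Kset, mem_filter, mem_Icc] at hk ⊢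
      omega
    · intro k hk
      simp
    · intro k hk
      simp only [Kset, mem_filter, mem_Icc] at hk ⊢
      congr 1; omega

lemma sqf_unique {q q' j j':ℕ} (hq : Squarefree q) (hq' : Squarefree q') (hj : 0 < j)
    (h : q*j^2 = q'*j'^2) : q = q' ∧ j = j' := by
  have hs : (j:ℝ)*√q = j'*√q' := by
    have : √((q*j^2:ℕ):ℝ) = √((q'*j'^2:ℕ):ℝ) := by rw [h]
    push_cast at this
    rw [sqrt_mul (by positivity), sqrt_mul (by positivity), sqrt_sq (by positivity),
      sqrt_sq (by positivity)] at this
    linarith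
  have hqq : q = q' := by
    by_contra hne
    have := sqrt_indep {q, q'} (by simp [hq, hq']) (fun n => if n = q then j else -j') (by
      rw [Finset.sum_pair hne]; simp [Ne.symm hne]; linarith) q (by simp)
    simp at this; omega
  refine ⟨hqq, ?_⟩
  subst hqq
  have hq0 : 0 < q := Nat.pos_of_ne_zero hq.ne_zero
  have := Nat.eq_of_mul_eq_mul_left hq0 h
  exact Nat.pow_left_injective (by norm_num : (2:ℕ) ≠ 0) this

lemma reindex {M : Type*} [AddCommMonoid M] (N:ℕ) (F:ℕ → ℝ → M) :
    ∑ q ∈ Qset N, ∑ k ∈ Kset N q, F (q*k.natAbs^2) (k*√q) =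
    ∑ n ∈ Icc 1 N, (F n √n+F n (-√n)) := by
  have h1 : ∀ q ∈ Qset N, ∑ k ∈ Kset N q, F (q*k.natAbs^2) (k*√q) =
     ∑ j ∈ (Icc 1 N).filter (fun j => q*j^2 ≤ N),
      (F (q*j^2) (√((q*j^2:ℕ):ℝ))+F (q*j^2) (-√((q*j^2:ℕ):ℝ))) := by
    intro q _
    rw [Kset_sum]
    apply sum_congr rfl
    intro j _
    have : √((q*j^2:ℕ):ℝ) = j*√q := by
      push_cast
      rw [sqrt_mul (by positivity), sqrt_sq (by positivity)]; ring
    rw [this]; simp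
  rw [sum_congr rfl h1, Finset.sum_sigma']
  refine Finset.sum_nbij (fun p => p.1*p.2^2) ?_ ?_ ?_ ?_
  · rintro ⟨q, j⟩ h
    simp only [Qset, Finset.mem_sigma, mem_filter, mem_Icc] at h ⊢
    exact ⟨Nat.mul_pos (by omega) (pow_pos (by omega) 2), h.2.2⟩
  · rintro ⟨q, j⟩ h ⟨q', j'⟩ h' heq
    simp only [Qset, Finset.coe_sigma, mem_coe, Set.mem_sigma_iff, mem_filter, mem_Icc] at h h' heq
    obtain ⟨rfl, rfl⟩ := sqf_unique h.1.2 h'.1.2 (by omega) heq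
    rfl
  · intro n hn
    simp only [Finset.coe_Icc, Set.mem_Icc] at hn
    obtain ⟨a, b, hab, ha⟩ := Nat.sq_mul_squarefree n
    have hb0 : 0 < b := Nat.pos_of_ne_zero (by rintro rfl; simp at hab; omega)
    have ha0 : 0 < a := Nat.pos_of_ne_zero ha.ne_zero
    have e : a*b^2 = n := by rw [← hab]; ring
    refine ⟨⟨a, b⟩, ?_, e⟩
    simp only [Qset, Finset.coe_sigma, Set.mem_sigma_iff, mem_coe, mem_filter, mem_Icc]
    refine ⟨⟨⟨ha0, ?_⟩, ha⟩, ⟨hb0, ?_⟩, by omega⟩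
    · nlinarith [Nat.pow_pos hb0 (n := 2)]
    · have : b ≤ b^2 := by nlinarith
      nlinarith
  · rintro ⟨q, j⟩ h
    rfl

lemma ee_norm (t:ℝ) : ‖ee t‖ = 1 := by
  have : ee t = Complex.exp ((2*π*t:ℝ)*Complex.I) := by
    unfold ee; congr 1; push_cast; ring
  rw [this, Complex.norm_exp_ofReal_mul_I]

lemma ee_conj (t:ℝ) : (starRingEnd ℂ) (ee t) = ee (-t) := by
  unfold ee; rw [← Complex.exp_conj]; congr 1; simp [show (starRingEnd ℂ) (2:ℂ)=2 from Complex.conj_ofNat 2]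

lemma ee_add (s t:ℝ) : ee (s+t) = ee s*ee t := by
  unfold ee; rw [← Complex.exp_add]; congr 1; push_cast; ring

lemma ee_zero : ee 0=1 := by simp [ee]

lemma ee_sub_one_norm (t:ℝ) : ‖ee t-1‖ = 2 * |sin (π*t)| := by
  have : ee t = Complex.exp (Complex.I*(2*π*t:ℝ)) := by
    unfold ee; congr 1; push_cast; ring
  rw [this, Complex.norm_exp_I_mul_ofReal_sub_one, norm_eq_abs, abs_mul]
  rw [show 2*π*t/2 = π*t by ring]; simp

lemma ee_sub_one_le (t:ℝ) : ‖ee t-1‖ ≤ 2*π * |t| := by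
  rw [ee_sub_one_norm]
  have := abs_sin_le_abs (x := π*t)
  rw [abs_mul, abs_of_pos pi_pos] at this
  linarith

lemma bet_conj (w:ℝ) (n:ℕ) (y:ℝ) : bet w n (-y)=(starRingEnd ℂ) (bet w n y) := by
  unfold bet
  rw [map_mul, map_sub, ee_conj, Complex.conj_ofReal]; simp

lemma bet_normSq (w:ℝ) (n:ℕ) (y:ℝ) :
    ‖bet w n y‖^2=(r2 n:ℝ)^2/(n:ℝ)^2*sin (π*y*w)^2 := by
  unfold bet
  rw [norm_mul, ee_sub_one_norm, mul_pow, norm_real, mul_pow, sq_abs, norm_eq_abs, sq_abs]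
  rw [div_pow, mul_pow, ← mul_assoc π]
  rcases Nat.eq_zero_or_pos n with h | h
  · subst h; simp
  · field_simp

lemma bet_bound (w:ℝ) (hw : 0 ≤ w) (n:ℕ) (y:ℝ) (hn : 0 < n) (hy : |y| = √n) : ‖bet w n y‖ ≤ π*w*r2 n/√n := by
  unfold bet
  rw [norm_mul, norm_real, norm_eq_abs, abs_of_nonneg (by positivity)]
  have := ee_sub_one_le (y*w)
  rw [abs_mul, hy, abs_of_nonneg hw] at this
  have h2 : (√(n:ℝ))^2 = n := sq_sqrt (by positivity)
  have hp : 0 < √(n:ℝ) := Real.sqrt_pos.2 (by positivity)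
  calc _≤(r2 n:ℝ)/(2*n)*(2*π*(√n*w)) := by gcongr
    _ = _ := by rw [← h2]; field_simp; rw [sqrt_sq hp.le]

lemma Zq_zero (N w q) : ((Zq N w q)^0).coeff 0=1 := by
  simp [AddMonoidAlgebra.one_def]

lemma Zq_one (N:ℕ) (w:ℝ) (q:ℕ) (hq : 0 < q) : ((Zq N w q)^1).coeff 0=0 := by
  rw [pow_one, Zq, AddMonoidAlgebra.coeff_sum, Finsupp.finsetSum_apply]
  apply Finset.sum_eq_zero
  intro k hk
  simp only [Kset, mem_filter] at hk
  rw [AddMonoidAlgebra.coeff_single, Finsupp.single_apply, if_neg]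
  have : √(q:ℝ) ≠ 0 := by positivity
  have h2 : (k:ℝ) ≠ 0 := by exact_mod_cast hk.2.1
  positivity

lemma Zq_two (N:ℕ) (w:ℝ) (q:ℕ) (hq : 0 < q) : ((Zq N w q)^2).coeff 0 =
    ((∑ k ∈ Kset N q, ‖bet w (q*k.natAbs^2) (k*√q)‖^2:ℝ):ℂ) := by
  rw [pow_two, Zq, sum_mul_sum, AddMonoidAlgebra.coeff_sum, Finsupp.finsetSum_apply]
  push_cast
  apply sum_congr rfl
  intro k hk
  rw [AddMonoidAlgebra.coeff_sum, Finsupp.finsetSum_apply]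
  have hs : √(q:ℝ) ≠ 0 := by positivity
  have hk' : -k ∈ Kset N q := by
    simp only [Kset, mem_filter, mem_Icc] at hk ⊢
    refine ⟨by omega, by omega, by simpa using hk.2.2⟩
  rw [Finset.sum_eq_single (-k)]
  · rw [AddMonoidAlgebra.single_mul_single, AddMonoidAlgebra.coeff_single]
    have : (k:ℝ)*√q+((-k:ℤ):ℝ)*√q=0 := by push_cast; ring
    rw [this, Finsupp.single_eq_same]
    have h2 : ((-k:ℤ):ℝ)*√q = -((k:ℝ)*√q) := by push_cast; ring
    rw [h2, bet_conj, Int.natAbs_neg, Complex.mul_conj, normSq_eq_norm_sq]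
    push_cast; rfl
  · intro l _ hl
    rw [AddMonoidAlgebra.single_mul_single, AddMonoidAlgebra.coeff_single, Finsupp.single_apply, if_neg]
    intro h
    apply hl
    have : ((k:ℝ)+l)*√q=0 := by rw [← h]; ring
    rcases mul_eq_zero.1 this with h' | h'
    · have : k+l=0 := by exact_mod_cast h'
      omega
    · exact absurd h' hs
  · intro h; exact absurd hk' h

lemma Zq_bound (ε:ℝ) (hε : 0 < ε) (i:ℕ) (hi : 2 ≤ i) (hεi : 2*ε*i < 1) : ∃ K ≥ 0, ∀ (N:ℕ) (w:ℝ) (q:ℕ),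
    0 ≤ w → 0 < q → ‖((Zq N w q)^i).coeff 0‖ ≤ K*(w*(q:ℝ)^(-(1/2-ε)))^i := by
  obtain ⟨n, rfl⟩ := Nat.exists_eq_add_of_le' hi
  obtain ⟨C, hC1, hC⟩ := r2_bound ε hε
  obtain ⟨K, hK0, hK⟩ := hyp_conv n (1-2*ε) (by
    rw [← mul_div_assoc, lt_div_iff₀ (by positivity)]
    push_cast at hεi
    nlinarith)
  refine ⟨K*(π*C)^(n+2), by positivity, fun N w q hw hq => ?_⟩
  rw [Zq, c0_pow]
  have hs : √(q:ℝ) ≠ 0 := by positivity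
  have hfil : (piFinset (fun _ : Fin (n+2) => Kset N q)).filter (fun f => ∑ l, ((f l:ℤ):ℝ)*√(q:ℝ)=0)
     = (piFinset (fun _ : Fin (n+2) => Kset N q)).filter (fun f => ∑ l, f l=0) := by
    apply Finset.filter_congr
    intro f _
    rw [← sum_mul]
    constructor
    · intro h
      rcases mul_eq_zero.1 h with h' | h'
      · exact_mod_cast h'
      · exact absurd h' hs
    · intro h
      have : ∑ l, ((f l:ℤ):ℝ)=0 := by exact_mod_cast h
      rw [this, zero_mul]
  rw [hfil]
  refine (norm_sum_le _ _).trans ?_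
  simp only [norm_prod]
  refine (hK (π*C*(w*(q:ℝ)^(-(1/2-ε)))) (by positivity) (Kset N q)
    (fun k => ‖bet w (q*k.natAbs^2) (k*√q)‖) (fun k => norm_nonneg _) ?_).trans (le_of_eq ?_)
  · intro k hk
    simp only [Kset, mem_filter, mem_Icc] at hk
    have hk0 : 0 < k.natAbs := Int.natAbs_pos.2 hk.2.1
    have hn : 0 < q*k.natAbs^2 := by positivity
    have habs : ((k.natAbs:ℕ):ℝ) = |(k:ℝ)| := by
      rw [Nat.cast_natAbs]; push_cast; rfl
    have hsq : √((q*k.natAbs^2:ℕ):ℝ) = |(k:ℝ)| * √q := by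
      push_cast
      rw [sqrt_mul (by positivity), sqrt_sq (by positivity), habs]; ring
    have hka : 0 < |(k:ℝ)| := by rw [← habs]; exact_mod_cast hk0
    have hqr : (0:ℝ) < q := by exact_mod_cast hq
    refine (bet_bound w hw _ _ hn (by rw [hsq, abs_mul, abs_of_nonneg (sqrt_nonneg _)])).trans ?_
    have h1 := hC _ hn
    have hnr : (0:ℝ) < ((q*k.natAbs^2:ℕ):ℝ) := by exact_mod_cast hn
    calc π*w*(r2 (q*k.natAbs^2))/√((q*k.natAbs^2:ℕ):ℝ)
        ≤ π*w*(C*((q*k.natAbs^2:ℕ):ℝ)^ε)/√((q*k.natAbs^2:ℕ):ℝ) := by gcongr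
      _ = π*w*C*((q*k.natAbs^2:ℕ):ℝ)^(-(1/2-ε)) := by
          rw [sqrt_eq_rpow, mul_div_assoc, mul_div_assoc, ← rpow_sub hnr]
          rw [show ε-1/2 = -(1/2-ε) by ring]; ring
      _ = _ := by
          push_cast
          rw [habs, mul_rpow (by positivity) (by positivity), ← rpow_natCast, ← rpow_mul (by positivity)]
          rw [show ((2:ℕ):ℝ)*(-(1/2-ε)) = -(1-2*ε) by push_cast; ring]
          ring
  · rw [mul_pow (π*C)]; ring

lemma Zq_bound_all (j:ℕ) : ∃ K ≥ 1, ∀ i, 2 ≤ i → i ≤ j+2 → ∀ (N:ℕ) (w:ℝ) (q:ℕ),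
    0 ≤ w → 0 < q → ‖((Zq N w q)^i).coeff 0‖ ≤ K*(w*(q:ℝ)^(-(5/12:ℝ)))^i := by
  set ε:ℝ := 1/(12*(j+3)) with hε
  have hε0 : 0 < ε := by positivity
  have hε1 : ε≤1/12 := by
    rw [hε]; apply one_div_le_one_div_of_le (by norm_num); nlinarith [(Nat.cast_nonneg j : (0:ℝ) ≤ j)]
  have H : ∀ i, ∃ K ≥ 0, 2 ≤ i → i ≤ j+2 → ∀ (N:ℕ) (w:ℝ) (q:ℕ),
    0 ≤ w → 0 < q → ‖((Zq N w q)^i).coeff 0‖ ≤ K*(w*(q:ℝ)^(-(1/2-ε)))^i := by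
    intro i
    by_cases h : 2 ≤ i ∧ i ≤ j+2
    · obtain ⟨K, hK0, hK⟩ := Zq_bound ε hε0 i h.1 (by
        have : (i:ℝ) ≤ j+2 := by exact_mod_cast h.2
        have e : ε*(12*(j+3))=1 := by rw [hε]; field_simp
        have : ε*i≤ε*(j+2) := by gcongr
        nlinarith)
      exact ⟨K, hK0, fun _ _ => hK⟩
    · exact ⟨0, le_rfl, fun h1 h2 => absurd ⟨h1, h2⟩ h⟩
  choose K hK0 hK using H
  refine ⟨1+∑ i ∈ Finset.range (j+3), K i, ?_, fun i h2 hi N w q hw hq => (hK i h2 hi N w q hw hq).trans ?_⟩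
  · have := sum_nonneg (fun i (_ : i ∈ Finset.range (j+3)) => hK0 i)
    linarith
  · have hle : K i≤1+∑ i ∈ Finset.range (j+3), K i := by
      have := single_le_sum (fun i (_ : i ∈ Finset.range (j+3)) => hK0 i) (Finset.mem_range.2 (by omega : i < j+3))
      linarith
    have hqr : (1:ℝ) ≤ q := by exact_mod_cast hq
    have := hK0 i
    gcongr
    · linarith
    · linarith

def GG (N:ℕ) (w:ℝ) (j:ℕ):ℂ := (SR N w (Qset N)^j).coeff 0

lemma sum_v (N:ℕ) (w:ℝ) : ∑ q ∈ Qset N, ∑ k ∈ Kset N q, ‖bet w (q*k.natAbs^2) (k*√q)‖^2=2*VV N w := by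
  rw [reindex N (fun n y => ‖bet w n y‖^2), VV, mul_sum]
  apply sum_congr rfl
  intro n _
  rw [bet_normSq, bet_normSq]
  rw [show π * -√n*w = -(π*√n*w) by ring, sin_neg]; ring

theorem GG_asymp (j:ℕ) : ∃ C ≥ 0, ∀ᶠ w in 𝓝[>] (0:ℝ), ∀ N:ℕ,
    ‖GG N w j-(gam j (2*VV N w):ℝ)‖ ≤ C*((w*(-log w))^j/(-log w)) := by
  obtain ⟨κ, hκ, hV⟩ := VV_asymp
  obtain ⟨K, hK1, hK⟩ := Zq_bound_all j
  have hsum : Summable (fun n:ℕ => (n:ℝ)^(-(5/4:ℝ))) := Real.summable_nat_rpow.2 (by norm_num)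
  obtain ⟨C, hC0, hC⟩ := clt_rec (2*(κ+1)) (K^2*∑' n:ℕ, (n:ℝ)^(-(5/4:ℝ))) (by positivity)
    (mul_nonneg (by positivity) (tsum_nonneg fun n => by positivity)) j
  refine ⟨C, hC0, ?_⟩
  have hw1 : ∀ᶠ w in 𝓝[>] (0:ℝ), (1:ℝ) ≤-log w := neglog_tendsto.eventually_ge_atTop 1
  filter_upwards [hV 1 one_pos, hw1, self_mem_nhdsWithin] with w hVw hl hw0 N
  have hw : 0 < w := hw0
  set ℓ :=-log w with hℓ
  have hℓ0 : 0 < ℓ := by linarith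
  have hL : 0 < w*ℓ := by positivity
  have hLc : ((w*ℓ:ℝ):ℂ) ≠ 0 := by exact_mod_cast hL.ne'
  have hQ : ∀ q ∈ Qset N, 0 < q ∧ Squarefree q := by
    intro q hq; simp only [Qset, mem_filter, mem_Icc] at hq
    exact ⟨by omega, hq.2⟩
  set v:ℕ → ℝ := fun q => (∑ k ∈ Kset N q, ‖bet w (q*k.natAbs^2) (k*√q)‖^2)/(w*ℓ)^2 with hv
  have hnorm : ∀ q ∈ Qset N, ∀ i, 2 ≤ i → i ≤ j+2 → ‖((Zq N w q)^i).coeff 0/((w*ℓ:ℝ):ℂ)^i‖ ≤ K*(ℓ⁻¹)^i*((q:ℝ)^(-(5/12:ℝ)))^i := by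
    intro q hq i h2 hi
    rw [norm_div, norm_pow, norm_real, norm_eq_abs, abs_of_pos hL, div_le_iff₀ (by positivity)]
    refine (hK i h2 hi N w q hw.le (hQ q hq).1).trans (le_of_eq ?_)
    rw [inv_pow, mul_pow, mul_pow]; field_simp
  have hli : ℓ⁻¹≤1 := inv_le_one_of_one_le₀ hl
  have hli0 : 0≤ℓ⁻¹ := by positivity
  have hz2 : ∀ q ∈ Qset N, ((Zq N w q)^2).coeff 0/((w*ℓ:ℝ):ℂ)^2=(v q:ℂ) := by
    intro q hq
    rw [Zq_two N w q (hQ q hq).1, hv]; push_cast; rfl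
  have hvn : ∀ q, 0 ≤ v q := fun q => by simp only [hv]; positivity
  have hdata : CltData (2*(κ+1)) (K^2*∑' n:ℕ, (n:ℝ)^(-(5/4:ℝ))) ℓ⁻¹ j (Qset N) v
     (fun q => K^2*(q:ℝ)^(-(5/4:ℝ))) (fun q i => ((Zq N w q)^i).coeff 0/((w*ℓ:ℝ):ℂ)^i)
     (fun R i => (SR N w R^i).coeff 0/((w*ℓ:ℝ):ℂ)^i) := by
    refine ⟨?_, ?_, ?_, ?_, ?_, hz2, fun q _ => hvn q, ?_, ?_, ?_, ?_, hli0, hli⟩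
    · simp [SR, AddMonoidAlgebra.one_def]
    · intro i hi; simp [SR, hi.ne']
    · intro R hR q hq hqR i
      rw [SR_step N w hqR (by
        intro n hn
        rcases Finset.mem_insert.1 hn with rfl | h
        · exact (hQ _ hq).2
        · exact (hQ _ (hR h)).2), sum_div]
      apply sum_congr rfl
      intro l hl'
      have : l ≤ i := by simpa [Nat.lt_succ_iff] using hl'
      have e : ((w*ℓ:ℝ):ℂ)^i=((w*ℓ:ℝ):ℂ)^(i-l)*((w*ℓ:ℝ):ℂ)^l := by rw [← pow_add]; congr 1; omega
      rw [e, div_mul_div_comm, mul_div_assoc]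
    · intro q _; rw [Zq_zero]; simp
    · intro q hq; rw [Zq_one N w q (hQ q hq).1]; simp
    · intro q hq
      have h := hnorm q hq 2 le_rfl (by omega)
      rw [hz2 q hq, norm_real, norm_eq_abs, abs_of_nonneg (hvn q)] at h
      have hq1 : (1:ℝ) ≤ q := by exact_mod_cast (hQ q hq).1
      have h2 : v q ^2≤(K*(ℓ⁻¹)^2*((q:ℝ)^(-(5/12:ℝ)))^2)^2 := pow_le_pow_left₀ (hvn q) h 2
      refine h2.trans ?_
      have e1 : (ℓ⁻¹)^4≤ℓ⁻¹ := by
        have := pow_le_pow_of_le_one hli0 hli (show 1≤4 by norm_num); simpa using this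
      have e2 : ((q:ℝ)^(-(5/12:ℝ)))^4≤(q:ℝ)^(-(5/4:ℝ)) := by
        rw [← rpow_natCast, ← rpow_mul (by positivity)]
        exact rpow_le_rpow_of_exponent_le hq1 (by norm_num)
      calc _ = (ℓ⁻¹)^4*(K^2*((q:ℝ)^(-(5/12:ℝ)))^4) := by ring
        _≤_ := by gcongr
    · intro q hq i h3 hi
      have hq1 : (1:ℝ) ≤ q := by exact_mod_cast (hQ q hq).1
      refine (hnorm q hq i (by omega) (by omega)).trans ?_
      have e1 : (ℓ⁻¹)^i≤ℓ⁻¹ := by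
        have := pow_le_pow_of_le_one hli0 hli (show 1 ≤ i by omega); simpa using this
      have e2 : ((q:ℝ)^(-(5/12:ℝ)))^i≤(q:ℝ)^(-(5/4:ℝ)) := by
        rw [← rpow_natCast, ← rpow_mul (by positivity)]
        apply rpow_le_rpow_of_exponent_le hq1
        have : (3:ℝ) ≤ i := by exact_mod_cast h3
        linarith
      have e3 : K ≤ K^2 := by nlinarith
      calc _ = (ℓ⁻¹)^i*(K*((q:ℝ)^(-(5/12:ℝ)))^i) := by ring
        _≤ℓ⁻¹*(K^2*(q:ℝ)^(-(5/4:ℝ))) := by gcongr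
    · simp only [hv]
      rw [← sum_div, sum_v, div_le_iff₀ (by positivity)]
      have := hVw.1 N
      have e : (w*ℓ)^2 = w^2*log w^2 := by rw [hℓ]; ring
      rw [e]; linarith
    · rw [← mul_sum]
      gcongr
      exact hsum.sum_le_tsum _ (fun n _ => by positivity)
  have hfin := hC _ _ _ _ _ _ hdata (Qset N) subset_rfl
  have hsumv : ∑ q ∈ Qset N, v q=2*VV N w/(w*ℓ)^2 := by
    simp only [hv]; rw [← sum_div, sum_v]
  rw [hsumv] at hfin
  have hg : gam j (2*VV N w) = gam j (2*VV N w/(w*ℓ)^2)*(w*ℓ)^j := by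
    unfold gam
    split_ifs with he
    · obtain ⟨r, rfl⟩ := he
      have : (r+r)/2 = r := by omega
      rw [this, div_pow, ← pow_mul, show 2*r = r+r by ring]
      field_simp
    · simp
  have e : GG N w j-(gam j (2*VV N w):ℝ)=((SR N w (Qset N)^j).coeff 0/((w*ℓ:ℝ):ℂ)^j-(gam j (2*VV N w/(w*ℓ)^2):ℝ))*((w*ℓ:ℝ):ℂ)^j := by
    rw [sub_mul, div_mul_cancel₀ _ (pow_ne_zero _ hLc), hg, GG]; push_cast; ring
  rw [e, norm_mul, norm_pow, norm_real, norm_eq_abs, abs_of_pos hL]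
  calc _ ≤ C*ℓ⁻¹*(w*ℓ)^j := by gcongr
    _ = _ := by rw [div_eq_mul_inv]; ring

/-- integer combinations of products of square roots, with bounded coefficients -/
def Rep (M:ℝ) (n:ℕ → ℕ):ℕ → ℕ → ℝ → Prop
  | 0, e, α => ∃ z:ℤ, α = z ∧ |α| ≤ M^e
  | k+1, e, α => ∃ a b, Rep M n k e a ∧ Rep M n k e b ∧ α = a+b*√(n k)

section
variable {M:ℝ} {n:ℕ → ℕ}

lemma Rep.mono (hM : 2 ≤ M) {k e e':ℕ} {α:ℝ} (h : Rep M n k e α) (he : e ≤ e') : Rep M n k e' α := by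
  induction k generalizing α with
  | zero =>
    obtain ⟨z, rfl, hz⟩ := h
    exact ⟨z, rfl, hz.trans (pow_le_pow_right₀ (by linarith) he)⟩
  | succ k ih =>
    obtain ⟨a, b, ha, hb, rfl⟩ := h
    exact ⟨a, b, ih ha, ih hb, rfl⟩

lemma Rep.int (k e:ℕ) (hM : 2 ≤ M) {z:ℤ} (hz : |(z:ℝ)| ≤ M^e) : Rep M n k e z := by
  induction k generalizing z with
  | zero => exact ⟨z, rfl, hz⟩
  | succ k ih =>
    refine ⟨z, (0:ℤ), ih hz, ih (by simp; positivity), by simp⟩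

lemma Rep.neg {k e:ℕ} {α:ℝ} (h : Rep M n k e α) : Rep M n k e (-α) := by
  induction k generalizing α with
  | zero =>
    obtain ⟨z, rfl, hz⟩ := h
    exact ⟨-z, by simp, by simpa using hz⟩
  | succ k ih =>
    obtain ⟨a, b, ha, hb, rfl⟩ := h
    exact ⟨-a, -b, ih ha, ih hb, by ring⟩

lemma Rep.add (hM : 2 ≤ M) {k e:ℕ} {α β:ℝ} (h : Rep M n k e α) (h' : Rep M n k e β) : Rep M n k (e+1) (α+β) := by
  induction k generalizing α β with
  | zero =>
    obtain ⟨z, rfl, hz⟩ := h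
    obtain ⟨z', rfl, hz'⟩ := h'
    refine ⟨z+z', by simp, (abs_add_le _ _).trans ?_⟩
    rw [pow_succ]
    have : 0 < M^e := by positivity
    nlinarith
  | succ k ih =>
    obtain ⟨a, b, ha, hb, rfl⟩ := h
    obtain ⟨a', b', ha', hb', rfl⟩ := h'
    exact ⟨a+a', b+b', ih ha ha', ih hb hb', by ring⟩

lemma Rep.nmul (hM : 2 ≤ M) {k e:ℕ} {α:ℝ} (h : Rep M n k e α) (m:ℕ) (hm : (m:ℝ) ≤ M) : Rep M n k (e+1) (m*α) := by
  induction k generalizing α with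
  | zero =>
    obtain ⟨z, rfl, hz⟩ := h
    refine ⟨m*z, by simp, ?_⟩
    rw [abs_mul, Nat.abs_cast, pow_succ, mul_comm]
    gcongr
  | succ k ih =>
    obtain ⟨a, b, ha, hb, rfl⟩ := h
    exact ⟨m*a, m*b, ih ha, ih hb, by ring⟩

lemma Rep.mul (hM : 2 ≤ M) (hn : ∀ i, (n i:ℝ) ≤ M) {k e:ℕ} {α β:ℝ} (h : Rep M n k e α) (h' : Rep M n k e β) : Rep M n k (2*e+2*k) (α*β) := by
  induction k generalizing α β with
  | zero =>
    obtain ⟨z, rfl, hz⟩ := h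
    obtain ⟨z', rfl, hz'⟩ := h'
    refine ⟨z*z', by simp, ?_⟩
    rw [abs_mul, show 2*e+2*0 = e+e by ring, pow_add]
    gcongr
  | succ k ih =>
    obtain ⟨a, b, ha, hb, rfl⟩ := h
    obtain ⟨a', b', ha', hb', rfl⟩ := h'
    refine ⟨a*a'+n k*(b*b'), a*b'+b*a', ?_, ?_, ?_⟩
    · exact Rep.add hM ((ih ha ha').mono hM (Nat.le_succ _)) ((ih hb hb').nmul hM _ (hn k))
    · exact (Rep.add hM (ih ha hb') (ih hb ha')).mono hM (by omega)
    · have : √(n k:ℝ)*√(n k:ℝ) = n k := mul_self_sqrt (by positivity)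
      linear_combination (b*b')*this

lemma Rep.abs_le (hM : 2 ≤ M) (hn : ∀ i, (n i:ℝ) ≤ M) {k e:ℕ} {α:ℝ} (h : Rep M n k e α) : |α| ≤ M^(e+2*k) := by
  induction k generalizing α with
  | zero =>
    obtain ⟨z, rfl, hz⟩ := h
    simpa using hz
  | succ k ih =>
    obtain ⟨a, b, ha, hb, rfl⟩ := h
    have h1 := ih ha
    have h2 := ih hb
    have h3 : √(n k:ℝ) ≤ M := by
      rw [sqrt_le_left (by linarith)]
      nlinarith [hn k]
    have : 0 < M^(e+2*k) := by positivity
    calc _ ≤ |a| + |b| * √(n k:ℝ) := by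
          refine (abs_add_le _ _).trans ?_
          rw [abs_mul, abs_of_nonneg (sqrt_nonneg _)]
      _ ≤ M^(e+2*k)+M^(e+2*k)*M := by gcongr
      _ = M^(e+2*k)*(1+M) := by ring
      _ ≤ M^(e+2*k)*M^2 := by gcongr; nlinarith
      _ = _ := by ring

lemma Rep.lower (k e:ℕ) : ∃ A:ℕ, ∀ (M:ℝ) (n:ℕ → ℕ), 2 ≤ M → (∀ i, (n i:ℝ) ≤ M) → ∀ α, Rep M n k e α → α ≠ 0 →
    1 ≤ |α| * M^A := by
  induction k generalizing e with
  | zero =>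
    refine ⟨0, fun M n hM hn α h h0 => ?_⟩
    obtain ⟨z, rfl, hz⟩ := h
    have : z ≠ 0 := by rintro rfl; simp at h0
    have := Int.one_le_abs this
    rw [pow_zero, mul_one]
    exact_mod_cast this
  | succ k ih =>
    obtain ⟨A1, hA1⟩ := ih e
    obtain ⟨A2, hA2⟩ := ih (2*e+2*k+2)
    refine ⟨A1+(A2+(e+2*(k+1))), fun M n hM hn α h h0 => ?_⟩
    have hc : Rep M n (k+1) e α := h
    obtain ⟨a, b, ha, hb, rfl⟩ := h
    have hs : √(n k:ℝ)*√(n k:ℝ) = n k := mul_self_sqrt (by positivity)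
    have hM1 : 1 ≤ M := by linarith
    by_cases hz : a*a-n k*(b*b)=0
    · have : (a-b*√(n k:ℝ))*(a+b*√(n k:ℝ))=0 := by linear_combination hz-b*b*hs
      rcases mul_eq_zero.1 this with h1 | h1
      · have e2 : a+b*√(n k:ℝ)=2*a := by linarith
        rw [e2] at h0 ⊢
        have := hA1 M n hM hn a ha (by rintro rfl; simp at h0)
        rw [abs_mul, pow_add]
        have hp : 1 ≤ M^(A2+(e+2*(k+1))) := one_le_pow₀ hM1
        calc (1:ℝ)≤2*(1*1) := by norm_num
          _≤2*((|a| * M^A1)*M^(A2+(e+2*(k+1)))) := by gcongr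
          _ = _ := by rw [abs_of_pos (by norm_num : (0:ℝ)<2)]; ring
      · exact absurd h1 h0
    · have hr : Rep M n k (2*e+2*k+2) (a*a-n k*(b*b)) := by
        rw [sub_eq_add_neg]
        exact Rep.add hM ((Rep.mul hM hn ha ha).mono hM (Nat.le_succ _)) ((Rep.mul hM hn hb hb).nmul hM _ (hn k)).neg
      have h1 := hA2 M n hM hn _ hr hz
      have hcj : Rep M n (k+1) e (a+(-b)*√(n k:ℝ)) := ⟨a, -b, ha, hb.neg, rfl⟩
      have h2 := hcj.abs_le hM hn
      have e1 : a*a-n k*(b*b)=(a+b*√(n k:ℝ))*(a+(-b)*√(n k:ℝ)) := by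
        linear_combination b*b*hs
      rw [e1, abs_mul] at h1
      have hp : 1 ≤ M^A1 := one_le_pow₀ hM1
      calc (1:ℝ)≤1*1 := by norm_num
        _ ≤ M^A1*(|a+b*√(n k:ℝ)| * |a+(-b)*√(n k:ℝ)| * M^A2) := by gcongr
        _ ≤ M^A1*(|a+b*√(n k:ℝ)| * M^(e+2*(k+1))*M^A2) := by gcongr
        _ = _ := by rw [pow_add, pow_add]; ring

end

lemma sqrt_sum_lower (j:ℕ) : ∃ A:ℕ, ∀ (M:ℝ) (f : Fin j → ℕ) (s : Fin j → ℤ), 2 ≤ M → (∀ i, (f i:ℝ) ≤ M) → (∀ i, |s i| ≤ 1) →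
    ∑ i, (s i:ℝ)*√(f i) ≠ 0 → 1 ≤ |∑ i, (s i:ℝ)*√(f i)| * M^A := by
  obtain ⟨A, hA⟩ := Rep.lower j 1
  refine ⟨A, fun M f s hM hf hs h0 => ?_⟩
  set n:ℕ → ℕ := fun i => if h : i < j then f ⟨i, h⟩ else 0 with hn
  set t:ℕ → ℤ := fun i => if h : i < j then s ⟨i, h⟩ else 0 with ht
  have e : ∑ i, (s i:ℝ)*√(f i) = ∑ i ∈ Finset.range j, (t i:ℝ)*√(n i) := by
    rw [← Fin.sum_univ_eq_sum_range (fun i => (t i:ℝ)*√(n i))]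
    apply sum_congr rfl
    intro i _
    simp [hn, ht]
  have hnM : ∀ i, (n i:ℝ) ≤ M := by
    intro i; simp only [hn]; split_ifs
    · exact hf _
    · simp; linarith
  have htM : ∀ i, |(t i:ℝ)| ≤ M^1 := by
    intro i
    have : |t i| ≤ 1 := by
      simp only [ht]; split_ifs
      · exact hs _
      · simp
    have : |(t i:ℝ)| ≤ 1 := by exact_mod_cast this
    linarith
  have hrep : ∀ k, Rep M n k 1 (∑ i ∈ Finset.range k, (t i:ℝ)*√(n i)) := by
    intro k
    induction k with
    | zero => exact ⟨0, by simp, by simp; linarith⟩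
    | succ k ih =>
      exact ⟨_, t k, ih, Rep.int k 1 hM (htM k), sum_range_succ _ _⟩
  rw [e] at h0 ⊢
  exact hA M n hM hnM _ (hrep j) h0

lemma tv_piece (ω:ℝ → ℝ) (W:ℝ) (m:ℕ) : ∀ (a b:ℝ), a ≤ b → (∀ x ∈ Set.Icc a b, HasDerivAt ω (deriv ω x) x) →
    ContinuousOn (deriv ω) (Set.Icc a b) → (∀ x ∈ Set.Icc a b, 0≤ω x ∧ ω x ≤ W) →
    {x ∈ Ioo a b | deriv ω x=0}.Finite → {x ∈ Ioo a b | deriv ω x=0}.ncard = m →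
    ∫ x in a..b, |deriv ω x| ≤ (m+1)*W := by
  induction m using Nat.strong_induction_on with
  | _ m ih =>
  intro a b hab hd hc hW hfin hcard
  have huIcc : uIcc a b = Set.Icc a b := uIcc_of_le hab
  by_cases hne : ∃ c ∈ Ioo a b, deriv ω c=0
  · obtain ⟨c, hcI, hc0⟩ := hne
    set U := {x ∈ Ioo a b | deriv ω x=0} with hU
    set U1 := {x ∈ Ioo a c | deriv ω x=0} with hU1
    set U2 := {x ∈ Ioo c b | deriv ω x=0} with hU2
    have s1 : U1 ⊆ U := fun x hx => ⟨⟨hx.1.1, hx.1.2.trans hcI.2⟩, hx.2⟩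
    have s2 : U2 ⊆ U := fun x hx => ⟨⟨hcI.1.trans hx.1.1, hx.1.2⟩, hx.2⟩
    have f1 := hfin.subset s1
    have f2 := hfin.subset s2
    have hdis : Disjoint U1 U2 := Set.disjoint_left.2 fun x h1 h2 => absurd (h1.1.2.trans h2.1.1) (lt_irrefl _)
    have hlt : U1.ncard+U2.ncard < U.ncard := by
      rw [← Set.ncard_union_eq hdis f1 f2]
      apply Set.ncard_lt_ncard _ hfin
      refine ⟨Set.union_subset s1 s2, fun h => ?_⟩
      have := h (show c ∈ U from ⟨hcI, hc0⟩)
      rcases this with h | h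
      · exact lt_irrefl _ h.1.2
      · exact lt_irrefl _ h.1.1
    have sub1 : Set.Icc a c ⊆ Set.Icc a b := Set.Icc_subset_Icc_right hcI.2.le
    have sub2 : Set.Icc c b ⊆ Set.Icc a b := Set.Icc_subset_Icc_left hcI.1.le
    have i1 := ih U1.ncard (by omega) a c hcI.1.le (fun x hx => hd x (sub1 hx)) (hc.mono sub1) (fun x hx => hW x (sub1 hx)) f1 rfl
    have i2 := ih U2.ncard (by omega) c b hcI.2.le (fun x hx => hd x (sub2 hx)) (hc.mono sub2) (fun x hx => hW x (sub2 hx)) f2 rfl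
    have hi1 : IntervalIntegrable (fun x => |deriv ω x|) volume a c := by
      apply ContinuousOn.intervalIntegrable; rw [uIcc_of_le hcI.1.le]; exact (hc.mono sub1).abs
    have hi2 : IntervalIntegrable (fun x => |deriv ω x|) volume c b := by
      apply ContinuousOn.intervalIntegrable; rw [uIcc_of_le hcI.2.le]; exact (hc.mono sub2).abs
    rw [← integral_add_adjacent_intervals hi1 hi2]
    have hW0 : 0 ≤ W := (hW a ⟨le_rfl, hab⟩).1.trans (hW a ⟨le_rfl, hab⟩).2
    have : ((U1.ncard:ℝ)+U2.ncard+1) ≤ m := by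
      have : U1.ncard+U2.ncard+1 ≤ m := by omega
      exact_mod_cast this
    nlinarith
  · push Not at hne
    have hsign : (∀ x ∈ Ioo a b, 0 < deriv ω x) ∨ (∀ x ∈ Ioo a b, deriv ω x < 0) := by
      by_contra hcon
      push Not at hcon
      obtain ⟨⟨x, hx, hx0⟩, ⟨y, hy, hy0⟩⟩ := hcon
      have hcon : uIcc x y ⊆ Ioo a b := (Set.ordConnected_Ioo).uIcc_subset hx hy
      have := intermediate_value_uIcc (hc.mono (hcon.trans Set.Ioo_subset_Icc_self))
      have h0 : (0:ℝ) ∈ uIcc (deriv ω x) (deriv ω y) := by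
        rw [Set.mem_uIcc]; left; exact ⟨hx0, hy0⟩
      obtain ⟨z, hz, hz0⟩ := this h0
      exact hne z (hcon hz) hz0
    have hig : IntervalIntegrable (deriv ω) volume a b := by
      apply ContinuousOn.intervalIntegrable; rwa [huIcc]
    have hFTC : ∫ x in a..b, deriv ω x = ω b-ω a :=
      integral_eq_sub_of_hasDerivAt (fun x hx => hd x (huIcc ▸ hx)) hig
    have ha := hW a ⟨le_rfl, hab⟩
    have hb := hW b ⟨hab, le_rfl⟩
    have hm0 : (0:ℝ) ≤ m := by positivity
    have hW0 : 0 ≤ W := ha.1.trans ha.2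
    rcases hsign with h | h
    · have : ∫ x in a..b, |deriv ω x| = ∫ x in a..b, deriv ω x := by
        apply intervalIntegral.integral_congr_ae
        filter_upwards [compl_mem_ae_iff.2 (measure_singleton (μ := volume) b)] with x hxb hx
        rw [uIoc_of_le hab] at hx
        exact abs_of_pos (h x ⟨hx.1, lt_of_le_of_ne hx.2 hxb⟩)
      rw [this, hFTC]; nlinarith
    · have : ∫ x in a..b, |deriv ω x| = ∫ x in a..b,-deriv ω x := by
        apply intervalIntegral.integral_congr_ae
        filter_upwards [compl_mem_ae_iff.2 (measure_singleton (μ := volume) b)] with x hxb hx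
        rw [uIoc_of_le hab] at hx
        exact abs_of_neg (h x ⟨hx.1, lt_of_le_of_ne hx.2 hxb⟩)
      rw [this, intervalIntegral.integral_neg, hFTC]; nlinarith

section
variable {ω:ℝ → ℝ}

lemma om_hasDeriv (hω : OmegaClass ω) {x:ℝ} (hx : 0 < x) : HasDerivAt ω (deriv ω x) x :=
  ((hω.contDiff.contDiffAt (Ioi_mem_nhds hx)).differentiableAt (by norm_num)).hasDerivAt

lemma om_cont_deriv (hω : OmegaClass ω) : ContinuousOn (deriv ω) (Ioi 0) :=
  hω.contDiff.continuousOn_deriv_of_isOpen isOpen_Ioi (by norm_num)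

lemma om_cont (hω : OmegaClass ω) : ContinuousOn ω (Ioi 0) := hω.contDiff.continuousOn

lemma om_small (hω : OmegaClass ω) {ε:ℝ} (hε : 0 < ε) : ∀ᶠ X in atTop, ∀ x, X ≤ x → 0 < ω x ∧ ω x < ε := by
  have := hω.tendsto_zero.eventually (gt_mem_nhds hε)
  obtain ⟨X0, hX0⟩ := eventually_atTop.1 this
  filter_upwards [eventually_ge_atTop X0, eventually_gt_atTop 0] with X h1 h2 x hx
  exact ⟨hω.pos x (by linarith), hX0 x (by linarith)⟩

lemma om_tv (hω : OmegaClass ω) : ∃ C ≥ 0, ∀ᶠ X in atTop, ∫ x in X..(2*X), |deriv ω x| ≤ C*√X := by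
  obtain ⟨C, hC, ξ, -, hz⟩ := hω.zeros_bound
  refine ⟨C+1, by linarith, ?_⟩
  filter_upwards [hz, om_small hω one_pos, eventually_ge_atTop 1] with X hh hs hX
  obtain ⟨hf, -, hb, -⟩ := hh
  set U := {x ∈ Set.Icc X (2*X) | deriv ω x=0}
  set W := sSup (ω '' Set.Icc X (2*X)) with hW
  have hsub : {x ∈ Ioo X (2*X) | deriv ω x=0} ⊆ U := fun x hx => ⟨Set.Ioo_subset_Icc_self hx.1, hx.2⟩
  have hbdd : BddAbove (ω '' Set.Icc X (2*X)) := ⟨1, by rintro _ ⟨x, hx, rfl⟩; exact (hs x hx.1).2.le⟩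
  have hmem : ∀ x ∈ Set.Icc X (2*X), 0≤ω x ∧ ω x ≤ W := fun x hx => ⟨(hs x hx.1).1.le, le_csSup hbdd ⟨x, hx, rfl⟩⟩
  have hW1 : W≤1 := csSup_le ⟨ω X, X, ⟨le_rfl, by linarith⟩, rfl⟩ (by rintro _ ⟨x, hx, rfl⟩; exact (hs x hx.1).2.le)
  have hsub2 : Set.Icc X (2*X) ⊆ Ioi 0 := fun x hx => by have := hx.1; simp; linarith
  have := tv_piece ω W _ X (2*X) (by linarith) (fun x hx => om_hasDeriv hω (hsub2 hx)) ((om_cont_deriv hω).mono hsub2)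
    hmem (hf.subset hsub) rfl
  have hcard : ({x ∈ Ioo X (2*X) | deriv ω x=0}.ncard:ℝ) ≤ U.ncard := by
    exact_mod_cast Set.ncard_le_ncard hsub hf
  have hW0 : 0 ≤ W := (hmem X ⟨le_rfl, by linarith⟩).1.trans (hmem X ⟨le_rfl, by linarith⟩).2
  rw [← sqrt_eq_rpow] at hb
  have hX1 : 1≤√X := Real.one_le_sqrt.2 hX
  refine this.trans ?_
  nlinarith

lemma osc_int (hω : OmegaClass ω) (B B':ℝ → ℂ) (hB : ∀ w, HasDerivAt B (B' w) w) (hBc : Continuous B') (b0 b1:ℝ)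
    (h0 : ∀ w, ‖B w‖ ≤ b0) (h1 : ∀ w, ‖B' w‖ ≤ b1) (Λ:ℝ) (hΛ : Λ ≠ 0) {X:ℝ} (hX : 0 < X) :
    ‖∫ x in X..(2*X), B (ω x)*Complex.exp (2*π*Complex.I*(Λ*x:ℝ))‖ ≤
      (2*b0+b1*∫ x in X..(2*X), |deriv ω x|) / |Λ| := by
  have hXX : X≤2*X := by linarith
  have hu : uIcc X (2*X) = Set.Icc X (2*X) := uIcc_of_le hXX
  have hsub2 : Set.Icc X (2*X) ⊆ Ioi 0 := fun x hx => by have := hx.1; simp; linarith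
  set c:ℂ := 2*π*Complex.I*Λ with hc
  have hc0 : c ≠ 0 := by
    simp [hc, pi_ne_zero, hΛ]
  have hcn : ‖c‖ = 2*π * |Λ| := by
    simp [hc, abs_of_pos pi_pos]
  have hexp : ∀ x:ℝ, Complex.exp (2*π*Complex.I*(Λ*x:ℝ)) = Complex.exp (c*x) := by
    intro x; congr 1; rw [hc]; push_cast; ring
  simp_rw [hexp]
  have hne : ∀ x:ℝ, ‖Complex.exp (c*x)‖ = 1 := by
    intro x
    have : c*x=((2*π*Λ*x:ℝ):ℂ)*Complex.I := by rw [hc]; push_cast; ring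
    rw [this, Complex.norm_exp_ofReal_mul_I]
  set v:ℝ → ℂ := fun x => Complex.exp (c*x)/c with hv
  have hvd : ∀ x:ℝ, HasDerivAt v (Complex.exp (c*x)) x := by
    intro x
    have h1 : HasDerivAt (fun x:ℝ => c*(x:ℂ)) (c*1) x := (Complex.ofRealCLM.hasDerivAt (x := x)).const_mul c
    have h2 := (h1.cexp).div_const c
    rw [mul_one, mul_div_cancel_right₀ _ hc0] at h2
    exact h2
  have hud : ∀ x ∈ uIcc X (2*X), HasDerivAt (fun x => B (ω x)) (deriv ω x • B' (ω x)) x := by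
    intro x hx
    rw [hu] at hx
    exact (hB (ω x)).scomp x (om_hasDeriv hω (hsub2 hx))
  have hcω : ContinuousOn ω (uIcc X (2*X)) := by rw [hu]; exact (om_cont hω).mono hsub2
  have hcω' : ContinuousOn (deriv ω) (uIcc X (2*X)) := by rw [hu]; exact (om_cont_deriv hω).mono hsub2
  have hui : IntervalIntegrable (fun x => deriv ω x • B' (ω x)) volume X (2*X) := by
    apply ContinuousOn.intervalIntegrable
    exact hcω'.smul (hBc.comp_continuousOn hcω)
  have hvi : IntervalIntegrable (fun x:ℝ => Complex.exp (c*x)) volume X (2*X) := by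
    apply Continuous.intervalIntegrable; fun_prop
  rw [intervalIntegral.integral_mul_deriv_eq_deriv_mul hud (fun x _ => hvd x) hui hvi]
  have hvn : ∀ x, ‖v x‖ = (2*π * |Λ|)⁻¹ := by
    intro x; simp only [hv]; rw [norm_div, hne, hcn, one_div]
  have hb0 : 0 ≤ b0 := (norm_nonneg _).trans (h0 0)
  have hb1 : 0 ≤ b1 := (norm_nonneg _).trans (h1 0)
  have hΛ0 : 0 < |Λ| := abs_pos.2 hΛ
  have hI : ‖∫ x in X..(2*X), deriv ω x • B' (ω x)*v x‖ ≤ ∫ x in X..(2*X), b1*(2*π * |Λ|)⁻¹ * |deriv ω x| := by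
    apply intervalIntegral.norm_integral_le_of_norm_le hXX
    · refine Eventually.of_forall fun x _ => ?_
      rw [norm_mul, norm_smul, hvn, norm_eq_abs]
      have := h1 (ω x)
      calc _ ≤ |deriv ω x| * b1*(2*π * |Λ|)⁻¹ := by gcongr
        _ = _ := by ring
    · apply ContinuousOn.intervalIntegrable
      exact continuousOn_const.mul hcω'.abs
  rw [intervalIntegral.integral_const_mul] at hI
  set J := ∫ x in X..(2*X), |deriv ω x| with hJ
  have hJ0 : 0 ≤ J := intervalIntegral.integral_nonneg hXX (fun x _ => abs_nonneg _)
  have hpi : (2*π * |Λ|)⁻¹ ≤ |Λ|⁻¹ := by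
    apply inv_anti₀ hΛ0
    nlinarith [pi_gt_three]
  calc _ ≤ ‖B (ω (2*X))*v (2*X)‖ + ‖B (ω X)*v X‖ + ‖∫ x in X..(2*X), deriv ω x • B' (ω x)*v x‖ := by
        refine (norm_sub_le _ _).trans ?_
        gcongr
        exact norm_sub_le _ _
    _ ≤ b0*(2*π * |Λ|)⁻¹+b0*(2*π * |Λ|)⁻¹+b1*(2*π * |Λ|)⁻¹*J := by
        rw [norm_mul, norm_mul, hvn, hvn]
        gcongr
        · exact h0 _
        · exact h0 _
    _ = (2*b0+b1*J)*(2*π * |Λ|)⁻¹ := by ring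
    _≤_ := by rw [div_eq_mul_inv]; gcongr

end

def Dl (N:ℕ) (x w:ℝ):ℝ := ∑ n ∈ Icc 1 N, (r2 n:ℝ)/n*(cos (2*π*√n*(x+w))-cos (2*π*√n*x))

def II (N:ℕ) : Finset (ℕ × ℤ) := (Icc 1 N) ×ˢ {1, -1}
def lam (i:ℕ × ℤ):ℝ := (i.2:ℝ)*√i.1

lemma II_sum {M : Type*} [AddCommMonoid M] (N:ℕ) (F:ℕ → ℝ → M) :
    ∑ i ∈ II N, F i.1 (lam i) = ∑ n ∈ Icc 1 N, (F n √n+F n (-√n)) := by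
  rw [II, sum_product]
  apply sum_congr rfl
  intro n _
  rw [Finset.sum_pair (by norm_num)]
  simp [lam]

lemma SR_eq (N:ℕ) (w:ℝ) : SR N w (Qset N) = ∑ i ∈ II N, (AddMonoidAlgebra.single (lam i) (bet w i.1 (lam i)) : TP) := by
  rw [II_sum N (fun n y => (AddMonoidAlgebra.single y (bet w n y) : TP)),
    ← reindex N (fun n y => (AddMonoidAlgebra.single y (bet w n y) : TP))]
  rfl

lemma ee_re (t:ℝ) : ee t+ee (-t)=((2*cos (2*π*t):ℝ):ℂ) := by
  rw [← ee_conj, Complex.add_conj]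
  congr 2
  have : ee t = Complex.exp ((2*π*t:ℝ)*Complex.I) := by
    unfold ee; congr 1; push_cast; ring
  rw [this, Complex.exp_ofReal_mul_I_re]

lemma Dl_eq (N:ℕ) (x w:ℝ) : ((Dl N x w:ℝ):ℂ) = ∑ i ∈ II N, bet w i.1 (lam i)*ee (lam i*x) := by
  rw [II_sum N (fun n y => bet w n y*ee (y*x)), Dl, Complex.ofReal_sum]
  apply sum_congr rfl
  intro n hn
  have hn0 : (n:ℂ) ≠ 0 := by
    simp only [mem_Icc] at hn
    exact_mod_cast (by omega : n ≠ 0)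
  unfold bet
  have e1 : (ee (√n*w)-1)*ee (√n*x) = ee (√n*(x+w))-ee (√n*x) := by
    rw [sub_mul, ← ee_add]; ring_nf
  have e2 : (ee (-√n*w)-1)*ee (-√n*x) = ee (-(√n*(x+w)))-ee (-(√n*x)) := by
    rw [sub_mul, ← ee_add]; ring_nf
  have e0 : ∀ c a b a' b':ℂ, c*a*b+c*a'*b' = c*(a*b+a'*b') := by intros; ring
  rw [e0, e1, e2]
  have e3 : ee (√n*(x+w))-ee (√n*x)+(ee (-(√n*(x+w)))-ee (-(√n*x))) =
    ((2*cos (2*π*(√n*(x+w))):ℝ):ℂ)-((2*cos (2*π*(√n*x)):ℝ):ℂ) := by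
    rw [← ee_re, ← ee_re]; ring
  rw [e3, ← mul_assoc (2*π), ← mul_assoc (2*π)]
  push_cast
  field_simp

lemma Dl_pow (N:ℕ) (x w:ℝ) (j:ℕ) : ((Dl N x w^j:ℝ):ℂ) =
    ∑ f ∈ piFinset (fun _ : Fin j => II N), (∏ l, bet w (f l).1 (lam (f l)))*ee ((∑ l, lam (f l))*x) := by
  rw [Complex.ofReal_pow, Dl_eq]
  have h := Finset.prod_univ_sum (fun _ : Fin j => II N) (fun _ i => bet w i.1 (lam i)*ee (lam i*x))
  simp only [prod_const, card_univ, card_fin] at h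
  rw [h]
  apply sum_congr rfl
  intro f _
  rw [Finset.prod_mul_distrib]
  congr 1
  unfold ee
  rw [← Complex.exp_sum]
  congr 1
  rw [← mul_sum, sum_mul]; push_cast; rfl

lemma GG_eq (N:ℕ) (w:ℝ) (j:ℕ) : GG N w j =
    ∑ f ∈ (piFinset (fun _ : Fin j => II N)).filter (fun f => ∑ l, lam (f l)=0), ∏ l, bet w (f l).1 (lam (f l)) := by
  rw [GG, SR_eq, c0_pow]

lemma Dl_sub_GG (N:ℕ) (x w:ℝ) (j:ℕ) : ((Dl N x w^j:ℝ):ℂ)-GG N w j =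
    ∑ f ∈ (piFinset (fun _ : Fin j => II N)).filter (fun f => ¬ ∑ l, lam (f l)=0),
      (∏ l, bet w (f l).1 (lam (f l)))*ee ((∑ l, lam (f l))*x) := by
  rw [Dl_pow, GG_eq, ← Finset.sum_filter_add_sum_filter_not _ (fun f : Fin j → ℕ × ℤ => ∑ l, lam (f l)=0),
    add_sub_right_comm, add_eq_right, sub_eq_zero]
  apply sum_congr rfl
  intro f hf
  rw [(Finset.mem_filter.1 hf).2]; simp [ee_zero]

def bet' (w:ℝ) (n:ℕ) (y:ℝ):ℂ := ((r2 n:ℝ)/(2*n):ℝ)*(2*π*Complex.I*y*ee (y*w))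

lemma bet_hasDeriv (w:ℝ) (n:ℕ) (y:ℝ) : HasDerivAt (fun w => bet w n y) (bet' w n y) w := by
  unfold bet bet'
  apply HasDerivAt.const_mul
  apply HasDerivAt.sub_const
  unfold ee
  have h1 : HasDerivAt (fun w:ℝ => (2*π*Complex.I*y:ℂ)*(w:ℂ)) ((2*π*Complex.I*y:ℂ)*1) w :=
    (Complex.ofRealCLM.hasDerivAt (x := w)).const_mul _
  have h2 := h1.cexp
  have e : ∀ w:ℝ, (2*π*Complex.I*((y*w:ℝ):ℂ))=(2*π*Complex.I*y:ℂ)*(w:ℂ) := by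
    intro w; push_cast; ring
  simp_rw [e]
  rw [mul_one, mul_comm (Complex.exp _)] at h2
  exact h2

lemma ee_cont : Continuous ee := by unfold ee; fun_prop

lemma bet_cont (n:ℕ) (y:ℝ) : Continuous (fun w => bet w n y) := by
  unfold bet; have := ee_cont; fun_prop

lemma bet'_cont (n:ℕ) (y:ℝ) : Continuous (fun w => bet' w n y) := by
  unfold bet'; have := ee_cont; fun_prop

lemma bet_bounds : ∃ C ≥ 1, ∀ (N:ℕ), ∀ i ∈ II N, ∀ w, ‖bet w i.1 (lam i)‖ ≤ C ∧ ‖bet' w i.1 (lam i)‖ ≤ C*N := by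
  obtain ⟨C, hC1, hC⟩ := r2_bound 1 one_pos
  refine ⟨C*π, by nlinarith [pi_gt_three], fun N i hi w => ?_⟩
  simp only [II, mem_product, mem_Icc, Finset.mem_insert, Finset.mem_singleton] at hi
  obtain ⟨⟨hn1, hnN⟩, hs⟩ := hi
  have hn0 : (0:ℝ) < i.1 := by exact_mod_cast hn1
  have h1 := hC i.1 hn1
  rw [rpow_one] at h1
  have hcoef : (r2 i.1:ℝ)/(2*i.1) ≤ C/2 := by
    rw [div_le_div_iff₀ (by positivity) (by norm_num)]; linarith
  have hcoef0 : 0≤(r2 i.1:ℝ)/(2*i.1) := by positivity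
  have hlam : |lam i| ≤ N := by
    unfold lam
    have h2 : |(i.2:ℝ)| = 1 := by rcases hs with h | h <;> simp [h]
    rw [abs_mul, h2, one_mul, abs_of_nonneg (sqrt_nonneg _)]
    have h3 : (i.1:ℝ) ≤ N := by exact_mod_cast hnN
    have h4 : (1:ℝ) ≤ i.1 := by exact_mod_cast hn1
    rw [sqrt_le_left (by positivity)]; nlinarith
  have hpi := pi_gt_three
  constructor
  · unfold bet
    rw [norm_mul, norm_real, norm_eq_abs, abs_of_nonneg hcoef0]
    have : ‖ee (lam i*w)-1‖ ≤ 2 := by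
      refine (norm_sub_le _ _).trans ?_
      rw [ee_norm]; norm_num
    calc _ ≤ C/2*2 := by gcongr
      _ ≤ C*π := by nlinarith
  · unfold bet'
    rw [norm_mul, norm_real, norm_eq_abs, abs_of_nonneg hcoef0]
    have : ‖2*π*Complex.I*(lam i)*ee (lam i*w)‖ = 2*π * |lam i| := by
      rw [norm_mul, ee_norm]; simp [abs_of_pos pi_pos]
    rw [this]
    calc _ ≤ C/2*(2*π*N) := by gcongr
      _ = _ := by ring

lemma osc_f {ω:ℝ → ℝ} (hω : OmegaClass ω) (j:ℕ) : ∃ A:ℕ, ∃ C ≥ 0, ∀ᶠ X in atTop, ∀ N:ℕ, 2 ≤ N →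
    ∀ f ∈ (piFinset (fun _ : Fin j => II N)).filter (fun f => ¬ ∑ l, lam (f l)=0),
    ‖∫ x in X..(2*X), (∏ l, bet (ω x) (f l).1 (lam (f l)))*ee ((∑ l, lam (f l))*x)‖ ≤ C*(N:ℝ)^A*√X := by
  obtain ⟨A, hA⟩ := sqrt_sum_lower j
  obtain ⟨C, hC1, hC⟩ := bet_bounds
  obtain ⟨D, hD0, hD⟩ := om_tv hω
  refine ⟨A+1, 2*C^j+j*C^j*D, by positivity, ?_⟩
  filter_upwards [hD, eventually_ge_atTop 1] with X hDX hX N hN f hf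
  rw [mem_filter, Fintype.mem_piFinset] at hf
  obtain ⟨hfI, hf0⟩ := hf
  have hN' : (2:ℝ) ≤ N := by exact_mod_cast hN
  have hb := hA N (fun l => (f l).1) (fun l => (f l).2) hN' (fun l => by
      have := hfI l
      simp only [II, mem_product, mem_Icc] at this
      exact_mod_cast this.1.2) (fun l => by
      have := hfI l
      simp only [II, mem_product, mem_Icc, Finset.mem_insert, Finset.mem_singleton] at this
      rcases this.2 with h | h <;> simp [h]) hf0
  change 1 ≤ |∑ l, lam (f l)| * _ at hb
  set Λ := ∑ l, lam (f l) with hΛ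
  have hΛ0 : 0 < |Λ| := abs_pos.2 hf0
  have hX0 : 0 < X := by linarith
  have main := osc_int hω (fun w => ∏ l, bet w (f l).1 (lam (f l)))
    (fun w => ∑ l, (∏ l' ∈ Finset.univ.erase l, bet w (f l').1 (lam (f l'))) • bet' w (f l).1 (lam (f l)))
    (fun w => HasDerivAt.fun_finsetProd (fun l _ => bet_hasDeriv w _ _)) (by
      apply continuous_finsetSum
      intro l _
      apply Continuous.fun_smul
      · apply continuous_finsetProd
        intro l' _; exact bet_cont _ _
      · exact bet'_cont _ _) (C^j) (j*(C^j*N)) (fun w => by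
      rw [norm_prod]
      calc _≤∏ l : Fin j, C := Finset.prod_le_prod (fun _ _ => norm_nonneg _) (fun l _ => (hC N _ (hfI l) w).1)
        _ = _ := by simp) (fun w => by
      refine (norm_sum_le _ _).trans ?_
      calc _≤∑ l : Fin j, C^j*N := by
            apply sum_le_sum
            intro l _
            rw [norm_smul, norm_prod]
            calc _≤(∏ l' ∈ Finset.univ.erase l, C)*(C*N) := by
                  gcongr with l' _
                  · exact (hC N _ (hfI l') w).1
                  · exact (hC N _ (hfI l) w).2
              _ = _ := by
                rw [prod_const, Finset.card_erase_of_mem (Finset.mem_univ _), card_univ, card_fin]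
                have : 0 < j := l.pos
                rw [← mul_assoc, ← pow_succ]; congr 2; omega
        _ = _ := by simp) Λ hf0 hX0
  refine main.trans ?_
  have hinv : |Λ|⁻¹≤(N:ℝ)^A := by
    rw [inv_le_iff_one_le_mul₀ hΛ0]; linarith
  have hX1 : 1≤√X := Real.one_le_sqrt.2 hX
  have hJ : 2*C^j+j*(C^j*N)*(∫ x in X..(2*X), |deriv ω x|)≤(2*C^j+j*C^j*D)*N*√X := by
    have e1 : 2*C^j≤2*C^j*(N*√X) := by
      apply le_mul_of_one_le_right (by positivity); nlinarith
    have e2 : j*(C^j*N)*(∫ x in X..(2*X), |deriv ω x|) ≤ j*(C^j*N)*(D*√X) := by gcongr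
    nlinarith
  rw [div_eq_mul_inv]
  calc _≤(2*C^j+j*C^j*D)*N*√X*(N:ℝ)^A := by gcongr
    _ = _ := by ring

theorem avg_Dl {ω:ℝ → ℝ} (hω : OmegaClass ω) (j:ℕ) : ∃ A:ℕ, ∃ C ≥ 0, ∀ᶠ X in atTop, ∀ N:ℕ, 2 ≤ N →
    ‖(∫ x in X..(2*X), ((Dl N x (ω x)^j:ℝ):ℂ))-∫ x in X..(2*X), GG N (ω x) j‖ ≤ C*(N:ℝ)^A*√X := by
  obtain ⟨A, C, hC0, hC⟩ := osc_f hω j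
  refine ⟨j+A, 2^j*C, by positivity, ?_⟩
  filter_upwards [hC, eventually_ge_atTop 1] with X hCX hX N hN
  have hXX : X≤2*X := by linarith
  have hu : uIcc X (2*X) = Set.Icc X (2*X) := uIcc_of_le hXX
  have hcω : ContinuousOn ω (uIcc X (2*X)) := by
    rw [hu]; exact (om_cont hω).mono (fun x hx => by have := hx.1; simp; linarith)
  have hi1 : IntervalIntegrable (fun x => ((Dl N x (ω x)^j:ℝ):ℂ)) volume X (2*X) := by
    apply ContinuousOn.intervalIntegrable
    unfold Dl
    fun_prop
  have hi2 : IntervalIntegrable (fun x => GG N (ω x) j) volume X (2*X) := by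
    apply ContinuousOn.intervalIntegrable
    simp_rw [GG_eq]
    apply continuousOn_finsetSum
    intro f _
    apply continuousOn_finsetProd
    intro l _
    exact (bet_cont _ _).comp_continuousOn hcω
  rw [← intervalIntegral.integral_sub hi1 hi2]
  simp_rw [Dl_sub_GG]
  rw [intervalIntegral.integral_finsetSum]
  · refine (norm_sum_le _ _).trans ?_
    refine (sum_le_sum (fun f hf => hCX N hN f hf)).trans ?_
    rw [sum_const, nsmul_eq_mul]
    have hcard : ((Finset.filter (fun f => ¬ ∑ l, lam (f l)=0) (piFinset (fun _ : Fin j => II N))).card:ℝ)≤(2*N:ℝ)^j := by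
      have h1 := Finset.card_filter_le (piFinset (fun _ : Fin j => II N)) (fun f => ¬ ∑ l, lam (f l)=0)
      rw [Fintype.card_piFinset] at h1
      have h2 : (II N).card=2*N := by simp [II, mul_comm]
      simp only [h2, prod_const, card_univ, card_fin] at h1
      exact_mod_cast h1
    calc _≤(2*N:ℝ)^j*(C*(N:ℝ)^A*√X) := by gcongr
      _ = _ := by rw [mul_pow, pow_add]; ring
  · intro f _
    apply ContinuousOn.intervalIntegrable
    apply ContinuousOn.mul
    · apply continuousOn_finsetProd
      intro l _
      exact (bet_cont _ _).comp_continuousOn hcω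
    · exact (ee_cont.comp (by fun_prop)).continuousOn

/-- The fibre length function over the plane. -/
def Ff (y:ℝ) (z:ℂ):ℝ := 2*√(y^4-(normSq z)^2)

/-- Integer points as complex numbers. -/
def zc (v:ℤ × ℤ):ℂ := ⟨(v.1:ℝ), (v.2:ℝ)⟩

/-- The box of integer points. -/
def Bx (M:ℕ) : Finset (ℤ × ℤ) :=
  (Icc (-(M:ℤ)) M) ×ˢ (Icc (-(M:ℤ)) M)

/-- The sawtooth sum. -/
def Tx (x:ℝ):ℝ := ∑ m ∈ Finset.range (⌊x^2⌋₊+1),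
  (r2 m:ℝ)*sawtooth (√(x^4-(m:ℝ)^2))

lemma normSq_zc (v:ℤ × ℤ) : normSq (zc v)=(v.1:ℝ)^2+(v.2:ℝ)^2 := by
  simp [zc, Complex.normSq_apply]; ring

lemma mem_dil {x:ℝ} (hx : 0 < x) (a b c:ℝ) :
    (a, b, c) ∈ heisDil x '' cyganBall ↔ (a^2+b^2)^2+c^2 ≤ x^4 := by
  have hball : ∀ u:ℝ × ℝ × ℝ, u ∈ cyganBall ↔ (u.1^2+u.2.1^2)^2+u.2.2^2≤1 := by
    intro u
    unfold cyganBall cyganNorm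
    show ((u.1^2+u.2.1^2)^2+u.2.2^2)^((1:ℝ)/4)≤1 ↔ (u.1^2+u.2.1^2)^2+u.2.2^2≤1
    constructor
    · intro h
      by_contra hc
      push Not at hc
      exact absurd (one_lt_rpow hc (by norm_num : (0:ℝ) < 1/4)) (not_lt.mpr h)
    · intro h
      exact rpow_le_one (by positivity) h (by norm_num)
  constructor
  · rintro ⟨u, hu, he⟩
    rw [hball] at hu
    simp only [heisDil, Prod.mk.injEq] at he
    obtain ⟨h1, h2, h3⟩ := he
    rw [← h1, ← h2, ← h3]
    have : ((x*u.1)^2+(x*u.2.1)^2)^2+(x^2*u.2.2)^2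
      = x^4*((u.1^2+u.2.1^2)^2+u.2.2^2) := by ring
    rw [this]
    have : 0 ≤ x^4 := by positivity
    nlinarith
  · intro h
    refine ⟨(a/x, b/x, c/x^2), ?_, ?_⟩
    · rw [hball]
      have : ((a/x)^2+(b/x)^2)^2+(c/x^2)^2
        = ((a^2+b^2)^2+c^2)/x^4 := by field_simp
      show ((a/x)^2+(b/x)^2)^2+(c/x^2)^2≤1
      rw [this, div_le_one (by positivity)]
      exact h
    · simp only [heisDil, Prod.mk.injEq]
      refine ⟨?_, ?_, ?_⟩ <;> field_simp

lemma mem_Bx_of {M:ℕ} {x:ℝ} (hM : x ≤ M) (hx : 0 < x) {v:ℤ × ℤ}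
    (h : (v.1:ℝ)^2+(v.2:ℝ)^2 ≤ x^2) : v ∈ Bx M := by
  have key : ∀ t:ℤ, (t:ℝ)^2 ≤ x^2 → t ∈ Icc (-(M:ℤ)) M := by
    intro t ht
    have h1 := abs_le.mp (abs_le_of_sq_le_sq ht hx.le)
    rw [mem_Icc]
    constructor
    · have : (-(M:ℝ)) ≤ t := by linarith [h1.1]
      exact_mod_cast this
    · have : (t:ℝ) ≤ M := by linarith [h1.2]
      exact_mod_cast this
  unfold Bx
  rw [mem_product]
  exact ⟨key _ (by nlinarith [sq_nonneg (v.2:ℝ)]), key _ (by nlinarith [sq_nonneg (v.1:ℝ)])⟩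

lemma lattice_decomp {x:ℝ} (hx : 0 < x) {M:ℕ} (hM : x ≤ M) :
    (latticeCount x:ℝ)=(∑ v ∈ Bx M, Ff x (zc v))-2*Tx x := by
  classical
  set V := (Bx M).filter (fun v => (v.1:ℝ)^2+(v.2:ℝ)^2 ≤ x^2) with hV
  set f:ℤ × ℤ → ℝ := fun v => √(x^4-((v.1:ℝ)^2+(v.2:ℝ)^2)^2) with hf
  set B : Finset (Σ _:ℤ × ℤ, ℤ) := V.sigma (fun v => Icc (-⌊f v⌋) ⌊f v⌋) with hB
  have hf0 : ∀ v, 0 ≤ f v := fun v => sqrt_nonneg _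
  have hset : {p:ℤ × ℤ × ℤ | ((p.1:ℝ), (p.2.1:ℝ), (p.2.2:ℝ)) ∈ heisDil x '' cyganBall}
      = (fun s : (Σ _:ℤ × ℤ, ℤ) => ((s.1.1, s.1.2, s.2):ℤ × ℤ × ℤ)) '' (B : Set _) := by
    ext ⟨a, b, c⟩
    rw [mem_ofPred_eq, mem_dil hx]
    constructor
    · intro h
      have h2 : ((a:ℝ)^2+(b:ℝ)^2) ≤ x^2 := by
        have : ((a:ℝ)^2+(b:ℝ)^2)^2≤(x^2)^2 := by nlinarith [sq_nonneg (c:ℝ)]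
        exact (abs_le_of_sq_le_sq' this (by positivity)).2
      refine ⟨⟨(a, b), c⟩, ?_, rfl⟩
      rw [mem_coe, hB, Finset.mem_sigma]
      refine ⟨?_, ?_⟩
      · rw [hV, mem_filter]
        exact ⟨mem_Bx_of hM hx h2, h2⟩
      · have h3 : |(c:ℝ)| ≤ f (a, b) := by
          rw [hf]; apply abs_le_sqrt; simp only; linarith
        have h4 := abs_le.mp h3
        rw [mem_Icc]
        constructor
        · rw [neg_le, Int.le_floor]; push_cast; linarith
        · rw [Int.le_floor]; linarith
    · rintro ⟨⟨⟨a', b'⟩, c'⟩, hs, he⟩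
      simp only [Prod.mk.injEq] at he
      obtain ⟨rfl, rfl, rfl⟩ := he
      rw [mem_coe, hB, Finset.mem_sigma] at hs
      obtain ⟨h1, h2⟩ := hs
      rw [hV, mem_filter] at h1
      rw [mem_Icc, neg_le, Int.le_floor, Int.le_floor] at h2
      have h3 : |(c':ℝ)| ≤ f (a', b') := by
        rw [abs_le]; push_cast at h2; constructor <;> linarith [h2.1, h2.2]
      have h5 : ((a':ℝ)^2+(b':ℝ)^2)^2 ≤ x^4 := by
        have := h1.2
        simp only at this
        have h6 : 0≤(a':ℝ)^2+(b':ℝ)^2 := by positivity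
        calc ((a':ℝ)^2+(b':ℝ)^2)^2≤(x^2)^2 := by gcongr
          _ = x^4 := by ring
      have h4 : (c':ℝ)^2≤(f (a', b'))^2 := by
        rw [← sq_abs (c':ℝ)]
        gcongr
      rw [hf] at h4
      simp only at h4
      rw [sq_sqrt (by linarith)] at h4
      linarith
  have hcard : latticeCount x = ∑ v ∈ V, (Icc (-⌊f v⌋) ⌊f v⌋).card := by
    unfold latticeCount
    rw [hset, Set.ncard_image_of_injective, Set.ncard_coe_finset, hB, Finset.card_sigma]
    rintro ⟨⟨a, b⟩, c⟩ ⟨⟨a', b'⟩, c'⟩ h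
    simp only [Prod.mk.injEq] at h
    obtain ⟨rfl, rfl, rfl⟩ := h
    rfl
  have hS : ∑ v ∈ Bx M, Ff x (zc v) = ∑ v ∈ V, 2*f v := by
    rw [hV, sum_filter]
    refine sum_congr rfl fun v _ => ?_
    split_ifs with h
    · simp only [Ff, normSq_zc, hf]
    · simp only [Ff, normSq_zc]
      rw [sqrt_eq_zero_of_nonpos, mul_zero]
      push Not at h
      have : (x^2)^2≤((v.1:ℝ)^2+(v.2:ℝ)^2)^2 := by gcongr
      nlinarith
  have hT : Tx x = ∑ v ∈ V, sawtooth (f v) := by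
    unfold Tx
    rw [← Finset.sum_fiberwise_of_maps_to (g := fun v:ℤ × ℤ => (v.1^2+v.2^2).toNat)
      (t := Finset.range (⌊x^2⌋₊+1))]
    · refine sum_congr rfl fun m hm => ?_
      have hm' : (m:ℝ) ≤ x^2 := by
        rw [mem_range, Nat.lt_succ_iff, Nat.le_floor_iff (by positivity)] at hm
        exact hm
      have : ∀ v ∈ V.filter (fun v:ℤ × ℤ => (v.1^2+v.2^2).toNat = m),
          sawtooth (f v) = sawtooth (√(x^4-(m:ℝ)^2)) := by
        intro v hv
        have h := (Finset.mem_filter.mp hv).2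
        have h2 : v.1^2+v.2^2=(m:ℤ) := by
          rw [← h, Int.toNat_of_nonneg (by positivity)]
        have h3 : (v.1:ℝ)^2+(v.2:ℝ)^2=(m:ℝ) := by exact_mod_cast h2
        simp only [hf, h3]
      rw [sum_congr rfl this, sum_const, nsmul_eq_mul]
      congr 2
      unfold r2
      rw [← Set.ncard_coe_finset]
      congr 1
      ext v
      rw [mem_ofPred_eq, mem_coe, mem_filter, hV, mem_filter]
      constructor
      · intro h
        have h3 : (v.1:ℝ)^2+(v.2:ℝ)^2=(m:ℝ) := by exact_mod_cast h
        have h4 : (v.1:ℝ)^2+(v.2:ℝ)^2 ≤ x^2 := by rw [h3]; exact hm'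
        refine ⟨⟨mem_Bx_of hM hx h4, h4⟩, by rw [h]; simp⟩
      · rintro ⟨_, h⟩
        rw [← h, Int.toNat_of_nonneg (by positivity)]
    · intro v hv
      rw [hV, mem_filter] at hv
      rw [mem_range, Nat.lt_succ_iff, Nat.le_floor_iff (by positivity)]
      have h2 : (((v.1^2+v.2^2).toNat:ℤ):ℝ)=(v.1:ℝ)^2+(v.2:ℝ)^2 := by
        rw [Int.toNat_of_nonneg (by positivity)]; push_cast; rfl
      have h3 : (((v.1^2+v.2^2).toNat:ℕ):ℝ)=(v.1:ℝ)^2+(v.2:ℝ)^2 := by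
        rw [← h2]; norm_cast
      rw [h3]; exact hv.2
  rw [hS, hT, hcard, mul_sum, ← sum_sub_distrib, Nat.cast_sum]
  refine sum_congr rfl fun v _ => ?_
  rw [Int.card_Icc]
  have h0 : 0≤⌊f v⌋ := Int.floor_nonneg.mpr (hf0 v)
  have h2 : (((⌊f v⌋+1 - -⌊f v⌋).toNat:ℤ):ℝ)=2*⌊f v⌋+1 := by
    rw [Int.toNat_of_nonneg (by linarith)]; push_cast; ring
  have h3 : (((⌊f v⌋+1 - -⌊f v⌋).toNat:ℕ):ℝ)=2*⌊f v⌋+1 := by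
    rw [← h2]; norm_cast
  rw [h3]
  unfold sawtooth
  ring

/-- Fourier transform of the fibre length function. -/
def Fh (ρ:ℝ):ℝ := ∫ z:ℂ, Ff 1 z*cos (2*π*ρ*z.re)

lemma Ff_cont (y:ℝ) : Continuous (Ff y) := by
  unfold Ff
  have := Complex.continuous_normSq
  fun_prop

lemma Ff_nonneg (y:ℝ) (z:ℂ) : 0 ≤ Ff y z := by unfold Ff; positivity

lemma Ff_eq_zero {y:ℝ} {z:ℂ} (h : y^2 ≤ normSq z) : Ff y z=0 := by
  unfold Ff
  rw [sqrt_eq_zero_of_nonpos, mul_zero]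
  have : (y^2)^2≤(normSq z)^2 := by gcongr
  nlinarith

lemma Ff_compact (y:ℝ) : HasCompactSupport (Ff y) := by
  refine HasCompactSupport.intro (isCompact_closedBall (0:ℂ) |y|) fun z hz => ?_
  apply Ff_eq_zero
  rw [mem_closedBall_zero_iff, not_le] at hz
  rw [normSq_eq_norm_sq, ← sq_abs y]
  gcongr

lemma Ff_mul_int (y:ℝ) {g:ℂ → ℝ} (hg : Continuous g) : Integrable (fun z => Ff y z*g z) :=
  ((Ff_cont y).mul hg).integrable_of_hasCompactSupport ((Ff_compact y).mul_right)

lemma Ff_scale {y:ℝ} (hy : 0 < y) (z:ℂ) : Ff y (y • z) = y^2*Ff 1 z := by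
  unfold Ff
  have h : normSq (y • z) = y^2*normSq z := by
    simp [normSq_eq_norm_sq, mul_pow]
  rw [h]
  have : y^4-(y^2*normSq z)^2=(y^2)^2*(1^4-(normSq z)^2) := by
    ring
  rw [this, sqrt_mul (by positivity), sqrt_sq (by positivity)]
  ring

lemma Ff_norm_eq {y:ℝ} {z w:ℂ} (h : ‖z‖ = ‖w‖) : Ff y z = Ff y w := by
  unfold Ff
  rw [normSq_eq_norm_sq, normSq_eq_norm_sq, h]

lemma Ff_rot (κ:ℂ) (hκ : κ ≠ 0) :
    ∫ z:ℂ, Ff 1 z*cos (2*π*(κ.re*z.re+κ.im*z.im)) = Fh ‖κ‖ := by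
  -- z ↦ rotation
  have hn : ‖κ‖ ≠ 0 := norm_ne_zero_iff.mpr hκ
  set a : Circle := ⟨(starRingEnd ℂ κ) / ‖κ‖, by
    simp [Submonoid.unitSphere, hn]⟩ with ha
  have hmp := (rotation a).measurePreserving
  unfold Fh
  have := hmp.integral_comp (rotation a).toHomeomorph.measurableEmbedding
    (fun z:ℂ => Ff 1 z*cos (2*π * ‖κ‖ * z.re))
  rw [← this]
  refine integral_congr_ae (Eventually.of_forall fun z => ?_)
  simp only
  have h1 : rotation a z=(a:ℂ)*z := rotation_apply a z
  have h2 : ‖rotation a z‖ = ‖z‖ := (rotation a).norm_map z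
  rw [Ff_norm_eq h2, h1, ha]
  simp only
  congr 2
  have : ‖κ‖ * ((starRingEnd ℂ κ) / ‖κ‖ * z:ℂ).re = κ.re*z.re+κ.im*z.im := by
    have h3 : ((‖κ‖ * ((starRingEnd ℂ κ) / ‖κ‖ * z):ℂ)).re = κ.re*z.re+κ.im*z.im := by
      have : ((‖κ‖:ℂ)*((starRingEnd ℂ κ) / ‖κ‖ * z)) = starRingEnd ℂ κ*z := by
        have : (‖κ‖:ℂ) ≠ 0 := by exact_mod_cast hn
        field_simp
      rw [this]
      simp [Complex.mul_re]
    rw [← h3]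
    simp [Complex.mul_re]
  rw [mul_assoc (2*π), this]

lemma Ff_fourier {y:ℝ} (hy : 0 < y) (k₁ k₂:ℝ) :
    ∫ z:ℂ, Ff y z*cos (2*π*(k₁*z.re+k₂*z.im)) = y^4*Fh (y*√(k₁^2+k₂^2)) := by
  have h1 := Measure.integral_comp_smul (volume : Measure ℂ)
    (fun z:ℂ => Ff y z*cos (2*π*(k₁*z.re+k₂*z.im))) y
  rw [Complex.finrank_real_complex, abs_of_pos (by positivity), smul_eq_mul] at h1
  have h2 : ∫ z:ℂ, Ff y z*cos (2*π*(k₁*z.re+k₂*z.im))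
      = y^2*∫ z:ℂ, Ff y (y • z)*cos (2*π*(k₁*(y • z).re+k₂*(y • z).im)) := by
    rw [h1]; field_simp
  rw [h2]
  have h3 : ∫ z:ℂ, Ff y (y • z)*cos (2*π*(k₁*(y • z).re+k₂*(y • z).im))
      = y^2*Fh (y*√(k₁^2+k₂^2)) := by
    have hn : ‖(⟨y*k₁, y*k₂⟩:ℂ)‖ = y*√(k₁^2+k₂^2) := by
      rw [Complex.norm_def, Complex.normSq_mk]
      have : y*k₁*(y*k₁)+y*k₂*(y*k₂) = y^2*(k₁^2+k₂^2) := by ring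
      rw [this, sqrt_mul (by positivity), sqrt_sq hy.le]
    have h4 : Fh (y*√(k₁^2+k₂^2)) =
        ∫ z:ℂ, Ff 1 z*cos (2*π*(y*k₁*z.re+y*k₂*z.im)) := by
      by_cases h0 : (⟨y*k₁, y*k₂⟩:ℂ)=0
      · have h5 : y*k₁ = 0 := congrArg Complex.re h0
        have h6 : y*k₂ = 0 := congrArg Complex.im h0
        rw [← hn, h0, h5, h6]
        simp [Fh]
      · rw [← hn, ← Ff_rot _ h0]
    rw [h4, ← integral_const_mul]
    refine integral_congr_ae (Eventually.of_forall fun z => ?_)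
    simp only
    rw [Ff_scale hy]
    simp only [Complex.smul_re, Complex.smul_im, smul_eq_mul]
    rw [mul_assoc]
    congr 3
    ring_nf
  rw [h3]; ring

lemma Ff_fourier_prod {y:ℝ} (hy : 0 < y) (k₁ k₂:ℝ) :
    ∫ z:ℂ, Ff y z*(cos (2*π*k₁*z.re)*cos (2*π*k₂*z.im))
      = y^4*Fh (y*√(k₁^2+k₂^2)) := by
  have h1 := Ff_fourier hy k₁ k₂
  have h2 := Ff_fourier hy k₁ (-k₂)
  rw [neg_sq] at h2
  have hi1 : Integrable (fun z:ℂ => Ff y z*cos (2*π*(k₁*z.re+k₂*z.im))) :=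
    Ff_mul_int y (by fun_prop)
  have hi2 : Integrable (fun z:ℂ => Ff y z*cos (2*π*(k₁*z.re+(-k₂)*z.im))) :=
    Ff_mul_int y (by fun_prop)
  have h3 : ∫ z:ℂ, Ff y z*(cos (2*π*k₁*z.re)*cos (2*π*k₂*z.im))
     = ∫ z:ℂ, (1/2)*(Ff y z*cos (2*π*(k₁*z.re+k₂*z.im)) +
        Ff y z*cos (2*π*(k₁*z.re+(-k₂)*z.im))) := by
    refine integral_congr_ae (Eventually.of_forall fun z => ?_)
    simp only
    have e1 : 2*π*(k₁*z.re+k₂*z.im)=2*π*k₁*z.re+2*π*k₂*z.im := by ring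
    have e2 : 2*π*(k₁*z.re + -k₂*z.im)=2*π*k₁*z.re-2*π*k₂*z.im := by ring
    rw [e1, e2, cos_add, cos_sub]; ring
  rw [h3, integral_const_mul, integral_add hi1 hi2, h1, h2]; ring

lemma Ff_prod (s t:ℝ) : Ff 1 ⟨s, t⟩ = 2*√(1-(s^2+t^2)^2) := by
  unfold Ff
  rw [Complex.normSq_mk]
  congr 2; ring

lemma integral_complex (f:ℂ → ℝ) : ∫ z:ℂ, f z = ∫ p:ℝ × ℝ, f ⟨p.1, p.2⟩ := by
  rw [← Complex.volume_preserving_equiv_real_prod.symm.integral_comp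
    (Complex.measurableEquivRealProd.symm.measurableEmbedding)]
  rfl

lemma integrable_complex {f:ℂ → ℝ} (h : Integrable f) :
    Integrable (fun p:ℝ × ℝ => f ⟨p.1, p.2⟩) :=
  (Complex.volume_preserving_equiv_real_prod.symm.integrable_comp_emb
    (Complex.measurableEquivRealProd.symm.measurableEmbedding)).mpr h

lemma Fh_zero : Fh 0 = volB := by
  have h0 : Fh 0 = ∫ p:ℝ × ℝ, 2*√(1-(p.1^2+p.2^2)^2) := by
    unfold Fh
    rw [integral_complex]
    simp [Ff_prod]
  have hig : Integrable (fun p:ℝ × ℝ => 2*√(1-(p.1^2+p.2^2)^2)) := by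
    have := integrable_complex (Ff_mul_int 1 (g := fun _ => 1) continuous_const)
    simpa [Ff_prod] using this
  rw [h0, integral_eq_lintegral_of_nonneg_ae (Eventually.of_forall fun p => by positivity)
    hig.aestronglyMeasurable]
  unfold volB
  congr 1
  have hball : cyganBall = {u:ℝ × ℝ × ℝ | (u.1^2+u.2.1^2)^2+u.2.2^2≤1} := by
    ext ⟨a, b, c⟩
    have := mem_dil (x := 1) one_pos a b c
    rw [mem_ofPred_eq]
    have h2 : heisDil 1 = id := by
      funext u; simp [heisDil]
    rw [h2, Set.image_id] at this
    rw [this]; norm_num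
  have hmeas : MeasurableSet {q : (ℝ × ℝ) × ℝ | (q.1.1^2+q.1.2^2)^2+q.2^2≤1} := by
    refine measurableSet_le ?_ measurable_const
    fun_prop
  have hvp := (volume_preserving_prodAssoc (α₁ := ℝ) (β₁ := ℝ) (γ₁ := ℝ))
  have h1 : volume cyganBall = volume {q : (ℝ × ℝ) × ℝ | (q.1.1^2+q.1.2^2)^2+q.2^2≤1} := by
    rw [← hvp.measure_preimage_equiv cyganBall, hball]
    rfl
  have h2 : (volume : Measure ((ℝ × ℝ) × ℝ))=(volume : Measure (ℝ × ℝ)).prod (volume : Measure ℝ) := rfl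
  rw [h1, h2, Measure.prod_apply hmeas]
  refine lintegral_congr fun p => ?_
  have hs : (Prod.mk p ⁻¹' {q : (ℝ × ℝ) × ℝ | (q.1.1^2+q.1.2^2)^2+q.2^2≤1})
      = {c:ℝ | c^2≤1-(p.1^2+p.2^2)^2} := by
    ext c
    simp only [Set.mem_preimage, mem_ofPred_eq]
    constructor <;> intro h <;> linarith
  rw [hs]
  by_cases h : 0≤1-(p.1^2+p.2^2)^2
  · have : {c:ℝ | c^2≤1-(p.1^2+p.2^2)^2}
      = Set.Icc (-√(1-(p.1^2+p.2^2)^2)) (√(1-(p.1^2+p.2^2)^2)) := by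
      ext c
      rw [mem_ofPred_eq, Set.mem_Icc, Real.sq_le h]
    rw [this, volume_Icc]
    congr 1; ring
  · have : {c:ℝ | c^2≤1-(p.1^2+p.2^2)^2} = ∅ := by
      ext c
      rw [mem_ofPred_eq]
      push Not at h
      simp only [Set.mem_empty_iff_false, iff_false, not_le]
      nlinarith [sq_nonneg c]
    rw [this, measure_empty, sqrt_eq_zero_of_nonpos (by linarith)]
    simp

lemma cos_ibp {K K1 K2 K3:ℝ → ℝ} (h1 : ∀ s, HasDerivAt K (K1 s) s)
    (h2 : ∀ s, HasDerivAt K1 (K2 s) s) (h3 : ∀ s, HasDerivAt K2 (K3 s) s) (hc : Continuous K3)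
    {A B c:ℝ} (hK : K 1=0) (hK' : K (-1)=0) (hA : |K2 1| ≤ A) (hA' : |K2 (-1)| ≤ A)
    (hB : ∀ s ∈ Set.Icc (-1:ℝ) 1, |K3 s| ≤ B) (hcc : K1 1-K1 (-1) = c) {o:ℝ} (ho : 0 < o) :
    |(∫ s in (-1:ℝ)..1, K s*cos (o*s))-c*cos o/o^2| ≤ (2*A+2*B)/o^3 := by
  have hKc : Continuous K := continuous_iff_continuousAt.mpr fun s => (h1 s).continuousAt
  have hd : ∀ s:ℝ, HasDerivAt (fun s => K s*sin (o*s)/o+K1 s*cos (o*s)/o^2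
      - K2 s*sin (o*s)/o^3) (K s*cos (o*s)-K3 s*sin (o*s)/o^3) s := by
    intro s
    have ho' : HasDerivAt (fun s:ℝ => o*s) o s := by simpa using (hasDerivAt_id s).const_mul o
    have hs := ho'.sin
    have hco := ho'.cos
    have := ((((h1 s).mul hs).div_const o).add (((h2 s).mul hco).div_const (o^2))).sub
      (((h3 s).mul hs).div_const (o^3))
    refine this.congr_deriv ?_
    field_simp
    ring
  have hi := integral_eq_sub_of_hasDerivAt (a := (-1:ℝ)) (b := 1)
    (fun s _ => hd s) (Continuous.intervalIntegrable (by fun_prop) _ _)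
  rw [intervalIntegral.integral_sub (Continuous.intervalIntegrable (by fun_prop) _ _)
    (Continuous.intervalIntegrable (by fun_prop) _ _)] at hi
  have hbound : |∫ s in (-1:ℝ)..1, K3 s*sin (o*s)/o^3| ≤ 2*B/o^3 := by
    have := intervalIntegral.norm_integral_le_of_norm_le_const (a := (-1:ℝ)) (b := 1)
      (f := fun s => K3 s*sin (o*s)/o^3) (C := B/o^3) (by
        intro s hs
        rw [uIoc_of_le (by norm_num)] at hs
        rw [norm_eq_abs, abs_div, abs_mul, abs_of_pos (by positivity : 0 < o^3)]
        have := hB s ⟨hs.1.le, hs.2⟩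
        have h4 := abs_sin_le_one (o*s)
        gcongr
        calc |K3 s| * |sin (o*s)| ≤ |K3 s| * 1 := by gcongr
          _ ≤ B := by linarith)
    rw [norm_eq_abs] at this
    calc _≤_ := this
      _ = _ := by norm_num; ring
  have e : (∫ s in (-1:ℝ)..1, K s*cos (o*s))-c*cos o/o^2
      = (∫ s in (-1:ℝ)..1, K3 s*sin (o*s)/o^3)-(K2 1+K2 (-1))*sin o/o^3 := by
    have : (∫ s in (-1:ℝ)..1, K s*cos (o*s)) = _ := eq_add_of_sub_eq hi
    rw [this, hK, hK', ← hcc]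
    simp only [mul_one, mul_neg, cos_neg, sin_neg]
    ring
  rw [e]
  have h5 : |(K2 1+K2 (-1))*sin o/o^3| ≤ 2*A/o^3 := by
    rw [abs_div, abs_mul, abs_of_pos (by positivity : 0 < o^3)]
    have h4 := abs_sin_le_one o
    apply div_le_div_of_nonneg_right _ (by positivity)
    calc |K2 1+K2 (-1)| * |sin o| ≤ |K2 1+K2 (-1)| * 1 := by gcongr
      _ ≤ |K2 1| + |K2 (-1)| := by rw [mul_one]; exact abs_add_le _ _
      _≤2*A := by linarith
  calc _≤_ := abs_sub _ _
    _≤2*B/o^3+2*A/o^3 := by gcongr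
    _ = _ := by ring

lemma inner_asymp {a b:ℝ} (ha : 1 ≤ a) (hb : 0 ≤ b) (hab : a+b=2) {ρ:ℝ} (hρ : 0 < ρ) :
    |(∫ s in (-1:ℝ)..1, (1-s^2)*√(a+b*s^2)*cos (2*π*ρ*s))
      - (-(√2/π^2))*cos (2*π*ρ)/ρ^2| ≤ 100/ρ^3 := by
  set q:ℝ → ℝ := fun s => √(a+b*s^2) with hq
  have hpos : ∀ s:ℝ, 0 < a+b*s^2 := fun s => by positivity
  have hq1 : ∀ s, 1 ≤ q s := fun s => by
    rw [hq]; apply Real.one_le_sqrt.mpr; nlinarith [mul_nonneg hb (sq_nonneg s)]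
  have hq0 : ∀ s, q s ≠ 0 := fun s => by have := hq1 s; linarith
  have hqs : ∀ s, q s^2 = a+b*s^2 := fun s => sq_sqrt (hpos s).le
  have hqd : ∀ s, HasDerivAt q (b*s/q s) s := by
    intro s
    have h1 : HasDerivAt (fun s:ℝ => a+b*s^2) (b*(2*s)) s := by
      have := ((hasDerivAt_pow 2 s).const_mul b).const_add a
      simpa using this
    have := h1.sqrt (hpos s).ne'
    refine this.congr_deriv ?_
    have := hq0 s
    simp only [hq] at this ⊢
    field_simp
  have hqd2 : ∀ s, HasDerivAt (fun s => b*s/q s) (a*b/q s^3) s := by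
    intro s
    have h1 : HasDerivAt (fun s:ℝ => b*s) b s := by simpa using (hasDerivAt_id s).const_mul b
    have := h1.div (hqd s) (hq0 s)
    refine this.congr_deriv ?_
    have h0 := hq0 s
    have h2 := hqs s
    field_simp
    rw [h2]; ring
  have hqd3 : ∀ s, HasDerivAt (fun s => a*b/q s^3) (-3*a*b^2*s/q s^5) s := by
    intro s
    have h1 := ((hqd s).pow 3)
    have := (hasDerivAt_const s (a*b)).div h1 (pow_ne_zero 3 (hq0 s))
    refine this.congr_deriv ?_
    have h0 := hq0 s
    simp only [Pi.pow_apply]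
    field_simp
    norm_num
    ring
  have hqc : Continuous q := continuous_iff_continuousAt.mpr fun s => (hqd s).continuousAt
  have hP : ∀ s:ℝ, HasDerivAt (fun s:ℝ => 1-s^2) (-2*s) s := by
    intro s
    simpa using (hasDerivAt_pow 2 s).const_sub 1
  have hS : ∀ s:ℝ, HasDerivAt (fun s:ℝ => -2*s) (-2) s := by
    intro s
    simpa using (hasDerivAt_id s).const_mul (-2)
  have key := cos_ibp (K := fun s => (1-s^2)*q s)
    (K1 := fun s => -2*s*q s+(1-s^2)*(b*s/q s))
    (K2 := fun s => -2*q s+2*(-2*s*(b*s/q s))+(1-s^2)*(a*b/q s^3))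
    (K3 := fun s => 3*(-2*(b*s/q s))+3*(-2*s*(a*b/q s^3))
      + (1-s^2)*(-3*a*b^2*s/q s^5))
    (A := 12) (B := 100) (c :=-4*√2) (fun s => (hP s).mul (hqd s))
    (fun s => by
      refine (((hS s).mul (hqd s)).add ((hP s).mul (hqd2 s))).congr_deriv ?_
      ring)
    (fun s => by
      refine ((((hqd s).const_mul (-2)).add (((hS s).mul (hqd2 s)).const_mul 2)).add
        ((hP s).mul (hqd3 s))).congr_deriv ?_
      ring)
    (by
      have h3 : ∀ s, q s^3 ≠ 0 := fun s => pow_ne_zero 3 (hq0 s)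
      have h5 : ∀ s, q s^5 ≠ 0 := fun s => pow_ne_zero 5 (hq0 s)
      fun_prop (disch := assumption))
    (by simp) (by simp) ?_ ?_ ?_ ?_ (o := 2*π*ρ) (by positivity)
  · have e : (-4*√2)*cos (2*π*ρ)/(2*π*ρ)^2=(-(√2/π^2))*cos (2*π*ρ)/ρ^2 := by
      field_simp; ring
    rw [e] at key
    refine key.trans ?_
    have hpi : (6:ℝ)≤2*π := by linarith [pi_gt_three]
    have : (6:ℝ)^3*ρ^3≤(2*π*ρ)^3 := by rw [mul_pow]; gcongr
    calc _≤(2*12+2*100)/((6:ℝ)^3*ρ^3) := by gcongr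
      _≤100/ρ^3 := by
        rw [div_le_div_iff₀ (by positivity) (by positivity)]
        have : 0 < ρ^3 := by positivity
        nlinarith
  · have h2 : q 1 = √2 := by simp only [hq]; congr 1; linarith
    have : |(-2*q 1+2*(-2*1*(b*1/q 1))+(1-1^2)*(a*b/q 1^3))| ≤ 12 := by
      have hb1 : 0 ≤ b/q 1 := by have := hq1 1; positivity
      have hb2 : b/q 1≤1 := by rw [div_le_one (by linarith [hq1 1])]; linarith [hq1 1]
      have h3 : q 1≤2 := by rw [h2, sqrt_le_left (by norm_num)]; norm_num
      rw [abs_le]; constructor <;> ring_nf <;> ring_nf at hb1 hb2 <;> linarith [hq1 1]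
    simpa using this
  · have h2 : q (-1) = √2 := by simp only [hq]; congr 1; linarith
    have : |(-2*q (-1)+2*(-2*(-1)*(b*(-1)/q (-1)))+(1-(-1)^2)*(a*b/q (-1)^3))| ≤ 12 := by
      have hb1 : 0 ≤ b/q (-1) := by have := hq1 (-1); positivity
      have hb2 : b/q (-1)≤1 := by rw [div_le_one (by linarith [hq1 (-1)])]; linarith [hq1 (-1)]
      have h3 : q (-1)≤2 := by rw [h2, sqrt_le_left (by norm_num)]; norm_num
      rw [abs_le]; constructor <;> ring_nf <;> ring_nf at hb1 hb2 <;> linarith [hq1 (-1)]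
    simpa using this
  · intro s hs
    have hs1 : |s| ≤ 1 := abs_le.mpr hs
    have hq1' := hq1 s
    have hqa : |q s| = q s := abs_of_pos (by linarith)
    have hb1 : b≤1 := by linarith
    have ha2 : a≤2 := by linarith
    have hs2 : |1-s^2| ≤ 1 := by
      have : s^2≤1 := by rw [← sq_abs]; nlinarith [abs_nonneg s]
      rw [abs_le]; constructor <;> nlinarith [sq_nonneg s]
    have t1 : |b*s/q s| ≤ 1 := by
      rw [abs_div, abs_mul, hqa, abs_of_nonneg hb, div_le_one (by linarith)]
      nlinarith [abs_nonneg s]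
    have t2 : |a*b/q s^3| ≤ 2 := by
      rw [abs_div, abs_mul, abs_of_nonneg hb, abs_of_nonneg (by linarith), abs_pow, hqa,
        div_le_iff₀ (by positivity)]
      have : 1 ≤ q s^3 := one_le_pow₀ hq1'
      nlinarith
    have t3 : |-3*a*b^2*s/q s^5| ≤ 6 := by
      have e : |-3*a*b^2*s| ≤ 6 := by
        rw [abs_mul, abs_mul, abs_mul, abs_of_nonneg (by linarith : 0 ≤ a), abs_of_nonneg (sq_nonneg b)]
        norm_num
        have : b^2≤1 := by nlinarith
        calc 3*a*b^2 * |s| ≤ 3*2*1*1 := by gcongr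
          _ = 6 := by norm_num
      rw [abs_div, abs_pow, hqa, div_le_iff₀ (by positivity)]
      have : 1 ≤ q s^5 := one_le_pow₀ hq1'
      nlinarith
    have u1 : |3*(-2*(b*s/q s))| ≤ 6 := by
      rw [abs_mul, abs_mul]; norm_num; linarith
    have u2 : |3*(-2*s*(a*b/q s^3))| ≤ 12 := by
      rw [abs_mul, abs_mul, abs_mul]; norm_num
      have : |s| * |a*b/q s^3| ≤ 1*2 := by gcongr
      linarith
    have u3 : |(1-s^2)*(-3*a*b^2*s/q s^5)| ≤ 6 := by
      rw [abs_mul]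
      calc _≤1*(6:ℝ) := by gcongr
        _ = 6 := by norm_num
    refine (abs_add_le _ _).trans ?_
    have := abs_add_le (3*(-2*(b*s/q s))) (3*(-2*s*(a*b/q s^3)))
    linarith
  · have h2 : q (-1) = √2 := by simp only [hq]; congr 1; linarith
    have h3 : q 1 = √2 := by simp only [hq]; congr 1; linarith
    simp only [h2, h3]; ring

lemma fibre_int {s:ℝ} (hs : s ∈ Ioo (-1:ℝ) 1) :
    ∫ t:ℝ, 2*√(1-(s^2+t^2)^2) =
      ∫ τ in (-1:ℝ)..1, 2*√(1-τ^2)*((1-s^2)*√((1+τ^2)+(1-τ^2)*s^2)) := by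
  have hs2 : 0 < 1-s^2 := by nlinarith [hs.1, hs.2]
  set c := √(1-s^2) with hc
  have hc0 : 0 < c := Real.sqrt_pos.mpr hs2
  have hcs : c^2=1-s^2 := sq_sqrt hs2.le
  have h1 := Measure.integral_comp_mul_left (fun t:ℝ => 2*√(1-(s^2+t^2)^2)) c
  rw [abs_of_pos (by positivity), smul_eq_mul] at h1
  have h2 : ∫ t:ℝ, 2*√(1-(s^2+t^2)^2) =
      c*∫ τ:ℝ, 2*√(1-(s^2+(c*τ)^2)^2) := by
    rw [h1]; field_simp
  rw [h2, ← integral_const_mul]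
  have h3 : ∀ τ:ℝ, c*(2*√(1-(s^2+(c*τ)^2)^2)) =
      2*√(1-τ^2)*((1-s^2)*√((1+τ^2)+(1-τ^2)*s^2)) := by
    intro τ
    have hp : 0≤(1+τ^2)+(1-τ^2)*s^2 := by nlinarith [sq_nonneg τ, sq_nonneg s, mul_nonneg (sq_nonneg τ) hs2.le]
    have e : 1-(s^2+(c*τ)^2)^2 =
        ((1-s^2)*(1-τ^2))*((1+τ^2)+(1-τ^2)*s^2) := by
      rw [mul_pow, hcs]; ring
    rw [e, Real.sqrt_mul' _ hp, sqrt_mul hs2.le, ← hc, ← hcs]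
    ring
  simp_rw [h3]
  rw [integral_of_le (by norm_num), ← integral_Icc_eq_integral_Ioc]
  symm
  apply setIntegral_eq_integral_of_forall_compl_eq_zero
  intro τ hτ
  have : √(1-τ^2)=0 := by
    apply sqrt_eq_zero_of_nonpos
    rw [Set.mem_Icc, not_and_or, not_le, not_le] at hτ
    rcases hτ with h | h <;> nlinarith
  rw [this]; ring

lemma Fh_eq (ρ:ℝ) : Fh ρ = ∫ τ in (-1:ℝ)..1, 2*√(1-τ^2) *
    ∫ s in (-1:ℝ)..1, (1-s^2)*√((1+τ^2)+(1-τ^2)*s^2)*cos (2*π*ρ*s) := by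
  have hig : Integrable (fun p:ℝ × ℝ => 2*√(1-(p.1^2+p.2^2)^2)*cos (2*π*ρ*p.1)) := by
    have := integrable_complex (Ff_mul_int 1 (g := fun z => cos (2*π*ρ*z.re)) (by fun_prop))
    simpa [Ff_prod] using this
  have h0 : Fh ρ = ∫ s:ℝ, (∫ t:ℝ, 2*√(1-(s^2+t^2)^2))*cos (2*π*ρ*s) := by
    unfold Fh
    rw [integral_complex]
    simp only [Ff_prod]
    rw [Measure.volume_eq_prod, integral_prod _ hig]
    simp_rw [integral_mul_const]
  have h1 : Fh ρ = ∫ s in (-1:ℝ)..1, (∫ t:ℝ, 2*√(1-(s^2+t^2)^2))*cos (2*π*ρ*s) := by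
    rw [h0, integral_of_le (by norm_num), ← integral_Icc_eq_integral_Ioc]
    symm
    apply setIntegral_eq_integral_of_forall_compl_eq_zero
    intro s hs
    rw [Set.mem_Icc, not_and_or, not_le, not_le] at hs
    have hs1 : 1 ≤ s^2 := by rcases hs with h | h <;> nlinarith
    have : ∀ t:ℝ, 2*√(1-(s^2+t^2)^2)=0 := by
      intro t
      rw [sqrt_eq_zero_of_nonpos, mul_zero]
      nlinarith [sq_nonneg t]
    simp [this]
  have h2 : Fh ρ = ∫ s in (-1:ℝ)..1, ∫ τ in (-1:ℝ)..1, 2*√(1-τ^2) *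
      ((1-s^2)*√((1+τ^2)+(1-τ^2)*s^2)*cos (2*π*ρ*s)) := by
    rw [h1, integral_of_le (by norm_num), integral_of_le (by norm_num),
      integral_Ioc_eq_integral_Ioo, integral_Ioc_eq_integral_Ioo]
    refine setIntegral_congr_fun measurableSet_Ioo fun s hs => ?_
    rw [fibre_int hs, ← intervalIntegral.integral_mul_const]
    congr 1
    ext τ; ring
  rw [h2, intervalIntegral_intervalIntegral_swap]
  · congr 1
    ext τ
    rw [intervalIntegral.integral_const_mul]
  · have hc : Continuous (Function.uncurry (fun s τ:ℝ => 2*√(1-τ^2) *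
      ((1-s^2)*√((1+τ^2)+(1-τ^2)*s^2)*cos (2*π*ρ*s)))) := by
      unfold Function.uncurry
      fun_prop
    refine (hc.continuousOn.integrableOn_compact
      (isCompact_Icc.prod isCompact_Icc : IsCompact (Set.Icc (-1:ℝ) 1 ×ˢ Set.Icc (-1:ℝ) 1))).mono_set ?_
    rw [uIoc_of_le (by norm_num)]
    exact Set.prod_mono Set.Ioc_subset_Icc_self Set.Ioc_subset_Icc_self

lemma Fh_asymp {ρ:ℝ} (hρ : 0 < ρ) :
    |Fh ρ-(-(√2/π))*cos (2*π*ρ)/ρ^2| ≤ 400/ρ^3 := by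
  have hc2 : ∀ τ:ℝ, Continuous fun s:ℝ => (1-s^2)*√((1+τ^2)+(1-τ^2)*s^2)*cos (2*π*ρ*s) :=
    fun τ => by fun_prop
  have hcJ : Continuous fun τ:ℝ => 2*√(1-τ^2) *
    ∫ s in (-1:ℝ)..1, (1-s^2)*√((1+τ^2)+(1-τ^2)*s^2)*cos (2*π*ρ*s) := by
    refine Continuous.mul (by fun_prop) ?_
    apply intervalIntegral.continuous_parametric_intervalIntegral_of_continuous'
    unfold Function.uncurry
    fun_prop
  have e : (-(√2/π))*cos (2*π*ρ)/ρ^2 =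
      ∫ τ in (-1:ℝ)..1, 2*√(1-τ^2)*((-(√2/π^2))*cos (2*π*ρ)/ρ^2) := by
    rw [intervalIntegral.integral_mul_const, intervalIntegral.integral_const_mul,
      integral_sqrt_one_sub_sq]
    field_simp
  rw [Fh_eq, e, ← intervalIntegral.integral_sub (hcJ.intervalIntegrable _ _)
    (Continuous.intervalIntegrable (by fun_prop) _ _)]
  have := intervalIntegral.norm_integral_le_of_norm_le_const (a := (-1:ℝ)) (b := 1)
      (f := fun τ => 2*√(1-τ^2) *
    (∫ s in (-1:ℝ)..1, (1-s^2)*√((1+τ^2)+(1-τ^2)*s^2)*cos (2*π*ρ*s)) -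
      2*√(1-τ^2)*((-(√2/π^2))*cos (2*π*ρ)/ρ^2)) (C := 2*(100/ρ^3)) (by
        intro τ hτ
        rw [uIoc_of_le (by norm_num)] at hτ
        have hin := inner_asymp (a := 1+τ^2) (b := 1-τ^2) (by nlinarith) (by nlinarith [hτ.1, hτ.2])
          (by ring) hρ
        rw [← mul_sub, norm_eq_abs, abs_mul]
        have h1 : |2*√(1-τ^2)| ≤ 2 := by
          rw [abs_of_nonneg (by positivity)]
          have : √(1-τ^2)≤1 := by
            rw [sqrt_le_left (by norm_num)]; nlinarith
          linarith
        gcongr)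
  rw [norm_eq_abs] at this
  refine this.trans ?_
  norm_num
  apply le_of_eq
  ring

/-- Triangle kernel. -/
def Lr (r u:ℝ):ℝ := max 0 (r - |u|)/r^2

/-- Periodised triangle kernel. -/
def per (r a:ℝ):ℝ := Lr r (a-round a)

/-- Fourier weights of the triangle kernel. -/
def wh (r:ℝ) (k:ℤ):ℝ := sinc (π*k*r)^2

lemma wh_nonneg (r:ℝ) (k:ℤ) : 0 ≤ wh r k := sq_nonneg _

lemma wh_le_one (r:ℝ) (k:ℤ) : wh r k≤1 := by
  unfold wh
  have := abs_sinc_le_one (π*k*r)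
  rw [← sq_abs]
  nlinarith [abs_nonneg (sinc (π*k*r))]

lemma wh_zero (r:ℝ) : wh r 0=1 := by simp [wh]

lemma wh_neg (r:ℝ) (k:ℤ) : wh r (-k) = wh r k := by
  unfold wh; push_cast
  rw [mul_neg, neg_mul, sinc_neg]

lemma B2_sum {x:ℝ} (hx : x ∈ Set.Icc (0:ℝ) 1) :
    HasSum (fun n:ℕ => 1/(n:ℝ)^2*cos (2*π*n*x)) (π^2*(x^2-x+1/6)) := by
  have h := hasSum_one_div_nat_pow_mul_cos (k := 1) one_ne_zero hx
  have e : (Polynomial.map (algebraMap ℚ ℝ) (Polynomial.bernoulli (2*1))).eval x = x^2-x+1/6 := by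
    simp [Polynomial.bernoulli, sum_range_succ, bernoulli_two, bernoulli_one, bernoulli_zero,
      Nat.choose]
    ring
  rw [e] at h
  convert h using 1
  rw [show Nat.factorial (2*1)=2 from rfl]
  push_cast
  ring

lemma per_sum_aux {r a:ℝ} (hr : 0 < r) (hr2 : r≤1/2) (ha : 0 ≤ a) (ha2 : a≤1/2) :
    HasSum (fun n:ℕ => wh r n*cos (2*π*n*a)) (1+(Lr r a-1)/2) := by
  have h1 := B2_sum (x := a) ⟨ha, by linarith⟩
  have h2 := B2_sum (x := a+r) ⟨by linarith, by linarith⟩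
  have h3 := B2_sum (x := |a-r|) ⟨abs_nonneg _, by rw [abs_le]; constructor <;> linarith⟩
  have h4 := ((h1.sub (h2.mul_left (1/2))).sub (h3.mul_left (1/2))).mul_left (1/(2*π^2*r^2))
  have h5 := (hasSum_ite_eq (0:ℕ) (1:ℝ)).add h4
  convert h5 using 1
  · funext n
    by_cases hn : n=0
    · subst hn; simp [wh]
    · have hn' : (n:ℝ) ≠ 0 := by exact_mod_cast hn
      simp only [hn, if_false, wh, Int.cast_natCast]
      rw [sinc_of_ne_zero (by positivity), div_pow, sin_sq_eq_half_sub]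
      have e1 : cos (2*π*n * |a-r|) = cos (2*π*n*(a-r)) := by
        rw [← cos_abs (2*π*n*(a-r)), abs_mul, abs_of_nonneg (by positivity : 0≤2*π*(n:ℝ))]
      rw [e1, mul_add (2*π*n), mul_sub (2*π*n), cos_add, cos_sub]
      have e2 : 2*(π*n*r)=2*π*n*r := by ring
      rw [e2]
      field_simp
      ring
  · congr 1
    unfold Lr
    rw [abs_of_nonneg ha]
    rcases le_total a r with h | h
    · rw [abs_of_nonpos (by linarith), max_eq_right (by linarith)]
      field_simp
      ring
    · rw [abs_of_nonneg (by linarith), max_eq_left (by linarith)]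
      field_simp
      ring

lemma cos_round (n:ℤ) (a:ℝ) : cos (2*π*n * |a-round a|) = cos (2*π*n*a) := by
  have h : cos (2*π*n * |a-round a|) = cos (2*π*n*(a-round a)) := by
    rcases abs_choice (a-round a) with h | h <;> rw [h]
    rw [mul_neg, cos_neg]
  rw [h]
  have : 2*π*n*(a-round a)=2*π*n*a-((n*round a:ℤ):ℝ)*(2*π) := by
    push_cast; ring
  rw [this, cos_sub_int_mul_two_pi]

lemma per_sum {r:ℝ} (hr : 0 < r) (hr2 : r≤1/2) (a:ℝ) :
    HasSum (fun k:ℤ => wh r k*cos (2*π*k*a)) (per r a) := by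
  have h := per_sum_aux hr hr2 (abs_nonneg (a-round a)) (abs_sub_round a)
  have h1 : HasSum (fun n:ℕ => wh r ((n:ℤ))*cos (2*π*((n:ℤ):ℝ)*a)) (1+(Lr r |a-round a| - 1)/2) := by
    convert h using 2 with n
    rw [← cos_round]; push_cast; rfl
  have h2 : HasSum (fun n:ℕ => wh r (-(n:ℤ))*cos (2*π*((-(n:ℤ):ℤ):ℝ)*a)) (1+(Lr r |a-round a| - 1)/2) := by
    convert h1 using 2 with n
    rw [wh_neg]
    push_cast
    rw [mul_neg, neg_mul, cos_neg]
  have h3 := HasSum.of_nat_of_neg (f := fun k:ℤ => wh r k*cos (2*π*k*a)) h1 h2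
  have e : per r a=1+(Lr r |a-round a| - 1)/2+(1+(Lr r |a-round a| - 1)/2)
      - wh r 0*cos (2*π*((0:ℤ):ℝ)*a) := by
    rw [Int.cast_zero, mul_zero, zero_mul, cos_zero, mul_one, wh_zero]
    unfold per Lr
    rw [abs_abs]; ring
  rw [e]
  exact h3

lemma wh_summable {r:ℝ} (hr : 0 < r) (hr2 : r≤1/2) : Summable (wh r) := by
  have := (per_sum hr hr2 0).summable
  simpa using this

lemma one_sub_wh {r:ℝ} (k:ℤ) : 1-wh r k≤2*(π * |(k:ℝ)| * |r|)^2 := by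
  unfold wh
  have h1 : 1-sinc (π*k*r)≤(π*k*r)^2 := by
    have : ∀ x:ℝ, 0 ≤ x → 1-sinc x ≤ x^2 := by
      intro x hx
      rcases hx.eq_or_lt with h | h
      · subst h; simp
      rcases le_total x 1 with h1 | h1
      · rw [sinc_of_ne_zero h.ne']
        have h9 : x-x^3/6 < sin x := sin_gt_sub_cube h
        have : x-x^3/4 ≤ sin x := by
          have : 0 < x^3 := by positivity
          linarith
        have h3 : 1-x^2/4 ≤ sin x/x := by
          rw [le_div_iff₀ h]; nlinarith
        nlinarith [sq_nonneg x]
      · have h2 := neg_abs_le (sinc x)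
        rw [sinc_of_ne_zero h.ne']
        have h3 : -1/x ≤ sin x/x := by gcongr; exact neg_one_le_sin x
        rcases le_total (sqrt 2) x with h4 | h4
        · have h5 : 2 ≤ x^2 := by
            have := sq_sqrt (show (0:ℝ)≤2 by norm_num)
            nlinarith [sqrt_nonneg 2]
          have h6 : -1 ≤ -1/x := by rw [le_div_iff₀ h]; linarith
          linarith
        · have : 0 ≤ sin x := by
            apply sin_nonneg_of_nonneg_of_le_pi hx
            have : √2≤2 := by rw [sqrt_le_left (by norm_num)]; norm_num
            linarith [pi_gt_three]
          have h7 : 0 ≤ sin x/x := by positivity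
          nlinarith
    rcases le_total 0 (π*k*r) with h | h
    · exact this _ h
    · have := this (-(π*k*r)) (by linarith)
      rw [sinc_neg, neg_sq] at this
      exact this
  have h2 : sinc (π*k*r)≤1 := (abs_le.mp (abs_sinc_le_one _)).2
  have e : (π * |(k:ℝ)| * |r|)^2=(π*k*r)^2 := by
    rw [mul_pow, mul_pow, sq_abs, sq_abs]; ring
  rw [e]
  nlinarith [neg_one_le_sinc (π*k*r)]

lemma per_cont {r:ℝ} (hr : 0 < r) (hr2 : r≤1/2) : Continuous (per r) := by
  have h : per r = fun a => ∑' k:ℤ, wh r k*cos (2*π*k*a) := by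
    funext a; exact (per_sum hr hr2 a).tsum_eq.symm
  rw [h]
  refine continuous_tsum (fun k => by fun_prop) (wh_summable hr hr2) fun k a => ?_
  rw [norm_eq_abs, abs_mul, abs_of_nonneg (wh_nonneg r k)]
  have := abs_cos_le_one (2*π*k*a)
  nlinarith [wh_nonneg r k]

lemma wh2_summable {r:ℝ} (hr : 0 < r) (hr2 : r≤1/2) :
    Summable (fun k:ℤ × ℤ => wh r k.1*wh r k.2) :=
  (wh_summable hr hr2).mul_of_nonneg (wh_summable hr hr2) (fun k => wh_nonneg r k) (fun k => wh_nonneg r k)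

lemma PP_int {r y:ℝ} (hr : 0 < r) (hr2 : r≤1/2) (hy : 0 < y) :
    HasSum (fun k:ℤ × ℤ => wh r k.1*wh r k.2*(y^4*Fh (y*√((k.1:ℝ)^2+(k.2:ℝ)^2))))
      (∫ z:ℂ, Ff y z*(per r z.re*per r z.im)) := by
  set G:ℤ × ℤ → ℂ → ℝ := fun k z => wh r k.1*wh r k.2 *
    (Ff y z*(cos (2*π*k.1*z.re)*cos (2*π*k.2*z.im))) with hG
  have hig : ∀ k, Integrable (G k) := fun k =>
    (Ff_mul_int y (by fun_prop)).const_mul _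
  have hF : Integrable (Ff y) := by
    simpa using Ff_mul_int y (g := fun _ => 1) continuous_const
  have hle : ∀ k z, ‖G k z‖ ≤ wh r k.1*wh r k.2*Ff y z := by
    intro k z
    simp only [hG]
    have h0 := mul_nonneg (wh_nonneg r k.1) (wh_nonneg r k.2)
    rw [norm_eq_abs, abs_mul, abs_of_nonneg h0, abs_mul (Ff y z), abs_of_nonneg (Ff_nonneg y z), abs_mul]
    have h1 := abs_cos_le_one (2*π*k.1*z.re)
    have h2 := abs_cos_le_one (2*π*k.2*z.im)
    have h3 := Ff_nonneg y z
    have : |cos (2*π*k.1*z.re)| * |cos (2*π*k.2*z.im)| ≤ 1 :=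
      mul_le_one₀ h1 (abs_nonneg _) h2
    calc _ ≤ wh r k.1*wh r k.2*(Ff y z*1) := by gcongr
      _ = _ := by ring
  have hsum : Summable fun k => ∫ z, ‖G k z‖ := by
    refine Summable.of_nonneg_of_le (fun k => integral_nonneg fun z => norm_nonneg _) (fun k => ?_)
      ((wh2_summable hr hr2).mul_right (∫ z, Ff y z))
    rw [← integral_const_mul]
    exact integral_mono (hig k).norm (hF.const_mul _) (hle k)
  have h := hasSum_integral_of_summable_integral_norm hig hsum
  have e1 : ∀ k, ∫ z, G k z = wh r k.1*wh r k.2*(y^4*Fh (y*√((k.1:ℝ)^2+(k.2:ℝ)^2))) := by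
    intro k
    simp only [hG]
    rw [integral_const_mul, Ff_fourier_prod hy]
  have e2 : ∀ z, ∑' k, G k z = Ff y z*(per r z.re*per r z.im) := by
    intro z
    have hs : Summable fun k:ℤ × ℤ => (wh r k.1*cos (2*π*k.1*z.re))*(wh r k.2*cos (2*π*k.2*z.im)) := by
      refine Summable.of_norm_bounded (wh2_summable hr hr2) fun k => ?_
      have h1 := abs_cos_le_one (2*π*k.1*z.re)
      have h2 := abs_cos_le_one (2*π*k.2*z.im)
      rw [norm_mul, norm_eq_abs, norm_eq_abs, abs_mul, abs_mul,
        abs_of_nonneg (wh_nonneg r k.1), abs_of_nonneg (wh_nonneg r k.2)]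
      have := wh_nonneg r k.1
      have := wh_nonneg r k.2
      calc _≤(wh r k.1*1)*(wh r k.2*1) := by gcongr
        _ = _ := by ring
    have := ((per_sum hr hr2 z.re).mul (per_sum hr hr2 z.im) hs).mul_left (Ff y z)
    rw [← this.tsum_eq]
    congr 1
    funext k
    simp only [hG]
    ring
  simp_rw [e1, e2] at h
  exact h

lemma Ff_mono {y h:ℝ} (hy : 0 ≤ y) (hh : 0 ≤ h) {v w:ℂ} (hvw : ‖v‖ ≤ ‖w‖ + h) :
    Ff y w ≤ Ff (y+h) v := by
  rcases le_total y ‖w‖ with h1 | h1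
  · rw [Ff_eq_zero]
    · exact Ff_nonneg _ _
    · rw [normSq_eq_norm_sq]; gcongr
  · unfold Ff
    rw [normSq_eq_norm_sq, normSq_eq_norm_sq]
    gcongr 2*√?_
    have hw := norm_nonneg w
    have h2 : ‖v‖ ^ 4≤(‖w‖ + h)^4 := by gcongr
    have h3 : (‖w‖ + h)^4 - ‖w‖ ^ 4≤(y+h)^4-y^4 := by
      have e : ∀ t:ℝ, (t+h)^4-t^4=4*h*t^3+6*h^2*t^2+4*h^3*t+h^4 := by
        intro t; ring
      rw [e, e]
      gcongr
    have e4 : ∀ t:ℝ, (t^2)^2 = t^4 := fun t => by ring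
    rw [e4, e4]
    linarith

lemma Lr_nonneg (r u:ℝ) : 0 ≤ Lr r u := by unfold Lr; positivity

lemma Lr_cont (r:ℝ) : Continuous (Lr r) := by unfold Lr; fun_prop

lemma Lr_zero {r u:ℝ} (h : r ≤ |u|) : Lr r u=0 := by
  unfold Lr; rw [max_eq_left (by linarith)]; simp

lemma Lr_integrable (r a:ℝ) : Integrable (fun u => Lr r (u-a)) := by
  refine ((Lr_cont r).comp (continuous_sub_right a)).integrable_of_hasCompactSupport ?_
  refine HasCompactSupport.intro (isCompact_closedBall a r) fun u hu => ?_
  apply Lr_zero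
  rw [Metric.mem_closedBall, dist_eq, not_le] at hu
  exact hu.le

lemma Lr_int {r:ℝ} (hr : 0 < r) (a:ℝ) : ∫ u, Lr r (u-a)=1 := by
  rw [integral_sub_right_eq_self (fun u => Lr r u) a]
  have h1 : ∫ u, Lr r u = ∫ u in (-r)..r, Lr r u := by
    rw [integral_of_le (by linarith), ← integral_Icc_eq_integral_Ioc]
    symm
    apply setIntegral_eq_integral_of_forall_compl_eq_zero
    intro u hu
    apply Lr_zero
    by_contra hc
    push Not at hc
    exact hu (by have := abs_lt.mp hc; exact ⟨this.1.le, this.2.le⟩)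
  rw [h1, ← integral_add_adjacent_intervals (b := 0)
    ((Lr_cont r).intervalIntegrable _ _) ((Lr_cont r).intervalIntegrable _ _)]
  have h2 : ∫ u in (-r)..0, Lr r u = ∫ u in (-r)..0, (r+u)/r^2 := by
    apply integral_congr
    intro u hu
    rw [uIcc_of_le (by linarith)] at hu
    unfold Lr
    simp only
    rw [abs_of_nonpos hu.2, max_eq_right (by linarith [hu.1]), sub_neg_eq_add]
  have h3 : ∫ u in (0)..r, Lr r u = ∫ u in (0)..r, (r-u)/r^2 := by
    apply integral_congr
    intro u hu
    rw [uIcc_of_le (by linarith)] at hu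
    unfold Lr
    simp only
    rw [abs_of_nonneg hu.1, max_eq_right (by linarith [hu.2])]
  rw [h2, h3, intervalIntegral.integral_div, intervalIntegral.integral_div,
    intervalIntegral.integral_add (by simp) (by simp), intervalIntegral.integral_sub (by simp) (by simp)]
  simp only [intervalIntegral.integral_const, integral_id, smul_eq_mul]
  field_simp
  ring

lemma sum_Lr {r:ℝ} (hr2 : r≤1/2) (s : Finset ℤ) (a:ℝ) :
    ∑ n ∈ s, Lr r (a-n) = if round a ∈ s then per r a else 0 := by
  classical
  have hper : per r a = Lr r (a-round a) := rfl
  rw [hper, ← Finset.sum_ite_eq' s (round a) (fun n => Lr r (a-n))]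
  · refine sum_congr rfl fun n _ => ?_
    split_ifs with h
    · rw [h]
    · apply Lr_zero
      by_contra hc
      push Not at hc
      apply h
      have h1 : |a-n| < 1/2 := by linarith
      rw [abs_lt] at h1
      symm
      rw [round_eq, Int.floor_eq_iff]
      constructor <;> linarith [h1.1, h1.2]

/-- Two dimensional kernel. -/
def Kv (r:ℝ) (v:ℤ × ℤ) (z:ℂ):ℝ := Lr r (z.re-v.1)*Lr r (z.im-v.2)

lemma Kv_nonneg (r:ℝ) (v:ℤ × ℤ) (z:ℂ) : 0 ≤ Kv r v z := mul_nonneg (Lr_nonneg _ _) (Lr_nonneg _ _)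

lemma Kv_cont (r:ℝ) (v:ℤ × ℤ) : Continuous (Kv r v) := by
  unfold Kv
  have := Lr_cont r
  fun_prop

lemma Kv_int {r:ℝ} (hr : 0 < r) (v:ℤ × ℤ) : ∫ z, Kv r v z=1 := by
  rw [integral_complex]
  unfold Kv
  rw [Measure.volume_eq_prod, integral_prod_mul (fun s => Lr r (s-v.1)) (fun s => Lr r (s-v.2)),
    Lr_int hr, Lr_int hr, one_mul]

lemma Kv_integrable (r:ℝ) (v:ℤ × ℤ) : Integrable (Kv r v) := by
  have h : Integrable (fun p:ℝ × ℝ => Lr r (p.1-v.1)*Lr r (p.2-v.2)) := by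
    rw [Measure.volume_eq_prod]
    exact (Lr_integrable r v.1).mul_prod (Lr_integrable r v.2)
  exact (Complex.volume_preserving_equiv_real_prod.integrable_comp_emb
    (Complex.measurableEquivRealProd.measurableEmbedding)).mpr h

lemma Kv_supp {r:ℝ} {v:ℤ × ℤ} {z:ℂ} (h : Kv r v z ≠ 0) : ‖z-zc v‖ ≤ 2*r := by
  have h1 : |z.re-v.1| < r := by
    by_contra hc; push Not at hc
    exact h (by unfold Kv; rw [Lr_zero hc, zero_mul])
  have h2 : |z.im-v.2| < r := by
    by_contra hc; push Not at hc
    exact h (by unfold Kv; rw [Lr_zero hc, mul_zero])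
  have := Complex.norm_le_abs_re_add_abs_im (z-zc v)
  rw [Complex.sub_re, Complex.sub_im] at this
  have e1 : (zc v).re = v.1 := rfl
  have e2 : (zc v).im = v.2 := rfl
  rw [e1, e2] at this
  linarith

lemma sum_Kv {r:ℝ} (hr2 : r≤1/2) (M:ℕ) (z:ℂ) :
    ∑ v ∈ Bx M, Kv r v z = if round z.re ∈ Icc (-(M:ℤ)) M ∧ round z.im ∈ Icc (-(M:ℤ)) M
      then per r z.re*per r z.im else 0 := by
  unfold Bx Kv
  rw [sum_product]
  simp_rw [← mul_sum]
  rw [← sum_mul, sum_Lr hr2, sum_Lr hr2]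
  split_ifs <;> simp_all

lemma sandwich_up {r x:ℝ} (hr : 0 < r) (hr2 : r≤1/2) (hx : 0 < x) (M:ℕ) :
    ∑ v ∈ Bx M, Ff x (zc v)≤∫ z:ℂ, Ff (x+2*r) z*(per r z.re*per r z.im) := by
  have h1 : ∀ v ∈ Bx M, Ff x (zc v)≤∫ z:ℂ, Ff (x+2*r) z*Kv r v z := by
    intro v _
    have : Ff x (zc v) = ∫ z, Ff x (zc v)*Kv r v z := by
      rw [integral_const_mul, Kv_int hr, mul_one]
    rw [this]
    refine integral_mono ((Kv_integrable r v).const_mul _) (Ff_mul_int _ (Kv_cont r v)) fun z => ?_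
    simp only
    by_cases h : Kv r v z=0
    · rw [h, mul_zero, mul_zero]
    · have h2 := Kv_supp h
      apply mul_le_mul_of_nonneg_right _ (Kv_nonneg _ _ _)
      apply Ff_mono hx.le (by linarith)
      have := norm_le_norm_add_norm_sub' z (zc v)
      linarith
  refine (sum_le_sum h1).trans ?_
  rw [← integral_finsetSum _ (fun v _ => Ff_mul_int _ (Kv_cont r v))]
  have hpc := per_cont hr hr2
  refine integral_mono (integrable_finsetSum _ fun v _ => Ff_mul_int _ (Kv_cont r v))
    (Ff_mul_int _ (by fun_prop)) fun z => ?_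
  simp only
  rw [← mul_sum, sum_Kv hr2]
  apply mul_le_mul_of_nonneg_left _ (Ff_nonneg _ _)
  split_ifs
  · exact le_rfl
  · exact mul_nonneg (Lr_nonneg _ _) (Lr_nonneg _ _)

lemma round_mem {M:ℕ} {a:ℝ} (h : |a| ≤ M) : round a ∈ Icc (-(M:ℤ)) M := by
  rw [abs_le] at h
  rw [mem_Icc, round_eq]
  constructor
  · rw [Int.le_floor]; push_cast; linarith [h.1]
  · rw [← Int.lt_add_one_iff, Int.floor_lt]; push_cast; linarith [h.2]

lemma sandwich_low {r x:ℝ} (hr : 0 < r) (hr2 : r≤1/2) (hx : 0 ≤ x-2*r) {M:ℕ} (hM : x ≤ M) :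
    ∫ z:ℂ, Ff (x-2*r) z*(per r z.re*per r z.im)≤∑ v ∈ Bx M, Ff x (zc v) := by
  have h1 : ∀ v ∈ Bx M, ∫ z:ℂ, Ff (x-2*r) z*Kv r v z ≤ Ff x (zc v) := by
    intro v _
    have : Ff x (zc v) = ∫ z, Ff x (zc v)*Kv r v z := by
      rw [integral_const_mul, Kv_int hr, mul_one]
    rw [this]
    refine integral_mono (Ff_mul_int _ (Kv_cont r v)) ((Kv_integrable r v).const_mul _) fun z => ?_
    simp only
    by_cases h : Kv r v z=0
    · rw [h, mul_zero, mul_zero]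
    · have h2 := Kv_supp h
      apply mul_le_mul_of_nonneg_right _ (Kv_nonneg _ _ _)
      have h3 : ‖zc v‖ ≤ ‖z‖ + 2*r := by
        have := norm_le_norm_add_norm_sub z (zc v)
        linarith
      have := Ff_mono hx (by linarith) h3
      rwa [sub_add_cancel] at this
  refine le_trans (le_of_eq ?_) (sum_le_sum h1)
  rw [← integral_finsetSum _ (fun v _ => Ff_mul_int _ (Kv_cont r v))]
  refine integral_congr_ae (Eventually.of_forall fun z => ?_)
  simp only
  rw [← mul_sum, sum_Kv hr2]
  by_cases h : Ff (x-2*r) z=0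
  · rw [h, zero_mul, zero_mul]
  · have hz : ‖z‖ ≤ M := by
      by_contra hc
      push Not at hc
      apply h
      apply Ff_eq_zero
      rw [normSq_eq_norm_sq]
      have : x-2*r ≤ ‖z‖ := by linarith
      gcongr
    rw [if_pos ⟨round_mem ((Complex.abs_re_le_norm z).trans hz), round_mem ((Complex.abs_im_le_norm z).trans hz)⟩]

lemma cos_int_bound {o:ℝ} (ho : 0 < |o|) (A B:ℝ) : |∫ y in A..B, cos (o*y)| ≤ 2 / |o| := by
  have ho' : o ≠ 0 := abs_pos.mp ho
  have h : ∫ y in A..B, cos (o*y)=(sin (o*B)-sin (o*A))/o := by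
    rw [intervalIntegral.integral_comp_mul_left (fun y => cos y) ho', integral_cos, smul_eq_mul]
    field_simp
  rw [h, abs_div]
  gcongr
  have h1 := abs_le.mp (abs_sin_le_one (o*B))
  have h2 := abs_le.mp (abs_sin_le_one (o*A))
  rw [abs_le]; constructor <;> linarith [h1.1, h1.2, h2.1, h2.2]

lemma sum_shift_le {h:ℕ → ℝ} (h0 : ∀ n, 0 ≤ h n) (hz : h 0=0) (hs : Summable h) (s : Finset ℕ) (m:ℕ) :
    ∑ n ∈ s, h (n-m)≤∑' d, h d := by
  classical
  have h1 : ∑ n ∈ s, h (n-m) = ∑ n ∈ s.filter (fun n => m < n), h (n-m) := by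
    rw [sum_filter]
    refine sum_congr rfl fun n _ => ?_
    split_ifs with hc
    · rfl
    · rw [Nat.sub_eq_zero_of_le (by omega), hz]
  rw [h1]
  have h2 : ∑ n ∈ s.filter (fun n => m < n), h (n-m)
      = ∑ d ∈ (s.filter (fun n => m < n)).image (fun n => n-m), h d := by
    rw [Finset.sum_image]
    intro a ha b hb hab
    have := (Finset.mem_filter.mp ha).2
    have := (Finset.mem_filter.mp hb).2
    simp only at hab
    omega
  rw [h2]
  exact hs.sum_le_tsum _ (fun d _ => h0 d)

lemma cos_pair {n m:ℕ} (hnm : n ≠ m) (A B:ℝ) :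
    |∫ y in A..B, cos (2*π*√n*y)*cos (2*π*√m*y)| ≤ 1 / |√(n:ℝ)-√m| := by
  have hne : √(n:ℝ)-√m ≠ 0 := by
    intro h
    have : √(n:ℝ) = √m := by linarith
    rw [sqrt_inj (by positivity) (by positivity)] at this
    exact hnm (by exact_mod_cast this)
  have hp : 0 < |√(n:ℝ)-√m| := abs_pos.mpr hne
  have hle : |√(n:ℝ)-√m| ≤ √(n:ℝ)+√m := by
    have := sqrt_nonneg (n:ℝ); have := sqrt_nonneg (m:ℝ)
    rw [abs_le]; constructor <;> linarith
  have e : ∫ y in A..B, cos (2*π*√n*y)*cos (2*π*√m*y)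
      = (1/2)*((∫ y in A..B, cos (2*π*(√n-√m)*y))+∫ y in A..B, cos (2*π*(√n+√m)*y)) := by
    rw [← intervalIntegral.integral_add (Continuous.intervalIntegrable (by fun_prop) _ _)
      (Continuous.intervalIntegrable (by fun_prop) _ _), ← intervalIntegral.integral_const_mul]
    congr 1
    funext y
    have e1 : 2*π*(√n-√m)*y=2*π*√n*y-2*π*√m*y := by ring
    have e2 : 2*π*(√n+√m)*y=2*π*√n*y+2*π*√m*y := by ring
    rw [e1, e2, cos_add, cos_sub]; ring
  have hpi : 1≤π := by linarith [pi_gt_three]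
  have key : ∀ t:ℝ, |√(n:ℝ)-√m| ≤ |t| → |∫ y in A..B, cos (2*π*t*y)| ≤ 1 / |√(n:ℝ)-√m| := by
    intro t ht
    have ht0 : 0 < |t| := by linarith
    have e3 : |2*π*t| = 2*π * |t| := by
      rw [abs_mul, abs_of_pos (by positivity)]
    refine (cos_int_bound (by rw [e3]; positivity) A B).trans ?_
    rw [e3, div_le_div_iff₀ (by positivity) hp]
    nlinarith
  rw [e, abs_mul]
  have h1 := key (√n-√m) le_rfl
  have h2 := key (√n+√m) (hle.trans (le_abs_self _))
  have h3 := abs_add_le (∫ y in A..B, cos (2*π*(√n-√m)*y)) (∫ y in A..B, cos (2*π*(√n+√m)*y))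
  rw [abs_of_pos (by norm_num : (0:ℝ) < 1/2)]
  linarith

/-- auxiliary weights -/
def gw (n:ℕ):ℝ := (n:ℝ)^(-(17/16):ℝ)
/-- auxiliary weights -/
def hw (n:ℕ):ℝ := (n:ℝ)^(-(19/16):ℝ)

lemma gw_sum : Summable gw := Real.summable_nat_rpow.mpr (by norm_num)
lemma hw_sum : Summable hw := Real.summable_nat_rpow.mpr (by norm_num)
lemma gw_nonneg (n:ℕ) : 0 ≤ gw n := by unfold gw; positivity
lemma hw_nonneg (n:ℕ) : 0 ≤ hw n := by unfold hw; positivity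
lemma hw_zero : hw 0=0 := by unfold hw; rw [Nat.cast_zero, zero_rpow (by norm_num)]

lemma off_diag_aux {n m:ℕ} (hm : 0 < m) (h : m < n) :
    (n:ℝ)^(-(7/8):ℝ)*(m:ℝ)^(-(7/8):ℝ)*(1 / |√(n:ℝ)-√m|)≤2*(gw m*hw (n-m)) := by
  have hm' : (0:ℝ) < m := by exact_mod_cast hm
  have hmn : (m:ℝ) < n := by exact_mod_cast h
  have hn' : (0:ℝ) < n := by linarith
  set d:ℕ := n-m with hd
  have hdn : (d:ℝ) = n-m := by rw [hd, Nat.cast_sub h.le]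
  have hd0 : (0:ℝ) < d := by rw [hdn]; linarith
  have hs : √(m:ℝ) < √n := sqrt_lt_sqrt hm'.le hmn
  have hsq1 := sq_sqrt hm'.le
  have hsq2 := sq_sqrt hn'.le
  have hsm := Real.sqrt_pos.mpr hm'
  rw [abs_of_pos (by linarith)]
  have h1 : 1/(√(n:ℝ)-√m)≤2*(n:ℝ)^(1/2:ℝ)*(d:ℝ)^(-1:ℝ) := by
    rw [← sqrt_eq_rpow, rpow_neg_one, hdn, div_le_iff₀ (by linarith)]
    have : (n:ℝ)-m=(√n-√m)*(√n+√m) := by nlinarith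
    have h3 : 0 < √(n:ℝ)-√m := by linarith
    rw [this, mul_inv]
    have e : 2*√(n:ℝ)*((√n-√m)⁻¹*(√n+√m)⁻¹)*(√n-√m)=2*√(n:ℝ)/(√n+√m) := by
      field_simp
    rw [e, le_div_iff₀ (by positivity)]
    linarith
  have h2 : (n:ℝ)^(-(3/8):ℝ)≤(m:ℝ)^(-(3/16):ℝ)*(d:ℝ)^(-(3/16):ℝ) := by
    have e : (n:ℝ)^(-(3/8):ℝ)=(n:ℝ)^(-(3/16):ℝ)*(n:ℝ)^(-(3/16):ℝ) := by
      rw [← rpow_add hn']; norm_num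
    rw [e]
    have a1 := rpow_le_rpow_of_nonpos hm' hmn.le (by norm_num : (-(3/16):ℝ)≤0)
    have a2 := rpow_le_rpow_of_nonpos hd0 (by linarith : (d:ℝ) ≤ n) (by norm_num : (-(3/16):ℝ)≤0)
    gcongr
  calc (n:ℝ)^(-(7/8):ℝ)*(m:ℝ)^(-(7/8):ℝ)*(1/(√(n:ℝ)-√m))
      ≤ (n:ℝ)^(-(7/8):ℝ)*(m:ℝ)^(-(7/8):ℝ)*(2*(n:ℝ)^(1/2:ℝ)*(d:ℝ)^(-1:ℝ)) := by gcongr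
    _ = 2*((n:ℝ)^(-(7/8):ℝ)*(n:ℝ)^(1/2:ℝ))*(m:ℝ)^(-(7/8):ℝ)*(d:ℝ)^(-1:ℝ) := by ring
    _ = 2*(n:ℝ)^(-(3/8):ℝ)*(m:ℝ)^(-(7/8):ℝ)*(d:ℝ)^(-1:ℝ) := by
        rw [← rpow_add hn']; norm_num
    _≤2*((m:ℝ)^(-(3/16):ℝ)*(d:ℝ)^(-(3/16):ℝ))*(m:ℝ)^(-(7/8):ℝ)*(d:ℝ)^(-1:ℝ) := by gcongr
    _ = 2*(((m:ℝ)^(-(3/16):ℝ)*(m:ℝ)^(-(7/8):ℝ))*((d:ℝ)^(-(3/16):ℝ)*(d:ℝ)^(-1:ℝ))) := by ring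
    _ = 2*(gw m*hw d) := by
        rw [← rpow_add hm', ← rpow_add hd0]
        unfold gw hw
        norm_num

lemma off_diag {n m:ℕ} (hn : 0 < n) (hm : 0 < m) (h : n ≠ m) :
    (n:ℝ)^(-(7/8):ℝ)*(m:ℝ)^(-(7/8):ℝ)*(1 / |√(n:ℝ)-√m|)
      ≤ 2*(gw m*hw (n-m))+2*(gw n*hw (m-n)) := by
  rcases lt_or_gt_of_ne h with h1 | h1
  · have := off_diag_aux hn h1
    rw [abs_sub_comm, mul_comm ((m:ℝ)^_)] at this
    have h2 := mul_nonneg (gw_nonneg m) (hw_nonneg (n-m))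
    linarith
  · have := off_diag_aux hm h1
    have h2 := mul_nonneg (gw_nonneg n) (hw_nonneg (m-n))
    linarith

lemma mean_square : ∃ C:ℝ, 0 ≤ C ∧ ∀ a:ℕ → ℝ, (∀ n, |a n| ≤ (r2 n:ℝ)/n) →
    ∀ N M:ℕ, 1 ≤ N → ∀ A B:ℝ, A ≤ B →
    ∫ y in A..B, (∑ n ∈ Finset.Ioc N M, a n*cos (2*π*√n*y))^2
      ≤ C*((B-A)*(N:ℝ)^(-(1/2):ℝ)+1) := by
  obtain ⟨C0, hC0, hr⟩ := r2_bound (1/8) (by norm_num)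
  have hC0' : 0 ≤ C0 := by linarith
  set G := ∑' n, gw n
  set H := ∑' n, hw n
  have hG : 0 ≤ G := tsum_nonneg gw_nonneg
  have hH : 0 ≤ H := tsum_nonneg hw_nonneg
  have hS : Summable fun n:ℕ => (n:ℝ)^(-(5/4):ℝ) := Real.summable_nat_rpow.mpr (by norm_num)
  set S := ∑' n:ℕ, (n:ℝ)^(-(5/4):ℝ) with hSdef
  have hS0 : 0 ≤ S := tsum_nonneg fun n => by positivity
  refine ⟨C0^2*(S+4*(G*H)), by positivity, ?_⟩
  intro a ha N M hN A B hAB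
  have hN' : (0:ℝ) < N := by exact_mod_cast hN
  have hBA : 0 ≤ B-A := by linarith
  set s := Finset.Ioc N M with hs
  have hpos : ∀ n ∈ s, 0 < n := fun n hn => by have := (Finset.mem_Ioc.mp hn).1; omega
  have ha' : ∀ n ∈ s, |a n| ≤ C0*(n:ℝ)^(-(7/8):ℝ) := by
    intro n hn
    have hn0 := hpos n hn
    have hn' : (0:ℝ) < n := by exact_mod_cast hn0
    refine (ha n).trans ?_
    calc (r2 n:ℝ)/n≤(C0*(n:ℝ)^(1/8:ℝ))/n := by gcongr; exact hr n hn0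
      _ = C0*((n:ℝ)^(1/8:ℝ)*(n:ℝ)^(-1:ℝ)) := by rw [rpow_neg_one]; ring
      _ = _ := by rw [← rpow_add hn']; norm_num
  have e1 : ∫ y in A..B, (∑ n ∈ s, a n*cos (2*π*√n*y))^2
      = ∑ n ∈ s, ∑ m ∈ s, a n*a m*∫ y in A..B, cos (2*π*√n*y)*cos (2*π*√m*y) := by
    have : ∀ y:ℝ, (∑ n ∈ s, a n*cos (2*π*√n*y))^2
        = ∑ n ∈ s, ∑ m ∈ s, a n*a m*(cos (2*π*√n*y)*cos (2*π*√m*y)) := by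
      intro y
      rw [sq, sum_mul_sum]
      refine sum_congr rfl fun n _ => sum_congr rfl fun m _ => ?_
      ring
    simp_rw [this]
    rw [intervalIntegral.integral_finsetSum]
    · refine sum_congr rfl fun n _ => ?_
      rw [intervalIntegral.integral_finsetSum]
      · refine sum_congr rfl fun m _ => ?_
        rw [intervalIntegral.integral_const_mul]
      · intro m _
        exact Continuous.intervalIntegrable (by fun_prop) _ _
    · intro n _
      refine Continuous.intervalIntegrable ?_ _ _
      refine continuous_finsetSum _ fun m _ => ?_
      fun_prop
  rw [e1]
  have hterm : ∀ n ∈ s, ∀ m ∈ s, a n*a m*(∫ y in A..B, cos (2*π*√n*y)*cos (2*π*√m*y))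
      ≤ C0^2*((if n = m then (B-A)*(N:ℝ)^(-(1/2):ℝ)*(n:ℝ)^(-(5/4):ℝ) else 0)
        + (2*(gw m*hw (n-m))+2*(gw n*hw (m-n)))) := by
    intro n hn m hm
    have hn' : (0:ℝ) < n := by exact_mod_cast hpos n hn
    refine (le_abs_self _).trans ?_
    rw [abs_mul, abs_mul]
    have hnn : 0≤2*(gw m*hw (n-m))+2*(gw n*hw (m-n)) := by
      have h2 := mul_nonneg (gw_nonneg n) (hw_nonneg (m-n))
      have h3 := mul_nonneg (gw_nonneg m) (hw_nonneg (n-m))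
      linarith
    split_ifs with hnm
    · subst hnm
      have hI : |∫ y in A..B, cos (2*π*√n*y)*cos (2*π*√n*y)| ≤ B-A := by
        have := intervalIntegral.norm_integral_le_of_norm_le_const (a := A) (b := B)
          (f := fun y => cos (2*π*√n*y)*cos (2*π*√n*y)) (C := 1) (by
            intro y _
            rw [norm_mul]
            exact mul_le_one₀ (abs_cos_le_one _) (norm_nonneg _) (abs_cos_le_one _))
        rw [norm_eq_abs, abs_of_nonneg hBA, one_mul] at this
        exact this
      have hp : (n:ℝ)^(-(7/8):ℝ)*(n:ℝ)^(-(7/8):ℝ)≤(N:ℝ)^(-(1/2):ℝ)*(n:ℝ)^(-(5/4):ℝ) := by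
        rw [← rpow_add hn']
        have : (n:ℝ)^(-(7/8) + -(7/8):ℝ)=(n:ℝ)^(-(1/2):ℝ)*(n:ℝ)^(-(5/4):ℝ) := by
          rw [← rpow_add hn']; norm_num
        rw [this]
        have h3 : (N:ℝ) ≤ n := by
          have := (Finset.mem_Ioc.mp hn).1
          exact_mod_cast this.le
        have := rpow_le_rpow_of_nonpos hN' h3 (by norm_num : (-(1/2):ℝ)≤0)
        gcongr
      calc |a n| * |a n| * |∫ y in A..B, cos (2*π*√n*y)*cos (2*π*√n*y)|
          ≤ (C0*(n:ℝ)^(-(7/8):ℝ))*(C0*(n:ℝ)^(-(7/8):ℝ))*(B-A) := by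
            gcongr
            · exact ha' n hn
            · exact ha' n hn
        _ = C0^2*((B-A)*((n:ℝ)^(-(7/8):ℝ)*(n:ℝ)^(-(7/8):ℝ))) := by ring
        _ ≤ C0^2*((B-A)*((N:ℝ)^(-(1/2):ℝ)*(n:ℝ)^(-(5/4):ℝ))) := by gcongr
        _≤_ := by
            rw [mul_assoc (B-A)]
            gcongr
            linarith
    · calc |a n| * |a m| * |∫ y in A..B, cos (2*π*√n*y)*cos (2*π*√m*y)|
          ≤ (C0*(n:ℝ)^(-(7/8):ℝ))*(C0*(m:ℝ)^(-(7/8):ℝ))*(1 / |√(n:ℝ)-√m|) := by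
            gcongr
            · exact ha' n hn
            · exact ha' m hm
            · exact cos_pair hnm A B
        _ = C0^2*((n:ℝ)^(-(7/8):ℝ)*(m:ℝ)^(-(7/8):ℝ)*(1 / |√(n:ℝ)-√m|)) := by ring
        _ ≤ C0^2*(2*(gw m*hw (n-m))+2*(gw n*hw (m-n))) := by
            gcongr
            exact off_diag (hpos n hn) (hpos m hm) hnm
        _ = _ := by ring
  refine (sum_le_sum fun n hn => sum_le_sum fun m hm => hterm n hn m hm).trans ?_
  simp_rw [← mul_sum]
  have hgh1 : ∑ n ∈ s, ∑ m ∈ s, gw n*hw (m-n) ≤ G*H := by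
    calc ∑ n ∈ s, ∑ m ∈ s, gw n*hw (m-n) = ∑ n ∈ s, gw n*∑ m ∈ s, hw (m-n) := by
          simp_rw [mul_sum]
      _≤∑ n ∈ s, gw n*H := by
          gcongr with n hn
          · exact gw_nonneg n
          · exact sum_shift_le hw_nonneg hw_zero hw_sum s n
      _ = (∑ n ∈ s, gw n)*H := by rw [sum_mul]
      _ ≤ G*H := by
          gcongr
          exact gw_sum.sum_le_tsum _ (fun n _ => gw_nonneg n)
  have hgh2 : ∑ n ∈ s, ∑ m ∈ s, gw m*hw (n-m) ≤ G*H := by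
    rw [sum_comm]; exact hgh1
  have hdiag : ∑ n ∈ s, ∑ m ∈ s, (if n = m then (B-A)*(N:ℝ)^(-(1/2):ℝ)*(n:ℝ)^(-(5/4):ℝ) else 0)
      ≤ (B-A)*(N:ℝ)^(-(1/2):ℝ)*S := by
    simp_rw [Finset.sum_ite_eq]
    rw [Finset.sum_ite_mem, Finset.inter_self, ← mul_sum]
    gcongr
    exact hS.sum_le_tsum _ (fun n _ => by positivity)
  have e2 : ∑ n ∈ s, ∑ m ∈ s, ((if n = m then (B-A)*(N:ℝ)^(-(1/2):ℝ)*(n:ℝ)^(-(5/4):ℝ) else 0)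
        + (2*(gw m*hw (n-m))+2*(gw n*hw (m-n))))
      = ∑ n ∈ s, ∑ m ∈ s, (if n = m then (B-A)*(N:ℝ)^(-(1/2):ℝ)*(n:ℝ)^(-(5/4):ℝ) else 0)
        + (2*∑ n ∈ s, ∑ m ∈ s, gw m*hw (n-m)+2*∑ n ∈ s, ∑ m ∈ s, gw n*hw (m-n)) := by
    simp only [sum_add_distrib, mul_sum]
  rw [e2, mul_assoc]
  gcongr
  have hN2 : 0≤(N:ℝ)^(-(1/2):ℝ) := by positivity
  have t1 := mul_nonneg hBA hN2
  nlinarith [mul_nonneg (mul_nonneg hG hH) t1]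

/-- lattice points on the circle of squared radius n -/
def Fb (n:ℕ) : Finset (ℤ × ℤ) := (Bx n).filter (fun k => k.1^2+k.2^2=(n:ℤ))
/-- lattice points in the disc -/
def Dk (M:ℕ) : Finset (ℤ × ℤ) := (Bx M).filter (fun k => k.1^2+k.2^2≤(M:ℤ))

lemma int_abs_le_sq (a:ℤ) : |a| ≤ a^2 := by
  rcases eq_or_ne a 0 with h | h
  · simp [h]
  · have : 1 ≤ |a| := Int.one_le_abs h
    rw [← sq_abs]; nlinarith

lemma mem_Bx_sq {M:ℕ} {k:ℤ × ℤ} (h : k.1^2+k.2^2≤(M:ℤ)) : k ∈ Bx M := by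
  have h1 := int_abs_le_sq k.1
  have h2 := int_abs_le_sq k.2
  have h3 := sq_nonneg k.1
  have h4 := sq_nonneg k.2
  simp only [Bx, mem_product, mem_Icc]
  exact ⟨abs_le.mp (by linarith), abs_le.mp (by linarith)⟩

lemma mem_Fb {n:ℕ} {k:ℤ × ℤ} : k ∈ Fb n ↔ k.1^2+k.2^2=(n:ℤ) := by
  simp only [Fb, mem_filter]
  exact ⟨fun h => h.2, fun h => ⟨mem_Bx_sq h.le, h⟩⟩

lemma mem_Dk {n:ℕ} {k:ℤ × ℤ} : k ∈ Dk n ↔ k.1^2+k.2^2≤(n:ℤ) := by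
  simp only [Dk, mem_filter]
  exact ⟨fun h => h.2, fun h => ⟨mem_Bx_sq h, h⟩⟩

lemma card_Fb (n:ℕ) : (Fb n).card = r2 n := by
  rw [r2, ← Set.ncard_coe_finset]
  congr 1
  ext k
  simp [mem_Fb]

lemma Dk_tendsto : Tendsto Dk atTop atTop := by
  refine tendsto_atTop_finset_of_monotone (fun a b h k hk => ?_) (fun k => ?_)
  · rw [mem_Dk] at *
    have : (a:ℤ) ≤ b := by exact_mod_cast h
    linarith
  · refine ⟨(k.1^2+k.2^2).toNat, ?_⟩
    rw [mem_Dk, Int.toNat_of_nonneg (by positivity)]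

lemma sum_Dk (M:ℕ) (f:ℤ × ℤ → ℝ) : ∑ k ∈ Dk M, f k = ∑ n ∈ Finset.range (M+1), ∑ k ∈ Fb n, f k := by
  rw [← Finset.sum_fiberwise_of_maps_to (s := Dk M) (t := Finset.range (M+1)) (g := fun k => (k.1^2+k.2^2).toNat)]
  · refine sum_congr rfl fun n hn => sum_congr ?_ fun _ _ => rfl
    ext k
    have h0 : 0 ≤ k.1^2+k.2^2 := by positivity
    simp only [mem_filter, mem_Dk, mem_Fb, mem_range] at *
    omega
  · intro k hk
    have h0 : 0 ≤ k.1^2+k.2^2 := by positivity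
    simp only [mem_Dk, mem_range] at *
    omega

/-- smoothed coefficients -/
def aw (r:ℝ) (n:ℕ):ℝ := (∑ k ∈ Fb n, wh r k.1*wh r k.2)/n

lemma aw_nonneg (r:ℝ) (n:ℕ) : 0 ≤ aw r n :=
  div_nonneg (sum_nonneg fun k _ => mul_nonneg (wh_nonneg _ _) (wh_nonneg _ _)) (by positivity)

lemma aw_le (r:ℝ) (n:ℕ) : aw r n≤(r2 n:ℝ)/n := by
  unfold aw
  gcongr
  rw [← card_Fb]
  refine (sum_le_card_nsmul _ _ 1 fun k _ => ?_).trans (by simp)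
  exact mul_le_one₀ (wh_le_one _ _) (wh_nonneg _ _) (wh_le_one _ _)

lemma aw_abs (r:ℝ) (n:ℕ) : |aw r n| ≤ (r2 n:ℝ)/n := by
  rw [abs_of_nonneg (aw_nonneg r n)]; exact aw_le r n

lemma aw_zero (r:ℝ) : aw r 0=0 := by simp [aw]

lemma aw_sub (r:ℝ) (n:ℕ) : (r2 n:ℝ)/n-aw r n≤(r2 n:ℝ)*(80*r^2) := by
  rcases Nat.eq_zero_or_pos n with h | h
  · subst h; rw [aw_zero]; simp; positivity
  have hn : (0:ℝ) < n := by exact_mod_cast h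
  unfold aw
  rw [← sub_div, div_le_iff₀ hn]
  have : (r2 n:ℝ)-∑ k ∈ Fb n, wh r k.1*wh r k.2 = ∑ k ∈ Fb n, (1-wh r k.1*wh r k.2) := by
    rw [sum_sub_distrib, ← card_Fb]; simp
  rw [this]
  refine (sum_le_card_nsmul _ _ (80*r^2*n) fun k hk => ?_).trans ?_
  · have h1 := one_sub_wh (r := r) k.1
    have h2 := one_sub_wh (r := r) k.2
    have h3 := wh_le_one r k.1
    have h4 := wh_nonneg r k.2
    have h5 : (k.1:ℝ)^2+(k.2:ℝ)^2 = n := by exact_mod_cast mem_Fb.mp hk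
    have h6 : 1-wh r k.1*wh r k.2≤(1-wh r k.1)+(1-wh r k.2) := by
      nlinarith [wh_le_one r k.2]
    have h7 : 2*(π * |(k.1:ℝ)| * |r|)^2+2*(π * |(k.2:ℝ)| * |r|)^2=2*π^2*r^2*n := by
      rw [← h5]; simp only [mul_pow, sq_abs]; ring
    have h8 : π^2≤40 := by nlinarith [pi_lt_four, pi_pos]
    have : π^2*(r^2*n)≤40*(r^2*n) := by gcongr
    nlinarith
  · rw [card_Fb, nsmul_eq_mul]; linarith

lemma aw_summable {r:ℝ} (hr : 0 < r) (hr2 : r≤1/2) : Summable (aw r) := by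
  refine summable_of_sum_range_le (c := ∑' k:ℤ × ℤ, wh r k.1*wh r k.2) (aw_nonneg r) fun n => ?_
  refine le_trans ?_ ((wh2_summable hr hr2).sum_le_tsum (Dk n) (fun k _ => mul_nonneg (wh_nonneg _ _) (wh_nonneg _ _)))
  rw [sum_Dk]
  refine (sum_le_sum_of_subset_of_nonneg (Finset.range_mono (Nat.le_succ n)) (fun i _ _ => aw_nonneg r i)).trans ?_
  refine sum_le_sum fun i _ => ?_
  rcases Nat.eq_zero_or_pos i with h | h
  · subst h; rw [aw_zero]; exact sum_nonneg fun k _ => mul_nonneg (wh_nonneg _ _) (wh_nonneg _ _)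
  · unfold aw
    exact div_le_self (sum_nonneg fun k _ => mul_nonneg (wh_nonneg _ _) (wh_nonneg _ _)) (by exact_mod_cast h)

/-- the smoothed series -/
def QQ (r y:ℝ):ℝ := ∑' n:ℕ, aw r n*cos (2*π*√n*y)

lemma QQ_summable {r:ℝ} (hr : 0 < r) (hr2 : r≤1/2) (y:ℝ) :
    Summable (fun n:ℕ => aw r n*cos (2*π*√n*y)) := by
  refine Summable.of_norm_bounded (aw_summable hr hr2) fun n => ?_
  rw [norm_mul, norm_eq_abs, norm_eq_abs, abs_of_nonneg (aw_nonneg r n)]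
  exact mul_le_of_le_one_right (aw_nonneg r n) (abs_cos_le_one _)

lemma QQ_cont {r:ℝ} (hr : 0 < r) (hr2 : r≤1/2) : Continuous (QQ r) := by
  unfold QQ
  refine continuous_tsum (fun n => by fun_prop) (aw_summable hr hr2) fun n y => ?_
  rw [norm_mul, norm_eq_abs, norm_eq_abs, abs_of_nonneg (aw_nonneg r n)]
  exact mul_le_of_le_one_right (aw_nonneg r n) (abs_cos_le_one _)

lemma range_split (f:ℕ → ℝ) (hf : f 0=0) {N M:ℕ} (h : N ≤ M) :
    ∑ n ∈ Finset.range (M+1), f n = ∑ n ∈ Icc 1 N, f n+∑ n ∈ Finset.Ioc N M, f n := by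
  rw [← sum_union]
  · symm
    apply Finset.sum_subset
    · intro n hn
      simp only [Finset.mem_union, mem_Icc, mem_Ioc, mem_range] at *
      omega
    · intro n hn hn2
      simp only [Finset.mem_union, mem_Icc, mem_Ioc, mem_range] at *
      have : n=0 := by omega
      rw [this, hf]
  · rw [Finset.disjoint_left]
    intro n hn
    simp only [mem_Icc, mem_Ioc] at *
    omega

/-- the tail -/
def TL (r:ℝ) (N:ℕ) (y:ℝ):ℝ := QQ r y-∑ n ∈ Icc 1 N, aw r n*cos (2*π*√n*y)

lemma TL_cont {r:ℝ} (hr : 0 < r) (hr2 : r≤1/2) (N:ℕ) : Continuous (TL r N) := by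
  unfold TL
  exact (QQ_cont hr hr2).sub (by fun_prop)

lemma TL_tendsto {r:ℝ} (hr : 0 < r) (hr2 : r≤1/2) (N:ℕ) (y:ℝ) :
    Tendsto (fun M => ∑ n ∈ Finset.Ioc N M, aw r n*cos (2*π*√n*y)) atTop (𝓝 (TL r N y)) := by
  have h := ((QQ_summable hr hr2 y).hasSum.tendsto_sum_nat.comp (tendsto_add_atTop_nat 1)).sub_const
    (∑ n ∈ Icc 1 N, aw r n*cos (2*π*√n*y))
  refine h.congr' ?_
  filter_upwards [eventually_ge_atTop N] with M hM
  simp only [Function.comp]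
  rw [range_split _ (by rw [aw_zero]; simp) hM]
  ring

lemma TL_ms : ∃ C:ℝ, 0 ≤ C ∧ ∀ r:ℝ, 0 < r → r≤1/2 → ∀ N:ℕ, 1 ≤ N → ∀ A B:ℝ, A ≤ B →
    ∫ y in A..B, (TL r N y)^2 ≤ C*((B-A)*(N:ℝ)^(-(1/2):ℝ)+1) := by
  obtain ⟨C, hC, h⟩ := mean_square
  refine ⟨C, hC, fun r hr hr2 N hN A B hAB => ?_⟩
  have ht : Tendsto (fun M => ∫ y in A..B, (∑ n ∈ Finset.Ioc N M, aw r n*cos (2*π*√n*y))^2) atTop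
      (𝓝 (∫ y in A..B, (TL r N y)^2)) := by
    refine intervalIntegral.tendsto_integral_filter_of_dominated_convergence (fun _ => (∑' n, aw r n)^2) ?_ ?_ ?_ ?_
    · exact Eventually.of_forall fun M => (Continuous.aestronglyMeasurable (by fun_prop))
    · refine Eventually.of_forall fun M => Eventually.of_forall fun y _ => ?_
      rw [norm_pow]
      gcongr
      refine (norm_sum_le _ _).trans (le_trans (sum_le_sum fun n _ => ?_) ((aw_summable hr hr2).sum_le_tsum (Finset.Ioc N M) (fun n _ => aw_nonneg r n)))
      rw [norm_mul, norm_eq_abs, norm_eq_abs, abs_of_nonneg (aw_nonneg r n)]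
      exact mul_le_of_le_one_right (aw_nonneg r n) (abs_cos_le_one _)
    · simp
    · exact Eventually.of_forall fun y _ => (TL_tendsto hr hr2 N y).pow 2
  exact le_of_tendsto' ht fun M => h (aw r) (aw_abs r) N M hN A B hAB

lemma Fb_zero : Fb 0 = {(0,0)} := by
  ext k
  rw [mem_Fb, Finset.mem_singleton]
  constructor
  · intro h
    have h1 := sq_nonneg k.1
    have h2 := sq_nonneg k.2
    push_cast at h
    ext
    · exact pow_eq_zero_iff (two_ne_zero) |>.mp (by linarith)
    · exact pow_eq_zero_iff (two_ne_zero) |>.mp (by linarith)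
  · intro h; rw [h]; simp

/-- the constant -/
def cc:ℝ := -(√2/π)

lemma P_approx : ∃ C:ℝ, 0 ≤ C ∧ ∀ r:ℝ, 0 < r → r≤1/2 → ∀ y:ℝ, 0 < y →
    |(∫ z:ℂ, Ff y z*(per r z.re*per r z.im))-(y^4*volB+cc*y^2*QQ r y)| ≤ C*y := by
  obtain ⟨C0, hC0, hr2b⟩ := r2_bound (1/4) (by norm_num)
  have hS : Summable (fun n:ℕ => (n:ℝ)^(-(5/4):ℝ)) := Real.summable_nat_rpow.mpr (by norm_num)
  set S := ∑' n:ℕ, (n:ℝ)^(-(5/4):ℝ)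
  have hS0 : 0 ≤ S := tsum_nonneg fun n => by positivity
  refine ⟨400*C0*S, by positivity, fun r hr hr2 y hy => ?_⟩
  have h1 := (PP_int hr hr2 hy).comp Dk_tendsto
  have h2 := ((QQ_summable hr hr2 y).hasSum.tendsto_sum_nat.comp (tendsto_add_atTop_nat 1)).const_mul (cc*y^2)
  have h3 := (h1.sub (h2.const_add (y^4*volB))).abs
  refine le_of_tendsto' h3 fun M => ?_
  simp only [Function.comp]
  rw [sum_Dk, Finset.sum_range_succ', Finset.sum_range_succ' (fun n => aw r n*cos (2*π*√n*y)), Fb_zero,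
    aw_zero]
  simp only [Finset.sum_singleton, wh_zero, Int.cast_zero]
  have e0 : y*√((0:ℝ)^2+(0:ℝ)^2)=0 := by norm_num
  rw [e0, Fh_zero]
  have e1 : ∀ n:ℕ, ∑ k ∈ Fb (n+1), wh r k.1*wh r k.2*(y^4*Fh (y*√((k.1:ℝ)^2+(k.2:ℝ)^2)))
      = aw r (n+1)*((n+1:ℕ):ℝ)*(y^4*Fh (y*√((n+1:ℕ):ℝ))) := by
    intro n
    have hn : ((n+1:ℕ):ℝ) ≠ 0 := by positivity
    unfold aw
    rw [div_mul_cancel₀ _ hn, sum_mul]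
    refine sum_congr rfl fun k hk => ?_
    have h5 : (k.1:ℝ)^2+(k.2:ℝ)^2=((n+1:ℕ):ℝ) := by exact_mod_cast mem_Fb.mp hk
    rw [h5]
  simp_rw [e1]
  have e2 : (∑ n ∈ Finset.range M, aw r (n+1)*((n+1:ℕ):ℝ)*(y^4*Fh (y*√((n+1:ℕ):ℝ)))+1*1*(y^4*volB)
      - (y^4*volB+cc*y^2*(∑ n ∈ Finset.range M, aw r (n+1)*cos (2*π*√((n+1:ℕ):ℝ)*y)+0*cos (2*π*√((0:ℕ):ℝ)*y))))
      = ∑ n ∈ Finset.range M, aw r (n+1)*((n+1:ℕ):ℝ)*y^4*(Fh (y*√((n+1:ℕ):ℝ))-cc*cos (2*π*(y*√((n+1:ℕ):ℝ)))/(y*√((n+1:ℕ):ℝ))^2) := by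
    have : ∀ n:ℕ, aw r (n+1)*((n+1:ℕ):ℝ)*y^4*(Fh (y*√((n+1:ℕ):ℝ))-cc*cos (2*π*(y*√((n+1:ℕ):ℝ)))/(y*√((n+1:ℕ):ℝ))^2)
       = aw r (n+1)*((n+1:ℕ):ℝ)*(y^4*Fh (y*√((n+1:ℕ):ℝ)))-cc*y^2*(aw r (n+1)*cos (2*π*√((n+1:ℕ):ℝ)*y)) := by
      intro n
      have hn : ((n+1:ℕ):ℝ) ≠ 0 := by positivity
      rw [mul_pow, sq_sqrt (by positivity), show 2*π*(y*√((n+1:ℕ):ℝ))=2*π*√((n+1:ℕ):ℝ)*y by ring]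
      field_simp
    simp_rw [this]
    rw [sum_sub_distrib, ← mul_sum]
    ring
  rw [e2]
  calc _≤∑ n ∈ Finset.range M, |aw r (n+1)*((n+1:ℕ):ℝ)*y^4*(Fh (y*√((n+1:ℕ):ℝ))-cc*cos (2*π*(y*√((n+1:ℕ):ℝ)))/(y*√((n+1:ℕ):ℝ))^2)| := abs_sum_le_sum_abs _ _
    _≤∑ n ∈ Finset.range M, 400*C0*y*((n+1:ℕ):ℝ)^(-(5/4):ℝ) := by
        refine sum_le_sum fun n _ => ?_
        have hn : (0:ℝ) < ((n+1:ℕ):ℝ) := by positivity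
        rw [abs_mul, abs_of_nonneg (by have := aw_nonneg r (n+1); positivity)]
        have f1 := Fh_asymp (ρ := y*√((n+1:ℕ):ℝ)) (by positivity)
        have f2 : aw r (n+1)*((n+1:ℕ):ℝ) ≤ C0*((n+1:ℕ):ℝ)^((1/4:ℝ)) := by
          have := aw_le r (n+1)
          rw [le_div_iff₀ hn] at this
          exact this.trans (hr2b _ (Nat.succ_pos n))
        have f3 : (0:ℝ) ≤ aw r (n+1)*((n+1:ℕ):ℝ) := mul_nonneg (aw_nonneg _ _) hn.le
        calc _ ≤ C0*((n+1:ℕ):ℝ)^((1/4:ℝ))*y^4*(400/(y*√((n+1:ℕ):ℝ))^3) := by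
              gcongr
              exact f1
          _ = 400*C0*y*(((n+1:ℕ):ℝ)^((1/4:ℝ))/√((n+1:ℕ):ℝ)^3) := by
              field_simp
          _ = _ := by
              congr 1
              rw [sqrt_eq_rpow, ← rpow_natCast, ← rpow_mul hn.le, ← rpow_sub hn]
              norm_num
    _≤400*C0*y*S := by
        rw [← mul_sum]
        gcongr
        have := ((summable_nat_add_iff 1).mpr hS).sum_le_tsum (Finset.range M) (fun n _ => by positivity)
        refine this.trans ?_
        have e3 := hS.sum_add_tsum_nat_add 1
        have : (0:ℝ)≤∑ i ∈ Finset.range 1, (i:ℝ)^(-(5/4):ℝ) := sum_nonneg fun i _ => by positivity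
        linarith
    _ = _ := by ring

/-- main trigonometric polynomial -/
def D0 (N:ℕ) (x:ℝ):ℝ := ∑ n ∈ Icc 1 N, (r2 n:ℝ)/n*cos (2*π*√n*x)

lemma D0_cont (N:ℕ) : Continuous (D0 N) := by unfold D0; fun_prop

lemma cc_abs : |cc| ≤ 1 := by
  unfold cc
  rw [abs_neg, abs_of_pos (by positivity), div_le_one pi_pos]
  have : √2≤2 := by rw [sqrt_le_left (by norm_num)]; norm_num
  linarith [pi_gt_three]

lemma cos_lip (a b:ℝ) : |cos a-cos b| ≤ |a-b| := by
  rw [cos_sub_cos, abs_mul, abs_mul, abs_neg, abs_two]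
  have h1 := abs_sin_le_abs (x := (a-b)/2)
  have h2 := abs_sin_le_one ((a+b)/2)
  rw [abs_div, abs_two] at h1
  have := abs_nonneg (sin ((a-b)/2))
  have := abs_nonneg (sin ((a+b)/2))
  nlinarith

set_option maxHeartbeats 1000000 in
lemma P_point : ∃ C:ℝ, 0 ≤ C ∧ ∀ X:ℝ, 2 ≤ X → ∀ N:ℕ, 1 ≤ N → ∀ x ∈ Set.Icc X (3*X), ∀ y:ℝ,
    |y-x| ≤ 2*(1/X^2) →
    |(∫ z:ℂ, Ff y z*(per (1/X^2) z.re*per (1/X^2) z.im))-(volB*x^4+cc*x^2*D0 N x)|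
      ≤ C*(x^2*(((N:ℝ)^2)/X + |TL (1/X^2) N y|)) := by
  obtain ⟨C0, hC0, hP⟩ := P_approx
  obtain ⟨C1, hC1, hr2b⟩ := r2_bound 1 (by norm_num)
  have hv : 0 ≤ volB := ENNReal.toReal_nonneg
  refine ⟨2*C0+270*volB+102*C1+4, by positivity, fun X hX N hN x hx y hy => ?_⟩
  set r := 1/X^2 with hr
  have hX0 : 0 < X := by linarith
  have hr0 : 0 < r := by positivity
  have hrX : r*X^2=1 := by rw [hr]; field_simp
  have hr4 : r≤1/4 := by rw [hr]; apply one_div_le_one_div_of_le <;> nlinarith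
  obtain ⟨hx1, hx2⟩ := hx
  have hx0 : 0 < x := by linarith
  obtain ⟨hy1, hy2⟩ := abs_le.mp hy
  have hy0 : 0 < y := by linarith
  have hyx : y≤2*x := by linarith
  have hN1 : (1:ℝ) ≤ N := by exact_mod_cast hN
  have hP' := hP r hr0 (by linarith) y hy0
  set P := ∫ z:ℂ, Ff y z*(per r z.re*per r z.im)
  set A := ∑ n ∈ Icc 1 N, aw r n*cos (2*π*√n*y) with hA
  have hQ : QQ r y = TL r N y+A := by unfold TL; ring
  have hb : ∀ n ∈ Icc 1 N, (r2 n:ℝ)/n ≤ C1 := by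
    intro n hn
    have hn1 := (Finset.mem_Icc.mp hn).1
    have hn0 : (0:ℝ) < n := by exact_mod_cast hn1
    rw [div_le_iff₀ hn0]
    simpa using hr2b n hn1
  have hsum : ∀ f:ℕ → ℝ, ∀ c:ℝ, (∀ n ∈ Icc 1 N, |f n| ≤ c) → |∑ n ∈ Icc 1 N, f n| ≤ N*c := by
    intro f c h
    refine (abs_sum_le_sum_abs _ _).trans ((sum_le_card_nsmul _ _ c h).trans ?_)
    simp
  have hA1 : |A| ≤ N*C1 := by
    refine hsum _ _ fun n hn => ?_
    rw [abs_mul]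
    refine (mul_le_of_le_one_right (abs_nonneg _) (abs_cos_le_one _)).trans ((aw_abs r n).trans (hb n hn))
  have hAD : |A-D0 N y| ≤ N*(C1*N*(80*r^2)) := by
    rw [hA, D0, ← sum_sub_distrib]
    refine hsum _ _ fun n hn => ?_
    rw [← sub_mul, abs_mul]
    refine (mul_le_of_le_one_right (abs_nonneg _) (abs_cos_le_one _)).trans ?_
    rw [abs_sub_comm, abs_of_nonneg (by linarith [aw_le r n])]
    refine (aw_sub r n).trans ?_
    have hn1 := Finset.mem_Icc.mp hn
    have hn0 : (0:ℝ) < n := by exact_mod_cast hn1.1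
    have := hr2b n hn1.1
    rw [rpow_one] at this
    have h3 : (n:ℝ) ≤ N := by exact_mod_cast hn1.2
    have : (r2 n:ℝ) ≤ C1*N := this.trans (by gcongr)
    gcongr
  have hDD : |D0 N y-D0 N x| ≤ N*(C1*(16*N*r)) := by
    rw [D0, D0, ← sum_sub_distrib]
    refine hsum _ _ fun n hn => ?_
    have hn1 := Finset.mem_Icc.mp hn
    have hn0 : (1:ℝ) ≤ n := by exact_mod_cast hn1.1
    have h3 : (n:ℝ) ≤ N := by exact_mod_cast hn1.2
    rw [← mul_sub, abs_mul, abs_of_nonneg (by positivity)]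
    refine mul_le_mul (hb n hn) ((cos_lip _ _).trans ?_) (abs_nonneg _) (by linarith)
    rw [← mul_sub, abs_mul, abs_of_nonneg (by positivity)]
    have h4 : √(n:ℝ) ≤ N := by
      rw [sqrt_le_left (by linarith)]; nlinarith
    have h5 := pi_lt_four
    calc 2*π*√n * |y-x| ≤ 2*4*N*(2*r) := by gcongr
      _ = 16*N*r := by ring
  set T := TL r N y
  have key : P-(volB*x^4+cc*x^2*D0 N x)=(P-(y^4*volB+cc*y^2*QQ r y))
      + volB*(y^4-x^4)+cc*(y^2*T)+cc*((y^2-x^2)*A)+cc*(x^2*(A-D0 N y))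
      + cc*(x^2*(D0 N y-D0 N x)) := by
    rw [hQ]; ring
  have hxX : x ≤ x^2/X := by rw [le_div_iff₀ hX0]; nlinarith
  have hrx : r*x^2≤9 := by
    have : r*x^2 ≤ r*(3*X)^2 := by gcongr
    nlinarith
  have hrX' : r≤1/X := by
    rw [le_div_iff₀ hX0]; nlinarith
  have hccm : ∀ t:ℝ, |cc*t| ≤ |t| := fun t => by
    rw [abs_mul]; exact mul_le_of_le_one_left (abs_nonneg _) cc_abs
  have b2 : |volB*(y^4-x^4)| ≤ 270*volB*(x^2/X) := by
    rw [abs_mul, abs_of_nonneg hv, show y^4-x^4=(y-x)*((y+x)*(y^2+x^2)) by ring, abs_mul,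
      abs_of_nonneg (show 0≤(y+x)*(y^2+x^2) by positivity)]
    calc volB*(|y-x| * ((y+x)*(y^2+x^2))) ≤ volB*(2*r*((2*x+x)*((2*x)^2+x^2))) := by gcongr
      _ = volB*(30*(r*x^2)*x) := by ring
      _ ≤ volB*(30*9*(x^2/X)) := by gcongr
      _ = _ := by ring
  have b3 : |y^2*T| ≤ 4*(x^2 * |T|) := by
    rw [abs_mul, abs_of_nonneg (sq_nonneg y)]
    calc y^2 * |T| ≤ (2*x)^2 * |T| := by gcongr
      _ = _ := by ring
  have hN2 : (N:ℝ) ≤ N^2 := by nlinarith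
  have b4 : |(y^2-x^2)*A| ≤ 6*C1*(x^2*(N^2/X)) := by
    rw [abs_mul, show y^2-x^2=(y-x)*(y+x) by ring, abs_mul, abs_of_nonneg (show 0 ≤ y+x by positivity)]
    calc |y-x| * (y+x) * |A| ≤ 2*1*(2*x+x)*(N*C1) := by gcongr; linarith
      _ = 6*C1*(x*N) := by ring
      _≤6*C1*(x^2/X*N^2) := by gcongr
      _ = _ := by ring
  have b5 : |x^2*(A-D0 N y)| ≤ 80*C1*(x^2*(N^2/X)) := by
    rw [abs_mul, abs_of_nonneg (sq_nonneg x)]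
    calc x^2 * |A-D0 N y| ≤ x^2*(N*(C1*N*(80*r^2))) := by gcongr
      _ ≤ x^2*(N*(C1*N*(80*(1/X)))) := by
          gcongr
          nlinarith
      _ = _ := by ring
  have b6 : |x^2*(D0 N y-D0 N x)| ≤ 16*C1*(x^2*(N^2/X)) := by
    rw [abs_mul, abs_of_nonneg (sq_nonneg x)]
    calc x^2 * |D0 N y-D0 N x| ≤ x^2*(N*(C1*(16*N*r))) := by gcongr
      _ ≤ x^2*(N*(C1*(16*N*(1/X)))) := by
          gcongr
      _ = _ := by ring
  have b7 : x^2/X ≤ x^2*(N^2/X) := by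
    rw [mul_div_assoc', mul_comm]
    gcongr
    nlinarith [sq_nonneg x]
  have b1 : C0*y≤2*C0*(x^2/X) := by
    calc C0*y ≤ C0*(2*x) := by gcongr
      _ = 2*C0*x := by ring
      _≤_ := by gcongr
  have b1' : 2*C0*(x^2/X)≤2*C0*(x^2*(N^2/X)) := by gcongr
  have b2' : 270*volB*(x^2/X)≤270*volB*(x^2*(N^2/X)) := by gcongr
  rw [key]
  have hu : 0 ≤ x^2*((N:ℝ)^2/X) := by positivity
  have hw : 0 ≤ x^2 * |T| := by positivity
  have big : ∀ a b c d e f:ℝ, |a+b+c+d+e+f| ≤ |a| + |b| + |c| + |d| + |e| + |f| := by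
    intro a b c d e f
    have h1 := abs_add_le (a+b+c+d+e) f
    have h2 := abs_add_le (a+b+c+d) e
    have h3 := abs_add_le (a+b+c) d
    have h4 := abs_add_le (a+b) c
    have h5 := abs_add_le a b
    linarith
  refine (big _ _ _ _ _ _).trans ?_
  have := hccm (y^2*T)
  have := hccm ((y^2-x^2)*A)
  have := hccm (x^2*(A-D0 N y))
  have := hccm (x^2*(D0 N y-D0 N x))
  rw [show (2*C0+270*volB+102*C1+4)*(x^2*((N:ℝ)^2/X + |T|))
    = (2*C0+270*volB+102*C1+4)*(x^2*((N:ℝ)^2/X))+(2*C0+270*volB+102*C1+4)*(x^2 * |T|) by ring]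
  have c1 : 4*(x^2 * |T|)≤(2*C0+270*volB+102*C1+4)*(x^2 * |T|) := by
    gcongr
    have : 0≤2*C0+270*volB+102*C1 := by positivity
    linarith
  linarith

lemma S_ms : ∃ C:ℝ, 0 ≤ C ∧ ∀ X:ℝ, 2 ≤ X → ∀ N:ℕ, 1 ≤ N → ∀ M:ℕ, 3*X ≤ M →
    ∫ x in X..(3*X), ((∑ v ∈ Bx M, Ff x (zc v))/x^2-volB*x^2-cc*D0 N x)^2
      ≤ C*(X*(N:ℝ)^(-(1/2):ℝ)+N^4) := by
  obtain ⟨C1, hC1, hp⟩ := P_point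
  obtain ⟨C2, hC2, ht⟩ := TL_ms
  refine ⟨3*C1^2*(8+2*(C2*2)), by positivity, fun X hX N hN M hM => ?_⟩
  have hX0 : 0 < X := by linarith
  set r := 1/X^2 with hr
  have hr0 : 0 < r := by positivity
  have hr4 : r≤1/4 := by rw [hr]; apply one_div_le_one_div_of_le <;> nlinarith
  have hN1 : (1:ℝ) ≤ N := by exact_mod_cast hN
  have hTc := TL_cont hr0 (by linarith : r≤1/2) N
  have pt : ∀ x ∈ Set.Icc X (3*X), ((∑ v ∈ Bx M, Ff x (zc v))/x^2-volB*x^2-cc*D0 N x)^2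
      ≤ 3*C1^2*(4*(N^2/X)^2+TL r N (x+2*r)^2+TL r N (x+(-(2*r)))^2) := by
    intro x hx
    have hx0 : 0 < x := by linarith [hx.1]
    have u := sandwich_up hr0 (by linarith : r≤1/2) hx0 M
    have l := sandwich_low hr0 (by linarith : r≤1/2) (by linarith [hx.1] : 0 ≤ x-2*r) (hx.2.trans hM)
    have pu := hp X hX N hN x hx (x+2*r) (by rw [add_sub_cancel_left, abs_of_pos (by positivity)])
    have pl := hp X hX N hN x hx (x-2*r) (by rw [sub_sub_cancel_left, abs_neg, abs_of_pos (by positivity)])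
    rw [← sub_eq_add_neg]
    set S := ∑ v ∈ Bx M, Ff x (zc v)
    set t1 := TL r N (x+2*r)
    set t2 := TL r N (x-2*r)
    set q := (N:ℝ)^2/X
    have hq : 0 ≤ q := by positivity
    set W := volB*x^4+cc*x^2*D0 N x
    have hS : |S-W| ≤ C1*(x^2*(2*q + |t1| + |t2|)) := by
      have e1 : 0 ≤ C1*(x^2*(q + |t1|)) := by positivity
      have e2 : 0 ≤ C1*(x^2*(q + |t2|)) := by positivity
      have e : C1*(x^2*(2*q + |t1| + |t2|)) = C1*(x^2*(q + |t1|))+C1*(x^2*(q + |t2|)) := by ring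
      rw [e]
      obtain ⟨a1, a2⟩ := abs_le.mp pu
      obtain ⟨a3, a4⟩ := abs_le.mp pl
      rw [abs_le]; constructor <;> linarith
    have e : S/x^2-volB*x^2-cc*D0 N x=(S-W)/x^2 := by
      simp only [W]; field_simp; ring
    have hS2 : |(S-W)/x^2| ≤ C1*(2*q + |t1| + |t2|) := by
      rw [abs_div, abs_of_pos (show 0 < x^2 by positivity), div_le_iff₀ (by positivity)]
      linarith
    rw [e, ← sq_abs]
    calc |(S-W)/x^2| ^ 2≤(C1*(2*q + |t1| + |t2|))^2 := by gcongr
      _ = C1^2*(2*q + |t1| + |t2|)^2 := by ring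
      _ ≤ C1^2*(3*(4*q^2+t1^2+t2^2)) := by
          gcongr
          rw [← sq_abs t1, ← sq_abs t2]
          nlinarith [sq_nonneg (2*q - |t1|), sq_nonneg (2*q - |t2|), sq_nonneg (|t1| - |t2|)]
      _ = _ := by ring
  have hXX : X≤3*X := by linarith
  have i1 : IntervalIntegrable (fun x => ((∑ v ∈ Bx M, Ff x (zc v))/x^2-volB*x^2-cc*D0 N x)^2) volume X (3*X) := by
    apply ContinuousOn.intervalIntegrable
    rw [uIcc_of_le hXX]
    have hD := D0_cont N
    have : ∀ x ∈ Set.Icc X (3*X), x^2 ≠ 0 := by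
      intro x hx
      have : 0 < x := by linarith [hx.1]
      positivity
    unfold Ff
    fun_prop (disch := assumption)
  have h1 := integral_mono_on hXX i1 (Continuous.intervalIntegrable (by fun_prop) _ _) pt
  refine h1.trans ?_
  rw [intervalIntegral.integral_const_mul, intervalIntegral.integral_add (Continuous.intervalIntegrable (by fun_prop) _ _) (Continuous.intervalIntegrable (by fun_prop) _ _),
    intervalIntegral.integral_add (Continuous.intervalIntegrable (by fun_prop) _ _) (Continuous.intervalIntegrable (by fun_prop) _ _),
    intervalIntegral.integral_const, intervalIntegral.integral_comp_add_right (fun y => TL r N y^2),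
    intervalIntegral.integral_comp_add_right (fun y => TL r N y^2)]
  have t1 := ht r hr0 (by linarith) N hN (X+2*r) (3*X+2*r) (by linarith)
  have t2 := ht r hr0 (by linarith) N hN (X + -(2*r)) (3*X + -(2*r)) (by linarith)
  have hp0 : 0≤(N:ℝ)^(-(1/2):ℝ) := by positivity
  set w := (N:ℝ)^(-(1/2):ℝ)
  rw [show 3*X+2*r-(X+2*r)=2*X by ring] at t1
  rw [show 3*X + -(2*r)-(X + -(2*r))=2*X by ring] at t2
  have hN4 : (1:ℝ)≤(N:ℝ)^4 := one_le_pow₀ hN1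
  have hXw : 0 ≤ X*w := by positivity
  have a0 : (3*X-X) • (4*((N:ℝ)^2/X)^2)≤8*(X*w+N^4) := by
    have : (3*X-X) • (4*((N:ℝ)^2/X)^2)=8*(N^4/X) := by
      rw [smul_eq_mul]; field_simp; ring
    rw [this]
    have : (N:ℝ)^4/X ≤ N^4 := div_le_self (by positivity) (by linarith)
    linarith
  have a1 : C2*(2*X*w+1) ≤ C2*2*(X*w+N^4) := by
    have := mul_le_mul_of_nonneg_left (show 2*X*w+1≤2*(X*w+N^4) by linarith) hC2
    linarith
  calc _≤3*C1^2*(8*(X*w+N^4)+C2*2*(X*w+N^4)+C2*2*(X*w+N^4)) := by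
        gcongr <;> linarith
    _ = _ := by ring

/-- remainder of the Fourier series of the sawtooth -/
def RK (K:ℕ) (t:ℝ):ℝ := sawtooth t+∑ k ∈ Icc 1 K, sin (2*π*k*t)/(π*k)

lemma int_cos_int {j:ℤ} (hj : j ≠ 0) : ∫ t in (0:ℝ)..1, cos (2*π*j*t)=0 := by
  have hj' : (2*π*j:ℝ) ≠ 0 := by
    have : (j:ℝ) ≠ 0 := by exact_mod_cast hj
    positivity
  rw [intervalIntegral.integral_comp_mul_left _ hj', integral_cos]
  have : sin (2*π*j*1)=0 := by
    rw [show 2*π*(j:ℝ)*1=((2*j:ℤ):ℝ)*π by push_cast; ring]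
    exact sin_int_mul_pi _
  rw [this]; simp

lemma int_sin_sin {k l:ℕ} (hk : 1 ≤ k) (hl : 1 ≤ l) :
    ∫ t in (0:ℝ)..1, sin (2*π*k*t)*sin (2*π*l*t) = if k = l then 1/2 else 0 := by
  have e : ∀ t:ℝ, sin (2*π*k*t)*sin (2*π*l*t)
      = (1/2)*(cos (2*π*((k:ℤ)-(l:ℤ):ℤ)*t)-cos (2*π*((k:ℤ)+(l:ℤ):ℤ)*t)) := by
    intro t
    push_cast
    rw [show 2*π*((k:ℝ)-l)*t=2*π*k*t-2*π*l*t by ring,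
      show 2*π*((k:ℝ)+l)*t=2*π*k*t+2*π*l*t by ring, cos_sub, cos_add]
    ring
  simp_rw [e]
  rw [intervalIntegral.integral_const_mul, intervalIntegral.integral_sub (Continuous.intervalIntegrable (by fun_prop) _ _)
    (Continuous.intervalIntegrable (by fun_prop) _ _), int_cos_int (j := (k:ℤ)+l) (by omega)]
  split_ifs with h
  · subst h; simp
  · rw [int_cos_int (by omega)]; simp

lemma int_saw_sin {k:ℕ} (hk : 1 ≤ k) :
    ∫ t in (0:ℝ)..1, (t-1/2)*sin (2*π*k*t) = -(1/(2*π*k)) := by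
  have hk0 : (0:ℝ) < k := by exact_mod_cast hk
  set o := 2*π*(k:ℝ) with ho
  have ho0 : o ≠ 0 := by positivity
  have hd : ∀ t ∈ uIcc (0:ℝ) 1, HasDerivAt (fun t => -(t-1/2)*cos (o*t)/o+sin (o*t)/o^2)
      ((t-1/2)*sin (o*t)) t := by
    intro t _
    have h1 : HasDerivAt (fun t => o*t) o t := by simpa using (hasDerivAt_id t).const_mul o
    have h2 := (((hasDerivAt_id t).sub_const (1/2)).neg.mul h1.cos).div_const o
    have h3 := (h1.sin).div_const (o^2)
    refine (h2.add h3).congr_deriv ?_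
    simp only [id]
    field_simp
    simp only [Pi.neg_apply, id]
    ring
  rw [integral_eq_sub_of_hasDerivAt hd (Continuous.intervalIntegrable (by fun_prop) _ _)]
  have c1 : cos (o*1)=1 := by
    rw [ho, show 2*π*(k:ℝ)*1 = k*(2*π) by ring]; exact cos_nat_mul_two_pi k
  have s1 : sin (o*1)=0 := by
    rw [ho, show 2*π*(k:ℝ)*1=((2*k:ℕ):ℝ)*π by push_cast; ring]; exact sin_nat_mul_pi _
  rw [c1, s1]
  simp only [mul_zero, cos_zero, sin_zero]
  field_simp
  ring

lemma inv_sq_tail {K:ℕ} (hK : 1 ≤ K) : π^2/6-∑ k ∈ Icc 1 K, 1/(k:ℝ)^2≤1/K := by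
  have h := hasSum_zeta_two.tendsto_sum_nat.comp (tendsto_add_atTop_nat 1)
  have h2 := h.sub_const (∑ k ∈ Icc 1 K, 1/(k:ℝ)^2)
  refine le_of_tendsto h2 ?_
  filter_upwards [eventually_ge_atTop K] with M hM
  simp only [Function.comp]
  have e : ∑ n ∈ Finset.range (M+1), 1/(n:ℝ)^2 = ∑ n ∈ Icc 1 K, 1/(n:ℝ)^2+∑ n ∈ Finset.Ioc K M, 1/(n:ℝ)^2 := by
    rw [Finset.sum_range_succ', ← sum_union]
    · simp only [Nat.cast_zero]
      rw [Finset.range_eq_Ico, Finset.sum_Ico_add' (fun n:ℕ => 1/(n:ℝ)^2)]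
      norm_num
      refine sum_congr ?_ fun _ _ => rfl
      ext n
      simp only [Finset.mem_union, mem_Icc, mem_Ioc, Finset.mem_Ico]
      omega
    · rw [Finset.disjoint_left]
      intro n hn
      simp only [mem_Icc, mem_Ioc] at *
      omega
  rw [e, add_sub_cancel_left]
  have := sum_Ioc_inv_sq_le_sub (α := ℝ) (k := K) (n := M) (by omega) hM
  simp only [one_div]
  have h3 : (0:ℝ)≤(M:ℝ)⁻¹ := by positivity
  linarith

lemma RK_int {K:ℕ} (hK : 1 ≤ K) : ∫ t in (0:ℝ)..1, RK K t^2≤1/K := by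
  have e0 : ∫ t in (0:ℝ)..1, RK K t^2
      = ∫ t in (0:ℝ)..1, ((t-1/2)+∑ k ∈ Icc 1 K, sin (2*π*k*t)/(π*k))^2 := by
    apply intervalIntegral.integral_congr_ae
    filter_upwards [Measure.ae_ne volume (1:ℝ)] with t ht h
    rw [uIoc_of_le zero_le_one] at h
    have : ⌊t⌋ = 0 := by
      rw [Int.floor_eq_zero_iff]
      exact ⟨h.1.le, lt_of_le_of_ne h.2 ht⟩
    simp [RK, sawtooth, this]
  have e1 : ∀ t:ℝ, ((t-1/2)+∑ k ∈ Icc 1 K, sin (2*π*k*t)/(π*k))^2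
      = (t-1/2)^2+(∑ k ∈ Icc 1 K, (2/(π*k))*((t-1/2)*sin (2*π*k*t)))
        + ∑ k ∈ Icc 1 K, ∑ l ∈ Icc 1 K, (1/(π*k)*(1/(π*l)))*(sin (2*π*k*t)*sin (2*π*l*t)) := by
    intro t
    rw [add_sq, sq (∑ k ∈ Icc 1 K, sin (2*π*k*t)/(π*k)), sum_mul_sum, mul_sum]
    congr 1
    · congr 1
      refine sum_congr rfl fun k _ => ?_
      ring
    · refine sum_congr rfl fun k _ => sum_congr rfl fun l _ => ?_
      ring
  rw [e0]
  simp_rw [e1]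
  rw [intervalIntegral.integral_add (Continuous.intervalIntegrable (by fun_prop) _ _) (Continuous.intervalIntegrable (by fun_prop) _ _),
    intervalIntegral.integral_add (Continuous.intervalIntegrable (by fun_prop) _ _) (Continuous.intervalIntegrable (by fun_prop) _ _),
    intervalIntegral.integral_finsetSum (fun k _ => Continuous.intervalIntegrable (by fun_prop) _ _),
    intervalIntegral.integral_finsetSum (fun k _ => Continuous.intervalIntegrable (by fun_prop) _ _)]
  have e2 : ∫ t in (0:ℝ)..1, (t-1/2)^2=1/12 := by
    rw [intervalIntegral.integral_comp_sub_right (fun t => t^2), integral_pow]; norm_num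
  have e3 : ∑ k ∈ Icc 1 K, ∫ t in (0:ℝ)..1, (2/(π*k))*((t-1/2)*sin (2*π*k*t))
      = ∑ k ∈ Icc 1 K, -(1/π^2)*(1/(k:ℝ)^2) := by
    refine sum_congr rfl fun k hk => ?_
    have hk1 := (Finset.mem_Icc.mp hk).1
    have hk0 : (0:ℝ) < k := by exact_mod_cast hk1
    rw [intervalIntegral.integral_const_mul, int_saw_sin hk1]
    field_simp
  have e4 : ∑ k ∈ Icc 1 K, ∫ t in (0:ℝ)..1, ∑ l ∈ Icc 1 K, (1/(π*k)*(1/(π*l)))*(sin (2*π*k*t)*sin (2*π*l*t))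
      = ∑ k ∈ Icc 1 K, (1/(2*π^2))*(1/(k:ℝ)^2) := by
    refine sum_congr rfl fun k hk => ?_
    have hk1 := (Finset.mem_Icc.mp hk).1
    have hk0 : (0:ℝ) < k := by exact_mod_cast hk1
    rw [intervalIntegral.integral_finsetSum (fun k _ => Continuous.intervalIntegrable (by fun_prop) _ _)]
    have : ∀ l ∈ Icc 1 K, ∫ t in (0:ℝ)..1, (1/(π*k)*(1/(π*l)))*(sin (2*π*k*t)*sin (2*π*l*t))
        = if k = l then (1/(π*k)*(1/(π*l)))*(1/2) else 0 := by
      intro l hl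
      rw [intervalIntegral.integral_const_mul, int_sin_sin hk1 (Finset.mem_Icc.mp hl).1]
      split_ifs <;> simp
    rw [sum_congr rfl this, Finset.sum_ite_eq, if_pos hk]
    field_simp
  rw [e2, e3, e4, ← mul_sum, ← mul_sum]
  have h := inv_sq_tail hK
  have hp : 1≤π^2 := by nlinarith [pi_gt_three]
  set S := ∑ k ∈ Icc 1 K, 1/(k:ℝ)^2
  have : 1/12 + -(1/π^2)*S+1/(2*π^2)*S=(π^2/6-S)/(2*π^2) := by
    field_simp; ring
  rw [this, div_le_iff₀ (by positivity)]
  have hK0 : (0:ℝ)≤1/K := by positivity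
  nlinarith

lemma RK_periodic (K:ℕ) : Function.Periodic (RK K) 1 := by
  intro t
  unfold RK sawtooth
  congr 1
  · rw [Int.floor_add_one]; push_cast; ring
  · refine sum_congr rfl fun k _ => ?_
    congr 1
    rw [show 2*π*(k:ℝ)*(t+1)=2*π*k*t+k*(2*π) by ring]
    exact sin_add_nat_mul_two_pi _ k

lemma saw_meas : Measurable sawtooth := by
  unfold sawtooth
  have : Measurable (fun t:ℝ => ((⌊t⌋:ℤ):ℝ)) := measurable_from_top.comp Int.measurable_floor
  fun_prop

lemma RK_meas (K:ℕ) : Measurable (RK K) := by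
  unfold RK
  have := saw_meas
  fun_prop

lemma saw_bound (t:ℝ) : |sawtooth t| ≤ 1 := by
  unfold sawtooth
  have h1 := Int.floor_le t
  have h2 := Int.lt_floor_add_one t
  rw [abs_le]; constructor <;> linarith

lemma RK_bound (K:ℕ) (t:ℝ) : |RK K t| ≤ 1+K := by
  unfold RK
  refine (abs_add_le _ _).trans (add_le_add (saw_bound t) ?_)
  refine (abs_sum_le_sum_abs _ _).trans ((sum_le_card_nsmul _ _ 1 fun k hk => ?_).trans (by simp))
  have hk0 : (1:ℝ) ≤ k := by exact_mod_cast (Finset.mem_Icc.mp hk).1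
  have : 1≤π*k := by nlinarith [pi_gt_three]
  rw [abs_div, abs_of_pos (show 0 < π*k by positivity), div_le_one (by positivity)]
  exact (abs_sin_le_one _).trans this

lemma first_deriv {a b D κ:ℝ} {P P' G G':ℝ → ℝ} (hab : a ≤ b) (hD : 0 < D) (hκ : 0 < κ)
    (hPc : ContinuousOn P (Set.Icc a b)) (hGc : ContinuousOn G (Set.Icc a b))
    (hP : ∀ x ∈ Ioo a b, HasDerivAt P (P' x) x) (hG : ∀ x ∈ Ioo a b, HasDerivAt G (G' x) x)
    (hG' : ∀ x ∈ Ioo a b, 0 ≤ G' x) (hGP : ∀ x ∈ Ioo a b, G x*P' x = D) (hGa : 0 ≤ G a) :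
    |∫ x in a..b, cos (κ*P x)| ≤ 2*G b/(κ*D) := by
  have hGi : IntervalIntegrable G' volume a b := by
    rw [intervalIntegrable_iff_integrableOn_Ioc_of_le hab]
    exact intervalIntegral.integrableOn_deriv_of_nonneg hGc hG hG'
  have hGint := intervalIntegral.integral_eq_sub_of_hasDerivAt_of_le hab hGc hG hGi
  have hci : IntervalIntegrable (fun x => cos (κ*P x)) volume a b := by
    apply ContinuousOn.intervalIntegrable
    rw [uIcc_of_le hab]
    fun_prop
  have hsc : ContinuousOn (fun x => sin (κ*P x)) (uIcc a b) := by
    rw [uIcc_of_le hab]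
    fun_prop
  have hsi : IntervalIntegrable (fun x => G' x*sin (κ*P x)) volume a b := hGi.mul_continuousOn hsc
  have hmain := intervalIntegral.integral_eq_sub_of_hasDerivAt_of_le (f := fun x => G x*sin (κ*P x))
    (f' := fun x => G' x*sin (κ*P x)+κ*D*cos (κ*P x)) hab (by fun_prop) (by
      intro x hx
      have h1 := (hG x hx).mul ((hP x hx).const_mul κ).sin
      refine h1.congr_deriv ?_
      rw [← hGP x hx]; ring) (hsi.add (hci.const_mul _))
  rw [intervalIntegral.integral_add hsi (hci.const_mul _), intervalIntegral.integral_const_mul] at hmain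
  have hb : |∫ x in a..b, G' x*sin (κ*P x)| ≤ G b-G a := by
    rw [← hGint]
    rw [← norm_eq_abs]
    refine intervalIntegral.norm_integral_le_of_norm_le hab ?_ hGi
    filter_upwards [Measure.ae_ne volume b] with x hxb hx
    have hx' : x ∈ Ioo a b := ⟨hx.1, lt_of_le_of_ne hx.2 hxb⟩
    rw [norm_mul, norm_eq_abs, abs_of_nonneg (hG' x hx')]
    exact mul_le_of_le_one_right (hG' x hx') (abs_sin_le_one _)
  have hGb : G a ≤ G b := by
    have := abs_nonneg (∫ x in a..b, G' x*sin (κ*P x)); linarith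
  rw [le_div_iff₀ (by positivity)]
  have e : (∫ x in a..b, cos (κ*P x))*(κ*D) = G b*sin (κ*P b)-G a*sin (κ*P a)-∫ x in a..b, G' x*sin (κ*P x) := by
    linarith
  have e2 : |∫ x in a..b, cos (κ*P x)| * (κ*D) = |(∫ x in a..b, cos (κ*P x))*(κ*D)| := by
    rw [abs_mul, abs_of_pos (show 0 < κ*D by positivity)]
  rw [e2, e]
  have b1 : |G b*sin (κ*P b)| ≤ G b := by
    rw [abs_mul, abs_of_nonneg (by linarith)]; exact mul_le_of_le_one_right (by linarith) (abs_sin_le_one _)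
  have b2 : |G a*sin (κ*P a)| ≤ G a := by
    rw [abs_mul, abs_of_nonneg (by linarith)]; exact mul_le_of_le_one_right (by linarith) (abs_sin_le_one _)
  have := abs_sub (G b*sin (κ*P b)-G a*sin (κ*P a)) (∫ x in a..b, G' x*sin (κ*P x))
  have := abs_sub (G b*sin (κ*P b)) (G a*sin (κ*P a))
  linarith

/-- phase -/
def fm (m:ℕ) (x:ℝ):ℝ := √(x^4-(m:ℝ)^2)

lemma fm_cont (m:ℕ) : Continuous (fm m) := by unfold fm; fun_prop

lemma fm_pos {m:ℕ} {x:ℝ} (h : (m:ℝ) < x^2) : 0 < fm m x := by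
  unfold fm
  apply Real.sqrt_pos.mpr
  have : (0:ℝ) ≤ m := by positivity
  nlinarith

lemma fm_nonneg (m:ℕ) (x:ℝ) : 0 ≤ fm m x := sqrt_nonneg _

lemma fm_sq {m:ℕ} {x:ℝ} (h : (m:ℝ) ≤ x^2) : fm m x^2 = x^4-(m:ℝ)^2 := by
  unfold fm
  apply sq_sqrt
  have : (0:ℝ) ≤ m := by positivity
  nlinarith

lemma fm_le (m:ℕ) (x:ℝ) : fm m x ≤ x^2 := by
  unfold fm
  rw [sqrt_le_left (by positivity)]
  nlinarith [sq_nonneg (m:ℝ)]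

lemma fm_deriv {m:ℕ} {x:ℝ} (h : (m:ℝ) < x^2) : HasDerivAt (fm m) (2*x^3/fm m x) x := by
  have hp := fm_pos h
  have h1 : HasDerivAt (fun x:ℝ => x^4-(m:ℝ)^2) (4*x^3) x := by
    simpa using (hasDerivAt_pow 4 x).sub_const ((m:ℝ)^2)
  have h2 := h1.sqrt (by have := Real.sqrt_pos.mp hp; exact this.ne')
  refine h2.congr_deriv ?_
  change 4*x^3/(2*fm m x) = _
  field_simp
  ring

/-- f/x is increasing -/
lemma pm_deriv {m:ℕ} {x:ℝ} (hx : 0 < x) (h : (m:ℝ) < x^2) :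
    HasDerivAt (fun x => fm m x/x) ((x^4+(m:ℝ)^2)/(fm m x*x^2)) x := by
  have hp := fm_pos h
  have h1 := (fm_deriv h).div (hasDerivAt_id x) hx.ne'
  refine h1.congr_deriv ?_
  have := fm_sq h.le
  simp only [id]
  field_simp
  nlinarith

lemma pair_int {m n k:ℕ} (hmn : m < n) (hk : 1 ≤ k) {X a:ℝ} (hX : 0 < X) (ha : X ≤ a) (ha3 : a≤3*X)
    (han : (n:ℝ) ≤ a^2) :
    |∫ x in a..(3*X), cos (2*π*k*(fm m x-fm n x))| ≤ 27*X^3/((n:ℝ)^2-(m:ℝ)^2) := by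
  have hmn' : (m:ℝ) < n := by exact_mod_cast hmn
  have hm0 : (0:ℝ) ≤ m := by positivity
  have hk1 : (1:ℝ) ≤ k := by exact_mod_cast hk
  have hD : 0 < (n:ℝ)^2-(m:ℝ)^2 := by nlinarith
  have e : ∀ x, cos (2*π*k*(fm m x-fm n x)) = cos (2*π*k*(fm n x-fm m x)) := by
    intro x
    rw [← cos_neg]; congr 1; ring
  simp_rw [e]
  have hn : ∀ x ∈ Ioo a (3*X), (n:ℝ) < x^2 := by
    intro x hx
    have := hx.1
    nlinarith
  have hm : ∀ x ∈ Ioo a (3*X), (m:ℝ) < x^2 := fun x hx => hmn'.trans (hn x hx)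
  have hx0 : ∀ x ∈ Set.Icc a (3*X), x ≠ 0 := fun x hx => by have := hx.1; linarith
  have hcm := fm_cont m
  have hcn := fm_cont n
  have hpm : ContinuousOn (fun x => fm m x/x) (Set.Icc a (3*X)) := hcm.continuousOn.div continuousOn_id hx0
  have hpn : ContinuousOn (fun x => fm n x/x) (Set.Icc a (3*X)) := hcn.continuousOn.div continuousOn_id hx0
  have key := first_deriv (κ := 2*π*k) (P := fun x => fm n x-fm m x) (P' := fun x => 2*x^3/fm n x-2*x^3/fm m x)
    (G := fun x => (fm m x/x)*(fm n x/x)*(fm m x/x+fm n x/x)/2) ha3 hD (by positivity)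
    (G' := fun x => (((x^4+(m:ℝ)^2)/(fm m x*x^2)*(fm n x/x)+(fm m x/x)*((x^4+(n:ℝ)^2)/(fm n x*x^2)))*(fm m x/x+fm n x/x)
      + (fm m x/x)*(fm n x/x)*((x^4+(m:ℝ)^2)/(fm m x*x^2)+(x^4+(n:ℝ)^2)/(fm n x*x^2)))/2)
    (by fun_prop) (((hpm.mul hpn).mul (hpm.add hpn)).div_const 2)
    (fun x hx => (fm_deriv (hn x hx)).sub (fm_deriv (hm x hx)))
    (fun x hx => by
      have hx1 : 0 < x := by linarith [hx.1]
      have h1 := pm_deriv hx1 (hm x hx)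
      have h2 := pm_deriv hx1 (hn x hx)
      exact ((h1.mul h2).mul (h1.add h2)).div_const 2)
    (fun x hx => by
      have hx1 : 0 < x := by linarith [hx.1]
      have := fm_pos (hm x hx)
      have := fm_pos (hn x hx)
      positivity)
    (fun x hx => by
      have hx1 : 0 < x := by linarith [hx.1]
      have h1 := fm_pos (hm x hx)
      have h2 := fm_pos (hn x hx)
      have h3 := fm_sq (hm x hx).le
      have h4 := fm_sq (hn x hx).le
      have : (n:ℝ)^2-(m:ℝ)^2 = fm m x^2-fm n x^2 := by linarith
      rw [this]
      field_simp
      ring)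
    (by
      have := fm_nonneg m a
      have := fm_nonneg n a
      have : 0 < a := by linarith
      positivity)
  refine key.trans ?_
  have hb : ∀ m:ℕ, fm m (3*X)/(3*X)≤3*X := by
    intro m
    rw [div_le_iff₀ (by positivity)]
    have := fm_le m (3*X)
    nlinarith
  have hb0 : ∀ m:ℕ, 0 ≤ fm m (3*X)/(3*X) := fun m => div_nonneg (fm_nonneg _ _) (by positivity)
  have hG : (fm m (3*X)/(3*X))*(fm n (3*X)/(3*X))*(fm m (3*X)/(3*X)+fm n (3*X)/(3*X))/2≤27*X^3 := by
    calc _≤(3*X)*(3*X)*(3*X+3*X)/2 := by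
          have := hb m; have := hb n; have := hb0 m; have := hb0 n
          gcongr
      _ = _ := by ring
  rw [div_le_div_iff₀ (by positivity) hD]
  have hpi := pi_gt_three
  have h5 : 2≤2*π*k := by nlinarith
  calc _≤2*(27*X^3)*((n:ℝ)^2-(m:ℝ)^2) := by gcongr
    _ = 27*X^3*(2*((n:ℝ)^2-(m:ℝ)^2)) := by ring
    _≤_ := by gcongr

/-- indicator -/
def ind (m:ℕ) (x:ℝ):ℝ := if (m:ℝ) ≤ x^2 then 1 else 0

lemma ind_meas (m:ℕ) : Measurable (ind m) := by
  unfold ind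
  exact Measurable.ite (measurableSet_le measurable_const (by fun_prop)) measurable_const measurable_const

lemma ind_abs (m:ℕ) (x:ℝ) : |ind m x| ≤ 1 := by unfold ind; split_ifs <;> simp

lemma bdd_ii {f:ℝ → ℝ} (hf : Measurable f) {C:ℝ} (h : ∀ x, |f x| ≤ C) (a b:ℝ) : IntervalIntegrable f volume a b := by
  refine (intervalIntegrable_const (c := C)).mono_fun hf.aestronglyMeasurable ?_
  filter_upwards with x
  exact (h x).trans (le_abs_self C)

lemma pair_ind {m n k:ℕ} (hmn : m < n) (hk : 1 ≤ k) {X:ℝ} (hX : 0 < X) (hn : (n:ℝ)≤9*X^2) :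
    |∫ x in X..(3*X), ind m x*ind n x*cos (2*π*k*(fm m x-fm n x))| ≤ 27*X^3/((n:ℝ)^2-(m:ℝ)^2) := by
  have hmn' : (m:ℝ) < n := by exact_mod_cast hmn
  set a := max X √n with ha
  have haX : X ≤ a := le_max_left _ _
  have hn0 : (0:ℝ) ≤ n := by positivity
  have ha3 : a≤3*X := by
    apply max_le (by linarith)
    rw [sqrt_le_left (by positivity)]
    linarith
  have han : (n:ℝ) ≤ a^2 := by
    have h1 : √(n:ℝ) ≤ a := le_max_right _ _
    have h2 := sq_sqrt hn0
    have h3 := sqrt_nonneg (n:ℝ)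
    nlinarith
  have hmeas : Measurable (fun x => ind m x*ind n x*cos (2*π*k*(fm m x-fm n x))) := by
    have := ind_meas m; have := ind_meas n
    have := (fm_cont m).measurable; have := (fm_cont n).measurable
    fun_prop
  have hig := bdd_ii (C := 1) hmeas (fun x => by
    rw [abs_mul, abs_mul]
    exact mul_le_one₀ (mul_le_one₀ (ind_abs _ _) (abs_nonneg _) (ind_abs _ _)) (abs_nonneg _) (abs_cos_le_one _))
  rw [← integral_add_adjacent_intervals (hig X a) (hig a (3*X))]
  have z : ∫ x in X..a, ind m x*ind n x*cos (2*π*k*(fm m x-fm n x))=0 := by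
    apply intervalIntegral.integral_zero_ae
    filter_upwards [Measure.ae_ne volume a] with x hx hx2
    rw [uIoc_of_le haX] at hx2
    have hxa : x < a := lt_of_le_of_ne hx2.2 hx
    have : x < √n := by
      rcases lt_max_iff.mp hxa with h | h
      · linarith [hx2.1]
      · exact h
    have hx3 : x^2 < n := by
      rw [← lt_sqrt (by linarith [hx2.1])]; exact this
    have : ind n x=0 := by unfold ind; rw [if_neg (by linarith)]
    rw [this]; simp
  have o : ∫ x in a..(3*X), ind m x*ind n x*cos (2*π*k*(fm m x-fm n x)) = ∫ x in a..(3*X), cos (2*π*k*(fm m x-fm n x)) := by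
    apply integral_congr
    intro x hx
    rw [uIcc_of_le ha3] at hx
    have : (n:ℝ) ≤ x^2 := han.trans (by nlinarith [hx.1])
    simp only [ind]
    rw [if_pos this, if_pos (hmn'.le.trans this)]
    ring
  rw [z, o, zero_add]
  exact pair_int hmn hk hX haX ha3 han

/-- substitution bound -/
lemma RK_subst {m K:ℕ} (hK : 1 ≤ K) {X:ℝ} (hX : 1 ≤ X) :
    ∫ x in X..(3*X), (ind m x*RK K (fm m x))^2≤5*X/K := by
  have hX0 : 0 < X := by linarith
  set s : Set ℝ := {x | X < x ∧ x < 3*X ∧ (m:ℝ) < x^2} with hs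
  have hso : MeasurableSet s := by
    apply IsOpen.measurableSet
    exact (isOpen_lt continuous_const continuous_id).inter ((isOpen_lt continuous_id continuous_const).inter (isOpen_lt continuous_const (continuous_pow 2)))
  have hinj : Set.InjOn (fm m) s := by
    intro x hx y hy hxy
    have h1 := fm_sq hx.2.2.le
    have h2 := fm_sq hy.2.2.le
    rw [hxy] at h1
    have : x^4 = y^4 := by linarith
    exact (pow_left_inj₀ (by linarith [hx.1]) (by linarith [hy.1]) (by norm_num)).mp this
  have hsub := lintegral_image_eq_lintegral_abs_deriv_mul hso (fun x hx => (fm_deriv hx.2.2).hasDerivWithinAt) hinj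
    (fun t => ENNReal.ofReal (RK K t^2))
  have him : fm m '' s ⊆ Ioc (0:ℝ) (⌈9*X^2⌉₊:ℝ) := by
    rintro _ ⟨x, hx, rfl⟩
    refine ⟨fm_pos hx.2.2, (fm_le m x).trans (le_trans ?_ (Nat.le_ceil _))⟩
    nlinarith [hx.1, hx.2.1]
  have hRm := RK_meas K
  have hRi : ∀ a b, IntervalIntegrable (fun t => RK K t^2) volume a b := fun a b =>
    bdd_ii (C := (1+K)^2) (by fun_prop) (fun t => by rw [abs_pow]; gcongr; exact RK_bound K t) a b
  have hper : ∫ t in (0:ℝ)..(⌈9*X^2⌉₊:ℝ), RK K t^2 = ⌈9*X^2⌉₊*∫ t in (0:ℝ)..1, RK K t^2 := by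
    have hp : Function.Periodic (fun t => RK K t^2) 1 := fun t => by simp only; rw [RK_periodic K t]
    have := hp.intervalIntegral_add_zsmul_eq (⌈9*X^2⌉₊:ℤ) 0 hRi
    simpa using this
  have h1 : ∫⁻ t in fm m '' s, ENNReal.ofReal (RK K t^2) ≤ ENNReal.ofReal (⌈9*X^2⌉₊*(1/K)) := by
    calc _≤∫⁻ t in Ioc (0:ℝ) (⌈9*X^2⌉₊:ℝ), ENNReal.ofReal (RK K t^2) := lintegral_mono_set him
      _ = ENNReal.ofReal (∫ t in (0:ℝ)..(⌈9*X^2⌉₊:ℝ), RK K t^2) := by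
          rw [integral_of_le (by positivity), ofReal_integral_eq_lintegral_ofReal]
          · exact (hRi _ _).1
          · exact Eventually.of_forall fun t => sq_nonneg _
      _≤_ := by
          apply ENNReal.ofReal_le_ofReal
          rw [hper]
          gcongr
          exact RK_int hK
  have h2 : ENNReal.ofReal (2*X)*∫⁻ x in s, ENNReal.ofReal (RK K (fm m x)^2) ≤ ENNReal.ofReal (⌈9*X^2⌉₊*(1/K)) := by
    refine le_trans ?_ h1
    rw [hsub, ← lintegral_const_mul]
    · refine setLIntegral_mono' hso fun x hx => ?_
      gcongr
      have hx0 : 0 < x := by linarith [hx.1]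
      have hp := fm_pos hx.2.2
      rw [abs_of_pos (by positivity), le_div_iff₀ hp]
      have := fm_le m x
      calc 2*X*fm m x≤2*x*x^2 := by
            gcongr
            exact hx.1.le
        _ = _ := by ring
    · have := (fm_cont m).measurable
      fun_prop
  have hmm : Measurable (fun x => (ind m x*RK K (fm m x))^2) := by
    have := (fm_cont m).measurable
    have := ind_meas m
    fun_prop
  have h3 : ∫⁻ x in Ioc X (3*X), ENNReal.ofReal ((ind m x*RK K (fm m x))^2)≤∫⁻ x in s, ENNReal.ofReal (RK K (fm m x)^2) := by
    rw [← lintegral_indicator measurableSet_Ioc, ← lintegral_indicator hso]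
    apply lintegral_mono_ae
    filter_upwards [Measure.ae_ne volume (3*X), Measure.ae_ne volume (√m)] with x hx1 hx2
    by_cases hxI : x ∈ Ioc X (3*X)
    · rw [Set.indicator_of_mem hxI]
      by_cases hmx : (m:ℝ) ≤ x^2
      · have hne : (m:ℝ) ≠ x^2 := by
          intro h
          apply hx2
          rw [h, sqrt_sq (by linarith [hxI.1])]
        rw [Set.indicator_of_mem (show x ∈ s from ⟨hxI.1, lt_of_le_of_ne hxI.2 hx1, lt_of_le_of_ne hmx hne⟩)]
        simp [ind, hmx]
      · simp [ind, hmx]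
    · rw [Set.indicator_of_notMem hxI]; exact zero_le
  have h4 : ENNReal.ofReal (∫ x in X..(3*X), (ind m x*RK K (fm m x))^2) = ∫⁻ x in Ioc X (3*X), ENNReal.ofReal ((ind m x*RK K (fm m x))^2) := by
    rw [integral_of_le (by linarith), ofReal_integral_eq_lintegral_ofReal]
    · exact (bdd_ii (C := (1*(1+K))^2) hmm (fun t => by
        rw [abs_pow, abs_mul]
        gcongr
        · exact ind_abs _ _
        · exact RK_bound K _) _ _).1
    · exact Eventually.of_forall fun t => sq_nonneg _
  have h5 : ENNReal.ofReal (2*X*∫ x in X..(3*X), (ind m x*RK K (fm m x))^2) ≤ ENNReal.ofReal (⌈9*X^2⌉₊*(1/K)) := by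
    rw [ENNReal.ofReal_mul (by positivity), h4]
    exact (mul_le_mul_right h3 _).trans h2
  rw [ENNReal.ofReal_le_ofReal_iff (by positivity)] at h5
  have h6 := Nat.ceil_lt_add_one (show 0≤9*X^2 by positivity)
  have hK0 : (0:ℝ) < K := by exact_mod_cast hK
  rw [le_div_iff₀ hK0]
  rw [mul_one_div, le_div_iff₀ hK0] at h5
  have h7 : (⌈9*X^2⌉₊:ℝ)≤10*X^2 := by nlinarith
  have h8 : X*((∫ x in X..(3*X), (ind m x*RK K (fm m x))^2)*K) ≤ X*(5*X) := by nlinarith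
  exact le_of_mul_le_mul_left h8 hX0

/-- weights -/
def uw (n:ℕ):ℝ := ((n:ℝ)+1)^(-(9/8):ℝ)
/-- weights -/
def vw (n:ℕ):ℝ := (n:ℝ)^(-(9/8):ℝ)

lemma uw_nonneg (n:ℕ) : 0 ≤ uw n := by unfold uw; positivity
lemma vw_nonneg (n:ℕ) : 0 ≤ vw n := by unfold vw; positivity
lemma vw_zero : vw 0=0 := by unfold vw; rw [Nat.cast_zero, zero_rpow (by norm_num)]
lemma vw_sum : Summable vw := Real.summable_nat_rpow.mpr (by norm_num)
lemma uw_sum : Summable uw := by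
  have := (summable_nat_add_iff 1).mpr vw_sum
  refine this.congr fun n => ?_
  unfold uw vw; push_cast; rfl

lemma inv_le_w {d M:ℝ} (hd : 0 < d) (hM : d ≤ M) : 1/d ≤ d^(-(9/8):ℝ)*M^((1/8):ℝ) := by
  have e : 1/d = d^(-(9/8):ℝ)*d^((1/8):ℝ) := by
    rw [← rpow_add hd, one_div, ← rpow_neg_one]; norm_num
  rw [e]; gcongr

lemma pair_w {m n M:ℕ} (hmn : m < n) (hn : n ≤ M) :
    1/((n:ℝ)^2-(m:ℝ)^2)≤((M:ℝ)+1)^((1/4):ℝ)*(uw m*vw (n-m)) := by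
  have h1 : (m:ℝ)+1 ≤ n := by exact_mod_cast hmn
  have h2 : (n:ℝ) ≤ M := by exact_mod_cast hn
  have hm0 : (0:ℝ) ≤ m := by positivity
  have hd : (0:ℝ) < (n:ℝ)-m := by linarith
  have a1 := inv_le_w (d := (m:ℝ)+1) (M := M+1) (by positivity) (by linarith)
  have a2 := inv_le_w (d := (n:ℝ)-m) (M := M+1) hd (by linarith)
  have e : ((M:ℝ)+1)^((1/4):ℝ)=(M+1)^((1/8):ℝ)*(M+1)^((1/8):ℝ) := by
    rw [← rpow_add (by positivity)]; norm_num
  have e2 : vw (n-m)=((n:ℝ)-m)^(-(9/8):ℝ) := by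
    unfold vw; rw [Nat.cast_sub hmn.le]
  rw [e, e2]
  unfold uw
  calc 1/((n:ℝ)^2-(m:ℝ)^2)≤1/(((m:ℝ)+1)*(n-m)) := by
        apply one_div_le_one_div_of_le (by positivity)
        nlinarith
    _ = 1/((m:ℝ)+1)*(1/((n:ℝ)-m)) := by field_simp
    _≤(((m:ℝ)+1)^(-(9/8):ℝ)*(M+1)^((1/8):ℝ))*(((n:ℝ)-m)^(-(9/8):ℝ)*(M+1)^((1/8):ℝ)) := by
        gcongr
    _ = _ := by ring

lemma double_sum (s : Finset ℕ) : ∑ m ∈ s, ∑ n ∈ s, (uw m*vw (n-m)+uw n*vw (m-n))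
    ≤ 2*((∑' n, uw n)*∑' n, vw n) := by
  have h1 : ∑ m ∈ s, ∑ n ∈ s, uw m*vw (n-m)≤(∑' n, uw n)*∑' n, vw n := by
    simp_rw [← mul_sum]
    calc _≤∑ m ∈ s, uw m*∑' n, vw n := by
          gcongr with m hm
          · exact uw_nonneg m
          · exact sum_shift_le vw_nonneg vw_zero vw_sum s m
      _ = (∑ m ∈ s, uw m)*∑' n, vw n := by rw [sum_mul]
      _≤_ := by
          gcongr
          · exact tsum_nonneg vw_nonneg
          · exact uw_sum.sum_le_tsum _ (fun n _ => uw_nonneg n)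
  have h2 : ∑ m ∈ s, ∑ n ∈ s, uw n*vw (m-n)≤(∑' n, uw n)*∑' n, vw n := by
    rw [sum_comm]; exact h1
  simp_rw [sum_add_distrib]
  linarith

lemma r2_range : ∃ C:ℝ, 1 ≤ C ∧ ∀ M:ℕ, ∀ m ∈ Finset.range (M+1), (r2 m:ℝ) ≤ C*((M:ℝ)+1)^((1/32):ℝ) := by
  obtain ⟨C, hC, h⟩ := r2_bound (1/32) (by norm_num)
  refine ⟨C, hC, fun M m hm => ?_⟩
  have hm1 : m ≤ M := by have := Finset.mem_range.mp hm; omega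
  have hm2 : (m:ℝ) ≤ M := by exact_mod_cast hm1
  rcases Nat.eq_zero_or_pos m with h0 | h0
  · subst h0
    rw [← card_Fb, Fb_zero]
    have : (1:ℝ)≤((M:ℝ)+1)^((1/32):ℝ) := one_le_rpow (by linarith) (by norm_num)
    simp
    nlinarith
  · refine (h m h0).trans ?_
    gcongr
    linarith

lemma t_bounds {X:ℝ} (hX : 2 ≤ X) : ∃ t:ℝ, 1 ≤ t ∧ X = t^8 ∧ t = X^((1/8):ℝ) ∧
    ((⌊9*X^2⌋₊:ℝ)+1≤10*X^2) ∧ ((⌊9*X^2⌋₊:ℝ)+1)^((1/4):ℝ)≤10*t^4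
    ∧ (((⌊9*X^2⌋₊:ℝ)+1)^((1/32):ℝ))^2≤10*t := by
  have hX0 : 0 < X := by linarith
  set t := X^((1/8):ℝ) with ht
  have ht8 : X = t^8 := by
    rw [ht, ← rpow_natCast, ← rpow_mul hX0.le]; norm_num
  have ht1 : 1 ≤ t := one_le_rpow (by linarith) (by norm_num)
  have ht0 : 0 < t := by linarith
  have hM : (⌊9*X^2⌋₊:ℝ)+1≤10*X^2 := by
    have := floor_le (show 0≤9*X^2 by positivity)
    nlinarith
  have hc : ∀ p:ℝ, 0 ≤ p → p≤1 → (10:ℝ)^p≤10 := fun p hp hp1 => by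
    calc (10:ℝ)^p≤10^(1:ℝ) := rpow_le_rpow_of_exponent_le (by norm_num) hp1
      _ = 10 := rpow_one _
  refine ⟨t, ht1, ht8, rfl, hM, ?_, ?_⟩
  · calc ((⌊9*X^2⌋₊:ℝ)+1)^((1/4):ℝ)≤(10*X^2)^((1/4):ℝ) := by gcongr
      _ = 10^((1/4):ℝ)*t^4 := by
          rw [mul_rpow (by norm_num) (by positivity), ht8, ← pow_mul, ← rpow_natCast t (8*2), ← rpow_mul ht0.le, ← rpow_natCast t 4]
          norm_num
      _≤_ := by gcongr; exact hc _ (by norm_num) (by norm_num)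
  · calc (((⌊9*X^2⌋₊:ℝ)+1)^((1/32):ℝ))^2≤((10*X^2)^((1/32):ℝ))^2 := by gcongr
      _ = 10^((1/16):ℝ)*t := by
          rw [← rpow_natCast, ← rpow_mul (by positivity), mul_rpow (by norm_num) (by positivity), ht8, ← pow_mul, ← rpow_natCast t (8*2), ← rpow_mul ht0.le]
          norm_num
      _≤_ := by gcongr; exact hc _ (by norm_num) (by norm_num)

lemma ii_sum {ι : Type*} (s : Finset ι) {f : ι → ℝ → ℝ} {a b:ℝ} (h : ∀ i ∈ s, IntervalIntegrable (f i) volume a b) :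
    IntervalIntegrable (fun x => ∑ i ∈ s, f i x) volume a b := by
  have e : (fun x => ∑ i ∈ s, f i x) = ∑ i ∈ s, f i := by funext x; simp
  rw [e]
  exact IntervalIntegrable.sum s h

lemma Sk_ms : ∃ C:ℝ, 0 ≤ C ∧ ∀ X:ℝ, 2 ≤ X → ∀ k:ℕ, 1 ≤ k →
    ∫ x in X..(3*X), (∑ m ∈ Finset.range (⌊9*X^2⌋₊+1), (r2 m:ℝ)*(ind m x*sin (2*π*k*fm m x)))^2
      ≤ C*(X^((1/8):ℝ))^29 := by
  obtain ⟨C0, hC0, hr⟩ := r2_range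
  have hU : 0≤∑' n, uw n := tsum_nonneg uw_nonneg
  have hV : 0≤∑' n, vw n := tsum_nonneg vw_nonneg
  set U := ∑' n, uw n
  set V := ∑' n, vw n
  refine ⟨C0^2*10*(20+540*(U*V)), by positivity, fun X hX k hk => ?_⟩
  obtain ⟨t, ht1, htX, htd, hM1, hM4, hM32⟩ := t_bounds hX
  rw [← htd]
  have hX0 : 0 < X := by linarith
  set M := ⌊9*X^2⌋₊ with hM
  set s := Finset.range (M+1) with hs
  have hcm := fun m => (fm_cont m).measurable
  have him := ind_meas
  set I:ℕ → ℕ → ℝ := fun m n => ∫ x in X..(3*X), ind m x*ind n x*cos (2*π*k*(fm m x-fm n x)) with hI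
  have hmeasI : ∀ m n, Measurable (fun x => ind m x*ind n x*cos (2*π*k*(fm m x-fm n x))) := by
    intro m n
    have := hcm m; have := hcm n; have := him m; have := him n
    fun_prop
  have hbI : ∀ m n x, |ind m x*ind n x*cos (2*π*k*(fm m x-fm n x))| ≤ 1 := by
    intro m n x
    rw [abs_mul, abs_mul]
    exact mul_le_one₀ (mul_le_one₀ (ind_abs _ _) (abs_nonneg _) (ind_abs _ _)) (abs_nonneg _) (abs_cos_le_one _)
  have hII := fun m n => bdd_ii (hmeasI m n) (hbI m n) X (3*X)
  have pt : ∀ x, (∑ m ∈ s, (r2 m:ℝ)*(ind m x*sin (2*π*k*fm m x)))^2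
      ≤ ∑ m ∈ s, ∑ n ∈ s, (r2 m:ℝ)*r2 n*(ind m x*ind n x*cos (2*π*k*(fm m x-fm n x))) := by
    intro x
    have e : ∑ m ∈ s, ∑ n ∈ s, (r2 m:ℝ)*r2 n*(ind m x*ind n x*cos (2*π*k*(fm m x-fm n x)))
        = (∑ m ∈ s, (r2 m:ℝ)*(ind m x*sin (2*π*k*fm m x)))^2+(∑ m ∈ s, (r2 m:ℝ)*(ind m x*cos (2*π*k*fm m x)))^2 := by
      rw [sq, sq, sum_mul_sum, sum_mul_sum, ← sum_add_distrib]
      refine sum_congr rfl fun m _ => ?_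
      rw [← sum_add_distrib]
      refine sum_congr rfl fun n _ => ?_
      rw [mul_sub, cos_sub]; ring
    rw [e]
    linarith [sq_nonneg (∑ m ∈ s, (r2 m:ℝ)*(ind m x*cos (2*π*k*fm m x)))]
  have hrn : ∀ m ∈ s, 0≤(r2 m:ℝ) := fun m _ => by positivity
  set R := C0*((M:ℝ)+1)^((1/32):ℝ) with hR
  have hR0 : 0 ≤ R := by positivity
  have hR2 : R^2 ≤ C0^2*(10*t) := by
    rw [hR, mul_pow]; gcongr
  have hIb : ∀ m ∈ s, ∀ n ∈ s, |I m n| ≤ (if m = n then 2*X else 0)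
      + 27*X^3*(((M:ℝ)+1)^((1/4):ℝ)*(uw m*vw (n-m)+uw n*vw (m-n))) := by
    intro m hm n hn
    have hle : ∀ m ∈ s, (m:ℝ)≤9*X^2 := by
      intro m hm
      have h1 : m ≤ M := by have := Finset.mem_range.mp hm; omega
      have h2 := floor_le (show 0≤9*X^2 by positivity)
      have h3 : (m:ℝ) ≤ M := by exact_mod_cast h1
      linarith
    have hleM : ∀ m ∈ s, m ≤ M := by
      intro m hm
      have := Finset.mem_range.mp hm; omega
    have huv : 0 ≤ uw m*vw (n-m) := mul_nonneg (uw_nonneg _) (vw_nonneg _)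
    have huv2 : 0 ≤ uw n*vw (m-n) := mul_nonneg (uw_nonneg _) (vw_nonneg _)
    rcases lt_trichotomy m n with h | h | h
    · rw [if_neg h.ne, zero_add]
      have h1 := pair_ind (k := k) h hk hX0 (hle n hn)
      have h2 := pair_w h (hleM n hn)
      refine h1.trans ?_
      rw [div_eq_mul_one_div]
      gcongr
      refine h2.trans ?_
      gcongr
      linarith
    · rw [if_pos h]
      have : |I m n| ≤ 2*X := by
        have := intervalIntegral.norm_integral_le_of_norm_le_const (a := X) (b := 3*X) (C := 1) (f := fun x => ind m x*ind n x*cos (2*π*k*(fm m x-fm n x))) (fun x _ => hbI m n x)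
        rw [norm_eq_abs, abs_of_pos (show 0 < 3*X-X by linarith)] at this
        refine this.trans (by linarith)
      have : 0≤27*X^3*(((M:ℝ)+1)^((1/4):ℝ)*(uw m*vw (n-m)+uw n*vw (m-n))) := by positivity
      linarith
    · rw [if_neg h.ne', zero_add]
      have h1 := pair_ind (k := k) h hk hX0 (hle m hm)
      have h2 := pair_w h (hleM m hm)
      have e : I m n = ∫ x in X..(3*X), ind n x*ind m x*cos (2*π*k*(fm n x-fm m x)) := by
        simp only [hI]
        congr 1
        funext x
        rw [← cos_neg, mul_comm (ind m x)]
        congr 2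
        ring
      rw [e]
      refine h1.trans ?_
      rw [div_eq_mul_one_div]
      gcongr
      refine h2.trans ?_
      gcongr
      linarith
  have hmeasS : Measurable (fun x => (∑ m ∈ s, (r2 m:ℝ)*(ind m x*sin (2*π*k*fm m x)))^2) := by
    fun_prop
  have hbS : ∀ x, |(∑ m ∈ s, (r2 m:ℝ)*(ind m x*sin (2*π*k*fm m x)))^2| ≤ (∑ m ∈ s, (r2 m:ℝ)*1)^2 := by
    intro x
    rw [abs_pow]
    gcongr
    refine (abs_sum_le_sum_abs _ _).trans (sum_le_sum fun m hm => ?_)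
    rw [abs_mul, abs_of_nonneg (hrn m hm), abs_mul]
    gcongr
    exact mul_le_one₀ (ind_abs _ _) (abs_nonneg _) (abs_sin_le_one _)
  have i1 := bdd_ii hmeasS hbS X (3*X)
  have i2 : IntervalIntegrable (fun x => ∑ m ∈ s, ∑ n ∈ s, (r2 m:ℝ)*r2 n*(ind m x*ind n x*cos (2*π*k*(fm m x-fm n x)))) volume X (3*X) := by
    exact ii_sum s (fun m _ => ii_sum s (fun n _ => (hII m n).const_mul _))
  refine (integral_mono_on (by linarith) i1 i2 (fun x _ => pt x)).trans ?_
  rw [intervalIntegral.integral_finsetSum (fun m _ => ii_sum s (fun n _ => (hII m n).const_mul _))]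
  have e2 : ∀ m ∈ s, ∫ x in X..(3*X), ∑ n ∈ s, (r2 m:ℝ)*r2 n*(ind m x*ind n x*cos (2*π*k*(fm m x-fm n x)))
      ≤ ∑ n ∈ s, R^2*((if m = n then 2*X else 0)
      + 27*X^3*(((M:ℝ)+1)^((1/4):ℝ)*(uw m*vw (n-m)+uw n*vw (m-n)))) := by
    intro m hm
    rw [intervalIntegral.integral_finsetSum (fun n _ => (hII m n).const_mul _)]
    refine sum_le_sum fun n hn => ?_
    rw [intervalIntegral.integral_const_mul]
    change (r2 m:ℝ)*r2 n*I m n≤_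
    have h1 := hIb m hm n hn
    calc (r2 m:ℝ)*r2 n*I m n≤(r2 m:ℝ)*r2 n * |I m n| := by gcongr; exact le_abs_self _
      _ ≤ R*R * |I m n| := by
          have := hr M m hm
          have := hr M n hn
          gcongr
      _≤_ := by rw [sq]; gcongr
  refine (sum_le_sum e2).trans ?_
  simp_rw [← mul_sum]
  have e3 : ∑ m ∈ s, ∑ n ∈ s, ((if m = n then 2*X else 0)
      + 27*X^3*(((M:ℝ)+1)^((1/4):ℝ)*(uw m*vw (n-m)+uw n*vw (m-n))))
      = (M+1)*(2*X)+27*X^3*(((M:ℝ)+1)^((1/4):ℝ)*∑ m ∈ s, ∑ n ∈ s, (uw m*vw (n-m)+uw n*vw (m-n))) := by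
    simp_rw [sum_add_distrib (s := s) (f := fun n => if _ = n then 2*X else 0), Finset.sum_ite_eq, sum_add_distrib (s := s) (f := fun m => if m ∈ s then 2*X else 0), ← mul_sum]
    congr 1
    rw [Finset.sum_ite_mem, Finset.inter_self]
    simp [hs]
  rw [e3]
  have h4 := double_sum s
  have h40 : 0≤∑ m ∈ s, ∑ n ∈ s, (uw m*vw (n-m)+uw n*vw (m-n)) :=
    sum_nonneg fun m _ => sum_nonneg fun n _ => add_nonneg (mul_nonneg (uw_nonneg _) (vw_nonneg _)) (mul_nonneg (uw_nonneg _) (vw_nonneg _))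
  have ht0 : 0 < t := by linarith
  calc _ ≤ C0^2*(10*t)*(10*X^2*(2*X)+27*X^3*(10*t^4*(2*(U*V)))) := by
        gcongr
    _ = C0^2*10*(20*t^25+540*(U*V)*t^29) := by rw [htX]; ring
    _ ≤ C0^2*10*(20*t^29+540*(U*V)*t^29) := by
        gcongr
        norm_num
    _ = _ := by ring

lemma Tx_eq {X x:ℝ} (hx0 : 0 ≤ x) (hx : x≤3*X) (K:ℕ) :
    Tx x=(∑ m ∈ Finset.range (⌊9*X^2⌋₊+1), (r2 m:ℝ)*(ind m x*RK K (fm m x)))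
      - ∑ k ∈ Icc 1 K, 1/(π*k)*∑ m ∈ Finset.range (⌊9*X^2⌋₊+1), (r2 m:ℝ)*(ind m x*sin (2*π*k*fm m x)) := by
  have h1 : Tx x = ∑ m ∈ Finset.range (⌊9*X^2⌋₊+1), (r2 m:ℝ)*(ind m x*sawtooth (fm m x)) := by
    unfold Tx
    have hsub : Finset.range (⌊x^2⌋₊+1) ⊆ Finset.range (⌊9*X^2⌋₊+1) := by
      apply Finset.range_subset_range.mpr
      have : ⌊x^2⌋₊≤⌊9*X^2⌋₊ := Nat.floor_le_floor (by nlinarith)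
      omega
    have e : ∀ m:ℕ, (m:ℝ) ≤ x^2 ↔ m ∈ Finset.range (⌊x^2⌋₊+1) := by
      intro m
      rw [mem_range, Nat.lt_succ_iff, Nat.le_floor_iff (by positivity)]
    rw [← Finset.sum_subset hsub]
    · refine sum_congr rfl fun m hm => ?_
      rw [ind, if_pos ((e m).mpr hm), one_mul, fm]
    · intro m _ hm
      rw [ind, if_neg (fun h => hm ((e m).mp h))]
      ring
  rw [h1]
  simp_rw [mul_sum]
  rw [sum_comm, ← sum_sub_distrib]
  refine sum_congr rfl fun m _ => ?_
  unfold RK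
  rw [mul_add, mul_add, mul_sum, mul_sum]
  rw [eq_sub_iff_add_eq, add_right_inj]
  refine sum_congr rfl fun k _ => ?_
  ring

lemma ii_mono {f g:ℝ → ℝ} {a b:ℝ} (hab : a ≤ b) (hg : IntervalIntegrable g volume a b)
    (hf : ∀ x, a < x → x ≤ b → 0 ≤ f x) (h : ∀ x, a < x → x ≤ b → f x ≤ g x) : ∫ x in a..b, f x≤∫ x in a..b, g x := by
  rw [integral_of_le hab, integral_of_le hab]
  refine integral_mono_of_nonneg ?_ ((intervalIntegrable_iff_integrableOn_Ioc_of_le hab).mp hg) ?_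
  · exact (ae_restrict_iff' measurableSet_Ioc).mpr (ae_of_all _ fun x hx => hf x hx.1 hx.2)
  · exact (ae_restrict_iff' measurableSet_Ioc).mpr (ae_of_all _ fun x hx => h x hx.1 hx.2)

lemma T_ms : ∃ C:ℝ, 0 ≤ C ∧ ∀ X:ℝ, 2 ≤ X →
    ∫ x in X..(3*X), Tx x^2 ≤ C*(X^((1/8):ℝ))^37 := by
  obtain ⟨C0, hC0, hr⟩ := r2_range
  obtain ⟨C1, hC1, hS⟩ := Sk_ms
  refine ⟨2*(10000*C0^2)+2*C1, by positivity, fun X hX => ?_⟩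
  obtain ⟨t, ht1, htX, htd, hM1, -, hM32⟩ := t_bounds hX
  have hS' := hS X hX
  rw [← htd] at hS' ⊢
  have ht0 : 0 < t := by linarith
  set K := ⌊t^4⌋₊ with hK
  have hKle : (K:ℝ) ≤ t^4 := floor_le (by positivity)
  have hK1 : 1 ≤ K := Nat.le_floor (by simpa using one_le_pow₀ ht1)
  have hK1' : (1:ℝ) ≤ K := by exact_mod_cast hK1
  have hKge : t^4≤2*K := by
    have := Nat.lt_floor_add_one (t^4)
    linarith
  have hrn : ∀ m, 0≤(r2 m:ℝ) := fun m => by positivity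
  set M := ⌊9*X^2⌋₊ with hM
  set s := Finset.range (M+1) with hs
  have hcm := fun m => (fm_cont m).measurable
  have him := ind_meas
  set A:ℝ → ℝ := fun x => ∑ m ∈ s, (r2 m:ℝ)*(ind m x*RK K (fm m x)) with hA
  set S:ℕ → ℝ → ℝ := fun k x => ∑ m ∈ s, (r2 m:ℝ)*(ind m x*sin (2*π*k*fm m x)) with hSd
  have hRm : ∀ m, Measurable (fun x => RK K (fm m x)) := fun m => (RK_meas K).comp (hcm m)
  have i0 : ∀ m, IntervalIntegrable (fun x => (ind m x*RK K (fm m x))^2) volume X (3*X) := by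
    intro m
    have := hRm m
    have := him m
    refine bdd_ii (C := (1*(1+K))^2) (by fun_prop) (fun x => ?_) _ _
    rw [abs_pow, abs_mul]
    gcongr
    · exact ind_abs _ _
    · exact RK_bound _ _
  have i2 : ∀ k, IntervalIntegrable (fun x => S k x^2) volume X (3*X) := by
    intro k
    refine bdd_ii (C := (∑ m ∈ s, (r2 m:ℝ)*1)^2) ?_ (fun x => ?_) _ _
    · simp only [hSd]; fun_prop
    · rw [abs_pow]
      gcongr
      refine (abs_sum_le_sum_abs _ _).trans (sum_le_sum fun m hm => ?_)
      rw [abs_mul, abs_of_nonneg (hrn m), abs_mul]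
      gcongr
      exact mul_le_one₀ (ind_abs _ _) (abs_nonneg _) (abs_sin_le_one _)
  set R2 := C0*((M:ℝ)+1)^((1/32):ℝ) with hR2
  have i3 : IntervalIntegrable (fun x => 2*(R2^2*((M+1)*∑ m ∈ s, (ind m x*RK K (fm m x))^2))+2*(K*∑ k ∈ Icc 1 K, S k x^2)) volume X (3*X) :=
    (((ii_sum s (fun m _ => i0 m)).const_mul _ |>.const_mul _).const_mul _).add
      (((ii_sum _ (fun k _ => i2 k)).const_mul _).const_mul _)
  have hcard : ((s.card:ℕ):ℝ) = M+1 := by simp [hs]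
  have hR20 : 0 ≤ R2 := by positivity
  have hRb : R2^2 ≤ C0^2*(10*t) := by rw [hR2, mul_pow]; gcongr
  have hbA : ∀ x, A x^2 ≤ R2^2*((M+1)*∑ m ∈ s, (ind m x*RK K (fm m x))^2) := by
    intro x
    have h1 := sq_sum_le_card_mul_sum_sq (s := s) (f := fun m => (r2 m:ℝ)*(ind m x*RK K (fm m x)))
    rw [hcard] at h1
    refine h1.trans ?_
    rw [mul_left_comm]
    refine mul_le_mul_of_nonneg_left ?_ (by positivity)
    rw [mul_sum]
    refine sum_le_sum fun m hm => ?_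
    rw [mul_pow]
    have := hr M m hm
    gcongr
  have hbB : ∀ x, (∑ k ∈ Icc 1 K, 1/(π*k)*S k x)^2 ≤ K*∑ k ∈ Icc 1 K, S k x^2 := by
    intro x
    have h1 := sq_sum_le_card_mul_sum_sq (s := Icc 1 K) (f := fun k:ℕ => 1/(π*k)*S k x)
    rw [Nat.card_Icc, Nat.add_sub_cancel] at h1
    refine h1.trans ?_
    refine mul_le_mul_of_nonneg_left (sum_le_sum fun k hk => ?_) (by positivity)
    have hk1 : (1:ℝ) ≤ k := by exact_mod_cast (Finset.mem_Icc.mp hk).1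
    rw [mul_pow]
    have : (1/(π*k))^2≤1 := by
      apply pow_le_one₀ (by positivity)
      rw [div_le_one (by positivity)]
      nlinarith [pi_gt_three]
    nlinarith [sq_nonneg (S k x)]
  have hX0 : 0 < X := by linarith
  refine (ii_mono (by linarith) i3 (fun x _ _ => sq_nonneg _) (fun x h1 h2 => ?_)).trans ?_
  · rw [Tx_eq (by linarith) h2 K]
    change (A x-∑ k ∈ Icc 1 K, 1/(π*k)*S k x)^2≤_
    have := hbA x
    have := hbB x
    nlinarith [sq_nonneg (A x+∑ k ∈ Icc 1 K, 1/(π*k)*S k x)]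
  rw [intervalIntegral.integral_add
      (((ii_sum s (fun m _ => i0 m)).const_mul _ |>.const_mul _).const_mul _)
      (((ii_sum _ (fun k _ => i2 k)).const_mul _).const_mul _)]
  simp only [intervalIntegral.integral_const_mul]
  rw [intervalIntegral.integral_finsetSum (fun m _ => i0 m), intervalIntegral.integral_finsetSum (fun k _ => i2 k)]
  have b1 : ∑ m ∈ s, ∫ x in X..(3*X), (ind m x*RK K (fm m x))^2≤(M+1)*(5*X/K) := by
    rw [← hcard, ← nsmul_eq_mul]
    exact sum_le_card_nsmul _ _ _ (fun m _ => RK_subst hK1 (by linarith))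
  have b2 : ∑ k ∈ Icc 1 K, ∫ x in X..(3*X), S k x^2 ≤ K*(C1*t^29) := by
    have := sum_le_card_nsmul (Icc 1 K) (fun k => ∫ x in X..(3*X), S k x^2) (C1*t^29) (fun k hk => hS' k (Finset.mem_Icc.mp hk).1)
    rwa [Nat.card_Icc, Nat.add_sub_cancel, nsmul_eq_mul] at this
  have hdiv : 5*X/K≤10*t^4 := by
    rw [div_le_iff₀ (by positivity), htX]
    nlinarith [pow_pos ht0 4]
  calc _≤2*(R2^2*((M+1)*((M+1)*(5*X/K))))+2*(K*(K*(C1*t^29))) := by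
        gcongr
    _≤2*(C0^2*(10*t)*(10*X^2*(10*X^2*(10*t^4))))+2*(t^4*(t^4*(C1*t^29))) := by
        gcongr
    _ = _ := by rw [htX]; ring

/-- normalised error -/
def Er (x:ℝ):ℝ := ((latticeCount x:ℝ)-volB*x^4)/x^2

lemma Ff_contx (z:ℂ) : Continuous (fun x => Ff x z) := by unfold Ff; fun_prop

/-- measurable representative of the sawtooth sum on a bounded range -/
def Tr (X x:ℝ):ℝ := ∑ m ∈ Finset.range (⌊9*X^2⌋₊+1), (r2 m:ℝ)*(ind m x*RK 0 (fm m x))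

lemma Tx_eq_Tr {X x:ℝ} (hx0 : 0 ≤ x) (hx : x≤3*X) : Tx x = Tr X x := by
  rw [Tx_eq hx0 hx 0]; simp [Tr]

lemma Tr_meas (X:ℝ) : Measurable (Tr X) := by
  have hRm : ∀ m, Measurable (fun x => RK 0 (fm m x)) := fun m => (RK_meas 0).comp (fm_cont m).measurable
  have := ind_meas
  unfold Tr; fun_prop

lemma Tr_bound (X:ℝ) : ∃ B, ∀ x, |Tr X x| ≤ B := by
  refine ⟨∑ m ∈ Finset.range (⌊9*X^2⌋₊+1), (r2 m:ℝ)*(1*(1+(0:ℕ))), fun x => ?_⟩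
  refine (abs_sum_le_sum_abs _ _).trans (sum_le_sum fun m hm => ?_)
  rw [abs_mul, abs_of_nonneg (show (0:ℝ) ≤ r2 m by positivity), abs_mul]
  gcongr
  · exact ind_abs _ _
  · exact RK_bound _ _

lemma lat_rep (X:ℝ) : ∃ G:ℝ → ℝ, Measurable G ∧ (∃ B, ∀ x, 0 < x → x≤3*X → |G x| ≤ B) ∧
    ∀ x, 0 < x → x≤3*X → (latticeCount x:ℝ) = G x := by
  obtain ⟨M, hM⟩ := exists_nat_ge (3*X)
  have hc : Continuous (fun x => ∑ v ∈ Bx M, Ff x (zc v)) := by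
    have := fun v => Ff_contx (zc v)
    fun_prop
  obtain ⟨B, hB⟩ := Tr_bound X
  obtain ⟨B', hB'⟩ := (isCompact_Icc (a := (0:ℝ)) (b := 3*X)).exists_bound_of_continuousOn hc.continuousOn
  refine ⟨fun x => (∑ v ∈ Bx M, Ff x (zc v))-2*Tr X x, hc.measurable.sub ((Tr_meas X).const_mul 2),
    ⟨B'+2*B, fun x h1 h2 => ?_⟩, fun x h1 h2 => ?_⟩
  · have a1 := hB' x ⟨h1.le, h2⟩
    have a2 := hB x
    rw [norm_eq_abs] at a1
    rw [abs_le] at *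
    constructor <;> linarith
  · rw [lattice_decomp h1 (h2.trans hM), Tx_eq_Tr h1.le h2]

lemma E_ms : ∃ C:ℝ, 0 ≤ C ∧ ∀ X:ℝ, 2 ≤ X → ∀ N:ℕ, 1 ≤ N →
    ∫ x in X..(3*X), (Er x-cc*D0 N x)^2 ≤ C*(X*(N:ℝ)^(-(1/2):ℝ)+N^4+X^((5/8):ℝ)) := by
  obtain ⟨C1, hC1, h1⟩ := S_ms
  obtain ⟨C2, hC2, h2⟩ := T_ms
  refine ⟨2*C1+8*C2, by positivity, fun X hX N hN => ?_⟩
  obtain ⟨M, hM⟩ := exists_nat_ge (3*X)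
  have hX0 : 0 < X := by linarith
  have a1 := h1 X hX N hN M hM
  have a2 := h2 X hX
  have i1 : IntervalIntegrable (fun x => ((∑ v ∈ Bx M, Ff x (zc v))/x^2-volB*x^2-cc*D0 N x)^2) volume X (3*X) := by
    apply ContinuousOn.intervalIntegrable
    rw [uIcc_of_le (by linarith)]
    have hc : Continuous (fun x => ∑ v ∈ Bx M, Ff x (zc v)) := by
      have := fun v => Ff_contx (zc v)
      fun_prop
    have := D0_cont N
    refine ContinuousOn.pow (((hc.continuousOn.div (by fun_prop) fun x hx => ?_).sub (by fun_prop)).sub (by fun_prop)) 2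
    have : 0 < x := by linarith [hx.1]
    positivity
  have i2 : IntervalIntegrable (fun x => Tx x^2) volume X (3*X) := by
    obtain ⟨B, hB⟩ := Tr_bound X
    have : IntervalIntegrable (fun x => Tr X x^2) volume X (3*X) := by
      refine bdd_ii (C := B^2) ((Tr_meas X).pow_const 2) (fun x => ?_) _ _
      rw [abs_pow]
      gcongr
      exact hB x
    refine this.congr fun x hx => ?_
    rw [uIoc_of_le (by linarith)] at hx
    rw [Tx_eq_Tr (by linarith [hx.1]) hx.2]
  refine (ii_mono (by linarith) ((i1.const_mul 2).add (i2.const_mul (8/X^4))) (fun x _ _ => sq_nonneg _) (fun x h1 h2 => ?_)).trans ?_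
  · have hx0 : 0 < x := by linarith
    have e : Er x-cc*D0 N x=((∑ v ∈ Bx M, Ff x (zc v))/x^2-volB*x^2-cc*D0 N x)-2*(Tx x/x^2) := by
      unfold Er
      rw [lattice_decomp hx0 (h2.trans hM)]
      field_simp
      ring
    have hT : (Tx x/x^2)^2≤1/X^4*Tx x^2 := by
      rw [div_pow, ← pow_mul, one_div, inv_mul_eq_div]
      gcongr
    rw [e]
    set u := (∑ v ∈ Bx M, Ff x (zc v))/x^2-volB*x^2-cc*D0 N x
    have : 8/X^4*Tx x^2=8*(1/X^4*Tx x^2) := by ring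
    rw [this]
    nlinarith [sq_nonneg (u+2*(Tx x/x^2))]
  rw [intervalIntegral.integral_add (i1.const_mul 2) (i2.const_mul (8/X^4)), intervalIntegral.integral_const_mul, intervalIntegral.integral_const_mul]
  have e5 : 8/X^4*(C2*(X^((1/8):ℝ))^37)=8*C2*X^((5/8):ℝ) := by
    have : (X^((1/8):ℝ))^37 = X^((5/8):ℝ)*X^4 := by
      rw [← rpow_natCast, ← rpow_mul hX0.le, ← rpow_natCast X 4, ← rpow_add hX0]
      norm_num
    rw [this]; field_simp
  have p1 : 0 ≤ X*(N:ℝ)^(-(1/2):ℝ)+N^4 := by positivity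
  have p2 : 0 ≤ X^((5/8):ℝ) := by positivity
  calc _≤2*(C1*(X*(N:ℝ)^(-(1/2):ℝ)+N^4))+8/X^4*(C2*(X^((1/8):ℝ))^37) := by gcongr
    _≤_ := by
      rw [e5]
      nlinarith [mul_nonneg hC1 p2, mul_nonneg hC2 p1]

/-- projection to `[X, 2X]` -/
def pr (X x:ℝ):ℝ := max X (min x (2*X))

lemma pr_cont (X:ℝ) : Continuous (pr X) := by unfold pr; fun_prop
lemma pr_eq {X x:ℝ} (h1 : X ≤ x) (h2 : x≤2*X) : pr X x = x := by
  rw [pr, min_eq_left h2, max_eq_right h1]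
lemma pr_ge (X x:ℝ) : X ≤ pr X x := le_max_left _ _
lemma pr_le {X:ℝ} (hX : 0 ≤ X) (x:ℝ) : pr X x≤2*X := max_le (by linarith) (min_le_right _ _)

/-- bounded and measurable on `[X, 2X]` -/
def BM (X:ℝ) (f:ℝ → ℝ) : Prop := Measurable (fun x => f (pr X x)) ∧ ∃ B, ∀ x, |f (pr X x)| ≤ B

lemma BM.ii {X:ℝ} {f:ℝ → ℝ} (hX : 0 ≤ X) (h : BM X f) : IntervalIntegrable f volume X (2*X) := by
  obtain ⟨hm, B, hB⟩ := h
  refine (bdd_ii hm hB X (2*X)).congr fun x hx => ?_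
  rw [uIoc_of_le (by linarith)] at hx
  simp only [pr_eq hx.1.le hx.2]

lemma BM.comp {X:ℝ} {f:ℝ → ℝ} {F:ℝ → ℝ} (hF : Continuous F) (h : BM X f) : BM X (fun x => F (f x)) := by
  obtain ⟨hm, B, hB⟩ := h
  refine ⟨hF.measurable.comp hm, ?_⟩
  obtain ⟨B', hB'⟩ := (isCompact_Icc (a := -B) (b := B)).exists_bound_of_continuousOn hF.continuousOn
  exact ⟨B', fun x => hB' _ (abs_le.mp (hB x))⟩

lemma BM.add {X:ℝ} {f g:ℝ → ℝ} (hf : BM X f) (hg : BM X g) : BM X (fun x => f x+g x) := by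
  obtain ⟨hm, B, hB⟩ := hf
  obtain ⟨hm', B', hB'⟩ := hg
  exact ⟨hm.add hm', B+B', fun x => (abs_add_le _ _).trans (add_le_add (hB x) (hB' x))⟩

lemma BM.mul {X:ℝ} {f g:ℝ → ℝ} (hf : BM X f) (hg : BM X g) : BM X (fun x => f x*g x) := by
  obtain ⟨hm, B, hB⟩ := hf
  obtain ⟨hm', B', hB'⟩ := hg
  refine ⟨hm.mul hm', B*B', fun x => ?_⟩
  rw [abs_mul]
  exact mul_le_mul (hB x) (hB' x) (abs_nonneg _) ((abs_nonneg _).trans (hB x))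

lemma BM.sub {X:ℝ} {f g:ℝ → ℝ} (hf : BM X f) (hg : BM X g) : BM X (fun x => f x-g x) := by
  simpa [sub_eq_add_neg] using hf.add (hg.comp continuous_neg)

lemma BM.cont {X:ℝ} {f:ℝ → ℝ} (hX : 0 < X) (hf : ContinuousOn f (Ioi 0)) : BM X f := by
  have hc : Continuous (fun x => f (pr X x)) :=
    hf.comp_continuous (pr_cont X) (fun x => lt_of_lt_of_le hX (pr_ge X x))
  refine ⟨hc.measurable, ?_⟩
  obtain ⟨B', hB'⟩ := (isCompact_Icc (a := X) (b := 2*X)).exists_bound_of_continuousOn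
    (hf.mono (fun x hx => lt_of_lt_of_le hX hx.1))
  exact ⟨B', fun x => hB' _ ⟨pr_ge X x, pr_le hX.le x⟩⟩

variable {ω:ℝ → ℝ}

lemma Ehat_eq {x:ℝ} (hx : 0 < x) (hw : 0 < ω x) :
    Ehat ω x=((x+ω x)/x)^2*Er (x+ω x)-Er x := by
  unfold Ehat Eshell Er
  rw [sum_Icc_succ_top (by norm_num), sum_Icc_succ_top (by norm_num), sum_Icc_succ_top (by norm_num), Finset.Icc_self, Finset.sum_singleton]
  have c2 : Nat.choose 4 2=6 := rfl
  have c3 : Nat.choose 4 3=4 := rfl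
  have : x+ω x ≠ 0 := by positivity
  norm_num [c2, c3]
  field_simp
  ring

lemma lat_BM (hω : OmegaClass ω) : ∀ᶠ X in atTop, BM X (fun x => (latticeCount (x+ω x):ℝ)) ∧ BM X (fun x => (latticeCount x:ℝ)) := by
  filter_upwards [om_small hω one_pos, eventually_ge_atTop 1] with X hs hX
  have hX0 : 0 < X := by linarith
  obtain ⟨G, hG, ⟨B, hB⟩, hGe⟩ := lat_rep X
  have r1 : ∀ x, 0 < pr X x ∧ pr X x≤3*X ∧ 0 < pr X x+ω (pr X x) ∧ pr X x+ω (pr X x)≤3*X := by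
    intro x
    have h1 := pr_ge X x
    have h2 := pr_le hX0.le x
    have h3 := hs _ h1
    refine ⟨?_, ?_, ?_, ?_⟩ <;> linarith
  have hc : Continuous (fun x => ω (pr X x)) :=
    (om_cont hω).comp_continuous (pr_cont X) (fun x => lt_of_lt_of_le hX0 (pr_ge X x))
  have b1 : BM X (fun x => (latticeCount (x+ω x):ℝ)) := by
    have e : (fun x => (latticeCount (pr X x+ω (pr X x)):ℝ)) = fun x => G (pr X x+ω (pr X x)) := by
      funext x; exact hGe _ (r1 x).2.2.1 (r1 x).2.2.2
    refine ⟨?_, B, fun x => ?_⟩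
    · rw [e]; exact hG.comp ((pr_cont X).add hc).measurable
    · refine (congrArg abs (congrFun e x)).le.trans ?_; exact hB _ (r1 x).2.2.1 (r1 x).2.2.2
  have b2 : BM X (fun x => (latticeCount x:ℝ)) := by
    have e : (fun x => (latticeCount (pr X x):ℝ)) = fun x => G (pr X x) := by
      funext x; exact hGe _ (r1 x).1 (r1 x).2.1
    refine ⟨?_, B, fun x => ?_⟩
    · rw [e]; exact hG.comp (pr_cont X).measurable
    · refine (congrArg abs (congrFun e x)).le.trans ?_; exact hB _ (r1 x).1 (r1 x).2.1
  exact ⟨b1, b2⟩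

lemma Ehat_BM (hω : OmegaClass ω) : ∀ᶠ X in atTop, BM X (Ehat ω) := by
  filter_upwards [lat_BM hω, eventually_gt_atTop 0] with X hl hX0
  obtain ⟨b1, b2⟩ := hl
  have hc0 := om_cont hω
  have b3 : BM X (fun x => volB*∑ j ∈ Icc 1 4, (Nat.choose 4 j:ℝ)*x^(4-j)*ω x^j) :=
    BM.cont hX0 (by fun_prop)
  have b4 : BM X (fun x => (x^2)⁻¹) := BM.cont hX0
    (ContinuousOn.inv₀ (by fun_prop) (fun x hx => by have hx : 0 < x := hx; positivity))
  exact ((b1.sub b2).sub b3).mul b4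

lemma cov_le (hω : OmegaClass ω) : ∀ᶠ X in atTop, ∀ h:ℝ → ℝ, (∀ x, 0 ≤ h x) → IntervalIntegrable h volume X (3*X) →
    ∫ x in X..(2*X), h (x+ω x)≤2*∫ x in X..(3*X), h x := by
  obtain ⟨X0, hd⟩ := eventually_atTop.mp hω.deriv_small
  filter_upwards [om_small hω one_pos, eventually_ge_atTop 1, eventually_ge_atTop X0] with X hs hX hXX h hh hi
  have hX0 : 0 < X := by linarith
  have hder : ∀ x ∈ Ioc X (2*X), HasDerivWithinAt (fun x => x+ω x) (1+deriv ω x) (Ioc X (2*X)) x :=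
    fun x hx => ((hasDerivAt_id x).add (om_hasDeriv hω (by linarith [hx.1]))).hasDerivWithinAt
  have hmono : StrictMonoOn (fun x => x+ω x) (Ioc X (2*X)) := by
    refine strictMonoOn_of_deriv_pos (convex_Ioc _ _) (fun x hx => (hder x hx).continuousWithinAt) (fun x hx => ?_)
    have hx := interior_subset hx
    have e : HasDerivAt (fun x => x+ω x) (1+deriv ω x) x := (hasDerivAt_id x).add (om_hasDeriv hω (by linarith [hx.1]))
    rw [e.deriv]
    have := abs_lt.mp (hd x (by linarith [hx.1]))
    linarith
  have himg : (fun x => x+ω x) '' Ioc X (2*X) ⊆ Ioc X (3*X) := by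
    rintro _ ⟨x, hx, rfl⟩
    have := hs x hx.1.le
    constructor <;> simp only <;> linarith [hx.1, hx.2]
  have hi' := (intervalIntegrable_iff_integrableOn_Ioc_of_le (by linarith)).mp hi
  have hii := (integrableOn_image_iff_integrableOn_abs_deriv_smul measurableSet_Ioc hder hmono.injOn h).mp (hi'.mono_set himg)
  have heq := integral_image_eq_integral_abs_deriv_smul measurableSet_Ioc hder hmono.injOn h
  rw [integral_of_le (by linarith), integral_of_le (by linarith)]
  calc ∫ x in Ioc X (2*X), h (x+ω x)≤∫ x in Ioc X (2*X), 2*(|1+deriv ω x| • h (x+ω x)) := by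
        refine integral_mono_of_nonneg (ae_of_all _ fun x => hh _) (hii.const_mul 2) ?_
        refine (ae_restrict_iff' measurableSet_Ioc).mpr (ae_of_all _ fun x hx => ?_)
        have := abs_lt.mp (hd x (by linarith [hx.1]))
        have h1 : 1/2 ≤ |1+deriv ω x| := le_trans (by linarith) (le_abs_self _)
        simp only [smul_eq_mul]
        nlinarith [hh (x+ω x)]
    _ = 2*∫ x in (fun x => x+ω x) '' Ioc X (2*X), h x := by rw [integral_const_mul, heq]
    _≤_ := by
        refine mul_le_mul_of_nonneg_left ?_ (by norm_num)
        exact setIntegral_mono_set hi' (ae_of_all _ hh) himg.eventuallyLE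

lemma D0_bound : ∃ C:ℝ, 0 ≤ C ∧ ∀ N x, |D0 N x| ≤ C*N := by
  obtain ⟨C, hC, h⟩ := r2_bound 1 one_pos
  refine ⟨C, by linarith, fun N x => ?_⟩
  unfold D0
  refine (abs_sum_le_sum_abs _ _).trans ?_
  have : ∀ n ∈ Icc 1 N, |(r2 n:ℝ)/n*cos (2*π*√n*x)| ≤ C := by
    intro n hn
    have hn1 : 0 < n := (Finset.mem_Icc.mp hn).1
    have := h n hn1
    rw [rpow_one] at this
    rw [abs_mul, abs_of_nonneg (by positivity)]
    have h2 : (r2 n:ℝ)/n ≤ C := by rw [div_le_iff₀ (by positivity)]; exact this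
    calc _ ≤ C*1 := by
          gcongr
          exact abs_cos_le_one _
      _ = C := mul_one C
  have := sum_le_card_nsmul _ _ _ this
  rwa [Nat.card_Icc, Nat.add_sub_cancel, nsmul_eq_mul, mul_comm (N:ℝ)] at this

lemma Er_ii {X:ℝ} (hX : 0 < X) (N:ℕ) : IntervalIntegrable (fun x => (Er x-cc*D0 N x)^2) volume X (3*X) := by
  obtain ⟨G, hG, ⟨B, hB⟩, hGe⟩ := lat_rep X
  have hD := (D0_cont N).measurable
  have hm : Measurable (fun x => ((G x-volB*x^4)/x^2-cc*D0 N x)^2) := by fun_prop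
  obtain ⟨C, hC, hDb⟩ := D0_bound
  rw [intervalIntegrable_iff_integrableOn_Ioc_of_le (by linarith)]
  refine Integrable.mono' (g := fun _ => ((B + |volB| * (3*X)^4)/X^2 + |cc| * (C*N))^2) (integrable_const _)
    (hm.aestronglyMeasurable.congr ?_) ?_
  · refine (ae_restrict_iff' measurableSet_Ioc).mpr (ae_of_all _ fun x hx => ?_)
    have hx0 : 0 < x := by linarith [hx.1]
    simp only [Er, hGe x hx0 hx.2]
  · refine (ae_restrict_iff' measurableSet_Ioc).mpr (ae_of_all _ fun x hx => ?_)
    have hx0 : 0 < x := by linarith [hx.1]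
    rw [norm_eq_abs, abs_pow]
    gcongr
    refine (abs_sub _ _).trans ?_
    have hB0 : 0 ≤ B := (abs_nonneg _).trans (hB x hx0 hx.2)
    rw [abs_mul]
    gcongr
    · rw [Er, hGe x hx0 hx.2, abs_div, abs_of_pos (show 0 < x^2 by positivity)]
      gcongr
      · refine (abs_sub _ _).trans ?_
        rw [abs_mul, abs_of_pos (show 0 < x^4 by positivity)]
        gcongr
        · exact hB x hx0 hx.2
        · exact hx.2
      · exact hx.1.le
    · exact hDb N x

lemma sq_three (y v z:ℝ) : (y-v+z)^2≤3*(y^2+v^2+z^2) := by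
  nlinarith [sq_nonneg (y+v), sq_nonneg (y-z), sq_nonneg (v+z)]

set_option maxHeartbeats 1000000 in
lemma Ehat_ms (hω : OmegaClass ω) : ∃ C:ℝ, 0 ≤ C ∧ ∀ᶠ X in atTop, ∀ N:ℕ, 1 ≤ N →
    ∫ x in X..(2*X), (Ehat ω x-cc*Dl N x (ω x))^2 ≤ C*(X*(N:ℝ)^(-(1/2):ℝ)+N^4+X^((5/8):ℝ)) := by
  obtain ⟨C1, hC1, h1⟩ := E_ms
  obtain ⟨C2, hC2, h2⟩ := D0_bound
  refine ⟨99*C1+27*C2^2, by positivity, ?_⟩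
  filter_upwards [om_small hω one_pos, eventually_ge_atTop 2, cov_le hω, lat_BM hω] with X hs hX hcov hBM N hN
  have hX0 : 0 < X := by linarith
  have hc0 := om_cont hω
  set h:ℝ → ℝ := fun x => (Er x-cc*D0 N x)^2 with hh
  have hi := Er_ii hX0 N
  have hi2 : IntervalIntegrable h volume X (2*X) := hi.mono_set (by
    rw [uIcc_of_le (by linarith), uIcc_of_le (by linarith)]
    exact Set.Icc_subset_Icc le_rfl (by linarith))
  have hI := h1 X hX N hN
  set I := ∫ x in X..(3*X), h x with hId
  have hcv : ∫ x in X..(2*X), h (x+ω x)≤2*I := hcov h (fun x => sq_nonneg _) hi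
  have hle : ∫ x in X..(2*X), h x ≤ I := by
    rw [hId, integral_of_le (by linarith), integral_of_le (by linarith)]
    refine setIntegral_mono_set ((intervalIntegrable_iff_integrableOn_Ioc_of_le (by linarith)).mp hi) (ae_of_all _ fun x => sq_nonneg _) ?_
    exact (Set.Ioc_subset_Ioc le_rfl (by linarith)).eventuallyLE
  have hfi : IntervalIntegrable (fun x => h (x+ω x)) volume X (2*X) := by
    have hD := D0_cont N
    have e1 : BM X (fun x => volB*(x+ω x)^4) := BM.cont hX0 (by fun_prop)
    have e2 : BM X (fun x => ((x+ω x)^2)⁻¹) := BM.cont hX0 (ContinuousOn.inv₀ (by fun_prop) (fun x hx => by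
      have hx : 0 < x := hx
      have := hω.pos x hx
      positivity))
    have e3 : BM X (fun x => cc*D0 N (x+ω x)) := BM.cont hX0 (by fun_prop)
    exact ((((hBM.1.sub e1).mul e2).sub e3).comp (F := fun y => y^2) (by fun_prop)).ii hX0.le
  refine (ii_mono (by linarith) (((hfi.const_mul 48).add (hi2.const_mul 3)).add (intervalIntegrable_const (c := 27*(C2*N)^2/X^2)))
    (fun x _ _ => sq_nonneg _) (fun x ha hb => ?_)).trans ?_
  · have hx0 : 0 < x := by linarith
    obtain ⟨w0, w1⟩ := hs x ha.le
    rw [Ehat_eq hx0 w0]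
    have eD : Dl N x (ω x) = D0 N (x+ω x)-D0 N x := by
      unfold Dl D0
      rw [← sum_sub_distrib]
      exact sum_congr rfl fun n _ => by ring
    rw [eD]
    have ea : (x+ω x)/x=1+ω x/x := by field_simp
    have hwx : ω x/x≤1/X := by gcongr
    have hX1 : 1/X≤1 := by rw [div_le_one hX0]; linarith
    have hwx0 : 0 < ω x/x := by positivity
    have hD2 := h2 N (x+ω x)
    rw [ea]
    set b := ω x/x
    set p := D0 N (x+ω x)
    have e : (1+b)^2*Er (x+ω x)-Er x-cc*(p-D0 N x)
        = (1+b)^2*(Er (x+ω x)-cc*p)-(Er x-cc*D0 N x)+(2*b+b^2)*(cc*p) := by ring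
    have t1 : ((1+b)^2)^2≤16 := by
      have : (1+b)^2≤4 := by nlinarith
      nlinarith [sq_nonneg (1+b)]
    have t2 : ((2*b+b^2)*(cc*p))^2≤9*(C2*N)^2/X^2 := by
      have q1 : |2*b+b^2| ≤ 3*(1/X) := by
        rw [abs_of_pos (by positivity)]
        nlinarith
      calc ((2*b+b^2)*(cc*p))^2=(|2*b+b^2| * (|cc| * |p|))^2 := by
            rw [← abs_mul, ← abs_mul, sq_abs]
        _≤(3*(1/X)*(1*(C2*N)))^2 := by
            have := cc_abs
            gcongr
        _ = _ := by field_simp; ring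
    rw [e]
    change _≤48*(Er (x+ω x)-cc*p)^2+3*(Er x-cc*D0 N x)^2+27*(C2*N)^2/X^2
    have t3 : 27*(C2*N)^2/X^2=3*(9*(C2*N)^2/X^2) := by ring
    rw [t3]
    set u := Er (x+ω x)-cc*p
    set v := Er x-cc*D0 N x
    set z := (2*b+b^2)*(cc*p)
    set y := (1+b)^2*u with hy
    have hy2 : y^2≤16*u^2 := by rw [hy, mul_pow]; gcongr
    linarith [sq_three y v z]
  rw [intervalIntegral.integral_add ((hfi.const_mul 48).add (hi2.const_mul 3)) intervalIntegrable_const,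
    intervalIntegral.integral_add (hfi.const_mul 48) (hi2.const_mul 3), intervalIntegral.integral_const_mul,
    intervalIntegral.integral_const_mul, intervalIntegral.integral_const, smul_eq_mul]
  have hN1 : (1:ℝ) ≤ N := by exact_mod_cast hN
  have hlast : (2*X-X)*(27*(C2*N)^2/X^2)≤27*C2^2*N^4 := by
    have e : (2*X-X)*(27*(C2*N)^2/X^2)=27*C2^2*N^2*(1/X) := by field_simp; ring
    have hX1 : 1/X≤1 := by rw [div_le_one hX0]; linarith
    rw [e]
    calc _≤27*C2^2*N^2*1 := by gcongr
      _≤_ := by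
        rw [mul_one]
        gcongr
        norm_num
  have p1 : 0 ≤ X*(N:ℝ)^(-(1/2):ℝ) := by positivity
  have p2 : 0 ≤ X^((5/8):ℝ) := by positivity
  have p3 : 0≤27*C2^2*(X*(N:ℝ)^(-(1/2):ℝ)+X^((5/8):ℝ)) := by positivity
  linarith

/-- average over `[X, 2X]` -/
def av (X:ℝ) (f:ℝ → ℝ):ℝ := (1/X)*∫ x in X..(2*X), f x

lemma av_lin {X:ℝ} (hX : 0 < X) {f:ℝ → ℝ} (hf : BM X f) (a c:ℝ) : av X (fun x => a*f x+c) = a*av X f+c := by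
  unfold av
  rw [intervalIntegral.integral_add ((hf.ii hX.le).const_mul a) intervalIntegrable_const, intervalIntegral.integral_const_mul,
    intervalIntegral.integral_const, smul_eq_mul]
  field_simp; ring

lemma BM.lin {X:ℝ} {f:ℝ → ℝ} (hf : BM X f) (a c:ℝ) : BM X (fun x => a*f x+c) :=
  hf.comp (F := fun y => a*y+c) (by fun_prop)

lemma av_abs_sub {X:ℝ} (hX : 0 < X) {f g h:ℝ → ℝ} (hf : BM X f) (hg : BM X g) (hh : BM X h)
    (hle : ∀ x, X < x → x≤2*X → |f x-g x| ≤ h x) : |av X f-av X g| ≤ av X h := by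
  unfold av
  rw [← mul_sub, ← intervalIntegral.integral_sub (hf.ii hX.le) (hg.ii hX.le), abs_mul, abs_of_pos (by positivity)]
  gcongr
  refine (intervalIntegral.abs_integral_le_integral_abs (by linarith)).trans ?_
  exact ii_mono (by linarith) (hh.ii hX.le) (fun x _ _ => abs_nonneg _) hle

/-- truncation -/
def clip (R y:ℝ):ℝ := max (-R) (min y R)

lemma clip_cont (R:ℝ) : Continuous (clip R) := by unfold clip; fun_prop

lemma clip_abs {R:ℝ} (hR : 0 ≤ R) (y:ℝ) : |clip R y| ≤ R :=
  abs_le.mpr ⟨le_max_left _ _, max_le (by linarith) (min_le_right _ _)⟩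

lemma clip_lip (R a b:ℝ) : |clip R a-clip R b| ≤ |a-b| := by
  have h1 := abs_max_sub_max_le_max (-R) (min a R) (-R) (min b R)
  have h2 := abs_min_sub_min_le_max a R b R
  rw [sub_self, abs_zero, max_eq_right (abs_nonneg (min a R-min b R))] at h1
  rw [sub_self, abs_zero, max_eq_left (abs_nonneg (a-b))] at h2
  exact h1.trans h2

lemma clip_eq {R y:ℝ} (h : |y| ≤ R) : clip R y = y := by
  have := abs_le.mp h
  rw [clip, min_eq_left this.2, max_eq_right this.1]

lemma clip_abs' {R:ℝ} (hR : 0 ≤ R) (y:ℝ) : |clip R y| ≤ |y| := by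
  have := clip_lip R y 0
  rwa [clip_eq (show |(0:ℝ)| ≤ R by simpa using hR), sub_zero, sub_zero] at this

lemma clip_pow {R:ℝ} (hR : 1 ≤ R) (y:ℝ) (j:ℕ) : |y^j-clip R y^j| ≤ y^(2*j+2)*(1/R) := by
  have hev : y^(2*j+2) = |y| ^ (2*j+2) := by rw [Even.pow_abs ⟨j+1, by ring⟩]
  rcases le_or_gt |y| R with h | h
  · rw [clip_eq h, sub_self, abs_zero, hev]; positivity
  · have h1 : |y^j-clip R y^j| ≤ |y| ^ j := by
      rcases lt_or_ge y 0 with hy | hy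
      · rw [abs_of_neg hy] at h
        have hc : clip R y = -R := by rw [clip, min_eq_left (by linarith), max_eq_left (by linarith)]
        have e : y^j-clip R y^j=(-1)^j*((-y)^j-R^j) := by
          rw [hc, mul_sub, ← mul_pow, ← mul_pow]; ring
        have := pow_le_pow_left₀ (by linarith : 0 ≤ R) h.le j
        rw [e, abs_mul, abs_pow, abs_neg, abs_one, one_pow, one_mul, abs_of_neg hy, abs_of_nonneg (by linarith)]
        linarith [pow_nonneg (by linarith : 0 ≤ R) j]
      · rw [abs_of_nonneg hy] at h
        have hc : clip R y = R := by rw [clip, min_eq_right h.le, max_eq_right (by linarith)]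
        have := pow_le_pow_left₀ (by linarith : 0 ≤ R) h.le j
        rw [hc, abs_of_nonneg hy, abs_of_nonneg (by linarith)]
        linarith [pow_nonneg (by linarith : 0 ≤ R) j]
    refine h1.trans ?_
    rw [hev, mul_one_div, le_div_iff₀ (by linarith)]
    calc |y| ^ j*R ≤ |y| ^ j * |y| := by gcongr
      _ = |y| ^ (j+1) := (pow_succ _ _).symm
      _≤_ := pow_le_pow_right₀ (by linarith) (by omega)

lemma clip_limit {μ : Measure ℝ} {Z Y:ℝ → ℝ → ℝ} (hBM : ∀ᶠ X in atTop, BM X (Z X) ∧ BM X (Y X))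
    (hZY : Tendsto (fun X => av X (fun x => (Z X x-Y X x)^2)) atTop (𝓝 0)) {F:ℝ → ℝ} (hF : Continuous F) {K:ℝ} (hK : 0 ≤ K)
    (hL : ∀ a b, |F a-F b| ≤ |a-b| * K) (hlim : Tendsto (fun X => av X (fun x => F (Z X x))) atTop (𝓝 (∫ α, F α ∂μ))) :
    Tendsto (fun X => av X (fun x => F (Y X x))) atTop (𝓝 (∫ α, F α ∂μ)) := by
  have hd : Tendsto (fun X => av X (fun x => F (Y X x))-av X (fun x => F (Z X x))) atTop (𝓝 0) := by
    rw [Metric.tendsto_atTop']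
    have key : ∀ η > 0, ∀ᶠ X in atTop, |av X (fun x => F (Y X x))-av X (fun x => F (Z X x))| ≤ K/η*av X (fun x => (Z X x-Y X x)^2)+K*η := by
      intro η hη
      filter_upwards [hBM, eventually_gt_atTop 0] with X hb hX
      have hq : BM X (fun x => (Z X x-Y X x)^2) := (hb.1.sub hb.2).comp (F := fun y => y^2) (by fun_prop)
      rw [← av_lin hX hq]
      refine av_abs_sub hX (hb.2.comp hF) (hb.1.comp hF) (hq.lin _ _) fun x _ _ => (hL _ _).trans ?_
      rw [abs_sub_comm]
      have h1 : |Z X x-Y X x| ≤ 1/η*(Z X x-Y X x)^2+η := by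
        rw [← sq_abs (Z X x-Y X x)]
        have := abs_nonneg (Z X x-Y X x)
        rw [one_div, inv_mul_eq_div, ← sub_le_iff_le_add, le_div_iff₀ hη]
        nlinarith [sq_nonneg (|Z X x-Y X x| - η)]
      calc _≤(1/η*(Z X x-Y X x)^2+η)*K := by gcongr
        _ = _ := by ring
    intro ε hε
    have h2 := key (ε/(2*(K+1))) (by positivity)
    have h3 := (hZY.const_mul (K/(ε/(2*(K+1))))).eventually_lt_const (show K/(ε/(2*(K+1)))*0 < ε/2 by simpa using hε)
    obtain ⟨N, hN⟩ := eventually_atTop.mp (h2.and h3)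
    refine ⟨N, fun X hX => ?_⟩
    obtain ⟨a, b⟩ := hN X hX.le
    rw [dist_eq, sub_zero]
    have : K*(ε/(2*(K+1)))≤ε/2 := by
      rw [mul_div_assoc', div_le_div_iff₀ (by positivity) (by norm_num)]
      nlinarith
    linarith
  simpa using hd.add hlim

theorem clip_moments (μ : Measure ℝ) [IsProbabilityMeasure μ] (Z:ℝ → ℝ → ℝ)
    (hμ : ∀ F:ℝ → ℝ, Continuous F → (∃ C, ∀ α, |F α| ≤ C) → Tendsto (fun X => av X (fun x => F (Z X x))) atTop (𝓝 (∫ α, F α ∂μ)))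
    (m:ℕ → ℝ) (hY : ∀ J:ℕ, ∃ Y:ℝ → ℝ → ℝ, (∀ᶠ X in atTop, BM X (Z X) ∧ BM X (Y X)) ∧
      Tendsto (fun X => av X (fun x => (Z X x-Y X x)^2)) atTop (𝓝 0) ∧
      ∀ j ≤ J, Tendsto (fun X => av X (fun x => Y X x^j)) atTop (𝓝 (m j))) :
    ∀ j:ℕ, Integrable (fun α:ℝ => α^j) μ ∧ ∫ α, α^j ∂μ = m j := by
  have key : ∀ j:ℕ, ∀ R:ℝ, 1 ≤ R → |m j-∫ α, clip R α^j ∂μ| ≤ m (2*j+2)*(1/R) := by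
    intro j R hR
    obtain ⟨Y, hBM, hZY, hm⟩ := hY (2*j+2)
    have hcc := clip_cont R
    have hF : Continuous (fun y => clip R y^j) := by fun_prop
    have hlim := clip_limit hBM hZY hF (K := j*R^(j-1)) (by positivity) (fun a b => by
      refine (abs_pow_sub_pow_le _ _ _).trans ?_
      rw [mul_assoc]
      have h1 := clip_lip R a b
      have h2 : max |clip R a| |clip R b| ≤ R := max_le (clip_abs (by linarith) _) (clip_abs (by linarith) _)
      gcongr) (hμ _ hF ⟨R^j, fun α => by rw [abs_pow]; gcongr; exact clip_abs (by linarith) _⟩)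
    refine le_of_tendsto_of_tendsto ((hm j (by omega)).sub hlim).abs ((hm (2*j+2) le_rfl).mul_const (1/R)) ?_
    filter_upwards [hBM, eventually_gt_atTop 0] with X hb hX
    have hp : ∀ i:ℕ, BM X (fun x => Y X x^i) := fun i => hb.2.comp (F := fun y => y^i) (by fun_prop)
    have e := av_lin hX (hp (2*j+2)) (1/R) 0
    simp only [add_zero] at e
    rw [mul_comm, ← e]
    refine av_abs_sub hX (hp j) (hb.2.comp (F := fun y => clip R y^j) hF) ((hp _).comp (F := fun y => 1/R*y) (by fun_prop)) fun x _ _ => ?_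
    rw [mul_comm]
    exact clip_pow hR _ _
  have hint2 : ∀ i:ℕ, Integrable (fun α:ℝ => α^(2*i)) μ := by
    intro i
    refine (aecover_Icc (a := fun n:ℕ => -(n:ℝ)) (b := fun n:ℕ => (n:ℝ)) (μ := μ) (tendsto_neg_atTop_atBot.comp tendsto_natCast_atTop_atTop)
      tendsto_natCast_atTop_atTop).integrable_of_integral_norm_bounded (m (2*i) + |m (2*(2*i)+2)|)
      (fun n => (by fun_prop : Continuous (fun α:ℝ => α^(2*i))).continuousOn.integrableOn_compact isCompact_Icc) ?_
    filter_upwards [eventually_ge_atTop 1] with n hn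
    have hn1 : (1:ℝ) ≤ n := by exact_mod_cast hn
    have h1 := key (2*i) n hn1
    have hR : m (2*(2*i)+2)*(1/n) ≤ |m (2*(2*i)+2)| := by
      calc _ ≤ |m (2*(2*i)+2)| * 1 := by
            gcongr
            · exact le_abs_self _
            · rw [div_le_one (by linarith)]; exact hn1
        _ = _ := mul_one _
    have hci := clip_cont n
    have hii : Integrable (fun α => clip n α^(2*i)) μ := by
      refine Integrable.mono' (integrable_const ((n:ℝ)^(2*i))) (by fun_prop) (ae_of_all _ fun α => ?_)
      rw [norm_pow]
      gcongr
      exact clip_abs (by linarith) _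
    have h2 : ∫ α in Set.Icc (-(n:ℝ)) n, ‖α^(2*i)‖ ∂μ≤∫ α, clip n α^(2*i) ∂μ := by
      refine le_trans (le_of_eq (setIntegral_congr_fun measurableSet_Icc fun α hα => ?_))
        (setIntegral_le_integral hii (ae_of_all _ fun α => (even_two_mul i).pow_nonneg _))
      rw [clip_eq (abs_le.mpr hα), norm_eq_abs, abs_of_nonneg ((even_two_mul i).pow_nonneg _)]
    have := abs_le.mp h1
    linarith
  intro j
  have hig : Integrable (fun α:ℝ => α^j) μ := by
    refine Integrable.mono' ((integrable_const (1:ℝ)).add (hint2 j)) (by fun_prop) (ae_of_all _ fun α => ?_)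
    rw [norm_eq_abs, Pi.add_apply, pow_mul', ← sq_abs]
    nlinarith [sq_nonneg (|α^j| - 1)]
  refine ⟨hig, ?_⟩
  have t1 : Tendsto (fun n:ℕ => ∫ α, clip n α^j ∂μ) atTop (𝓝 (∫ α, α^j ∂μ)) := by
    have hci := clip_cont
    refine tendsto_integral_of_dominated_convergence (fun α => ‖α^j‖) (fun n => by fun_prop) hig.norm (fun n => ae_of_all _ fun α => ?_) (ae_of_all _ fun α => ?_)
    · rw [norm_pow, norm_pow]
      gcongr
      exact clip_abs' (by positivity) _
    · refine tendsto_const_nhds.congr' ?_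
      filter_upwards [tendsto_natCast_atTop_atTop.eventually_ge_atTop |α|] with n hn
      rw [clip_eq hn]
  have t2 : Tendsto (fun n:ℕ => ∫ α, clip n α^j ∂μ) atTop (𝓝 (m j)) := by
    rw [tendsto_iff_norm_sub_tendsto_zero]
    have h0 : Tendsto (fun n:ℕ => m (2*j+2)*(1/(n:ℝ))) atTop (𝓝 0) := by
      simpa using (tendsto_one_div_atTop_nhds_zero_nat (𝕜 := ℝ)).const_mul (m (2*j+2))
    refine squeeze_zero' (Eventually.of_forall fun n => norm_nonneg _) ?_ h0
    filter_upwards [eventually_ge_atTop 1] with n hn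
    rw [norm_eq_abs, abs_sub_comm]
    exact key j n (by exact_mod_cast hn)
  exact tendsto_nhds_unique t1 t2

def pp (w:ℝ):ℝ := w*(-log w)

lemma gam_hom (j:ℕ) (a p:ℝ) : gam j (a*p^2) = gam j a*p^j := by
  unfold gam
  split_ifs with h
  · obtain ⟨k, rfl⟩ := h
    rw [show (k+k)/2 = k by omega, mul_pow, ← pow_mul, two_mul]; ring
  · ring

lemma gam_cont (j:ℕ) : Continuous (gam j) := by
  unfold gam
  split_ifs <;> fun_prop

lemma pp_half : ∀ᶠ w in 𝓝[>] (0:ℝ), pp w ≤ w^(1/2:ℝ) := by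
  have h := tendsto_log_mul_rpow_nhdsGT_zero (r := 1/2) (by norm_num)
  have := h.eventually (Ioi_mem_nhds (show (-1:ℝ) < 0 by norm_num))
  filter_upwards [this, self_mem_nhdsWithin] with w h1 hw
  have hw : 0 < w := hw
  have h1 : -1 < log w*w^(1/2:ℝ) := h1
  have e : w = w^(1/2:ℝ)*w^(1/2:ℝ) := by rw [← rpow_add hw]; norm_num
  have h2 : 0 < w^(1/2:ℝ) := by positivity
  calc pp w=(w^(1/2:ℝ)*w^(1/2:ℝ))*(-log w) := by rw [← e, pp]
    _ = w^(1/2:ℝ)*(-(log w*w^(1/2:ℝ))) := by ring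
    _ ≤ w^(1/2:ℝ)*1 := by gcongr; linarith
    _ = _ := mul_one _

lemma G1 {κ:ℝ} (hκ : 0 < κ) (hV : ∀ ε > 0, ∀ᶠ w in 𝓝[>] (0:ℝ), (∀ N:ℕ, VV N w≤(κ+ε)*(w^2*log w^2)) ∧
      (∀ N:ℕ, (w^4)⁻¹ ≤ N+1 → (κ-ε)*(w^2*log w^2) ≤ VV N w)) (j:ℕ) {ε:ℝ} (hε : 0 < ε) :
    ∃ B:ℝ, 0 ≤ B ∧ ∀ᶠ w in 𝓝[>] (0:ℝ), ∀ N:ℕ,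
      ‖GG N w j-((gam j (2*κ)*pp w^j:ℝ):ℂ)‖ ≤ ε*pp w^j+B*((N:ℝ)+1)^(-(1/8):ℝ) := by
  obtain ⟨C, hC, hG⟩ := GG_asymp j
  obtain ⟨η, hη, hc⟩ := Metric.continuousAt_iff.1 ((gam_cont j).continuousAt (x := 2*κ)) (ε/2) (by linarith)
  set η' := min (η/4) 1 with hη'
  have hη0 : 0 < η' := lt_min (by linarith) one_pos
  have hη1 : η'≤1 := min_le_right _ _
  have hη2 : η'≤η/4 := min_le_left _ _
  set B := gaussMoment j*(2*κ+2)^(j/2) with hB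
  have hB0 : 0 ≤ B := mul_nonneg (gaussMoment_nonneg j) (by positivity)
  refine ⟨2*B, by positivity, ?_⟩
  filter_upwards [hG, hV η' hη0, pp_half, neglog_tendsto.eventually_ge_atTop (2*C/ε+1), self_mem_nhdsWithin,
    (nhdsWithin_le_nhds (gt_mem_nhds one_pos) : ∀ᶠ w in 𝓝[>] (0:ℝ), w < 1)] with w hG hV hp hl hw hw1 N
  have hw : 0 < w := hw
  have hCe : 0≤2*C/ε := by positivity
  have hl0 : 0 < -log w := by linarith
  have hp0 : 0 < pp w := mul_pos hw hl0
  set p := pp w with hpdef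
  have e2 : w^2*log w^2 = p^2 := by rw [hpdef, pp]; ring
  rw [e2] at hV
  set t := VV N w/p^2 with ht
  have hVt : VV N w = t*p^2 := by rw [ht]; field_simp
  have hp2 : 0 < p^2 := by positivity
  have ht0 : 0 ≤ t := div_nonneg (sum_nonneg fun n _ => by positivity) hp2.le
  have ht1 : t≤κ+η' := (div_le_iff₀ hp2).2 (hV.1 N)
  have h1 : ‖GG N w j-((gam j (2*VV N w):ℝ):ℂ)‖ ≤ ε/2*p^j := by
    refine (hG N).trans ?_
    have : C/(-log w)≤ε/2 := by
      rw [div_le_iff₀ hl0]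
      have : 2*C/ε ≤ -log w := by linarith
      rw [div_le_iff₀ hε] at this
      linarith
    calc C*((w*(-log w))^j/(-log w)) = C/(-log w)*p^j := by rw [hpdef, pp]; ring
      _≤_ := by gcongr
  have h2 : |gam j (2*VV N w)-gam j (2*κ)*p^j| ≤ ε/2*p^j+2*B*((N:ℝ)+1)^(-(1/8):ℝ) := by
    rw [hVt, show 2*(t*p^2)=(2*t)*p^2 by ring, gam_hom, ← sub_mul, abs_mul, abs_of_pos (pow_pos hp0 j)]
    rcases le_or_gt ((w^4)⁻¹) ((N:ℝ)+1) with h | h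
    · have h3 : κ-η' ≤ t := (le_div_iff₀ hp2).2 (hV.2 N h)
      have h4 := (hc (x := 2*t) (by rw [dist_eq, abs_lt]; constructor <;> linarith)).le
      rw [dist_eq] at h4
      have : |gam j (2*t)-gam j (2*κ)| * p^j≤ε/2*p^j := by gcongr
      have : 0≤2*B*((N:ℝ)+1)^(-(1/8):ℝ) := by positivity
      linarith
    · rcases Nat.eq_zero_or_pos j with rfl | hj
      · have : |gam 0 (2*t)-gam 0 (2*κ)| * p^0=0 := by simp [gam]
        rw [this]; positivity
      · have h3 : |gam j (2*t)-gam j (2*κ)| ≤ 2*B := by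
          have a1 := gam_bound (2*κ+2) (by linarith) j (V := 2*t) (by linarith) (by linarith)
          have a2 := gam_bound (2*κ+2) (by linarith) j (V := 2*κ) (by linarith) (by linarith)
          have := abs_sub (gam j (2*t)) (gam j (2*κ))
          linarith
        have h4 : w^(1/2:ℝ)≤((N:ℝ)+1)^(-(1/8):ℝ) := by
          have e : w^(1/2:ℝ)=((w^4)⁻¹)^(-(1/8):ℝ) := by
            rw [← rpow_neg_one, ← rpow_natCast, ← rpow_mul hw.le, ← rpow_mul hw.le]; norm_num
          rw [e]
          exact rpow_le_rpow_of_nonpos (by positivity) h.le (by norm_num)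
        have h5 : p≤1 := hp.trans (rpow_le_one hw.le hw1.le (by norm_num))
        have h6 : p^j≤((N:ℝ)+1)^(-(1/8):ℝ) := (pow_le_of_le_one hp0.le h5 hj.ne').trans (hp.trans h4)
        have : 0≤ε/2*p^j := by positivity
        have : |gam j (2*t)-gam j (2*κ)| * p^j≤2*B*((N:ℝ)+1)^(-(1/8):ℝ) := by gcongr
        linarith
  have h3 : ‖((gam j (2*VV N w):ℝ):ℂ)-((gam j (2*κ)*p^j:ℝ):ℂ)‖ = |gam j (2*VV N w)-gam j (2*κ)*p^j| := by
    rw [← Complex.ofReal_sub, norm_real, norm_eq_abs]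
  calc _≤_ := norm_sub_le_norm_sub_add_norm_sub _ ((gam j (2*VV N w):ℝ):ℂ) _
    _≤_ := by rw [h3]; linarith


lemma small_div (hω : OmegaClass ω) {β:ℝ} (hβ : 0 < β) (j:ℕ) :
    Tendsto (fun X => X^(-β)/√(Mom 2 X ω)^j) atTop (𝓝 0) := by
  obtain ⟨c, hc, h⟩ := hω.mom2_lower (β/(j+1)) (by positivity)
  have h0 : Tendsto (fun X:ℝ => X^(-(β/2))*(√c^j)⁻¹) atTop (𝓝 0) := by
    simpa using (tendsto_rpow_neg_atTop (by positivity : 0 < β/2)).mul_const (√c^j)⁻¹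
  refine squeeze_zero' ?_ ?_ h0
  · filter_upwards [eventually_gt_atTop 0] with X hX; positivity
  · filter_upwards [h, eventually_ge_atTop 1] with X h hX
    have hX0 : 0 < X := by linarith
    have h1 : √c*X^(-(β/(j+1))/2)≤√(Mom 2 X ω) := by
      rw [show X^(-(β/(j+1))/2) = √(X^(-(β/(j+1)))) by
        rw [sqrt_eq_rpow, ← rpow_mul hX0.le]; congr 1; ring, ← sqrt_mul hc.le]
      exact sqrt_le_sqrt h
    have h2 : √c^j*X^(-(β/2))≤√(Mom 2 X ω)^j := by
      refine le_trans ?_ (pow_le_pow_left₀ (by positivity) h1 j)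
      rw [mul_pow, ← rpow_natCast (X^_), ← rpow_mul hX0.le]
      have : -(β/2) ≤ -(β/(j+1))/2*j := by
        have : β/(j+1)*j≤β := by
          rw [div_mul_eq_mul_div, div_le_iff₀ (by positivity)]; nlinarith
        linarith
      gcongr
    have h3 : 0 < √c^j*X^(-(β/2)) := by have := sqrt_pos.2 hc; positivity
    rw [div_le_iff₀ (h3.trans_le h2)]
    calc X^(-β) = X^(-(β/2))*(√c^j)⁻¹*(√c^j*X^(-(β/2))) := by
          have := (sqrt_pos.2 hc).ne'
          rw [show -β = -(β/2) + -(β/2) by ring, rpow_add hX0]; field_simp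
      _≤_ := by gcongr

lemma mom2_pos (hω : OmegaClass ω) : ∀ᶠ X in atTop, 0 < Mom 2 X ω := by
  obtain ⟨c, hc, h⟩ := hω.mom2_lower 1 one_pos
  filter_upwards [h, eventually_gt_atTop 0] with X h hX
  exact lt_of_lt_of_le (by positivity) h

lemma pp_cont (hω : OmegaClass ω) : ContinuousOn (fun x => pp (ω x)) (Ioi 0) := by
  have h := om_cont hω
  exact h.mul (h.log fun x hx => (hω.pos x hx).ne').neg

lemma av_pp {j:ℕ} (hj : Even j) (X:ℝ) : av X (fun x => pp (ω x)^j) = Mom j X ω := by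
  unfold av Mom pp
  congr 2; ext x
  show (ω x * -log (ω x))^j = _
  rw [mul_neg, hj.neg_pow]

lemma sqrt_mom {j:ℕ} (hj : Even j) {X:ℝ} (h : 0 < Mom 2 X ω) : √(Mom 2 X ω)^j = Mom 2 X ω^(j/2) := by
  obtain ⟨k, rfl⟩ := hj
  rw [show k+k=2*k by ring, pow_mul, sq_sqrt h.le, show 2*k/2 = k by omega]

lemma av_pp_lim (hω : OmegaClass ω) {j:ℕ} (hj : Even j) :
    Tendsto (fun X => av X (fun x => pp (ω x)^j)/√(Mom 2 X ω)^j) atTop (𝓝 (Llim ω j)) := by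
  refine (hω.Llim_exists j hj).congr' ?_
  filter_upwards [mom2_pos hω] with X h
  rw [av_pp hj, sqrt_mom hj h]

lemma av_pp_bdd (hω : OmegaClass ω) (j:ℕ) : ∃ K:ℝ, 0 < K ∧ ∀ᶠ X in atTop,
    av X (fun x => pp (ω x)^j)/√(Mom 2 X ω)^j ≤ K := by
  have h := av_pp_lim hω (j := 2*j) ⟨j, by ring⟩
  refine ⟨|Llim ω (2*j)| + 2, by positivity, ?_⟩
  filter_upwards [h.eventually (Iio_mem_nhds (lt_add_one _)), mom2_pos hω, eventually_gt_atTop 0] with X h1 h2 hX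
  have h1 : av X (fun x => pp (ω x)^(2*j))/√(Mom 2 X ω)^(2*j) < Llim ω (2*j)+1 := h1
  set s := √(Mom 2 X ω)^j with hs
  have hs0 : 0 < s := pow_pos (sqrt_pos.2 h2) j
  have hb : BM X (fun x => pp (ω x)^(2*j)) := BM.cont hX ((pp_cont hω).pow (2*j))
  have hb1 : BM X (fun x => pp (ω x)^j) := BM.cont hX ((pp_cont hω).pow j)
  have h3 : av X (fun x => s⁻¹*pp (ω x)^j+0) ≤ av X (fun x => (s^2)⁻¹*pp (ω x)^(2*j)+1) := by
    unfold av
    have := (hb.lin (s^2)⁻¹ 1).ii hX.le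
    have h' := (hb1.lin s⁻¹ 0).ii hX.le
    refine mul_le_mul_of_nonneg_left (integral_mono_on (by linarith) h' this ?_) (by positivity)
    intro x _
    have : (s^2)⁻¹*pp (ω x)^(2*j)=(s⁻¹*pp (ω x)^j)^2 := by
      rw [mul_pow, inv_pow, ← pow_mul (pp (ω x)), mul_comm 2 j]
    rw [this]
    nlinarith [sq_nonneg (s⁻¹*pp (ω x)^j-1/2)]
  rw [av_lin hX hb1, av_lin hX hb] at h3
  have e : √(Mom 2 X ω)^(2*j) = s^2 := by rw [hs, ← pow_mul, mul_comm]
  rw [e, div_eq_inv_mul] at h1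
  rw [div_eq_inv_mul]
  have := le_abs_self (Llim ω (2*j))
  linarith

lemma GG_cont (N j:ℕ) : Continuous (fun w => GG N w j) := by
  simp_rw [GG_eq]
  exact continuous_finsetSum _ fun f _ => continuous_finsetProd _ fun l _ => bet_cont _ _

lemma Dl_cont (hω : OmegaClass ω) (N:ℕ) : ContinuousOn (fun x => Dl N x (ω x)) (Ioi 0) := by
  have := om_cont hω
  unfold Dl; fun_prop

lemma E1 (hω : OmegaClass ω) {κ:ℝ} (hκ : 0 < κ) (hV : ∀ ε > 0, ∀ᶠ w in 𝓝[>] (0:ℝ), (∀ N:ℕ, VV N w≤(κ+ε)*(w^2*log w^2)) ∧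
      (∀ N:ℕ, (w^4)⁻¹ ≤ N+1 → (κ-ε)*(w^2*log w^2) ≤ VV N w)) (j:ℕ) : ∃ A:ℕ, ∃ C:ℝ, 0 ≤ C ∧ ∀ ε > 0, ∃ B:ℝ, 0 ≤ B ∧
    ∀ᶠ X in atTop, ∀ N:ℕ, 2 ≤ N → |av X (fun x => Dl N x (ω x)^j)-gam j (2*κ)*av X (fun x => pp (ω x)^j)| ≤
      C*(N:ℝ)^A*X^(-(1/2):ℝ)+ε*av X (fun x => pp (ω x)^j)+B*((N:ℝ)+1)^(-(1/8):ℝ) := by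
  obtain ⟨A, C, hC, hA⟩ := avg_Dl hω j
  refine ⟨A, C, hC, fun ε hε => ?_⟩
  obtain ⟨B, hB, hG⟩ := G1 hκ hV j hε
  refine ⟨B, hB, ?_⟩
  rw [eventually_nhdsWithin_iff, Metric.eventually_nhds_iff] at hG
  obtain ⟨r, hr, hG⟩ := hG
  filter_upwards [hA, om_small hω hr, eventually_gt_atTop 0] with X hA hs hX N hN
  have hA := hA N hN
  have hsub : uIcc X (2*X) ⊆ Ioi 0 := by
    rw [uIcc_of_le (by linarith)]; exact fun x hx => lt_of_lt_of_le hX hx.1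
  have hP : BM X (fun x => pp (ω x)^j) := BM.cont hX ((pp_cont hω).pow j)
  have iG : IntervalIntegrable (fun x => GG N (ω x) j) volume X (2*X) :=
    (((GG_cont N j).comp_continuousOn (om_cont hω)).mono hsub).intervalIntegrable
  have iP : IntervalIntegrable (fun x => ((gam j (2*κ)*pp (ω x)^j:ℝ):ℂ)) volume X (2*X) :=
    ((Complex.continuous_ofReal.comp_continuousOn (((pp_cont hω).pow j).const_smul (gam j (2*κ)))).mono hsub).intervalIntegrable
  have h1 : ‖(∫ x in X..(2*X), GG N (ω x) j)-∫ x in X..(2*X), ((gam j (2*κ)*pp (ω x)^j:ℝ):ℂ)‖ ≤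
      ∫ x in X..(2*X), (ε*pp (ω x)^j+B*((N:ℝ)+1)^(-(1/8):ℝ)) := by
    rw [← intervalIntegral.integral_sub iG iP]
    refine intervalIntegral.norm_integral_le_of_norm_le (by linarith) (ae_of_all _ fun x hx => ?_) ((hP.lin ε _).ii hX.le)
    obtain ⟨h2, h3⟩ := hs x hx.1.le
    exact hG (by rw [dist_eq, sub_zero, abs_of_pos h2]; exact h3) h2 N
  have h2 : |(∫ x in X..(2*X), Dl N x (ω x)^j)-∫ x in X..(2*X), gam j (2*κ)*pp (ω x)^j| ≤
      C*(N:ℝ)^A*√X+∫ x in X..(2*X), (ε*pp (ω x)^j+B*((N:ℝ)+1)^(-(1/8):ℝ)) := by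
    rw [← norm_eq_abs, ← norm_real, Complex.ofReal_sub, ← intervalIntegral.integral_ofReal,
      ← intervalIntegral.integral_ofReal]
    exact (norm_sub_le_norm_sub_add_norm_sub _ _ _).trans (add_le_add hA h1)
  have h3 := mul_le_mul_of_nonneg_left h2 (show 0≤1/X by positivity)
  have h4 := av_lin hX hP ε (B*((N:ℝ)+1)^(-(1/8):ℝ))
  have h5 : 1/X*√X = X^(-(1/2):ℝ) := by
    rw [sqrt_eq_rpow, one_div, ← rpow_neg_one, ← rpow_add hX]; norm_num
  rw [← abs_of_pos (show 0 < 1/X by positivity), ← abs_mul, abs_of_pos (show 0 < 1/X by positivity), mul_sub, mul_add,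
    intervalIntegral.integral_const_mul, mul_left_comm, mul_left_comm (1/X), h5] at h3
  unfold av at *
  linarith

lemma E2 (hω : OmegaClass ω) {κ:ℝ} (hκ : 0 < κ) (hV : ∀ ε > 0, ∀ᶠ w in 𝓝[>] (0:ℝ), (∀ N:ℕ, VV N w≤(κ+ε)*(w^2*log w^2)) ∧
      (∀ N:ℕ, (w^4)⁻¹ ≤ N+1 → (κ-ε)*(w^2*log w^2) ≤ VV N w)) (j:ℕ) : ∃ A:ℕ, ∀ δ:ℝ, 0 < δ → δ*A≤1/4 →
    Tendsto (fun X => av X (fun x => Dl ⌊X^δ⌋₊ x (ω x)^j)/√(Mom 2 X ω)^j) atTop (𝓝 (gam j (2*κ)*Llim ω j)) := by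
  obtain ⟨A, C, hC, hA⟩ := E1 hω hκ hV j
  obtain ⟨K, hK, hKb⟩ := av_pp_bdd hω j
  refine ⟨A, fun δ hδ hδA => ?_⟩
  have h0 : Tendsto (fun X => gam j (2*κ)*(av X (fun x => pp (ω x)^j)/√(Mom 2 X ω)^j)) atTop (𝓝 (gam j (2*κ)*Llim ω j)) := by
    by_cases hj : Even j
    · exact (av_pp_lim hω hj).const_mul _
    · simp [gam, hj]
  suffices h : Tendsto (fun X => av X (fun x => Dl ⌊X^δ⌋₊ x (ω x)^j)/√(Mom 2 X ω)^j -
      gam j (2*κ)*(av X (fun x => pp (ω x)^j)/√(Mom 2 X ω)^j)) atTop (𝓝 0) by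
    simpa using h.add h0
  rw [Metric.tendsto_nhds]
  intro η hη
  obtain ⟨B, hB, hE⟩ := hA (η/(2*K)) (by positivity)
  have l1 := ((small_div hω (show (0:ℝ) < 1/4 by norm_num) j).const_mul C).add
    ((small_div hω (show 0 < δ/8 by positivity) j).const_mul B)
  rw [mul_zero, mul_zero, add_zero] at l1
  filter_upwards [hE, hKb, mom2_pos hω, eventually_ge_atTop 1, l1.eventually (gt_mem_nhds (half_pos hη)),
    (tendsto_rpow_atTop hδ).eventually_ge_atTop 2] with X hE hKb hm hX hl h2
  have hX0 : 0 < X := by linarith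
  have hN : 2≤⌊X^δ⌋₊ := Nat.le_floor (by exact_mod_cast h2)
  have hE := hE _ hN
  set S := √(Mom 2 X ω)^j with hS
  have hS0 : 0 < S := pow_pos (sqrt_pos.2 hm) j
  have a1 : ((⌊X^δ⌋₊:ℕ):ℝ)^A*X^(-(1/2):ℝ) ≤ X^(-(1/4):ℝ) := by
    calc ((⌊X^δ⌋₊:ℕ):ℝ)^A*X^(-(1/2):ℝ)≤(X^δ)^A*X^(-(1/2):ℝ) := by
          gcongr; exact floor_le (by positivity)
      _ = X^(δ*A + -(1/2)) := by rw [← rpow_natCast, ← rpow_mul hX0.le, ← rpow_add hX0]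
      _≤_ := rpow_le_rpow_of_exponent_le hX (by linarith)
  have a2 : (((⌊X^δ⌋₊:ℕ):ℝ)+1)^(-(1/8):ℝ) ≤ X^(-(δ/8)) := by
    calc _≤(X^δ)^(-(1/8):ℝ) := rpow_le_rpow_of_nonpos (by positivity) (Nat.lt_floor_add_one _).le (by norm_num)
      _ = _ := by rw [← rpow_mul hX0.le]; congr 1; ring
  have a3 := mul_le_mul_of_nonneg_left a1 hC
  have a4 := mul_le_mul_of_nonneg_left a2 hB
  have a5 := mul_le_mul_of_nonneg_left hKb (show 0≤η/(2*K) by positivity)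
  have a6 : η/(2*K)*K = η/2 := by field_simp
  rw [dist_eq, sub_zero, ← mul_div_assoc, ← sub_div, abs_div, abs_of_pos hS0]
  calc _≤_ := div_le_div_of_nonneg_right hE hS0.le
    _≤(C*X^(-(1/4):ℝ)+η/(2*K)*av X (fun x => pp (ω x)^j)+B*X^(-(δ/8)))/S := by
        apply div_le_div_of_nonneg_right _ hS0.le; linarith
    _ = (C*(X^(-(1/4):ℝ)/S)+B*(X^(-(δ/8))/S))+η/(2*K)*(av X (fun x => pp (ω x)^j)/S) := by ring
    _ < η := by linarith

lemma sq_close (f g η:ℝ) (hη : 0 < η) : |f^2-g^2| ≤ η*g^2+(1+1/η)*(f-g)^2 := by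
  have e : f^2-g^2=(f-g)^2+2*((f-g)*g) := by ring
  have h : 2 * |(f-g)*g| ≤ η*g^2+1/η*(f-g)^2 := by
    have e1 : η*g^2+1/η*(f-g)^2-2 * |(f-g)*g| = (η * |g| - |f-g|)^2/η := by
      rw [abs_mul, ← sq_abs g, ← sq_abs (f-g)]; field_simp; ring
    have : 0≤(η * |g| - |f-g|)^2/η := by positivity
    linarith
  rw [e]
  refine (abs_add_le _ _).trans ?_
  rw [abs_of_nonneg (sq_nonneg (f-g)), abs_mul, abs_two]
  linarith

lemma L2lim (f g:ℝ → ℝ → ℝ) (T:ℝ → ℝ) (L:ℝ) (hB : ∀ᶠ X in atTop, 0 < T X ∧ BM X (f X) ∧ BM X (g X))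
    (h1 : Tendsto (fun X => av X (fun x => (f X x-g X x)^2)/T X) atTop (𝓝 0))
    (h2 : Tendsto (fun X => av X (fun x => g X x^2)/T X) atTop (𝓝 L)) :
    Tendsto (fun X => av X (fun x => f X x^2)/T X) atTop (𝓝 L) := by
  suffices h : Tendsto (fun X => av X (fun x => f X x^2)/T X-av X (fun x => g X x^2)/T X) atTop (𝓝 0) by
    simpa using h.add h2
  rw [Metric.tendsto_nhds]
  intro ε hε
  have hη : 0 < ε/(2*(|L| + 1)) := by positivity
  set η := ε/(2*(|L| + 1)) with hηd
  have l1 := (h1.const_mul (1+1/η))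
  rw [mul_zero] at l1
  filter_upwards [hB, l1.eventually (gt_mem_nhds (half_pos hε)), h2.eventually (gt_mem_nhds (show L < |L| + 1 by linarith [le_abs_self L])),
    eventually_gt_atTop 0] with X hB l1 l2 hX
  obtain ⟨hT, hf, hg⟩ := hB
  have bf : BM X (fun x => f X x^2) := hf.comp (F := fun y => y^2) (by fun_prop)
  have bg : BM X (fun x => g X x^2) := hg.comp (F := fun y => y^2) (by fun_prop)
  have bd : BM X (fun x => (f X x-g X x)^2) := (hf.sub hg).comp (F := fun y => y^2) (by fun_prop)
  have b1 : BM X (fun x => η*g X x^2) := bg.comp (F := fun y => η*y) (by fun_prop)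
  have b2 : BM X (fun x => (1+1/η)*(f X x-g X x)^2) := bd.comp (F := fun y => (1+1/η)*y) (by fun_prop)
  have h3 := av_abs_sub hX bf bg (b1.add b2) (fun x _ _ => sq_close _ _ η hη)
  have h4 : av X (fun x => η*g X x^2+(1+1/η)*(f X x-g X x)^2) =
      η*av X (fun x => g X x^2)+(1+1/η)*av X (fun x => (f X x-g X x)^2) := by
    unfold av
    rw [intervalIntegral.integral_add (b1.ii hX.le) (b2.ii hX.le), intervalIntegral.integral_const_mul,
      intervalIntegral.integral_const_mul]
    ring
  rw [h4] at h3
  rw [dist_eq, sub_zero, ← sub_div, abs_div, abs_of_pos hT]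
  have h5 : η*(|L| + 1) = ε/2 := by rw [hηd]; field_simp
  have h6 := mul_lt_mul_of_pos_left l2 hη
  calc _≤_ := div_le_div_of_nonneg_right h3 hT.le
    _ = η*(av X (fun x => g X x^2)/T X)+(1+1/η)*(av X (fun x => (f X x-g X x)^2)/T X) := by ring
    _ < ε := by linarith

lemma av_cmul (X c:ℝ) (f:ℝ → ℝ) : av X (fun x => c*f x) = c*av X f := by
  unfold av; rw [intervalIntegral.integral_const_mul]; ring


lemma E3 (hω : OmegaClass ω) {δ:ℝ} (hδ : 0 < δ) (hδ1 : δ≤1/16) :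
    Tendsto (fun X => av X (fun x => (Ehat ω x-cc*Dl ⌊X^δ⌋₊ x (ω x))^2)/√(Mom 2 X ω)^2) atTop (𝓝 0) := by
  obtain ⟨C, hC, h⟩ := Ehat_ms hω
  have l := (small_div hω (show 0 < δ/2 by positivity) 2).const_mul (4*C)
  rw [mul_zero] at l
  refine squeeze_zero' ?_ ?_ l
  · filter_upwards [eventually_gt_atTop 0] with X hX
    refine div_nonneg (mul_nonneg (by positivity) (intervalIntegral.integral_nonneg (by linarith) fun x _ => sq_nonneg _)) (by positivity)
  · filter_upwards [h, eventually_ge_atTop 1, (tendsto_rpow_atTop hδ).eventually_ge_atTop 2] with X h hX h2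
    have hX0 : 0 < X := by linarith
    have hf := floor_le (show 0 ≤ X^δ by positivity)
    have hf' := Nat.lt_floor_add_one (X^δ)
    have hN : 1≤⌊X^δ⌋₊ := Nat.le_floor (by push_cast; linarith)
    have h := h _ hN
    set N := ⌊X^δ⌋₊
    have a1 : (N:ℝ)^(-(1/2):ℝ)≤2*X^(-(δ/2)) := by
      have e : (X^δ/4)^(-(1/2):ℝ)=2*X^(-(δ/2)) := by
        rw [div_rpow (by positivity) (by norm_num), ← rpow_mul hX0.le, show (4:ℝ)=2^(2:ℝ) by norm_num, ← rpow_mul (by norm_num),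
          show (2:ℝ) * -(1/2) = -1 by norm_num, rpow_neg_one, div_inv_eq_mul, mul_comm]
        congr 2; ring
      rw [← e]
      exact rpow_le_rpow_of_nonpos (by positivity) (by linarith) (by norm_num)
    have a2 : 1/X*(N:ℝ)^4 ≤ X^(-(δ/2)) := by
      calc 1/X*(N:ℝ)^4≤1/X*(X^δ)^4 := by gcongr
        _ = X^(-1+δ*(4:ℕ)) := by rw [rpow_add hX0, rpow_neg_one, rpow_mul hX0.le, rpow_natCast, one_div]
        _≤_ := rpow_le_rpow_of_exponent_le hX (by push_cast; linarith)
    have a3 : 1/X*X^((5/8):ℝ) ≤ X^(-(δ/2)) := by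
      calc 1/X*X^((5/8):ℝ) = X^(-1+(5/8):ℝ) := by rw [rpow_add hX0, rpow_neg_one, one_div]
        _≤_ := rpow_le_rpow_of_exponent_le hX (by linarith)
    rw [← mul_div_assoc]
    refine div_le_div_of_nonneg_right ?_ (by positivity)
    calc _≤1/X*(C*(X*(N:ℝ)^(-(1/2):ℝ)+N^4+X^((5/8):ℝ))) := mul_le_mul_of_nonneg_left h (by positivity)
      _ = C*((N:ℝ)^(-(1/2):ℝ)+1/X*(N:ℝ)^4+1/X*X^((5/8):ℝ)) := by field_simp
      _ ≤ C*(4*X^(-(δ/2))) := mul_le_mul_of_nonneg_left (by linarith) hC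
      _ = _ := by ring

lemma Llim_two (hω : OmegaClass ω) : Llim ω 2=1 := by
  refine tendsto_nhds_unique (hω.Llim_exists 2 even_two) (tendsto_const_nhds.congr' ?_)
  filter_upwards [mom2_pos hω] with X h
  rw [show 2/2=1 from rfl, pow_one, div_self h.ne']

lemma gaussMoment_two : gaussMoment 2=1 := by norm_num [gaussMoment, Nat.factorial]

def mm (ω:ℝ → ℝ) (j:ℕ):ℝ := if Even j then gaussMoment j*Llim ω j else 0

lemma cc_ne : cc ≠ 0 := by unfold cc; have := pi_pos; simp [this.ne']

lemma Dl_BM (hω : OmegaClass ω) {X:ℝ} (hX : 0 < X) (N:ℕ) (c:ℝ) : BM X (fun x => c*Dl N x (ω x)) :=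
  (BM.cont hX (Dl_cont hω N)).comp (F := fun y => c*y) (by fun_prop)

lemma main_moments (hω : OmegaClass ω) (μ : Measure ℝ) [IsProbabilityMeasure μ]
    (hμ : ∀ F:ℝ → ℝ, Continuous F → (∃ C, ∀ α, |F α| ≤ C) →
      Tendsto (fun X => av X (fun x => F (Ehat ω x/sigmaShell ω X))) atTop (𝓝 (∫ α, F α ∂μ))) :
    ∀ j:ℕ, Integrable (fun α:ℝ => α^j) μ ∧ ∫ α, α^j ∂μ = mm ω j := by
  obtain ⟨κ, hκ, hV⟩ := VV_asymp
  choose A hA using fun j => E2 hω hκ hV j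
  refine clip_moments μ (fun X x => Ehat ω x/sigmaShell ω X) hμ (mm ω) fun J => ?_
  obtain ⟨δ, hδ, hδ1, hδA⟩ : ∃ δ:ℝ, 0 < δ ∧ δ≤1/16 ∧ ∀ j ≤ J+2, δ*A j≤1/4 := by
    set Q:ℝ := ∑ j ∈ Finset.range (J+3), (A j:ℝ) with hQ
    have hQ0 : 0 ≤ Q := sum_nonneg fun _ _ => Nat.cast_nonneg _
    refine ⟨1/(16*(1+Q)), by positivity, ?_, fun j hj => ?_⟩
    · apply one_div_le_one_div_of_le <;> linarith
    · have : (A j:ℝ) ≤ Q := single_le_sum (f := fun j => (A j:ℝ)) (fun _ _ => Nat.cast_nonneg _) (Finset.mem_range.2 (by omega))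
      rw [div_mul_eq_mul_div, div_le_div_iff₀ (by positivity) (by norm_num)]
      linarith
  have hm := mom2_pos hω
  have r0 := E3 hω hδ hδ1
  have hcc := cc_ne
  have cpos : 0 < |cc| := abs_pos.2 cc_ne
  have d2 := (hA 2 δ hδ (hδA 2 (by omega))).const_mul (cc^2)
  have hsig : Tendsto (fun X => av X (fun x => Ehat ω x^2)/√(Mom 2 X ω)^2) atTop (𝓝 (cc^2*(2*κ))) := by
    refine L2lim (fun _ x => Ehat ω x) (fun X x => cc*Dl ⌊X^δ⌋₊ x (ω x)) _ _ ?_ r0 ?_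
    · filter_upwards [hm, Ehat_BM hω, eventually_gt_atTop 0] with X h1 h2 h3
      exact ⟨pow_pos (sqrt_pos.2 h1) 2, h2, Dl_BM hω h3 _ _⟩
    · have e : gam 2 (2*κ)*Llim ω 2=2*κ := by rw [Llim_two hω, gam, if_pos even_two, gaussMoment_two]; norm_num
      rw [e] at d2
      refine d2.congr fun X => ?_
      simp_rw [mul_pow, av_cmul]; ring
  have hsr : Tendsto (fun X => √(Mom 2 X ω)/sigmaShell ω X) atTop (𝓝 (|cc| * √(2*κ))⁻¹) := by
    have h1 := (hsig.sqrt).inv₀ (sqrt_pos.2 (by positivity)).ne'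
    rw [sqrt_mul (sq_nonneg cc), sqrt_sq_eq_abs] at h1
    refine h1.congr fun X => ?_
    rw [sqrt_div' _ (sq_nonneg _), sqrt_sq (sqrt_nonneg _), inv_div]; rfl
  refine ⟨fun X x => cc/sigmaShell ω X*Dl ⌊X^δ⌋₊ x (ω x), ?_, ?_, fun j hj => ?_⟩
  · filter_upwards [Ehat_BM hω, eventually_gt_atTop 0] with X h1 h2
    exact ⟨h1.comp (F := fun y => y/sigmaShell ω X) (by fun_prop), Dl_BM hω h2 _ _⟩
  · have l := r0.mul (hsr.pow 2)
    rw [zero_mul] at l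
    refine l.congr' ?_
    filter_upwards [hm] with X h
    have hs := (sqrt_pos.2 h).ne'
    have e : ∀ x, (Ehat ω x/sigmaShell ω X-cc/sigmaShell ω X*Dl ⌊X^δ⌋₊ x (ω x))^2 =
        (1/sigmaShell ω X)^2*(Ehat ω x-cc*Dl ⌊X^δ⌋₊ x (ω x))^2 := fun x => by ring
    simp_rw [e, av_cmul]
    rw [div_pow, div_pow]; field_simp
  · have l := ((hA j δ hδ (hδA j (by omega))).const_mul (cc^j)).mul (hsr.pow j)
    have e : cc^j*(gam j (2*κ)*Llim ω j)*(|cc| * √(2*κ))⁻¹^j = mm ω j := by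
      unfold gam mm
      split_ifs with hj
      · obtain ⟨k, rfl⟩ := hj
        have h1 : cc^(k+k) = |cc| ^ (k+k) := by rw [Even.pow_abs ⟨k, rfl⟩]
        have h2 : (2*κ)^k = √(2*κ)^(k+k) := by rw [← two_mul, pow_mul, sq_sqrt (by positivity)]
        have h3 : √(2*κ) ≠ 0 := (sqrt_pos.2 (by positivity)).ne'
        rw [h1, show (k+k)/2 = k by omega, h2, inv_pow, mul_pow]
        field_simp
      · ring
    rw [e] at l
    refine l.congr' ?_
    filter_upwards [hm] with X h
    have hs := (sqrt_pos.2 h).ne'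
    simp_rw [mul_pow, av_cmul]
    rw [div_pow, div_pow]; field_simp

theorem final (hω : OmegaClass ω) (μ : Measure ℝ) [IsProbabilityMeasure μ]
    (hμ : ∀ F:ℝ → ℝ, Continuous F → (∃ C, ∀ α, |F α| ≤ C) →
      Tendsto (fun X => av X (fun x => F (Ehat ω x/sigmaShell ω X))) atTop (𝓝 (∫ α, F α ∂μ))) :
    (∀ j:ℕ, Integrable (fun α:ℝ => α^j) μ) ∧
    (∀ j:ℕ, Even j → ∫ α, α^j ∂μ = gaussMoment j*Llim ω j) ∧
    (∀ j:ℕ, Odd j → ∫ α, α^j ∂μ = 0) ∧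
    (∀ ν : Measure ℝ, IsProbabilityMeasure ν →
      (∀ j:ℕ, Integrable (fun α:ℝ => α^j) ν) →
      (∀ j:ℕ, ∫ α, α^j ∂ν = ∫ α, α^j ∂μ) → ν = μ) := by
  have h := main_moments hω μ hμ
  have he : ∀ j:ℕ, Even j → ∫ α, α^j ∂μ = gaussMoment j*Llim ω j := fun j hj => by rw [(h j).2, mm, if_pos hj]
  refine ⟨fun j => (h j).1, he, fun j hj => ?_, fun ν hν hi heq => ?_⟩
  · rw [(h j).2, mm, if_neg (Nat.not_even_iff_odd.2 hj)]
  · refine carleman_unique μ ν (fun j => (h j).1) hi heq (fun k => ?_) ?_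
    · have h0 : ∀ α:ℝ, 0≤α^(2*k) := fun α => Even.pow_nonneg ⟨k, by ring⟩ α
      refine lt_of_le_of_ne (integral_nonneg h0) fun hz => ?_
      have h1 := (integral_eq_zero_iff_of_nonneg h0 (h (2*k)).1).1 hz.symm
      rcases Nat.eq_zero_or_pos k with rfl | hk
      · simp at hz
      · have h2 : ∫ α, α^2 ∂μ = 0 := by
          refine integral_eq_zero_of_ae ?_
          filter_upwards [h1] with α hα
          have : α = 0 := pow_eq_zero_iff (by omega) |>.1 hα
          simp [this]
        rw [he 2 even_two, Llim_two hω, gaussMoment_two] at h2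
        norm_num at h2
    · refine hω.carleman.congr fun n => sum_congr rfl fun k _ => ?_
      rw [he _ ⟨k+1, by ring⟩]

end CK

/-- The limiting distribution is moment-determinate, with moments
`j!/(2^{j/2}(j/2)!)·L_j(ω)` for even `j` and `0` for odd `j`. -/
theorem limiting_distribution_moments (ω : ℝ → ℝ) (hω : OmegaClass ω)
    (μ : Measure ℝ) [IsProbabilityMeasure μ]
    (hμ : ∀ F : ℝ → ℝ, Continuous F → (∃ C, ∀ α, |F α| ≤ C) →
      Tendsto (fun X => (1 / X) * ∫ x in X..(2 * X), F (Ehat ω x / sigmaShell ω X))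
        atTop (nhds (∫ α, F α ∂μ))) :
    (∀ j : ℕ, Integrable (fun α : ℝ => α ^ j) μ) ∧
    (∀ j : ℕ, Even j → ∫ α, α ^ j ∂μ = gaussMoment j * Llim ω j) ∧
    (∀ j : ℕ, Odd j → ∫ α, α ^ j ∂μ = 0) ∧
    (∀ ν : Measure ℝ, IsProbabilityMeasure ν →
      (∀ j : ℕ, Integrable (fun α : ℝ => α ^ j) ν) →
      (∀ j : ℕ, ∫ α, α ^ j ∂ν = ∫ α, α ^ j ∂μ) → ν = μ) := by
  exact CK.final hω μ hμ
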